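/- Let 2 ≤ k ≤ n and α > 0. Suppose u ∈ C⁴(ℝⁿ × (−∞, 0]) is a (k−1)-convex (λ(D²_x u) ∈ Γ_{k−1} everywhere) and semi-convex solution of −∂_t u · (σ_k(λ(D²_x u)) + α σ_{k−1}(λ(D²_x u))) = 1 on ℝⁿ × (−∞, 0], such that x ↦ u(x, 0) satisfies the quadratic growth condition and 0 < m₁ ≤ −∂_t u ≤ m₂. Then there exist a constant m > 0 and a quadratic polynomial p (i.e., p(x) = ½⟨Ax, x⟩ + ⟨b, x⟩ + c with A a symmetric n×n matrix, b ∈ ℝⁿ, c ∈ ℝ) such that u(x, t) = −m t + p(x) for all (x,t) ∈ ℝⁿ × (−∞, 0]. -/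

import Mathlib

open scoped BigOperators

noncomputable section

/-- The `j`-th elementary symmetric function of the entries of `lam` indexed by `T`
(`j : ℤ`, with value `0` for `j < 0`). -/
def sigmaOn {n : ℕ} (T : Finset (Fin n)) (j : ℤ) (lam : Fin n → ℝ) : ℝ :=
  if 0 ≤ j then ∑ s ∈ T.powersetCard j.toNat, ∏ i ∈ s, lam i else 0

/-- The `j`-th elementary symmetric polynomial `σ_j(λ)`. -/
def esymmR {n : ℕ} (j : ℤ) (lam : Fin n → ℝ) : ℝ := sigmaOn Finset.univ j lam

/-- The Garding cone `Γ_k`. -/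
def GammaCone (n k : ℕ) : Set (Fin n → ℝ) :=
  {lam | ∀ i : ℕ, 1 ≤ i → i ≤ k → 0 < esymmR (i : ℤ) lam}

/-- The Hessian matrix `D²u(x)`. -/
def hess {n : ℕ} (u : (Fin n → ℝ) → ℝ) (x : Fin n → ℝ) : Matrix (Fin n) (Fin n) ℝ :=
  Matrix.of fun i j => iteratedFDeriv ℝ 2 u x ![Pi.single i 1, Pi.single j 1]

/-- The spatial Hessian `D²ₓu(x,t)`. -/
def hessX {n : ℕ} (u : (Fin n → ℝ) × ℝ → ℝ) (x : Fin n → ℝ) (t : ℝ) :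
    Matrix (Fin n) (Fin n) ℝ := hess (fun y => u (y, t)) x

/-- The time derivative `∂ₜu(x,t)`. -/
def uT {n : ℕ} (u : (Fin n → ℝ) × ℝ → ℝ) (x : Fin n → ℝ) (t : ℝ) : ℝ :=
  deriv (fun s => u (x, s)) t

/-- Euclidean norm on `Fin n → ℝ`. -/
def eucNorm {n : ℕ} (x : Fin n → ℝ) : ℝ := Real.sqrt (∑ i, (x i) ^ 2)

set_option linter.all false

section
/-- elementary symmetric functions on a finset -/
def es {ι : Type*} (S : Finset ι) (k : ℕ) (x : ι → ℝ) : ℝ := ∑ s ∈ S.powersetCard k, ∏ i ∈ s, x i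

section A
variable {ι : Type*} [DecidableEq ι]

lemma es_zero (S : Finset ι) (x : ι → ℝ) : es S 0 x = 1 := by simp [es]

lemma es_empty_succ (k : ℕ) (x : ι → ℝ) : es (∅ : Finset ι) (k+1) x = 0 := by
  unfold es
  rw [Finset.powersetCard_eq_empty.2 (by simp)]; simp

lemma es_insert {S : Finset ι} {a : ι} (ha : a ∉ S) (k : ℕ) (x : ι → ℝ) :
    es (insert a S) (k+1) x = x a * es S k x + es S (k+1) x := by
  unfold es
  rw [Finset.powersetCard_succ_insert ha, Finset.sum_union]
  · rw [Finset.sum_image]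
    · rw [add_comm, Finset.mul_sum]
      congr 1
      refine Finset.sum_congr rfl fun s hs => ?_
      have : a ∉ s := fun h => ha ((Finset.mem_powersetCard.1 hs).1 h)
      rw [Finset.prod_insert this]
    · intro s hs t ht hst
      have h1 : a ∉ s := fun h => ha ((Finset.mem_powersetCard.1 hs).1 h)
      have h2 : a ∉ t := fun h => ha ((Finset.mem_powersetCard.1 ht).1 h)
      have h3 : insert a s = insert a t := hst
      rw [← Finset.erase_insert h1, ← Finset.erase_insert h2, h3]
  · rw [Finset.disjoint_left]
    intro s hs hs'
    obtain ⟨t, ht, rfl⟩ := Finset.mem_image.1 hs'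
    exact ha ((Finset.mem_powersetCard.1 hs).1 (Finset.mem_insert_self a t))

lemma es_erase {S : Finset ι} {a : ι} (ha : a ∈ S) (k : ℕ) (x : ι → ℝ) :
    es S (k+1) x = x a * es (S.erase a) k x + es (S.erase a) (k+1) x := by
  conv_lhs => rw [← Finset.insert_erase ha]
  exact es_insert (Finset.notMem_erase a S) k x

lemma es_congr {S : Finset ι} {k : ℕ} {x y : ι → ℝ} (h : ∀ i ∈ S, x i = y i) :
    es S k x = es S k y := by
  unfold es
  refine Finset.sum_congr rfl fun s hs => Finset.prod_congr rfl fun i hi => h i ?_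
  exact (Finset.mem_powersetCard.1 hs).1 hi

lemma es_smul (S : Finset ι) (k : ℕ) (c : ℝ) (x : ι → ℝ) :
    es S k (c • x) = c ^ k * es S k x := by
  unfold es
  rw [Finset.mul_sum]
  refine Finset.sum_congr rfl fun s hs => ?_
  simp [Finset.prod_mul_distrib, (Finset.mem_powersetCard.1 hs).2]

lemma es_one (S : Finset ι) (x : ι → ℝ) : es S 1 x = ∑ i ∈ S, x i := by
  unfold es
  rw [Finset.powersetCard_one]
  simp

lemma es_pol (S : Finset ι) (k : ℕ) (x v : ι → ℝ) :
    ∑ s ∈ S.powersetCard (k+1), ∑ i ∈ s, v i * ∏ j ∈ s.erase i, x j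
      = ∑ i ∈ S, v i * es (S.erase i) k x := by
  unfold es
  simp_rw [Finset.mul_sum]
  rw [Finset.sum_sigma', Finset.sum_sigma']
  refine Finset.sum_bij' (fun p _ => ⟨p.2, p.1.erase p.2⟩) (fun p _ => ⟨insert p.1 p.2, p.1⟩)
    ?_ ?_ ?_ ?_ ?_
  · rintro ⟨s, i⟩ h
    simp only [Finset.mem_sigma, Finset.mem_powersetCard] at h ⊢
    obtain ⟨⟨h1, h2⟩, h3⟩ := h
    refine ⟨h1 h3, Finset.erase_subset_erase _ h1, ?_⟩
    rw [Finset.card_erase_of_mem h3, h2]; rfl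
  · rintro ⟨i, s⟩ h
    simp only [Finset.mem_sigma, Finset.mem_powersetCard] at h ⊢
    obtain ⟨h1, h2, h3⟩ := h
    have : i ∉ s := fun hi => (Finset.mem_erase.1 (h2 hi)).1 rfl
    refine ⟨⟨?_, ?_⟩, Finset.mem_insert_self _ _⟩
    · exact Finset.insert_subset h1 (h2.trans (Finset.erase_subset _ _))
    · rw [Finset.card_insert_of_notMem this, h3]
  · rintro ⟨s, i⟩ h
    simp only [Finset.mem_sigma, Finset.mem_powersetCard] at h
    simp [Finset.insert_erase h.2]
  · rintro ⟨i, s⟩ h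
    simp only [Finset.mem_sigma, Finset.mem_powersetCard] at h
    have : i ∉ s := fun hi => (Finset.mem_erase.1 (h.2.1 hi)).1 rfl
    simp [Finset.erase_insert this]
  · rintro ⟨s, i⟩ h
    rfl

lemma es_euler (S : Finset ι) (k : ℕ) (x : ι → ℝ) :
    ∑ i ∈ S, x i * es (S.erase i) k x = (k+1) * es S (k+1) x := by
  rw [← es_pol, es, Finset.mul_sum]
  refine Finset.sum_congr rfl fun s hs => ?_
  have : ∀ i ∈ s, x i * ∏ j ∈ s.erase i, x j = ∏ j ∈ s, x j := fun i hi =>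
    Finset.mul_prod_erase s x hi
  rw [Finset.sum_congr rfl this]
  simp [(Finset.mem_powersetCard.1 hs).2]

lemma es_sum_erase (S : Finset ι) (k : ℕ) (x : ι → ℝ) :
    ∑ i ∈ S, es (S.erase i) k x = ((S.card : ℝ) - k) * es S k x := by
  cases k with
  | zero => simp [es_zero]
  | succ k =>
    have h : ∀ i ∈ S, es (S.erase i) (k+1) x = es S (k+1) x - x i * es (S.erase i) k x := by
      intro i hi; rw [es_erase hi]; ring
    rw [Finset.sum_congr rfl h, Finset.sum_sub_distrib, es_euler]
    simp; ring

lemma es_hasDeriv (S : Finset ι) (k : ℕ) (x v : ι → ℝ) (s : ℝ) :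
    HasDerivAt (fun t : ℝ => es S (k+1) (x + t • v))
      (∑ i ∈ S, v i * es (S.erase i) k (x + s • v)) s := by
  rw [← es_pol]
  unfold es
  refine HasDerivAt.fun_sum fun A hA => ?_
  have h := HasDerivAt.fun_finsetProd (u := A) (f := fun i (t:ℝ) => (x + t • v) i)
    (f' := fun i => v i) (x := s) (fun i hi => by
      simpa using ((hasDerivAt_id s).mul_const (v i)).const_add (x i))
  refine h.congr_deriv ?_
  refine Finset.sum_congr rfl fun i hi => ?_
  simp [mul_comm]

/-! Newton -/
open Polynomial in
lemma splits_ineq_aux (m : Multiset ℝ) (x : ℝ) :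
    (m.map fun r => X - C r).prod.eval x * (derivative (derivative (m.map fun r => X - C r).prod)).eval x
      ≤ ((derivative (m.map fun r => X - C r).prod).eval x)^2 := by
  induction m using Multiset.induction with
  | empty => simp
  | cons a m ih =>
    simp only [Multiset.map_cons, Multiset.prod_cons, derivative_mul, derivative_sub, derivative_X,
      derivative_C, derivative_add, eval_add, eval_mul, eval_sub, eval_X, eval_C, sub_zero, one_mul, eval_one,
      derivative_one, derivative_zero, zero_mul, zero_add] at ih ⊢
    set Q := (m.map fun r => X - C r).prod
    nlinarith [mul_le_mul_of_nonneg_left ih (sq_nonneg (x - a)), sq_nonneg (Q.eval x)]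

open Polynomial in
lemma splits_ineq {P : ℝ[X]} (h : P.Splits) (x : ℝ) :
    P.eval x * (derivative (derivative P)).eval x ≤ ((derivative P).eval x)^2 := by
  rw [h.eq_prod_roots]
  simp only [derivative_C_mul, eval_mul, eval_C]
  have := splits_ineq_aux P.roots x
  nlinarith [mul_le_mul_of_nonneg_left this (sq_nonneg P.leadingCoeff)]

open Polynomial in
lemma splits_deriv {P : ℝ[X]} (h : P.Splits) : (derivative P).Splits := by
  rw [splits_iff_card_roots] at h ⊢
  by_cases hd : P.natDegree = 0
  · rw [derivative_of_natDegree_zero hd]; simp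
  have h1 := card_roots_le_derivative P
  have h2 := natDegree_derivative_lt hd
  have h3 := card_roots' (derivative P)
  omega

open Polynomial in
lemma splits_iter {P : ℝ[X]} (h : P.Splits) (k : ℕ) : (derivative^[k] P).Splits := by
  induction k with
  | zero => exact h
  | succ k ih => rw [Function.iterate_succ_apply']; exact splits_deriv ih

open Polynomial in
lemma esPoly_coeff (S : Finset ι) (x : ι → ℝ) (k : ℕ) :
    (∏ i ∈ S, (1 + C (x i) * X)).coeff k = es S k x := by
  induction S using Finset.induction generalizing k with
  | empty => cases k with
    | zero => simp [es_zero]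
    | succ k => simp [es_empty_succ, coeff_one]
  | insert a S ha ih =>
    rw [Finset.prod_insert ha, add_mul, one_mul, coeff_add, ih, mul_assoc, coeff_C_mul]
    cases k with
    | zero => simp [es_zero]
    | succ k => rw [coeff_X_mul, ih, es_insert ha]; ring

open Polynomial in
lemma newton (S : Finset ι) (x : ι → ℝ) (k : ℕ) :
    es S k x * es S (k+2) x ≤ (es S (k+1) x)^2 := by
  have hs : (∏ i ∈ S, (1 + C (x i) * X)).Splits := by
    refine Splits.prod fun i _ => Splits.of_natDegree_le_one ?_
    compute_degree
  have h := splits_ineq (splits_iter hs k) 0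
  rw [← Function.iterate_succ_apply' derivative, ← Function.iterate_succ_apply' derivative] at h
  simp only [← coeff_zero_eq_eval_zero, coeff_iterate_derivative, esPoly_coeff, zero_add,
    Nat.descFactorial_self, nsmul_eq_mul, Nat.succ_eq_add_one] at h
  have e1 : (((k+1+1).factorial : ℕ) : ℝ) = (k+2)*((k+1)*k.factorial) := by
    push_cast [Nat.factorial_succ]; ring
  have e2 : (((k+1).factorial : ℕ) : ℝ) = ((k+1)*k.factorial) := by
    push_cast [Nat.factorial_succ]; ring
  rw [e1, e2] at h
  have hf : (0:ℝ) < k.factorial := by exact_mod_cast Nat.factorial_pos k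
  have hk : (0:ℝ) ≤ k := Nat.cast_nonneg k
  have h3 : ((k:ℝ)+2) * (es S k x * es S (k+2) x) ≤ (k+1) * (es S (k+1) x)^2 := by
    have : (0:ℝ) < k.factorial^2*(k+1) := by positivity
    refine le_of_mul_le_mul_left ?_ this
    calc _ = _ := ?_
      _ ≤ _ := h
      _ = _ := ?_ <;> ring_nf
  by_contra hc
  push Not at hc
  nlinarith [sq_nonneg (es S (k+1) x), mul_pos (by linarith : (0:ℝ) < k+2) (sub_pos.2 hc)]
end A
end

section
/-- Garding cone on a finset -/
def Gam {ι : Type*} (S : Finset ι) (k : ℕ) (x : ι → ℝ) : Prop := ∀ j ≤ k, 0 < es S j x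

section A
variable {ι : Type*} [DecidableEq ι]

lemma Gam.mono {S : Finset ι} {k j : ℕ} {x : ι → ℝ} (h : Gam S k x) (hj : j ≤ k) : Gam S j x :=
  fun i hi => h i (hi.trans hj)

lemma Gam.erase {S : Finset ι} {k : ℕ} {x : ι → ℝ} (h : Gam S (k+1) x) {i : ι} (hi : i ∈ S) :
    Gam (S.erase i) k x := by
  intro j hj
  induction j with
  | zero => rw [es_zero]; norm_num
  | succ j ih =>
    have h0 := ih (by omega)
    have h1 := h (j+1) (by omega)
    rw [es_erase hi] at h1
    by_contra hc
    push Not at hc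
    rcases le_or_gt (x i) 0 with hx | hx
    · nlinarith
    · have h2 := h (j+1+1) (by omega)
      rw [es_erase hi] at h2
      have hn := newton (S.erase i) x j
      set a := es (S.erase i) j x
      set b := es (S.erase i) (j+1) x
      set c := es (S.erase i) (j+1+1) x
      have hn' : a * c ≤ b^2 := hn
      have hc0 : 0 < c := by nlinarith
      nlinarith [mul_pos h0 (by linarith : 0 < x i * b + c), mul_nonneg (neg_nonneg.2 hc) h1.le]

lemma es_succ_div {S : Finset ι} {k : ℕ} {x : ι → ℝ} (h : Gam S (k+1) x) :
    (k+2) * (es S (k+2) x / es S (k+1) x) =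
      ∑ i ∈ S, (x i - (x i)^2 / (x i + es (S.erase i) (k+1) x / es (S.erase i) k x)) := by
  have he := es_euler S (k+1) x
  push_cast at he
  have hp := h (k+1) le_rfl
  have : ((k:ℝ)+2) * es S (k+2) x = ((k:ℝ)+1+1) * es S (k+1+1) x := by ring
  rw [← mul_div_assoc, this, ← he, Finset.sum_div]
  refine Finset.sum_congr rfl fun i hi => ?_
  have h1 := h.erase hi k le_rfl
  have h2 := es_erase hi k x
  have h3 : x i + es (S.erase i) (k+1) x / es (S.erase i) k x = es S (k+1) x / es (S.erase i) k x := by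
    rw [h2]; field_simp
  rw [h3, div_div_eq_mul_div]
  rw [eq_sub_iff_add_eq, ← add_div, div_eq_iff hp.ne', h2]; ring

lemma titu {x y a b c : ℝ} (ha : 0 < a) (hb : 0 < b) (hc : a + b ≤ c) :
    (x+y)^2/c ≤ x^2/a + y^2/b := by
  calc (x+y)^2/c ≤ (x+y)^2/(a+b) := by gcongr
    _ ≤ _ := div_add_div_same_sq ha hb x y
where
  div_add_div_same_sq {a b : ℝ} (ha : 0 < a) (hb : 0 < b) (x y : ℝ) :
      (x+y)^2/(a+b) ≤ x^2/a + y^2/b := by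
    rw [div_add_div _ _ ha.ne' hb.ne', div_le_div_iff₀ (by positivity) (by positivity)]
    nlinarith [sq_nonneg (x*b - y*a), mul_pos ha hb]

lemma marcus_lopes (k : ℕ) : ∀ (S : Finset ι) (x y : ι → ℝ), Gam S k x → Gam S k y →
    Gam S k (x+y) ∧ es S (k+1) x / es S k x + es S (k+1) y / es S k y
      ≤ es S (k+1) (x+y) / es S k (x+y) := by
  induction k with
  | zero =>
    intro S x y _ _
    refine ⟨fun j hj => ?_, ?_⟩
    · obtain rfl : j = 0 := by omega
      rw [es_zero]; norm_num
    · simp [es_zero, es_one, Finset.sum_add_distrib]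
  | succ k ih =>
    intro S x y hx hy
    obtain ⟨h1, h2⟩ := ih S x y (hx.mono (by omega)) (hy.mono (by omega))
    have hG : Gam S (k+1) (x+y) := by
      intro j hj
      rcases Nat.lt_or_ge j (k+1) with hj' | hj'
      · exact h1 j (by omega)
      · obtain rfl : j = k+1 := by omega
        have a1 : 0 < es S (k+1) x / es S k x := div_pos (hx _ le_rfl) (hx _ (by omega))
        have a2 : 0 < es S (k+1) y / es S k y := div_pos (hy _ le_rfl) (hy _ (by omega))
        have a3 : 0 < es S (k+1) (x+y) / es S k (x+y) := by linarith
        exact (div_pos_iff_of_pos_right (h1 k le_rfl)).1 a3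
    refine ⟨hG, ?_⟩
    have e1 := es_succ_div hx
    have e2 := es_succ_div hy
    have e3 := es_succ_div hG
    refine le_of_mul_le_mul_left ?_ (by positivity : (0:ℝ) < k+2)
    rw [mul_add]
    show ((k:ℝ)+2) * (es S (k+2) x / es S (k+1) x) + ((k:ℝ)+2) * (es S (k+2) y / es S (k+1) y) ≤
      ((k:ℝ)+2) * (es S (k+2) (x+y) / es S (k+1) (x+y))
    rw [e1, e2, e3, ← Finset.sum_add_distrib]
    refine Finset.sum_le_sum fun i hi => ?_
    have g1 := hx.erase hi
    have g2 := hy.erase hi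
    obtain ⟨_, h4⟩ := ih (S.erase i) x y g1 g2
    have hz : ∀ z : ι → ℝ, Gam S (k+1) z → 0 < z i + es (S.erase i) (k+1) z / es (S.erase i) k z := by
      intro z hz
      have := hz (k+1) le_rfl
      rw [es_erase hi] at this
      have h5 := hz.erase hi k le_rfl
      have : z i + es (S.erase i) (k+1) z / es (S.erase i) k z
        = (z i * es (S.erase i) k z + es (S.erase i) (k+1) z) / es (S.erase i) k z := by field_simp
      rw [this]; positivity
    have := titu (x := x i) (y := y i) (hz x hx) (hz y hy)
      (c := (x+y) i + es (S.erase i) (k+1) (x+y) / es (S.erase i) k (x+y)) (by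
        simp only [Pi.add_apply]; linarith)
    simp only [Pi.add_apply] at this ⊢
    linarith

lemma Gam.smul {S : Finset ι} {k : ℕ} {x : ι → ℝ} (h : Gam S k x) {c : ℝ} (hc : 0 < c) :
    Gam S k (c • x) := fun j hj => by rw [es_smul]; exact mul_pos (pow_pos hc j) (h j hj)

/-- concavity of `log es` in multiplicative form avoided: direct log version -/
lemma log_es_concave (k : ℕ) {S : Finset ι} {x y : ι → ℝ} (hx : Gam S k x) (hy : Gam S k y)
    {s : ℝ} (h0 : 0 < s) (h1 : s < 1) : Gam S k ((1-s) • x + s • y) ∧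
    (1-s) * Real.log (es S k x) + s * Real.log (es S k y)
      ≤ Real.log (es S k ((1-s) • x + s • y)) := by
  have hs : 0 < 1 - s := by linarith
  induction k with
  | zero =>
    refine ⟨(marcus_lopes 0 S _ _ (hx.smul hs) (hy.smul h0)).1, ?_⟩
    simp [es_zero]
  | succ k ih =>
    obtain ⟨i1, i2⟩ := ih (hx.mono (by omega)) (hy.mono (by omega))
    have hG := (marcus_lopes (k+1) S _ _ (hx.smul hs) (hy.smul h0)).1
    have hml := (marcus_lopes k S _ _ ((hx.smul hs).mono (Nat.le_succ k)) ((hy.smul h0).mono (Nat.le_succ k))).2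
    refine ⟨hG, ?_⟩
    set z := (1-s) • x + s • y
    have px := hx k (by omega)
    have py := hy k (by omega)
    have px' := hx (k+1) le_rfl
    have py' := hy (k+1) le_rfl
    have pz := hG k (by omega)
    have pz' := hG (k+1) le_rfl
    have q : ∀ (c : ℝ) (w : ι → ℝ), 0 < c → es S (k+1) (c • w) / es S k (c • w) = c * (es S (k+1) w / es S k w) := by
      intro c w hc
      rw [es_smul, es_smul, pow_succ]
      field_simp
    rw [q _ _ hs, q _ _ h0] at hml
    have qx : 0 < es S (k+1) x / es S k x := by positivity
    have qy : 0 < es S (k+1) y / es S k y := by positivity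
    have hc := strictConcaveOn_log_Ioi.concaveOn.2 (Set.mem_Ioi.2 qx) (Set.mem_Ioi.2 qy) hs.le h0.le (by ring)
    simp only [smul_eq_mul] at hc
    have hl := Real.log_le_log (by positivity) hml
    rw [Real.log_div px'.ne' px.ne', Real.log_div py'.ne' py.ne'] at hc
    rw [Real.log_div pz'.ne' pz.ne'] at hl
    linarith

lemma log_es_tangent (k : ℕ) {S : Finset ι} {x y : ι → ℝ} (hx : Gam S (k+1) x) (hy : Gam S (k+1) y) :
    Real.log (es S (k+1) y) - Real.log (es S (k+1) x) ≤
      (∑ i ∈ S, (y i - x i) * es (S.erase i) k x) / es S (k+1) x := by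
  have hd := (es_hasDeriv S k x (y - x) 0)
  simp only [zero_smul, add_zero] at hd
  have hd2 := hd.log (by simpa using (hx (k+1) le_rfl).ne')
  simp only [zero_smul, add_zero] at hd2
  have ht := hd2.tendsto_slope_zero_right
  refine ge_of_tendsto ht ?_
  filter_upwards [Ioo_mem_nhdsGT (show (0:ℝ) < 1 by norm_num)] with s hs
  have := (log_es_concave (k+1) hx hy hs.1 hs.2).2
  have e : (1-s) • x + s • y = x + (s • (y - x)) := by ext i; simp; ring
  rw [e] at this
  simp only [zero_add, zero_smul, add_zero, smul_eq_mul]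
  rw [inv_mul_eq_div, le_div_iff₀ hs.1]
  linarith

/-- gradient inequality for `G = -1/es` -/
lemma G_tangent (k : ℕ) {S : Finset ι} {x y : ι → ℝ} (hx : Gam S (k+1) x) (hy : Gam S (k+1) y) :
    -1 / es S (k+1) y ≤ -1 / es S (k+1) x +
      ∑ i ∈ S, es (S.erase i) k x / (es S (k+1) x)^2 * (y i - x i) := by
  have h := log_es_tangent k hx hy
  have px := hx (k+1) le_rfl
  have py := hy (k+1) le_rfl
  have h2 := Real.one_sub_inv_le_log_of_pos (div_pos py px)
  rw [Real.log_div py.ne' px.ne', inv_div] at h2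
  have h3 := h2.trans h
  have : ∑ i ∈ S, es (S.erase i) k x / (es S (k+1) x)^2 * (y i - x i)
     = (∑ i ∈ S, (y i - x i) * es (S.erase i) k x) / es S (k+1) x / es S (k+1) x := by
    rw [Finset.sum_div, Finset.sum_div]
    refine Finset.sum_congr rfl fun i _ => ?_
    field_simp
  rw [this]
  have h4 : -1 / es S (k+1) y = -1 / es S (k+1) x + (1 - es S (k+1) x / es S (k+1) y) / es S (k+1) x := by
    field_simp; ring
  rw [h4]
  gcongr
end A
end

section
section A
variable {ι : Type*} [DecidableEq ι]

lemma es_nonneg {S : Finset ι} {x : ι → ℝ} (h : ∀ i ∈ S, 0 ≤ x i) (k : ℕ) : 0 ≤ es S k x :=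
  Finset.sum_nonneg fun s hs => Finset.prod_nonneg fun i hi =>
    h i ((Finset.mem_powersetCard.1 hs).1 hi)

lemma es_abs_le {S : Finset ι} {x : ι → ℝ} {C : ℝ} (hC : 0 ≤ C) (h : ∀ i ∈ S, |x i| ≤ C) (k : ℕ) :
    |es S k x| ≤ 2 ^ S.card * C ^ k := by
  unfold es
  refine (Finset.abs_sum_le_sum_abs _ _).trans ?_
  have h1 : ∀ s ∈ S.powersetCard k, |∏ i ∈ s, x i| ≤ C ^ k := by
    intro s hs
    obtain ⟨h1, h2⟩ := Finset.mem_powersetCard.1 hs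
    rw [Finset.abs_prod, ← h2]
    calc ∏ i ∈ s, |x i| ≤ ∏ i ∈ s, C :=
          Finset.prod_le_prod (fun i _ => abs_nonneg _) (fun i hi => h i (h1 hi))
      _ = C ^ s.card := by simp
  calc _ ≤ ∑ s ∈ S.powersetCard k, C ^ k := Finset.sum_le_sum h1
    _ = (S.card.choose k : ℝ) * C ^ k := by simp
    _ ≤ _ := by
        gcongr
        exact_mod_cast Nat.choose_le_two_pow _ _

/-- lower ellipticity -/
lemma f_i_lower {S : Finset ι} {x : ι → ℝ} {C : ℝ} (hC : 0 ≤ C) (h : ∀ i ∈ S, |x i| ≤ C) {k : ℕ}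
    (hx : Gam S (k+1) x) {i : ι} (hi : i ∈ S) :
    es S (k+1) x ≤ C * (S.card + 1) * es (S.erase i) k x := by
  have he := hx.erase hi k le_rfl
  have hxi := (abs_le.1 (h i hi)).2
  have h1 : x i * es (S.erase i) k x ≤ C * es (S.erase i) k x := by gcongr
  have h2 : es (S.erase i) (k+1) x ≤ C * S.card * es (S.erase i) k x := by
    by_cases hp : 0 < es (S.erase i) (k+1) x
    · have hG : Gam (S.erase i) (k+1) x := by
        intro j hj
        rcases Nat.lt_or_ge j (k+1) with hj' | hj'
        · exact hx.erase hi j (by omega)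
        · obtain rfl : j = k+1 := by omega
          exact hp
      have h3 := es_euler (S.erase i) k x
      have h4 : ∑ j ∈ S.erase i, x j * es ((S.erase i).erase j) k x
          ≤ ∑ j ∈ S.erase i, C * es ((S.erase i).erase j) k x := by
        refine Finset.sum_le_sum fun j hj => ?_
        have h5 := hG.erase hj k le_rfl
        have h6 := (abs_le.1 (h j (Finset.mem_of_mem_erase hj))).2
        gcongr
      rw [h3, ← Finset.mul_sum, es_sum_erase, Finset.card_erase_of_mem hi] at h4
      have hc : ((S.card - 1 : ℕ) : ℝ) ≤ S.card := by exact_mod_cast Nat.sub_le _ _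
      have hk : (0:ℝ) ≤ k := Nat.cast_nonneg k
      have : C * ((((S.card - 1 : ℕ) : ℝ) - k) * es (S.erase i) k x) ≤ C * (S.card * es (S.erase i) k x) := by
        gcongr; linarith
      nlinarith [mul_nonneg hk hp.le]
    · push Not at hp
      have : 0 ≤ C * S.card * es (S.erase i) k x := by positivity
      linarith
  rw [es_erase hi]; linarith

lemma e_pow {S : Finset ι} {x : ι → ℝ} (k : ℕ) (hx : Gam S (k+2) x) :
    es S 1 x * es S (k+2) x ^ k ≤ es S (k+1) x ^ (k+1) := by
  induction k with
  | zero => simp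
  | succ k ih =>
    have h0 := ih (hx.mono (by omega))
    have a := hx (k+1) (by omega)
    have b := hx (k+2) (by omega)
    have c := hx (k+3) (by omega)
    have hn := newton S x (k+1)
    have h1 : (es S (k+1) x * es S (k+3) x)^(k+1) ≤ (es S (k+2) x ^2)^(k+1) := by
      gcongr
    have h2 : es S 1 x * es S (k+2) x ^ k * es S (k+3) x ^ (k+1) ≤ (es S (k+1) x * es S (k+3) x)^(k+1) := by
      rw [mul_pow]; gcongr
    have h3 : es S (k+2) x ^ k * (es S 1 x * es S (k+3) x ^ (k+1)) ≤ es S (k+2) x ^ k * (es S (k+2) x ^ (k+2)) := by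
      calc _ = es S 1 x * es S (k+2) x ^ k * es S (k+3) x ^ (k+1) := by ring
        _ ≤ _ := h2.trans h1
        _ = _ := by ring
    exact le_of_mul_le_mul_left h3 (by positivity)

lemma es_shift_hasDeriv (S : Finset ι) (k : ℕ) (x : ι → ℝ) (s : ℝ) :
    HasDerivAt (fun t : ℝ => es S (k+1) (x + t • fun _ => 1))
      (((S.card : ℝ) - k) * es S k (x + s • fun _ => 1)) s := by
  have h := es_hasDeriv S k x (fun _ => 1) s
  rw [← es_sum_erase]
  simpa using h

lemma shift_step (S : Finset ι) (k : ℕ) (x : ι → ℝ) {s B : ℝ} (hB : 0 ≤ B) (hs : 0 ≤ s)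
    (hk : k ≤ S.card)
    (h : ∀ t ∈ Set.Icc 0 s, es S k (x + t • fun _ => 1) ≤ B) :
    es S (k+1) (x + s • fun _ => 1) ≤ es S (k+1) x + S.card * B * s := by
  have h1 : AntitoneOn (fun t : ℝ => es S (k+1) (x + t • fun _ => 1) - (S.card * B) * t) (Set.Icc 0 s) := by
    have hd : ∀ t : ℝ, HasDerivAt (fun t : ℝ => es S (k+1) (x + t • fun _ => 1) - (S.card * B) * t)
      (((S.card : ℝ) - k) * es S k (x + t • fun _ => 1) - (S.card * B) * 1) t := fun t =>
        (es_shift_hasDeriv S k x t).sub ((hasDerivAt_id t).const_mul _)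
    refine antitoneOn_of_hasDerivWithinAt_nonpos (convex_Icc 0 s)
      (fun t _ => (hd t).continuousAt.continuousWithinAt) (fun t _ => (hd t).hasDerivWithinAt) ?_
    intro t ht
    rw [interior_Icc] at ht
    have := h t ⟨ht.1.le, ht.2.le⟩
    have hk' : (0:ℝ) ≤ (S.card:ℝ) - k := sub_nonneg.2 (by exact_mod_cast hk)
    have hk0 : (0:ℝ) ≤ k := Nat.cast_nonneg k
    nlinarith [mul_le_mul_of_nonneg_left this hk', mul_nonneg hk0 hB]
  have := h1 (Set.left_mem_Icc.2 hs) (Set.right_mem_Icc.2 hs) hs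
  simp at this
  linarith

lemma es_card_lt {S : Finset ι} {k : ℕ} (h : S.card < k) (x : ι → ℝ) : es S k x = 0 := by
  unfold es
  rw [Finset.powersetCard_eq_empty.2 h]; simp

/-- bound for shifted symmetric functions -/
lemma shift_bound (S : Finset ι) (k : ℕ) (x : ι → ℝ) {m : ℝ} (hm : 0 ≤ m)
    (h : ∀ j < k, 0 ≤ es S j x ∧ m * es S j x ≤ es S (j+1) x) :
    ∀ j ≤ k, ∀ t ∈ Set.Icc 0 m, es S j (x + t • fun _ => 1) ≤ (1 + S.card)^j * es S j x := by
  intro j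
  induction j with
  | zero => intro _ t _; simp [es_zero]
  | succ j ih =>
    intro hj t ht
    by_cases hc : j ≤ S.card
    · have h1 := shift_step S j x (s := t) (B := (1 + S.card)^j * es S j x)
        (mul_nonneg (by positivity) (h j (by omega)).1) ht.1 hc
        (fun r hr => ih (by omega) r ⟨hr.1, hr.2.trans ht.2⟩)
      obtain ⟨h2, h3⟩ := h j (by omega)
      have h4 : t * es S j x ≤ es S (j+1) x := (mul_le_mul_of_nonneg_right ht.2 h2).trans h3
      have h5 : 0 ≤ es S (j+1) x := (mul_nonneg hm h2).trans h3
      have h6 : (1:ℝ) ≤ (1 + S.card)^j := one_le_pow₀ (by linarith [(Nat.cast_nonneg S.card : (0:ℝ) ≤ _)])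
      have h7 : (S.card : ℝ) * ((1 + S.card)^j * es S j x) * t ≤ S.card * (1 + S.card)^j * es S (j+1) x := by
        calc _ = S.card * (1 + S.card)^j * (t * es S j x) := by ring
          _ ≤ _ := by gcongr
      rw [pow_succ]
      nlinarith [mul_le_mul_of_nonneg_right h6 h5]
    · rw [es_card_lt (by omega), es_card_lt (by omega)]; simp

/-- A4 : top eigenvalue times its coefficient. -/
lemma top_bound {S : Finset ι} {x : ι → ℝ} {k : ℕ} (hx : Gam S (k+2) x) {K X : ℝ} (hK : 0 ≤ K)
    {i0 : ι} (hi0 : i0 ∈ S) (hX : x i0 = X) (hlow : ∀ i ∈ S, -K ≤ x i) (hX0 : 0 < X)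
    (hXl : 2 * ((1 + S.card)^(k+2)) * K ≤ X) :
    X * es (S.erase i0) (k+1) x ≤ 2 * es S (k+2) x ∨
    ∃ i ∈ S, x i < 0 ∧ X * es (S.erase i0) (k+1) x ≤
      2 * es S (k+2) x + 2 * (1 + S.card)^(k+2) * K^2 * (es (S.erase i) (k+1) x / X) := by
  have hf := hx (k+2) le_rfl
  have hS := hx.erase hi0
  have hfe : es S (k+2) x = X * es (S.erase i0) (k+1) x + es (S.erase i0) (k+2) x := by
    rw [← hX]; exact es_erase hi0 (k+1) x
  by_cases hneg : ∃ i ∈ S.erase i0, x i < 0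
  · right
    obtain ⟨j, hj, hjneg⟩ := hneg
    obtain ⟨i, hi, hmin⟩ := Finset.exists_min_image (S.erase i0) x ⟨j, hj⟩
    have hineg : x i < 0 := (hmin j hj).trans_lt hjneg
    set N := (S.erase i0).erase i with hN
    set m := - x i with hm
    have hm0 : 0 < m := by rw [hm]; linarith
    have hmK : m ≤ K := by have := hlow i (Finset.mem_of_mem_erase hi); rw [hm]; linarith
    have hNG : ∀ j ≤ k+1, 0 < es N j x := by
      intro j
      induction j with
      | zero => intro _; rw [es_zero]; norm_num
      | succ j ih =>
        intro hj
        have h1 := hS (j+1) hj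
        rw [es_erase hi] at h1
        nlinarith [ih (by omega)]
    have hNm : ∀ j < k+1, 0 ≤ es N j x ∧ m * es N j x ≤ es N (j+1) x := by
      intro j hj
      refine ⟨(hNG j (by omega)).le, ?_⟩
      have h1 := hS (j+1) (by omega)
      rw [es_erase hi] at h1
      have : x i = -m := by rw [hm]; ring
      rw [this] at h1; linarith
    have hcN : (N.card : ℝ) ≤ S.card := by
      exact_mod_cast Finset.card_le_card ((Finset.erase_subset _ _).trans (Finset.erase_subset _ _))
    have hc0 : (0:ℝ) ≤ N.card := Nat.cast_nonneg _
    -- lower bound of es N (k+2)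
    have hlowN : -((1 + S.card)^(k+2) - 1) * m * es N (k+1) x ≤ es N (k+2) x := by
      have hpos : 0 ≤ es N (k+2) (x + m • fun _ => 1) := by
        refine es_nonneg (fun l hl => ?_) _
        have := hmin l (Finset.mem_of_mem_erase hl)
        simp [hm]; linarith
      by_cases hc : k + 1 ≤ N.card
      · have h1 := shift_step N (k+1) x (s := m) (B := (1 + N.card)^(k+1) * es N (k+1) x)
          (mul_nonneg (by positivity) (hNG _ le_rfl).le) hm0.le hc
          (shift_bound N (k+1) x hm0.le hNm (k+1) le_rfl)
        have h2 : (N.card:ℝ) * (1 + N.card)^(k+1) ≤ (1 + S.card)^(k+2) - 1 := by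
          have h3 : (1:ℝ) ≤ (1 + N.card)^(k+1) := one_le_pow₀ (by linarith)
          have h4 : ((1:ℝ) + N.card)^(k+2) ≤ (1 + S.card)^(k+2) := by gcongr
          rw [pow_succ] at h4
          nlinarith
        have h5 : (N.card:ℝ) * (1 + N.card)^(k+1) * (m * es N (k+1) x) ≤
          ((1 + S.card)^(k+2) - 1) * (m * es N (k+1) x) := by
          gcongr
          exact mul_nonneg hm0.le (hNG _ le_rfl).le
        nlinarith
      · rw [es_card_lt (S := N) (k := k+1) (by omega), es_card_lt (S := N) (k := k+2) (by omega)]; simp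
    set C := ((1:ℝ) + S.card)^(k+2) with hC
    have hC1 : 1 ≤ C := one_le_pow₀ (by linarith)
    have e1 : es (S.erase i0) (k+2) x = -m * es N (k+1) x + es N (k+2) x := by
      rw [es_erase hi, hm]; ring
    have e2 : es (S.erase i0) (k+1) x = -m * es N k x + es N (k+1) x := by
      rw [es_erase hi, hm]; ring
    have hii : i0 ∈ S.erase i := by
      refine Finset.mem_erase.2 ⟨?_, hi0⟩
      rintro rfl; simp at hi
    have e3 : es (S.erase i) (k+1) x = X * es N k x + es N (k+1) x := by
      rw [es_erase hii, hX, hN, Finset.erase_right_comm]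
    have p1 := hNG k (by omega)
    have p2 := hNG (k+1) le_rfl
    refine ⟨i, Finset.mem_of_mem_erase hi, hineg, ?_⟩
    have h6 : es N k x ≤ es (S.erase i) (k+1) x / X := by
      rw [le_div_iff₀ hX0, e3]; linarith
    have q := hS (k+1) le_rfl
    set F := es (S.erase i0) (k+1) x
    -- X F = f - es (S.erase i0) (k+2) ≤ f + C m es N (k+1) = f + C m (F + m es N k)
    have h7 : X * F ≤ es S (k+2) x + C * m * (F + m * es N k x) := by
      have : F + m * es N k x = es N (k+1) x := by linarith
      rw [this]; nlinarith
    have h8 : C * m * F ≤ X / 2 * F := by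
      gcongr
      nlinarith
    have h9 : C * m * (m * es N k x) ≤ C * K^2 * (es (S.erase i) (k+1) x / X) := by
      have : C * m * (m * es N k x) = C * m^2 * es N k x := by ring
      rw [this]
      gcongr
    nlinarith
  · left
    push Not at hneg
    have := es_nonneg (S := S.erase i0) hneg (k+2)
    linarith
end A
end

section
def hat {n : ℕ} (α : ℝ) (lam : Fin n → ℝ) : Option (Fin n) → ℝ := fun o => o.elim α lam

/-- `f` with `k = K+2` -/
def fv {n : ℕ} (α : ℝ) (K : ℕ) (lam : Fin n → ℝ) : ℝ := es Finset.univ (K+2) (hat α lam)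
def fvi {n : ℕ} (α : ℝ) (K : ℕ) (lam : Fin n → ℝ) (i : Fin n) : ℝ :=
  es (Finset.univ.erase (some i)) (K+1) (hat α lam)
def gvi {n : ℕ} (α : ℝ) (K : ℕ) (lam : Fin n → ℝ) (i : Fin n) : ℝ := fvi α K lam i / (fv α K lam)^2
def Cone {n : ℕ} (α : ℝ) (K : ℕ) (lam : Fin n → ℝ) : Prop := Gam Finset.univ (K+2) (hat α lam)

section A
variable {n : ℕ} {α : ℝ} {K : ℕ}

lemma Cone.fv_pos {lam : Fin n → ℝ} (h : Cone α K lam) : 0 < fv α K lam := h _ le_rfl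
lemma Cone.fvi_pos {lam : Fin n → ℝ} (h : Cone α K lam) (i : Fin n) : 0 < fvi α K lam i :=
  Gam.erase h (Finset.mem_univ _) _ le_rfl
lemma Cone.gvi_pos {lam : Fin n → ℝ} (h : Cone α K lam) (i : Fin n) : 0 < gvi α K lam i :=
  div_pos (h.fvi_pos i) (pow_pos h.fv_pos 2)

lemma gv_tangent {lam mu : Fin n → ℝ} (h : Cone α K lam) (h' : Cone α K mu) :
    -1 / fv α K mu ≤ -1 / fv α K lam + ∑ i, gvi α K lam i * (mu i - lam i) := by
  have := G_tangent (K+1) h h'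
  rw [Fintype.sum_option] at this
  simpa [hat, fv, gvi, fvi] using this

lemma es_perm {ι : Type*} [DecidableEq ι] [Fintype ι] (e : Equiv.Perm ι) (k : ℕ) (x : ι → ℝ) :
    es Finset.univ k (x ∘ e) = es Finset.univ k x := by
  unfold es
  refine Finset.sum_bij' (fun s _ => s.map e.toEmbedding) (fun s _ => s.map e.symm.toEmbedding)
    ?_ ?_ ?_ ?_ ?_
  · intro s hs; simpa [Finset.mem_powersetCard] using hs
  · intro s hs; simpa [Finset.mem_powersetCard] using hs
  · intro s hs; ext; simp
  · intro s hs; ext; simp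
  · intro s hs; simp

lemma hat_perm (e : Equiv.Perm (Fin n)) (lam : Fin n → ℝ) :
    hat α (lam ∘ e) = hat α lam ∘ (Equiv.optionCongr e) := by
  ext o; cases o <;> simp [hat]

lemma fv_perm (e : Equiv.Perm (Fin n)) (lam : Fin n → ℝ) : fv α K (lam ∘ e) = fv α K lam := by
  unfold fv; rw [hat_perm, es_perm]

lemma Cone.perm {lam : Fin n → ℝ} (h : Cone α K lam) (e : Equiv.Perm (Fin n)) : Cone α K (lam ∘ e) := by
  intro j hj; rw [hat_perm, es_perm]; exact h j hj

lemma es_none (k : ℕ) (lam : Fin n → ℝ) :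
    es (Finset.univ.erase (none : Option (Fin n))) k (hat α lam) = es Finset.univ k lam := by
  have : (Finset.univ.erase (none : Option (Fin n))) = Finset.univ.map Function.Embedding.some := by
    ext o; cases o <;> simp
  rw [this]
  unfold es
  rw [Finset.powersetCard_map, Finset.sum_map]
  refine Finset.sum_congr rfl fun s hs => ?_
  simp [hat, Finset.mapEmbedding]

lemma es_hat_succ (k : ℕ) (lam : Fin n → ℝ) :
    es Finset.univ (k+1) (hat α lam) = α * es Finset.univ k lam + es Finset.univ (k+1) lam := by
  rw [es_erase (Finset.mem_univ (none : Option (Fin n))), es_none, es_none]; rfl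

lemma fvi_anti {lam : Fin n → ℝ} (h : Cone α K lam) {i j : Fin n} (hij : lam i ≤ lam j) :
    fvi α K lam j ≤ fvi α K lam i := by
  by_cases e : i = j
  · rw [e]
  unfold fvi
  have hi : (some i) ∈ (Finset.univ : Finset (Option (Fin n))).erase (some j) := by simp [e]
  have hj : (some j) ∈ (Finset.univ : Finset (Option (Fin n))).erase (some i) := by simp [Ne.symm e]
  rw [es_erase hi, es_erase hj, Finset.erase_right_comm]
  have : 0 < es ((Finset.univ.erase (some i)).erase (some j)) K (hat α lam) :=
    Gam.erase (Gam.erase h (Finset.mem_univ _)) hj K le_rfl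
  have : lam i * es ((Finset.univ.erase (some i)).erase (some j)) K (hat α lam)
    ≤ lam j * es ((Finset.univ.erase (some i)).erase (some j)) K (hat α lam) := by gcongr
  simp only [hat, Option.elim] at this ⊢
  linarith

lemma gvi_anti {lam : Fin n → ℝ} (h : Cone α K lam) {i j : Fin n} (hij : lam i ≤ lam j) :
    gvi α K lam j ≤ gvi α K lam i := by
  unfold gvi
  have := fvi_anti h hij
  gcongr

lemma gvi_euler {lam : Fin n → ℝ} (h : Cone α K lam) (hα : 0 < α) :
    ∑ i, gvi α K lam i * lam i ≤ (K+2) / fv α K lam := by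
  have he := es_euler (Finset.univ : Finset (Option (Fin n))) (K+1) (hat α lam)
  rw [Fintype.sum_option] at he
  have h0 : 0 < es (Finset.univ.erase (none : Option (Fin n))) (K+1) (hat α lam) :=
    Gam.erase h (Finset.mem_univ _) _ le_rfl
  have hf := h.fv_pos
  have h1 : ∑ i, lam i * fvi α K lam i ≤ (K+2) * fv α K lam := by
    have e : hat α lam none = α := rfl
    have e2 : ∀ i, hat α lam (some i) = lam i := fun i => rfl
    simp only [e, e2] at he
    push_cast at he
    unfold fvi fv
    have := mul_pos hα h0
    have e3 : ((K:ℝ) + 2) = K + 1 + 1 := by ring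
    rw [e3]; linarith
  have : ∑ i, gvi α K lam i * lam i = (∑ i, lam i * fvi α K lam i) / (fv α K lam)^2 := by
    rw [Finset.sum_div]
    refine Finset.sum_congr rfl fun i _ => ?_
    unfold gvi; ring
  rw [this, div_le_div_iff₀ (by positivity) hf]
  nlinarith

lemma fvi_sum_lower {lam : Fin n → ℝ} (h : Cone α K lam) (hα : 0 < α) (hKn : K + 2 ≤ n) :
    es Finset.univ (K+1) (hat α lam) ≤ ∑ i, fvi α K lam i := by
  have hs := es_sum_erase (Finset.univ : Finset (Option (Fin n))) (K+1) (hat α lam)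
  rw [Fintype.sum_option] at hs
  have h0 : 0 < es (Finset.univ.erase (none : Option (Fin n))) K (hat α lam) :=
    Gam.erase h (Finset.mem_univ _) _ (by omega)
  have he := es_erase (Finset.mem_univ (none : Option (Fin n))) K (hat α lam)
  have e : hat α lam none = α := rfl
  rw [e] at he
  have hp := h (K+1) (by omega)
  simp only [Finset.card_univ, Fintype.card_option, Fintype.card_fin] at hs
  push_cast at hs
  have hn : (K:ℝ) + 2 ≤ n := by exact_mod_cast hKn
  unfold fvi
  nlinarith [mul_pos hα h0, mul_nonneg (by linarith : (0:ℝ) ≤ n - K - 2) hp.le]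

lemma T_lower {lam : Fin n → ℝ} (h : Cone α K lam) (hα : 0 < α) (hKn : K + 2 ≤ n) (i : Fin n) :
    lam i * fv α K lam ^ K ≤ (∑ i, fvi α K lam i)^(K+1) := by
  have h1 := e_pow K h
  have h2 := fvi_sum_lower h hα hKn
  have hp := h (K+1) (by omega)
  have h3 : lam i ≤ es Finset.univ 1 (hat α lam) := by
    have := es_erase (Finset.mem_univ (some i)) 0 (hat α lam)
    rw [es_zero, mul_one] at this
    have h4 : 0 < es (Finset.univ.erase (some i)) 1 (hat α lam) :=
      Gam.erase h (Finset.mem_univ _) 1 (by omega)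
    have e : hat α lam (some i) = lam i := rfl
    rw [e] at this
    simp only [zero_add] at this
    linarith
  have hf := h.fv_pos
  calc _ ≤ es Finset.univ 1 (hat α lam) * fv α K lam ^ K := by gcongr
    _ ≤ _ := h1
    _ ≤ _ := by gcongr

lemma top_bound' {lam : Fin n → ℝ} (h : Cone α K lam) (hα : 0 < α) {K0 : ℝ} (hK : 0 ≤ K0)
    (hlow : ∀ i, -K0 ≤ lam i) (i0 : Fin n) (hX0 : 0 < lam i0)
    (hXl : 2 * ((n + 2)^(K+2)) * K0 ≤ lam i0) :
    lam i0 * fvi α K lam i0 ≤ 2 * fv α K lam + 2 * (n+2)^(K+2) * K0^2 * ((∑ i, fvi α K lam i) / lam i0) := by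
  have hc : (1 + ((Finset.univ : Finset (Option (Fin n))).card : ℝ)) = n + 2 := by
    simp; ring
  have hs : 0 ≤ ∑ i, fvi α K lam i := Finset.sum_nonneg fun i _ => (h.fvi_pos i).le
  rcases top_bound (S := Finset.univ) h hK (i0 := some i0) (Finset.mem_univ _) (X := lam i0) rfl
    (by
      intro o _
      cases o with
      | none => simp only [hat, Option.elim]; linarith
      | some i => exact hlow i) hX0 (by rw [hc]; exact hXl) with h1 | ⟨o, _, ho, h1⟩
  · refine h1.trans ?_
    have : 0 ≤ 2 * ((n:ℝ)+2)^(K+2) * K0^2 * ((∑ i, fvi α K lam i) / lam i0) := by positivity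
    unfold fv at *; linarith
  · cases o with
    | none => simp only [hat, Option.elim] at ho; linarith
    | some i =>
      rw [hc] at h1
      refine h1.trans ?_
      have : fvi α K lam i ≤ ∑ i, fvi α K lam i :=
        Finset.single_le_sum (f := fun i => fvi α K lam i) (fun i _ => (h.fvi_pos i).le) (Finset.mem_univ i)
      unfold fv fvi at *
      gcongr

lemma hat_abs {lam : Fin n → ℝ} {C : ℝ} (hα : 0 < α) (hC : α ≤ C) (hl : ∀ i, |lam i| ≤ C) (o : Option (Fin n)) :
    |hat α lam o| ≤ C := by
  cases o with
  | none => simpa [hat, abs_of_pos hα] using hC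
  | some i => exact hl i

/-- uniform ellipticity at the vector level -/
lemma gvi_bounds (hα : 0 < α) (n K : ℕ) {C m1 m2 : ℝ} (hm1 : 0 < m1) (hm2 : 0 < m2) : ∃ c0 C0 : ℝ, 0 < c0 ∧ 0 < C0 ∧
    ∀ lam : Fin n → ℝ, Cone α K lam → (∀ i, |lam i| ≤ C) → m1 ≤ fv α K lam → fv α K lam ≤ m2 →
      ∀ i, c0 ≤ gvi α K lam i ∧ gvi α K lam i ≤ C0 := by
  set C' := max C α + 1
  have hC' : 0 < C' := by have := le_max_right C α; simp only [C']; linarith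
  refine ⟨m1 / (C' * (n+1+1)) / m2^2, 2^n * C'^(K+1) / m1^2, by positivity, by positivity, ?_⟩
  intro lam h hl h1 h2 i
  have hl' : ∀ o ∈ (Finset.univ : Finset (Option (Fin n))), |hat α lam o| ≤ C' := fun o _ =>
    hat_abs hα (by simp only [C']; linarith [le_max_right C α]) (fun i => (hl i).trans (by simp only [C']; linarith [le_max_left C α])) o
  have a1 := f_i_lower hC'.le hl' h (Finset.mem_univ (some i))
  have a2 := es_abs_le hC'.le (fun o ho => hl' o (Finset.mem_of_mem_erase ho)) (K+1) (S := Finset.univ.erase (some i))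
  have hf := h.fv_pos
  have hfi := h.fvi_pos i
  constructor
  · unfold gvi
    have : m1 / (C' * (n+1+1)) ≤ fvi α K lam i := by
      rw [div_le_iff₀ (by positivity)]
      simp only [Finset.card_univ, Fintype.card_option, Fintype.card_fin] at a1
      push_cast at a1
      unfold fvi; unfold fv at h1; linarith
    gcongr
  · unfold gvi
    have : fvi α K lam i ≤ 2^n * C'^(K+1) := by
      have := (abs_le.1 a2).2
      rw [Finset.card_erase_of_mem (Finset.mem_univ _)] at this
      simpa [fvi] using this
    gcongr
end A
end

section
abbrev Mat (n : ℕ) := Fin n → Fin n → ℝ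

/-- bilinear form -/
def qf {n : ℕ} (B : Mat n) (v w : Fin n → ℝ) : ℝ := ∑ i, ∑ j, v i * B i j * w j
def dot {n : ℕ} (v w : Fin n → ℝ) : ℝ := ∑ i, v i * w i
def ON {n : ℕ} (q : Fin n → Fin n → ℝ) : Prop := ∀ i j, dot (q i) (q j) = if i = j then 1 else 0
def Symm {n : ℕ} (B : Mat n) : Prop := ∀ i j, B i j = B j i

def sg {n : ℕ} (j : ℕ) (A : Mat n) : ℝ :=
  ∑ s ∈ (Finset.univ : Finset (Fin n)).powersetCard j,
    ((Matrix.of A).submatrix (Subtype.val : s → Fin n) (Subtype.val : s → Fin n)).det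

def fm {n : ℕ} (α : ℝ) (K : ℕ) (A : Mat n) : ℝ := α * sg (K+1) A + sg (K+2) A

def Gm {n : ℕ} (α : ℝ) (K : ℕ) (A : Mat n) : ℝ := -1 / fm α K A

/-- eigendecomposition data -/
def Eig {n : ℕ} (A : Mat n) (lam : Fin n → ℝ) (q : Fin n → Fin n → ℝ) : Prop :=
  ON q ∧ (∀ i l, ∑ j, A l j * q i j = lam i * q i l) ∧ ∀ j, sg j A = es Finset.univ j lam

section M
variable {n : ℕ} {α : ℝ} {K : ℕ}

lemma dot_comm (v w : Fin n → ℝ) : dot v w = dot w v := by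
  unfold dot; exact Finset.sum_congr rfl fun i _ => mul_comm _ _

lemma ON.complete {q : Fin n → Fin n → ℝ} (h : ON q) (a b : Fin n) :
    ∑ i, q i a * q i b = if a = b then 1 else 0 := by
  have h1 : (Matrix.of q) * (Matrix.of q).transpose = 1 := by
    ext i j
    have := h i j
    simpa [Matrix.mul_apply, dot, Matrix.one_apply] using this
  have h2 := mul_eq_one_comm.1 h1
  have := congrFun (congrFun h2 a) b
  simpa [Matrix.mul_apply, Matrix.one_apply] using this

lemma ON.expand {q : Fin n → Fin n → ℝ} (h : ON q) (v : Fin n → ℝ) (a : Fin n) :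
    ∑ i, dot (q i) v * q i a = v a := by
  unfold dot
  simp_rw [Finset.sum_mul]
  rw [Finset.sum_comm]
  have : ∀ b, ∑ i, q i b * v b * q i a = v b * (if a = b then 1 else 0) := by
    intro b
    rw [← h.complete a b, Finset.mul_sum]
    exact Finset.sum_congr rfl fun i _ => by ring
  simp [this]

lemma ON.parseval {q : Fin n → Fin n → ℝ} (h : ON q) (v w : Fin n → ℝ) :
    ∑ i, dot (q i) v * dot (q i) w = dot v w := by
  have : ∀ i, dot (q i) v * dot (q i) w = ∑ a, (dot (q i) v * q i a) * w a := by
    intro i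
    conv_lhs => rw [dot.eq_1 (q i) w, Finset.mul_sum]
    exact Finset.sum_congr rfl fun a _ => by ring
  simp_rw [this]
  rw [Finset.sum_comm]
  simp_rw [← Finset.sum_mul, h.expand]
  rfl

lemma qf_eq_dot (B : Mat n) (v w : Fin n → ℝ) : qf B v w = dot v (fun i => ∑ j, B i j * w j) := by
  unfold qf dot
  refine Finset.sum_congr rfl fun i _ => ?_
  rw [Finset.mul_sum]
  exact Finset.sum_congr rfl fun j _ => by ring

lemma qf_comm {B : Mat n} (h : Symm B) (v w : Fin n → ℝ) : qf B v w = qf B w v := by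
  unfold qf
  rw [Finset.sum_comm]
  refine Finset.sum_congr rfl fun i _ => Finset.sum_congr rfl fun j _ => ?_
  rw [h j i]; ring

lemma Eig.qf_right {A : Mat n} {lam q} (h : Eig A lam q) (v : Fin n → ℝ) (i : Fin n) :
    qf A v (q i) = lam i * dot v (q i) := by
  rw [qf_eq_dot]
  simp_rw [h.2.1 i]
  unfold dot
  rw [Finset.mul_sum]
  exact Finset.sum_congr rfl fun j _ => by ring

lemma Eig.qf_self {A : Mat n} {lam q} (h : Eig A lam q) (i j : Fin n) :
    qf A (q i) (q j) = if i = j then lam j else 0 := by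
  rw [h.qf_right, h.1]; split_ifs <;> simp

lemma Eig.qf_expand {A : Mat n} {lam q} (h : Eig A lam q) (v w : Fin n → ℝ) :
    qf A v w = ∑ i, lam i * (dot (q i) v * dot (q i) w) := by
  rw [qf_eq_dot]
  have : ∀ l, ∑ j, A l j * w j = ∑ i, dot (q i) w * (lam i * q i l) := by
    intro l
    have : ∀ j, A l j * w j = ∑ i, dot (q i) w * (A l j * q i j) := by
      intro j
      conv_lhs => rw [← h.1.expand w j, Finset.mul_sum]
      exact Finset.sum_congr rfl fun i _ => by ring
    simp_rw [this]
    rw [Finset.sum_comm]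
    simp_rw [← Finset.mul_sum, h.2.1]
  simp_rw [this]
  rw [dot.eq_1]
  simp_rw [Finset.mul_sum]
  rw [Finset.sum_comm]
  refine Finset.sum_congr rfl fun i _ => ?_
  rw [dot.eq_1 (q i) v, Finset.sum_mul, Finset.mul_sum]
  exact Finset.sum_congr rfl fun j _ => by ring

lemma Eig.symm {A : Mat n} {lam q} (h : Eig A lam q) : Symm A := by
  have e : ∀ i j, qf A (Pi.single i 1) (Pi.single j 1) = A i j := by
    intro i j; simp [qf, Pi.single_apply]
  intro i j
  rw [← e i j, ← e j i, h.qf_expand, h.qf_expand]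
  exact Finset.sum_congr rfl fun i _ => by ring

lemma sg_eig {A : Mat n} (hA : (Matrix.of A).IsHermitian) (j : ℕ) :
    sg j A = es Finset.univ j hA.eigenvalues := by
  by_cases hj : j ≤ n
  · have h1 := Matrix.charpoly_coeff_eq_sum_minors (Matrix.of A) j (by simpa using hj)
    have h2 := Multiset.prod_X_sub_C_coeff (Finset.univ.val.map hA.eigenvalues) (k := n - j) (by simp)
    have h3 : ((Finset.univ.val.map hA.eigenvalues).map fun t => Polynomial.X - Polynomial.C t).prod
        = (Matrix.of A).charpoly := by
      rw [hA.charpoly_eq, Multiset.map_map]; rfl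
    rw [h3] at h2
    simp only [Fintype.card_fin] at h1
    rw [h1] at h2
    simp only [Multiset.card_map, Finset.card_val, Finset.card_univ, Fintype.card_fin,
      Nat.sub_sub_self hj, Finset.esymm_map_val] at h2
    have h4 : ((-1:ℝ))^j ≠ 0 := by positivity
    exact mul_left_cancel₀ h4 h2
  · unfold sg
    rw [Finset.powersetCard_eq_empty.2 (by simpa using hj), es_card_lt (by simpa using hj)]; simp

lemma eig_of_herm {A : Mat n} (hA : (Matrix.of A).IsHermitian) :
    ∃ q, Eig A hA.eigenvalues q := by
  refine ⟨fun i => (hA.eigenvectorBasis i).ofLp, ?_, ?_, fun j => sg_eig hA j⟩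
  · intro i j
    have := (orthonormal_iff_ite.1 hA.eigenvectorBasis.orthonormal) j i
    rw [EuclideanSpace.inner_eq_star_dotProduct] at this
    simp only [star_trivial, dotProduct] at this
    unfold dot
    rw [this]
    by_cases h : i = j <;> simp [h, eq_comm]
  · intro i l
    have := congrFun (hA.mulVec_eigenvectorBasis i) l
    simpa [Matrix.mulVec, dotProduct] using this

lemma exists_eig {A : Mat n} (hA : Symm A) : ∃ lam q, Eig A lam q := by
  have : (Matrix.of A).IsHermitian := by
    ext i j; simp [hA i j]
  exact ⟨_, eig_of_herm this⟩

def ConeM (α : ℝ) (K : ℕ) (A : Mat n) : Prop := Symm A ∧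
  ∀ j < K + 2, 0 < α * sg j A + sg (j+1) A

lemma ConeM.cone {A : Mat n} (h : ConeM α K A) {lam q} (he : Eig A lam q) : Cone α K lam := by
  intro j hj
  cases j with
  | zero => rw [es_zero]; norm_num
  | succ j =>
    rw [es_hat_succ, ← he.2.2, ← he.2.2]; exact h.2 j (by omega)

lemma Eig.fm_eq {A : Mat n} {lam q} (he : Eig A lam q) : fm α K A = fv α K lam := by
  unfold fm fv
  rw [es_hat_succ, he.2.2, he.2.2]

lemma birkhoff_aux {M : Matrix (Fin n) (Fin n) ℝ} (hM : M ∈ doublyStochastic ℝ (Fin n))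
    {g mu : Fin n → ℝ} {c : ℝ} (h : ∀ e : Equiv.Perm (Fin n), c ≤ ∑ i, g i * mu (e i)) :
    c ≤ ∑ i, g i * ∑ j, M i j * mu j := by
  have hM' : M ∈ convexHull ℝ {x | ∃ σ : Equiv.Perm (Fin n), σ.permMatrix ℝ = x} := by
    rw [← doublyStochastic_eq_convexHull_permMatrix]; exact hM
  have hc : Convex ℝ {M : Matrix (Fin n) (Fin n) ℝ | c ≤ ∑ i, g i * ∑ j, M i j * mu j} := by
    intro A hA B hB a b ha hb hab
    simp only [Set.mem_setOf_eq] at *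
    have : ∑ i, g i * ∑ j, (a • A + b • B) i j * mu j =
      a * (∑ i, g i * ∑ j, A i j * mu j) + b * (∑ i, g i * ∑ j, B i j * mu j) := by
      simp only [Finset.mul_sum, ← Finset.sum_add_distrib]
      refine Finset.sum_congr rfl fun i _ => Finset.sum_congr rfl fun j _ => ?_
      simp; ring
    rw [this]
    have h1 := mul_le_mul_of_nonneg_left hA ha
    have h2 := mul_le_mul_of_nonneg_left hB hb
    have : c = a * c + b * c := by rw [← add_mul, hab, one_mul]
    linarith
  refine (convexHull_min ?_ hc) hM'
  rintro _ ⟨σ, rfl⟩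
  simp only [Set.mem_setOf_eq]
  refine (h σ).trans (le_of_eq ?_)
  refine Finset.sum_congr rfl fun i _ => ?_
  congr 1
  simp [Equiv.Perm.permMatrix, PEquiv.toMatrix_apply, Equiv.toPEquiv]

/-- KEY inequality -/
lemma key {B : Mat n} (hB : ConeM α K B) {lam : Fin n → ℝ} (hl : Cone α K lam)
    {v : Fin n → Fin n → ℝ} (hv : ON v) :
    Gm α K B ≤ -1 / fv α K lam + ∑ i, gvi α K lam i * (qf B (v i) (v i) - lam i) := by
  obtain ⟨mu, q, he⟩ := exists_eig hB.1
  have hmu := hB.cone he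
  unfold Gm
  rw [he.fm_eq]
  have hM : (Matrix.of fun i j => (dot (q j) (v i))^2) ∈ doublyStochastic ℝ (Fin n) := by
    rw [mem_doublyStochastic_iff_sum]
    refine ⟨fun i j => sq_nonneg _, fun i => ?_, fun j => ?_⟩
    · have := he.1.parseval (v i) (v i)
      rw [hv] at this
      simpa [sq] using this
    · have := hv.parseval (q j) (q j)
      rw [he.1] at this
      simpa [sq, dot_comm] using this
  have h1 := birkhoff_aux hM (g := gvi α K lam) (mu := mu)
    (c := -1 / fv α K mu - -1 / fv α K lam + ∑ i, gvi α K lam i * lam i) (fun e => by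
      have := gv_tangent hl (hmu.perm e)
      rw [fv_perm] at this
      simp only [mul_sub, Finset.sum_sub_distrib, Function.comp] at this
      linarith)
  have h2 : ∀ i, qf B (v i) (v i) = ∑ j, (Matrix.of fun i j => (dot (q j) (v i))^2) i j * mu j := by
    intro i
    rw [he.qf_expand]
    refine Finset.sum_congr rfl fun j _ => ?_
    simp; ring
  simp only [mul_sub, Finset.sum_sub_distrib, h2]
  linarith
end M
end

section
def aa {n : ℕ} (r : Fin n → Fin n → ℝ) (X : Mat n) : ℝ := ∑ k, qf X (r k) (r k)

structure Data (n : ℕ) where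
  D : Set (Mat n)
  G : Mat n → ℝ
  r : Mat n → Fin n → Fin n → ℝ
  c0 : ℝ
  C0 : ℝ
  CL : ℝ
  c0_pos : 0 < c0
  C0_pos : 0 < C0
  CL_pos : 0 < CL
  symm : ∀ A ∈ D, Symm A
  bdd : ∀ A ∈ D, ∀ i j, |A i j| ≤ CL
  ell1 : ∀ A ∈ D, ∀ v, c0 * dot v v ≤ ∑ k, (dot (r A k) v)^2
  ell2 : ∀ A ∈ D, ∀ v, ∑ k, (dot (r A k) v)^2 ≤ C0 * dot v v
  key : ∀ A ∈ D, ∀ B ∈ D, G B ≤ G A + aa (r A) (B - A)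
  semi : ∀ A ∈ D, ∀ B ∈ D, G A + aa (r A) (B - A) - CL * ‖B - A‖^2 ≤ G B
  lip : ∀ A ∈ D, ∀ B ∈ D, ∀ v, |∑ k, (dot (r A k) v)^2 - ∑ k, (dot (r B k) v)^2| ≤ CL * ‖A - B‖ * dot v v
  ext : ∀ B, Symm B → D.Nonempty → ∃ c, ∃ A' ∈ D, (∀ A ∈ D, G A ≤ c + aa (r A') (A - B)) ∧
    ∀ A ∈ D, c ≤ G A + aa (r A) (B - A)

section M2
variable {n : ℕ} {α : ℝ} {K : ℕ}

lemma qf_add (A B : Mat n) (v w : Fin n → ℝ) : qf (A + B) v w = qf A v w + qf B v w := by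
  simp only [qf, ← Finset.sum_add_distrib, Pi.add_apply]
  exact Finset.sum_congr rfl fun i _ => Finset.sum_congr rfl fun j _ => by ring
lemma qf_sub (A B : Mat n) (v w : Fin n → ℝ) : qf (A - B) v w = qf A v w - qf B v w := by
  simp only [qf, ← Finset.sum_sub_distrib, Pi.sub_apply]
  exact Finset.sum_congr rfl fun i _ => Finset.sum_congr rfl fun j _ => by ring
lemma qf_smul (c : ℝ) (B : Mat n) (v w : Fin n → ℝ) : qf (c • B) v w = c * qf B v w := by
  simp only [qf, Finset.mul_sum, Pi.smul_apply, smul_eq_mul]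
  exact Finset.sum_congr rfl fun i _ => Finset.sum_congr rfl fun j _ => by ring
lemma aa_add (r) (A B : Mat n) : aa r (A + B) = aa r A + aa r B := by
  simp [aa, qf_add, Finset.sum_add_distrib]
lemma aa_sub (r) (A B : Mat n) : aa r (A - B) = aa r A - aa r B := by
  simp [aa, qf_sub, Finset.sum_sub_distrib]
lemma aa_smul (r) (c : ℝ) (B : Mat n) : aa r (c • B) = c * aa r B := by
  simp [aa, qf_smul, Finset.mul_sum]

lemma sg_contDiff (j : ℕ) : ContDiff ℝ (⊤ : ℕ∞) (sg j : Mat n → ℝ) := by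
  unfold sg
  refine ContDiff.sum fun s _ => ?_
  simp_rw [Matrix.det_apply]
  refine ContDiff.sum fun σ _ => ?_
  refine ContDiff.const_smul _ ?_
  refine contDiff_prod fun i _ => ?_
  simp only [Matrix.submatrix_apply, Matrix.of_apply]
  fun_prop

lemma fm_contDiff : ContDiff ℝ (⊤ : ℕ∞) (fm α K : Mat n → ℝ) := by
  unfold fm
  exact (contDiff_const.mul (sg_contDiff _)).add (sg_contDiff _)

lemma ConeM.fm_pos {A : Mat n} (h : ConeM α K A) : 0 < fm α K A := h.2 (K+1) (by omega)

lemma coneM_eventually {A X : Mat n} (h : ConeM α K A) (hX : Symm X) :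
    ∀ᶠ s : ℝ in nhds 0, ConeM α K (A + s • X) := by
  have h1 : ∀ j < K+2, ∀ᶠ s : ℝ in nhds 0, 0 < α * sg j (A + s • X) + sg (j+1) (A + s • X) := by
    intro j hj
    have c : Continuous fun s : ℝ => α * sg j (A + s • X) + sg (j+1) (A + s • X) := by
      have a1 := (sg_contDiff (n := n) j).continuous
      have a2 := (sg_contDiff (n := n) (j+1)).continuous
      fun_prop
    refine c.continuousAt.eventually_mem (Ioi_mem_nhds ?_)
    simpa using h.2 j hj
  have h2 : ∀ᶠ s : ℝ in nhds 0, ∀ j ∈ Finset.range (K+2), 0 < α * sg j (A + s • X) + sg (j+1) (A + s • X) := by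
    rw [Filter.eventually_all_finset]
    intro j hj; exact h1 j (by simpa using hj)
  filter_upwards [h2] with s hs
  refine ⟨fun i j => ?_, fun j hj => hs j (by simpa using hj)⟩
  simp [h.1 i j, hX i j]

/-- derivative identification -/
lemma Gm_deriv {A X : Mat n} (h : ConeM α K A) {lam q} (he : Eig A lam q) (hX : Symm X) :
    fderiv ℝ (fm α K) A X / (fm α K A)^2 = ∑ i, gvi α K lam i * qf X (q i) (q i) := by
  have hl := h.cone he
  have hf := h.fm_pos
  set a := ∑ i, gvi α K lam i * qf X (q i) (q i) with ha
  have hd : HasDerivAt (fun s : ℝ => fm α K (A + s • X)) (fderiv ℝ (fm α K) A X) 0 := by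
    have h1 : HasFDerivAt (fm α K) (fderiv ℝ (fm α K) A) (A + (0:ℝ) • X) := by
      simpa using ((fm_contDiff (n := n) (α := α) (K := K)).differentiable (by simp) A).hasFDerivAt
    have h2 : HasDerivAt (fun s : ℝ => A + s • X) X 0 := by
      simpa using ((hasDerivAt_id (0:ℝ)).smul_const X).const_add A
    exact h1.comp_hasDerivAt 0 h2
  have hg : HasDerivAt (fun s : ℝ => Gm α K (A + s • X) - s * a)
      (fderiv ℝ (fm α K) A X / (fm α K A)^2 - a) 0 := by
    unfold Gm
    have h1 := (hasDerivAt_const (0:ℝ) (-1:ℝ)).div hd (by simpa using hf.ne')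
    have h2 := h1.sub ((hasDerivAt_id (0:ℝ)).mul_const a)
    refine HasDerivAt.congr_deriv (f := fun s : ℝ => -1 / fm α K (A + s • X) - s * a) h2 ?_
    simp
  have hm : IsLocalMax (fun s : ℝ => Gm α K (A + s • X) - s * a) 0 := by
    filter_upwards [coneM_eventually h hX] with s hs
    have := key hs hl he.1
    have e1 : Gm α K (A + (0:ℝ) • X) = -1 / fv α K lam := by
      simp [Gm, he.fm_eq]
    have e2 : ∑ i, gvi α K lam i * (qf (A + s • X) (q i) (q i) - lam i) = s * a := by
      rw [ha, Finset.mul_sum]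
      refine Finset.sum_congr rfl fun i _ => ?_
      rw [qf_add, qf_smul, he.qf_self]; simp; ring
    show Gm α K (A + s • X) - s * a ≤ Gm α K (A + (0:ℝ) • X) - 0 * a
    rw [e1]
    rw [e2] at this
    linarith
  have := hm.hasDerivAt_eq_zero hg
  linarith

lemma Cone.e_succ {lam : Fin n → ℝ} (h : Cone α K lam) (j : ℕ) (hj : j < K + 2) :
    es Finset.univ (j+1) (hat α lam) ≤ es Finset.univ 1 (hat α lam) * es Finset.univ j (hat α lam) := by
  induction j with
  | zero => simp [es_zero]
  | succ j ih =>
    have h1 := ih (by omega)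
    have h2 := newton Finset.univ (hat α lam) j
    have p0 := h j (by omega)
    have p1 := h (j+1) (by omega)
    have : es Finset.univ j (hat α lam) * es Finset.univ (j+2) (hat α lam) ≤
      es Finset.univ j (hat α lam) * (es Finset.univ 1 (hat α lam) * es Finset.univ (j+1) (hat α lam)) := by
      nlinarith
    exact le_of_mul_le_mul_left this p0

lemma Cone.e_lower {lam : Fin n → ℝ} (h : Cone α K lam) {B m : ℝ} (hB : 1 ≤ B)
    (h1 : es Finset.univ 1 (hat α lam) ≤ B) (hm : 0 < m) (hf : m ≤ fv α K lam) (i : ℕ) (hi : i ≤ K + 2) :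
    m / B^i ≤ es Finset.univ (K + 2 - i) (hat α lam) := by
  induction i with
  | zero => simpa [fv] using hf
  | succ i ih =>
    have a := ih (by omega)
    have b := h.e_succ (K + 2 - (i+1)) (by omega)
    rw [show K + 2 - (i+1) + 1 = K + 2 - i by omega] at b
    have p := h (K+2-(i+1)) (by omega)
    have hB0 : 0 < B := by linarith
    have : m / B^i ≤ B * es Finset.univ (K+2-(i+1)) (hat α lam) :=
      a.trans (b.trans (mul_le_mul_of_nonneg_right h1 p.le))
    rw [pow_succ, ← div_div, div_le_iff₀ hB0]; linarith

lemma dot_self_nonneg (v : Fin n → ℝ) : 0 ≤ dot v v := Finset.sum_nonneg fun i _ => mul_self_nonneg _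
lemma sq_le_dot (v : Fin n → ℝ) (i : Fin n) : v i * v i ≤ dot v v :=
  Finset.single_le_sum (f := fun i => v i * v i) (fun i _ => mul_self_nonneg _) (Finset.mem_univ i)
lemma dot_smul_left (c : ℝ) (v w : Fin n → ℝ) : dot (fun i => c * v i) w = c * dot v w := by
  simp only [dot, Finset.mul_sum]; exact Finset.sum_congr rfl fun i _ => by ring

lemma qf_smul_vec (c : ℝ) (B : Mat n) (v : Fin n → ℝ) :
    qf B (fun i => c * v i) (fun i => c * v i) = c^2 * qf B v v := by
  simp only [qf, Finset.mul_sum]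
  exact Finset.sum_congr rfl fun i _ => Finset.sum_congr rfl fun j _ => by ring

lemma qf_outer (v w : Fin n → ℝ) : qf (fun i j => v i * v j) w w = (dot w v)^2 := by
  simp only [qf, dot, sq, Finset.sum_mul_sum]
  exact Finset.sum_congr rfl fun i _ => Finset.sum_congr rfl fun j _ => by ring

def DD (α : ℝ) (K n : ℕ) (C c : ℝ) : Set (Mat n) :=
  {A | Symm A ∧ (∀ i j, |A i j| ≤ C) ∧ ∀ j < K + 2, c ≤ α * sg j A + sg (j+1) A}

lemma DD_compact (C c : ℝ) : IsCompact (DD α K n C c) := by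
  have h1 : IsCompact (Set.pi Set.univ (fun _ : Fin n => Set.pi Set.univ (fun _ : Fin n => Set.Icc (-C) C))) :=
    isCompact_univ_pi fun i => isCompact_univ_pi fun j => isCompact_Icc
  refine h1.of_isClosed_subset ?_ ?_
  · unfold DD Symm
    have a : ∀ j, Continuous (sg j : Mat n → ℝ) := fun j => (sg_contDiff j).continuous
    simp only [Set.setOf_and, Set.setOf_forall]
    refine IsClosed.inter ?_ (IsClosed.inter ?_ ?_)
    · refine isClosed_iInter fun i => isClosed_iInter fun j => isClosed_eq (by fun_prop) (by fun_prop)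
    · refine isClosed_iInter fun i => isClosed_iInter fun j => isClosed_le (by fun_prop) (by fun_prop)
    · refine isClosed_iInter fun i => isClosed_iInter fun j => isClosed_le (by fun_prop) (by
        have := a i; have := a (i+1); fun_prop)
  · intro A hA
    simp only [Set.mem_pi, Set.mem_univ, true_imp_iff, Set.mem_Icc]
    exact fun i j => abs_le.1 (hA.2.1 i j)

lemma DD_cone {C c : ℝ} (hc : 0 < c) {A : Mat n} (hA : A ∈ DD α K n C c) : ConeM α K A :=
  ⟨hA.1, fun j hj => hc.trans_le (hA.2.2 j hj)⟩

lemma qf_abs_le {A : Mat n} {C : ℝ} (hC : ∀ i j, |A i j| ≤ C) (v : Fin n → ℝ) :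
    |qf A v v| ≤ C * n * dot v v := by
  have h : ∀ i j, |v i * A i j * v j| ≤ C * ((v i * v i + v j * v j) / 2) := by
    intro i j
    rw [abs_mul, abs_mul]
    have := abs_nonneg (v i); have := abs_nonneg (v j); have := abs_nonneg (A i j)
    have h1 := hC i j
    have h2 : |v i| * |v j| ≤ (v i * v i + v j * v j) / 2 := by
      have := abs_mul_abs_self (v i); have := abs_mul_abs_self (v j)
      nlinarith [sq_nonneg (|v i| - |v j|)]
    calc |v i| * |A i j| * |v j| = |A i j| * (|v i| * |v j|) := by ring
      _ ≤ _ := mul_le_mul h1 h2 (by positivity) (by linarith)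
  calc |qf A v v| ≤ ∑ i, ∑ j, |v i * A i j * v j| :=
        (Finset.abs_sum_le_sum_abs _ _).trans (Finset.sum_le_sum fun i _ => Finset.abs_sum_le_sum_abs _ _)
    _ ≤ ∑ i, ∑ j, C * ((v i * v i + v j * v j) / 2) :=
        Finset.sum_le_sum fun i _ => Finset.sum_le_sum fun j _ => h i j
    _ = _ := by
        have e : ∀ i, ∑ j, C * ((v i * v i + v j * v j) / 2) = C / 2 * (n * (v i * v i) + dot v v) := by
          intro i
          rw [dot, ← Finset.mul_sum, ← Finset.sum_div, Finset.sum_add_distrib]; simp; ring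
        simp_rw [e]
        rw [← Finset.mul_sum, Finset.sum_add_distrib, ← Finset.mul_sum]
        simp [dot]; ring

lemma taylor_ball {F : Type*} [NormedAddCommGroup F] [NormedSpace ℝ F] [ProperSpace F] {f : F → ℝ}
    (hf : ContDiff ℝ (⊤ : ℕ∞) f) (R : ℝ) : ∃ L > 0, ∀ A ∈ Metric.closedBall (0:F) R, ∀ B ∈ Metric.closedBall (0:F) R,
      ‖fderiv ℝ f A - fderiv ℝ f B‖ ≤ L * ‖A - B‖ ∧ |f B - f A - fderiv ℝ f A (B - A)| ≤ L * ‖B - A‖^2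
      ∧ |f A| ≤ L ∧ ‖fderiv ℝ f A‖ ≤ L := by
  have hf1 : ContDiff ℝ (⊤ : ℕ∞) (fderiv ℝ f) := hf.fderiv_right (by simp)
  have hf2 : Continuous (fderiv ℝ (fderiv ℝ f)) := (hf1.continuous_fderiv (by simp))
  have n2 : Continuous fun x => ‖fderiv ℝ (fderiv ℝ f) x‖ := Continuous.comp (@continuous_norm (F →L[ℝ] F →L[ℝ] ℝ) _) hf2
  have n1 : Continuous fun x => ‖fderiv ℝ f x‖ := hf1.continuous.norm
  obtain ⟨L, hL⟩ := (isCompact_closedBall (0:F) R).exists_bound_of_continuousOn (f := fun x => ‖fderiv ℝ (fderiv ℝ f) x‖) n2.continuousOn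
  obtain ⟨L1, hL1⟩ := (isCompact_closedBall (0:F) R).exists_bound_of_continuousOn (f := fun x => ‖fderiv ℝ f x‖) n1.continuousOn
  obtain ⟨L2, hL2⟩ := (isCompact_closedBall (0:F) R).exists_bound_of_continuousOn hf.continuous.continuousOn
  simp only [norm_norm] at hL hL1
  set L' := max (max L L1) (max L2 1)
  have q0 : L ≤ L' := (le_max_left _ _).trans (le_max_left _ _)
  have q1 : L1 ≤ L' := (le_max_right _ _).trans (le_max_left _ _)
  have q2 : L2 ≤ L' := (le_max_left _ _).trans (le_max_right _ _)
  have q3 : 1 ≤ L' := (le_max_right _ _).trans (le_max_right _ _)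
  have lipf : ∀ A ∈ Metric.closedBall (0:F) R, ∀ B ∈ Metric.closedBall (0:F) R,
      ‖fderiv ℝ f A - fderiv ℝ f B‖ ≤ L' * ‖A - B‖ := fun A hA B hB =>
    (convex_closedBall (0:F) R).norm_image_sub_le_of_norm_fderiv_le (𝕜 := ℝ)
      (fun x _ => (hf1.differentiable (by simp)) x) (fun x hx => (le_abs_self _).trans ((hL x hx).trans q0)) hB hA
  refine ⟨L', by linarith, fun A hA B hB => ⟨lipf A hA B hB, ?_, ?_, (hL1 A hA).trans q1⟩⟩
  · have hs : segment ℝ A B ⊆ Metric.closedBall (0:F) R := (convex_closedBall (0:F) R).segment_subset hA hB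
    have := (convex_segment A B).norm_image_sub_le_of_norm_hasFDerivWithin_le' (𝕜 := ℝ) (f := f) (f' := fderiv ℝ f)
      (φ := fderiv ℝ f A) (C := L' * ‖B - A‖)
      (fun x hx => ((hf.differentiable (by simp)) x).hasFDerivAt.hasFDerivWithinAt) (fun x hx => by
        refine (lipf x (hs hx) A hA).trans ?_
        refine mul_le_mul_of_nonneg_left ?_ (by linarith)
        exact norm_sub_le_of_mem_segment hx) (left_mem_segment ℝ A B) (right_mem_segment ℝ A B)
    rw [Real.norm_eq_abs] at this
    calc _ ≤ _ := this
      _ = _ := by ring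
  · simpa using (hL2 A hA).trans q2

lemma Eig.abs_le {A : Mat n} {lam q} (he : Eig A lam q) {C : ℝ} (hC : ∀ i j, |A i j| ≤ C) (i : Fin n) :
    |lam i| ≤ C * n := by
  have h := qf_abs_le hC (q i)
  rw [he.qf_self, he.1] at h
  simpa using h

lemma dot_le_of_entry {A : Mat n} {lam q} (he : Eig A lam q) {C : ℝ} (hC : ∀ i, |lam i| ≤ C) (i j : Fin n) :
    |A i j| ≤ C * n := by
  have e : A i j = ∑ k, lam k * (q k i * q k j) := by
    have := he.qf_expand (Pi.single i 1) (Pi.single j 1)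
    simpa [qf, dot, Pi.single_apply] using this
  rw [e]
  have hq : ∀ k a, |q k a| ≤ 1 := by
    intro k a
    have := sq_le_dot (q k) a
    rw [he.1] at this
    simp at this
    exact abs_le_one_iff_mul_self_le_one.2 this
  calc _ ≤ ∑ k, |lam k * (q k i * q k j)| := Finset.abs_sum_le_sum_abs _ _
    _ ≤ ∑ k : Fin n, C := by
        refine Finset.sum_le_sum fun k _ => ?_
        rw [abs_mul, abs_mul]
        have := mul_le_one₀ (hq k i) (abs_nonneg _) (hq k j)
        calc _ ≤ C * 1 := mul_le_mul (hC k) this (by positivity) ((abs_nonneg _).trans (hC k))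
          _ = C := by ring
    _ = _ := by simp; ring

theorem exists_data (hα : 0 < α) (n K : ℕ) {C m1 m2 : ℝ} (hm1 : 0 < m1) (hC : 0 ≤ C) :
    ∃ Dt : Data n, Dt.G = Gm α K ∧ ∀ A lam q, Eig A lam q → Cone α K lam → (∀ i, |lam i| ≤ C) →
      m1 ≤ fv α K lam → A ∈ Dt.D := by
  set C1 := C * n with hC1
  have hC10 : 0 ≤ C1 := by positivity
  -- bound on e1
  set B := max 1 ((n+1) * (max C α)) with hB
  set cs := m1 / B^(K+2) with hcs
  have hB1 : 1 ≤ B := le_max_left _ _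
  have hcs0 : 0 < cs := by positivity
  set D := DD α K n C1 cs with hD
  obtain ⟨L, hL, hT⟩ := taylor_ball (fm_contDiff (n := n) (α := α) (K := K)) C1
  have hball : ∀ A ∈ D, A ∈ Metric.closedBall (0 : Mat n) C1 := by
    intro A hA
    rw [mem_closedBall_zero_iff, pi_norm_le_iff_of_nonneg hC10]
    intro i
    rw [pi_norm_le_iff_of_nonneg hC10]
    exact fun j => hA.2.1 i j
  have hcone : ∀ A ∈ D, ConeM α K A := fun A hA => DD_cone hcs0 hA
  have hfm : ∀ A ∈ D, cs ≤ fm α K A := fun A hA => hA.2.2 (K+1) (by omega)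
  obtain ⟨c0, C0, hc0, hC0, hg⟩ := gvi_bounds hα n K (C := C1 * n) (m1 := cs) (m2 := L) hcs0 hL
  have hex : ∀ A : Mat n, ∃ r : Fin n → Fin n → ℝ, A ∈ D → ((∀ X, Symm X → aa r X = fderiv ℝ (fm α K) A X / (fm α K A)^2)
      ∧ (∀ v, c0 * dot v v ≤ ∑ k, (dot (r k) v)^2) ∧ (∀ v, ∑ k, (dot (r k) v)^2 ≤ C0 * dot v v) ∧
      ∀ B ∈ D, Gm α K B ≤ Gm α K A + aa r (B - A)) := by
    intro A
    by_cases hA : A ∈ D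
    swap
    · exact ⟨0, fun h => absurd h hA⟩
    obtain ⟨lam, q, he⟩ := exists_eig hA.1
    have hl := (hcone A hA).cone he
    have hb := hg lam hl (he.abs_le hA.2.1) (by rw [← he.fm_eq]; exact hfm A hA)
      (by rw [← he.fm_eq]; exact (le_abs_self _).trans (hT A (hball A hA) A (hball A hA)).2.2.1)
    have hs : ∀ k, (Real.sqrt (gvi α K lam k))^2 = gvi α K lam k := fun k => Real.sq_sqrt (hl.gvi_pos k).le
    have haa : ∀ X : Mat n, aa (fun k i => Real.sqrt (gvi α K lam k) * q k i) X = ∑ i, gvi α K lam i * qf X (q i) (q i) := by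
      intro X
      unfold aa
      refine Finset.sum_congr rfl fun k _ => ?_
      rw [qf_smul_vec, hs]
    have hdd : ∀ v, ∑ k, (dot (fun i => Real.sqrt (gvi α K lam k) * q k i) v)^2 = ∑ k, gvi α K lam k * (dot (q k) v * dot (q k) v) := by
      intro v
      refine Finset.sum_congr rfl fun k _ => ?_
      rw [dot_smul_left, mul_pow, hs, sq]
    refine ⟨fun k i => Real.sqrt (gvi α K lam k) * q k i, fun _ => ⟨fun X hX => ?_, fun v => ?_, fun v => ?_, fun B hB => ?_⟩⟩
    · rw [haa, Gm_deriv (hcone A hA) he hX]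
    · rw [hdd, ← he.1.parseval v v, Finset.mul_sum]
      exact Finset.sum_le_sum fun k _ => mul_le_mul_of_nonneg_right (hb k).1 (mul_self_nonneg _)
    · rw [hdd, ← he.1.parseval v v, Finset.mul_sum]
      exact Finset.sum_le_sum fun k _ => mul_le_mul_of_nonneg_right (hb k).2 (mul_self_nonneg _)
    · have := key (hcone B hB) hl he.1
      rw [haa]
      have e1 : Gm α K A = -1 / fv α K lam := by unfold Gm; rw [he.fm_eq]
      rw [e1]
      refine this.trans (le_of_eq ?_)
      congr 1
      refine Finset.sum_congr rfl fun k _ => ?_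
      rw [qf_sub, he.qf_self]; simp
  choose r hr using hex
  have hsub : ∀ A ∈ D, ∀ B, Symm B → Symm (B - A) := fun A hA B hB i j => by
    simp [hA.1 i j, hB i j]
  have hLip : ∀ A ∈ D, ∀ B ∈ D, |fm α K B - fm α K A| ≤ (L + 2 * L * C1) * ‖B - A‖ := by
    intro A hA B hB
    have h1 := (hT A (hball A hA) B (hball B hB)).2.1
    have h2 := (fderiv ℝ (fm α K) A).le_opNorm (B - A)
    have h3 := (hT A (hball A hA) B (hball B hB)).2.2.2
    have h4 : ‖B - A‖ ≤ 2 * C1 := by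
      have a1 := mem_closedBall_zero_iff.1 (hball A hA)
      have a2 := mem_closedBall_zero_iff.1 (hball B hB)
      linarith [norm_sub_le B A]
    rw [Real.norm_eq_abs] at h2
    have h5 := norm_nonneg (B - A)
    have h6 : |fderiv ℝ (fm α K) A (B - A)| ≤ L * ‖B - A‖ := h2.trans (mul_le_mul_of_nonneg_right h3 h5)
    have h7 : L * ‖B - A‖^2 ≤ L * (2 * C1) * ‖B - A‖ := by
      rw [sq, ← mul_assoc]
      exact mul_le_mul_of_nonneg_right (mul_le_mul_of_nonneg_left h4 hL.le) h5
    have h8 := abs_le.1 h1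
    have h9 := abs_le.1 h6
    rw [abs_le]; constructor <;> nlinarith
  set L1 := L + 2 * L * C1
  have hL1 : 0 < L1 := by positivity
  have hinv : ∀ A ∈ D, ∀ B ∈ D, |1 / (fm α K A)^2 - 1 / (fm α K B)^2| ≤ 2 * L1 / cs^3 * ‖A - B‖ := by
    intro A hA B hB
    have a1 := hfm A hA; have a2 := hfm B hB
    have p1 : 0 < fm α K A := by linarith
    have p2 : 0 < fm α K B := by linarith
    have e : 1 / (fm α K A)^2 - 1 / (fm α K B)^2 = (fm α K B - fm α K A) * (1 / (fm α K A * (fm α K B)^2) + 1 / ((fm α K A)^2 * fm α K B)) := by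
      field_simp; ring
    have b1 : 1 / (fm α K A * (fm α K B)^2) ≤ 1 / cs^3 :=
      one_div_le_one_div_of_le (by positivity) (by
        rw [show cs^3 = cs * cs^2 by ring]; gcongr)
    have b2 : 1 / ((fm α K A)^2 * fm α K B) ≤ 1 / cs^3 :=
      one_div_le_one_div_of_le (by positivity) (by
        rw [show cs^3 = cs^2 * cs by ring]; gcongr)
    have hl := hLip A hA B hB
    rw [e, abs_mul, abs_of_pos (a := (_ + _)) (by positivity)]
    calc _ ≤ (L1 * ‖B - A‖) * (1 / cs^3 + 1 / cs^3) := mul_le_mul hl (by linarith) (by positivity) (by positivity)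
      _ = _ := by rw [norm_sub_rev]; ring
  set CL := C1 + (L1^2 / cs^3 + L / cs^2) + (L / cs^2 + L * (2 * L1 / cs^3)) + 1 with hCL
  have t1 : 0 ≤ L1^2 / cs^3 + L / cs^2 := by positivity
  have t2 : 0 ≤ L / cs^2 + L * (2 * L1 / cs^3) := by positivity
  have hGc : ContinuousOn (fun A => Gm α K A) D := by
    unfold Gm
    exact continuousOn_const.div (fm_contDiff.continuous.continuousOn) (fun A hA => (hcone A hA).fm_pos.ne')
  refine ⟨{
    D := D, G := Gm α K, r := r, c0 := c0, C0 := C0, CL := CL, c0_pos := hc0, C0_pos := hC0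
    CL_pos := (by linarith), symm := fun A hA => hA.1, bdd := fun A hA i j => (hA.2.1 i j).trans (by linarith)
    ell1 := fun A hA => (hr A hA).2.1, ell2 := fun A hA => (hr A hA).2.2.1
    key := fun A hA B hB => (hr A hA).2.2.2 B hB, semi := ?_, lip := ?_, ext := ?_ }, rfl, ?_⟩
  · intro A hA B hB
    rw [(hr A hA).1 _ (hsub A hA B hB.1)]
    have a1 := hfm A hA; have a2 := hfm B hB
    have p1 : 0 < fm α K A := by linarith
    have p2 : 0 < fm α K B := by linarith
    have h1 := (abs_le.1 (hT A (hball A hA) B (hball B hB)).2.1).1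
    have h2 := hLip A hA B hB
    have h3 : (fm α K B - fm α K A)^2 ≤ L1^2 * ‖B - A‖^2 := by
      rw [← mul_pow, ← sq_abs]; exact pow_le_pow_left₀ (abs_nonneg _) h2 2
    have e : Gm α K B - Gm α K A - fderiv ℝ (fm α K) A (B - A) / (fm α K A)^2 =
      (fm α K B - fm α K A - fderiv ℝ (fm α K) A (B - A)) * (1 / (fm α K A)^2) - (fm α K B - fm α K A)^2 * (1 / ((fm α K A)^2 * fm α K B)) := by
      unfold Gm; field_simp; ring
    have b2 : 1 / ((fm α K A)^2 * fm α K B) ≤ 1 / cs^3 :=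
      one_div_le_one_div_of_le (by positivity) (by
        rw [show cs^3 = cs^2 * cs by ring]; gcongr)
    have b3 : 1 / (fm α K A)^2 ≤ 1 / cs^2 := one_div_le_one_div_of_le (by positivity) (by gcongr)
    have q1 : (fm α K B - fm α K A)^2 * (1 / ((fm α K A)^2 * fm α K B)) ≤ (L1^2 * ‖B - A‖^2) * (1 / cs^3) :=
      mul_le_mul h3 b2 (by positivity) (by positivity)
    have q2 : -(L * ‖B - A‖^2) * (1 / cs^2) ≤ (fm α K B - fm α K A - fderiv ℝ (fm α K) A (B - A)) * (1 / (fm α K A)^2) := by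
      have w1 : -(L * ‖B - A‖^2) * (1 / cs^2) ≤ -(L * ‖B - A‖^2) * (1 / (fm α K A)^2) :=
        mul_le_mul_of_nonpos_left b3 (by simp; positivity)
      exact w1.trans (mul_le_mul_of_nonneg_right h1 (by positivity))
    have q3 : (L1^2 / cs^3 + L / cs^2) * ‖B - A‖^2 ≤ CL * ‖B - A‖^2 :=
      mul_le_mul_of_nonneg_right (by linarith) (by positivity)
    have q4 : (L1^2 / cs^3 + L / cs^2) * ‖B - A‖^2 = (L1^2 * ‖B - A‖^2) * (1 / cs^3) + (L * ‖B - A‖^2) * (1 / cs^2) := by ring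
    linarith
  · intro A hA B hB v
    have hS : Symm (fun i j => v i * v j) := fun i j => mul_comm _ _
    have e : ∀ A, ∑ k, (dot (r A k) v)^2 = aa (r A) (fun i j => v i * v j) := fun A => by
      simp [aa, qf_outer]
    rw [e, e, (hr A hA).1 _ hS, (hr B hB).1 _ hS]
    set X : Mat n := fun i j => v i * v j
    have hX : ‖X‖ ≤ dot v v := by
      rw [pi_norm_le_iff_of_nonneg (dot_self_nonneg v)]; intro i
      rw [pi_norm_le_iff_of_nonneg (dot_self_nonneg v)]; intro j
      simp only [X, Real.norm_eq_abs, abs_mul]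
      have h1 := sq_le_dot v i; have h2 := sq_le_dot v j
      have := abs_mul_abs_self (v i); have := abs_mul_abs_self (v j)
      nlinarith [sq_nonneg (|v i| - |v j|)]
    have h0 := dot_self_nonneg v
    have hi := hinv A hA B hB
    have hd := (hT A (hball A hA) B (hball B hB)).1
    have hn : ‖fderiv ℝ (fm α K) A‖ ≤ L := (hT A (hball A hA) B (hball B hB)).2.2.2
    have e2 : fderiv ℝ (fm α K) A X / (fm α K A)^2 - fderiv ℝ (fm α K) B X / (fm α K B)^2
      = (fderiv ℝ (fm α K) A - fderiv ℝ (fm α K) B) X * (1 / (fm α K B)^2) + fderiv ℝ (fm α K) A X * (1 / (fm α K A)^2 - 1 / (fm α K B)^2) := by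
      simp; ring
    have g1 : |(fderiv ℝ (fm α K) A - fderiv ℝ (fm α K) B) X| ≤ L * ‖A - B‖ * dot v v := by
      have := (fderiv ℝ (fm α K) A - fderiv ℝ (fm α K) B).le_opNorm X
      exact this.trans (mul_le_mul hd hX (norm_nonneg _) (by positivity))
    have g2 : |fderiv ℝ (fm α K) A X| ≤ L * dot v v := by
      have := (fderiv ℝ (fm α K) A).le_opNorm X
      exact this.trans (mul_le_mul hn hX (norm_nonneg _) (by positivity))
    have b3 : |1 / (fm α K B)^2| ≤ 1 / cs^2 := by
      have := hfm B hB
      rw [abs_of_nonneg (by positivity)]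
      exact one_div_le_one_div_of_le (by positivity) (by gcongr)
    rw [e2]
    refine (abs_add_le _ _).trans ?_
    rw [abs_mul, abs_mul]
    have g3 := mul_le_mul g1 b3 (abs_nonneg _) (by positivity)
    have g4 := mul_le_mul g2 hi (abs_nonneg _) (by positivity)
    refine (add_le_add g3 g4).trans ?_
    have : (L / cs^2 + L * (2 * L1 / cs^3)) * (‖A - B‖ * dot v v) ≤ CL * (‖A - B‖ * dot v v) :=
      mul_le_mul_of_nonneg_right (by linarith) (by positivity)
    calc _ = (L / cs^2 + L * (2 * L1 / cs^3)) * (‖A - B‖ * dot v v) := by ring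
      _ ≤ _ := this
      _ = _ := by ring
  · intro B hB hne
    have hcont : ContinuousOn (fun A => Gm α K A + fderiv ℝ (fm α K) A (B - A) / (fm α K A)^2) D := by
      have f1 : Continuous (fderiv ℝ (fm α K : Mat n → ℝ)) := fm_contDiff.continuous_fderiv (by simp)
      have f2 : Continuous fun A : Mat n => fderiv ℝ (fm α K) A (B - A) :=
        f1.clm_apply (continuous_const.sub continuous_id)
      refine hGc.add (f2.continuousOn.div ((fm_contDiff.continuous.pow 2).continuousOn) fun A hA => ?_)
      exact pow_ne_zero 2 (hcone A hA).fm_pos.ne'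
    obtain ⟨A', hA', hmin⟩ := (DD_compact (α := α) (K := K) (n := n) C1 cs).exists_isMinOn hne hcont
    refine ⟨Gm α K A' + fderiv ℝ (fm α K) A' (B - A') / (fm α K A')^2, A', hA', fun A hA => ?_, fun A hA => ?_⟩
    rotate_left
    · have := hmin hA
      rw [(hr A hA).1 _ (hsub A hA B hB)]
      exact this
    · have := (hr A' hA').2.2.2 A hA
      rw [← (hr A' hA').1 _ (hsub A' hA' B hB)]
      simp only [aa_sub] at *
      linarith
  · intro A lam q he hl hb hf
    refine ⟨he.symm, fun i j => dot_le_of_entry he hb i j, fun j hj => ?_⟩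
    rw [he.2.2, he.2.2, ← es_hat_succ]
    have h1 : es Finset.univ 1 (hat α lam) ≤ B := by
      rw [es_one]
      calc _ ≤ ∑ o : Option (Fin n), max C α := Finset.sum_le_sum fun o _ => by
            cases o with
            | none => exact le_max_right _ _
            | some i => exact ((le_abs_self _).trans (hb i)).trans (le_max_left _ _)
        _ = (n+1) * max C α := by simp
        _ ≤ B := le_max_right _ _
    have := hl.e_lower hB1 h1 hm1 hf (K + 2 - (j+1)) (by omega)
    rw [show K + 2 - (K + 2 - (j+1)) = j + 1 by omega] at this
    refine le_trans ?_ this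
    simp only [hcs]
    exact div_le_div_of_nonneg_left hm1.le (by positivity) (pow_le_pow_right₀ hB1 (by omega))
end M2
end

open Filter Topology

section
section Calc
variable {E : Type*} [NormedAddCommGroup E] [NormedSpace ℝ E]

def dd (v : E) (f : E → ℝ) (p : E) : ℝ := fderiv ℝ f p v
def d2 (v : E) (f : E → ℝ) (p : E) : ℝ := dd v (dd v f) p

variable {f g : E → ℝ} {p v w : E}

lemma dd_add_dir : dd (v + w) f p = dd v f p + dd w f p := map_add _ _ _
lemma dd_sub_dir : dd (v - w) f p = dd v f p - dd w f p := map_sub _ _ _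
lemma dd_smul_dir (c : ℝ) : dd (c • v) f p = c * dd v f p := by simp [dd]
lemma dd_zero_dir : dd (0 : E) f p = 0 := by simp [dd]
lemma dd_sum_dir {ι : Type*} (s : Finset ι) (v : ι → E) : dd (∑ i ∈ s, v i) f p = ∑ i ∈ s, dd (v i) f p := map_sum _ _ _

lemma dd_contDiffAt {m n : ℕ} (hf : ContDiffAt ℝ n f p) (h : m + 1 ≤ n) : ContDiffAt ℝ m (dd v f) p := by
  have := hf.fderiv_right (m := m) (by exact_mod_cast h)
  exact this.clm_apply contDiffAt_const

lemma dd_congr (h : f =ᶠ[𝓝 p] g) : dd v f p = dd v g p := by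
  unfold dd; rw [h.fderiv_eq]

lemma dd_congr' (h : f =ᶠ[𝓝 p] g) : dd v f =ᶠ[𝓝 p] dd v g := by
  filter_upwards [h.fderiv (𝕜 := ℝ)] with q hq
  unfold dd; rw [hq]

lemma d2_congr (h : f =ᶠ[𝓝 p] g) : d2 v f p = d2 v g p := dd_congr (dd_congr' h)

lemma C2.ev (hf : ContDiffAt ℝ 2 f p) : ∀ᶠ q in 𝓝 p, DifferentiableAt ℝ f q := by
  filter_upwards [hf.eventually (by simp)] with q hq
  exact hq.differentiableAt (by simp)

lemma C2.d (hf : ContDiffAt ℝ 2 f p) : DifferentiableAt ℝ f p := hf.differentiableAt (by simp)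
lemma C2.dd (hf : ContDiffAt ℝ 2 f p) : DifferentiableAt ℝ (dd v f) p :=
  (dd_contDiffAt (m := 1) (n := 2) hf le_rfl).differentiableAt (by simp)

lemma dd_const (c : ℝ) : dd v (fun _ => c) p = 0 := by simp [dd]
lemma d2_const (c : ℝ) : d2 v (fun _ => c) p = 0 := by
  unfold d2
  have : dd v (fun _ : E => c) = fun _ => 0 := by funext q; exact dd_const c
  rw [this]; exact dd_const 0

lemma dd_add (hf : DifferentiableAt ℝ f p) (hg : DifferentiableAt ℝ g p) :
    dd v (fun q => f q + g q) p = dd v f p + dd v g p := by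
  unfold dd; rw [fderiv_fun_add hf hg]; rfl
lemma dd_sub (hf : DifferentiableAt ℝ f p) (hg : DifferentiableAt ℝ g p) :
    dd v (fun q => f q - g q) p = dd v f p - dd v g p := by
  unfold dd; rw [fderiv_fun_sub hf hg]; rfl
lemma dd_mul (hf : DifferentiableAt ℝ f p) (hg : DifferentiableAt ℝ g p) :
    dd v (fun q => f q * g q) p = dd v f p * g p + f p * dd v g p := by
  unfold dd; rw [fderiv_fun_mul hf hg]; simp; ring
lemma dd_cmul (c : ℝ) (hf : DifferentiableAt ℝ f p) : dd v (fun q => c * f q) p = c * dd v f p := by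
  unfold dd; rw [fderiv_const_mul hf]; rfl
lemma dd_sum {ι : Type*} (s : Finset ι) {F : ι → E → ℝ} (hF : ∀ i ∈ s, DifferentiableAt ℝ (F i) p) :
    dd v (fun q => ∑ i ∈ s, F i q) p = ∑ i ∈ s, dd v (F i) p := by
  unfold dd; rw [fderiv_fun_sum hF]; simp
lemma dd_comp {φ : ℝ → ℝ} (hφ : DifferentiableAt ℝ φ (f p)) (hf : DifferentiableAt ℝ f p) :
    dd v (fun q => φ (f q)) p = deriv φ (f p) * dd v f p := by
  unfold dd
  have := (hφ.hasDerivAt.comp_hasFDerivAt p hf.hasFDerivAt).fderiv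
  have h2 : fderiv ℝ (fun q => φ (f q)) p = _ := this
  rw [h2]; simp

lemma d2_add (hf : ContDiffAt ℝ 2 f p) (hg : ContDiffAt ℝ 2 g p) :
    d2 v (fun q => f q + g q) p = d2 v f p + d2 v g p := by
  unfold d2
  rw [dd_congr (g := fun q => dd v f q + dd v g q), dd_add (C2.dd hf) (C2.dd hg)]
  filter_upwards [C2.ev hf, C2.ev hg] with q h1 h2 using dd_add h1 h2
lemma d2_sub (hf : ContDiffAt ℝ 2 f p) (hg : ContDiffAt ℝ 2 g p) :
    d2 v (fun q => f q - g q) p = d2 v f p - d2 v g p := by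
  unfold d2
  rw [dd_congr (g := fun q => dd v f q - dd v g q), dd_sub (C2.dd hf) (C2.dd hg)]
  filter_upwards [C2.ev hf, C2.ev hg] with q h1 h2 using dd_sub h1 h2
lemma d2_cmul (c : ℝ) (hf : ContDiffAt ℝ 2 f p) : d2 v (fun q => c * f q) p = c * d2 v f p := by
  unfold d2
  rw [dd_congr (g := fun q => c * dd v f q), dd_cmul _ (C2.dd hf)]
  filter_upwards [C2.ev hf] with q h1 using dd_cmul c h1
lemma d2_sum {ι : Type*} (s : Finset ι) {F : ι → E → ℝ} (hF : ∀ i ∈ s, ContDiffAt ℝ 2 (F i) p) :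
    d2 v (fun q => ∑ i ∈ s, F i q) p = ∑ i ∈ s, d2 v (F i) p := by
  unfold d2
  rw [dd_congr (g := fun q => ∑ i ∈ s, dd v (F i) q), dd_sum s fun i hi => C2.dd (hF i hi)]
  have : ∀ᶠ q in 𝓝 p, ∀ i ∈ s, DifferentiableAt ℝ (F i) q :=
    (Filter.eventually_all_finset s).2 fun i hi => C2.ev (hF i hi)
  filter_upwards [this] with q h1 using dd_sum s h1
lemma d2_mul (hf : ContDiffAt ℝ 2 f p) (hg : ContDiffAt ℝ 2 g p) :
    d2 v (fun q => f q * g q) p = d2 v f p * g p + 2 * (dd v f p * dd v g p) + f p * d2 v g p := by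
  unfold d2
  rw [dd_congr (g := fun q => dd v f q * g q + f q * dd v g q),
    dd_add (f := fun q => dd v f q * g q) (g := fun q => f q * dd v g q) ((C2.dd hf).mul (C2.d hg)) ((C2.d hf).mul (C2.dd hg)),
    dd_mul (C2.dd hf) (C2.d hg), dd_mul (C2.d hf) (C2.dd hg)]
  · ring
  filter_upwards [C2.ev hf, C2.ev hg] with q h1 h2 using dd_mul h1 h2
lemma d2_sq (hf : ContDiffAt ℝ 2 f p) :
    d2 v (fun q => f q ^ 2) p = 2 * f p * d2 v f p + 2 * (dd v f p)^2 := by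
  have : (fun q => f q ^ 2) = fun q => f q * f q := by funext q; ring
  rw [this, d2_mul hf hf]; ring
lemma dd_sq (hf : DifferentiableAt ℝ f p) : dd v (fun q => f q ^ 2) p = 2 * f p * dd v f p := by
  have : (fun q => f q ^ 2) = fun q => f q * f q := by funext q; ring
  rw [this, dd_mul hf hf]; ring
lemma d2_comp {φ : ℝ → ℝ} (hφ : ContDiffAt ℝ 2 φ (f p)) (hf : ContDiffAt ℝ 2 f p) :
    d2 v (fun q => φ (f q)) p = deriv φ (f p) * d2 v f p + deriv (deriv φ) (f p) * (dd v f p)^2 := by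
  have hφ' : DifferentiableAt ℝ (deriv φ) (f p) := by
    have h := C2.dd (v := (1:ℝ)) hφ
    exact h
  unfold d2
  have hc : ∀ᶠ q in 𝓝 p, DifferentiableAt ℝ φ (f q) := (C2.d hf).continuousAt.eventually (C2.ev hφ)
  rw [dd_congr (g := fun q => deriv φ (f q) * dd v f q),
    dd_mul (f := fun q => deriv φ (f q)) (hφ'.comp p (C2.d hf)) (C2.dd hf), dd_comp hφ' (C2.d hf)]
  · ring
  filter_upwards [C2.ev hf, hc] with q h1 h2 using dd_comp h2 h1

/-- symmetry -/
lemma dd_comm (hf : ContDiffAt ℝ 2 f p) : dd v (dd w f) p = dd w (dd v f) p := by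
  have hs : IsSymmSndFDerivAt ℝ f p := hf.isSymmSndFDerivAt (by simp)
  have h1 : DifferentiableAt ℝ (fderiv ℝ f) p :=
    (hf.fderiv_right (m := 1) (by norm_num)).differentiableAt (by simp)
  have key : ∀ a b : E, dd a (dd b f) p = fderiv ℝ (fderiv ℝ f) p a b := by
    intro a b
    unfold dd
    rw [fderiv_clm_apply h1 (differentiableAt_const b)]; simp
  rw [key, key]; exact hs v w

lemma dd_comm_ev (hf : ContDiffAt ℝ 2 f p) : dd v (dd w f) =ᶠ[𝓝 p] dd w (dd v f) := by
  filter_upwards [hf.eventually (by simp)] with q hq using dd_comm hq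

lemma dd_dd_add (hf : ContDiffAt ℝ 2 f p) (a : E) : dd a (dd (v + w) f) p = dd a (dd v f) p + dd a (dd w f) p := by
  rw [dd_comm hf, dd_add_dir, dd_comm hf, dd_comm (v := w) hf]
lemma dd_dd_smul (hf : ContDiffAt ℝ 2 f p) (a : E) (c : ℝ) : dd a (dd (c • v) f) p = c * dd a (dd v f) p := by
  rw [dd_comm hf, dd_smul_dir, dd_comm hf]
lemma dd_dd_sum (hf : ContDiffAt ℝ 2 f p) {ι : Type*} (s : Finset ι) (v : ι → E) (a : E) :
    dd a (dd (∑ i ∈ s, v i) f) p = ∑ i ∈ s, dd a (dd (v i) f) p := by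
  rw [dd_comm hf, dd_sum_dir]; exact Finset.sum_congr rfl fun i _ => dd_comm hf

lemma d2_add_dir (hf : ContDiffAt ℝ 2 f p) :
    d2 (v + w) f p = d2 v f p + 2 * dd v (dd w f) p + d2 w f p := by
  unfold d2
  rw [dd_dd_add hf, dd_add_dir, dd_add_dir, dd_comm (v := w) (w := v) hf]; ring
lemma d2_smul_dir (hf : ContDiffAt ℝ 2 f p) (c : ℝ) : d2 (c • v) f p = c^2 * d2 v f p := by
  unfold d2; rw [dd_dd_smul hf, dd_smul_dir]; ring

/-- commuting second derivatives with first ones -/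
lemma dd_d2 (hf : ContDiffAt ℝ 3 f p) : d2 v (dd w f) p = dd w (d2 v f) p := by
  have h2 : ContDiffAt ℝ 2 f p := hf.of_le (by norm_num)
  have h1 : ContDiffAt ℝ 2 (dd v f) p := dd_contDiffAt (n := 3) hf le_rfl
  unfold d2
  rw [dd_congr (dd_comm_ev h2), dd_comm h1]

/-- affine substitution -/
lemma dd_affine {F : Type*} [NormedAddCommGroup F] [NormedSpace ℝ F] (A : F →L[ℝ] E) (c : E) {q : F} {b : F} {f : E → ℝ}
    (hf : DifferentiableAt ℝ f (c + A q)) : dd b (fun x => f (c + A x)) q = dd (A b) f (c + A q) := by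
  unfold dd
  have h1 : HasFDerivAt (fun x => c + A x) A q := A.hasFDerivAt.const_add c
  have := (HasFDerivAt.comp (g := f) (f := fun x => c + A x) q hf.hasFDerivAt h1).fderiv
  have h2 : fderiv ℝ (fun x => f (c + A x)) q = _ := this
  rw [h2]; rfl
lemma cd_affine {F : Type*} [NormedAddCommGroup F] [NormedSpace ℝ F] (A : F →L[ℝ] E) (c : E) {q : F} {f : E → ℝ} {m : ℕ}
    (hf : ContDiffAt ℝ m f (c + A q)) : ContDiffAt ℝ m (fun x => f (c + A x)) q :=
  ContDiffAt.comp (f := fun x => c + A x) (g := f) q hf (contDiffAt_const.add A.contDiff.contDiffAt)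
lemma cont_affine {F : Type*} [NormedAddCommGroup F] [NormedSpace ℝ F] (A : F →L[ℝ] E) (c : E) :
    Continuous (fun x => c + A x) := by fun_prop
lemma dd2_affine {F : Type*} [NormedAddCommGroup F] [NormedSpace ℝ F] (A : F →L[ℝ] E) (c : E) {q : F} {a b : F} {f : E → ℝ}
    (hf : ContDiffAt ℝ 2 f (c + A q)) : dd a (dd b (fun x => f (c + A x))) q = dd (A a) (dd (A b) f) (c + A q) := by
  rw [dd_congr (g := fun x => dd (A b) f (c + A x)), dd_affine A c (C2.dd hf)]
  have := ((cont_affine A c).continuousAt (x := q)).eventually (C2.ev hf)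
  filter_upwards [this] with x hx using dd_affine A c hx
lemma d2_affine {F : Type*} [NormedAddCommGroup F] [NormedSpace ℝ F] (A : F →L[ℝ] E) (c : E) {q : F} {b : F} {f : E → ℝ}
    (hf : ContDiffAt ℝ 2 f (c + A q)) : d2 b (fun x => f (c + A x)) q = d2 (A b) f (c + A q) :=
  dd2_affine A c hf

/-- line restriction -/
lemma line_hasDeriv {s : ℝ} (hf : DifferentiableAt ℝ f (p + s • v)) :
    HasDerivAt (fun s : ℝ => f (p + s • v)) (dd v f (p + s • v)) s := by
  have h1 : HasDerivAt (fun s : ℝ => p + s • v) v s := by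
    simpa using ((hasDerivAt_id s).smul_const v).const_add p
  exact (HasFDerivAt.comp_hasDerivAt s hf.hasFDerivAt h1)
lemma line_cont (s : ℝ) : ContinuousAt (fun s : ℝ => p + s • v) s := by fun_prop

lemma max_line (hf : ContDiffAt ℝ 2 f p) (h : ∀ᶠ s : ℝ in 𝓝 0, f (p + s • v) ≤ f p) :
    dd v f p = 0 ∧ d2 v f p ≤ 0 := by
  set φ : ℝ → ℝ := fun s => f (p + s • v) with hφ
  have h0 : φ 0 = f p := by simp [hφ]
  have hp : p + (0:ℝ) • v = p := by simp
  have e1 : ∀ᶠ s : ℝ in 𝓝 0, HasDerivAt φ (dd v f (p + s • v)) s := by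
    have := (line_cont (p := p) (v := v) 0).eventually (p := fun q => DifferentiableAt ℝ f q) (by beta_reduce; rw [hp]; exact C2.ev hf)
    filter_upwards [this] with s hs using line_hasDeriv hs
  have hd : deriv φ =ᶠ[𝓝 0] fun s => dd v f (p + s • v) := by
    filter_upwards [e1] with s hs using hs.deriv
  have hmax : IsLocalMax φ 0 := by
    filter_upwards [h] with s hs; rw [h0]; exact hs
  have d0 : deriv φ 0 = 0 := hmax.deriv_eq_zero
  have d0' : dd v f p = 0 := by rw [← d0, hd.eq_of_nhds]; simp
  refine ⟨d0', ?_⟩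
  have dd0 : deriv (deriv φ) 0 = d2 v f p := by
    rw [hd.deriv_eq]
    have := line_hasDeriv (f := dd v f) (p := p) (v := v) (s := 0) (by rw [hp]; exact C2.dd hf)
    rw [this.deriv]; simp [d2]
  by_contra hc
  push Not at hc
  have hmin := isLocalMin_of_deriv_deriv_pos (f := φ) (x₀ := 0) (by rw [dd0]; exact hc) d0 e1.self_of_nhds.continuousAt
  have hconst : φ =ᶠ[𝓝 0] fun _ => φ 0 := by
    filter_upwards [hmax, hmin] with s h1 h2 using le_antisymm h1 h2
  have : deriv (deriv φ) 0 = 0 := by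
    rw [hconst.deriv.deriv_eq]; simp
  rw [dd0] at this; linarith

lemma max_left (hf : DifferentiableAt ℝ f p) (h : ∃ δ > 0, ∀ s : ℝ, -δ ≤ s → s ≤ 0 → f (p + s • v) ≤ f p) :
    0 ≤ dd v f p := by
  obtain ⟨δ, hδ, h⟩ := h
  have hp : p + (0:ℝ) • v = p := by simp
  have h1 := line_hasDeriv (f := f) (p := p) (v := v) (s := 0) (by rw [hp]; exact hf)
  rw [hp] at h1
  have h2 := h1.hasDerivWithinAt (s := Set.Iio 0)
  rw [hasDerivWithinAt_iff_tendsto_slope' (by simp)] at h2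
  refine ge_of_tendsto h2 ?_
  have : Set.Ico (-δ) 0 ∈ 𝓝[<] (0:ℝ) := Ico_mem_nhdsLT (by linarith)
  filter_upwards [this] with s hs
  rw [slope_def_field]
  have := h s hs.1 hs.2.le
  simp only [zero_smul, add_zero, sub_zero]
  exact div_nonneg_of_nonpos (by linarith) hs.2.le

end Calc
end

section
abbrev En (n : ℕ) := (Fin n → ℝ) × ℝ
def sp {n : ℕ} (v : Fin n → ℝ) : En n := (v, 0)
def et {n : ℕ} : En n := (0, 1)
def bs {n : ℕ} (i : Fin n) : Fin n → ℝ := Pi.single i 1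
def Hess {n : ℕ} (u : En n → ℝ) (p : En n) : Mat n := fun i j => dd (sp (bs i)) (dd (sp (bs j)) u) p
def Lop {n : ℕ} (r : Fin n → Fin n → ℝ) (f : En n → ℝ) (p : En n) : ℝ := ∑ k, d2 (sp (r k)) f p - dd et f p

section Sp
variable {n : ℕ} {f g u : En n → ℝ} {p q : En n}

lemma sp_eq_sum (v : Fin n → ℝ) : sp v = ∑ i, v i • (sp (bs i) : En n) := by
  ext j
  · simp [sp, bs, Prod.fst_sum, Finset.sum_apply, Pi.single_apply]
  · simp [sp, Prod.snd_sum]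
lemma sp_add (v w : Fin n → ℝ) : sp (v + w) = sp v + sp w := by simp [sp]
lemma sp_sub (v w : Fin n → ℝ) : sp (v - w) = sp v - sp w := by simp [sp]
lemma sp_smul (c : ℝ) (v : Fin n → ℝ) : sp (c • v) = c • sp v := by simp [sp]

lemma qf_hess (hf : ContDiffAt ℝ 2 f p) (v w : Fin n → ℝ) :
    qf (Hess f p) v w = dd (sp v) (dd (sp w) f) p := by
  rw [sp_eq_sum v, sp_eq_sum w, dd_sum_dir]
  unfold qf
  refine Finset.sum_congr rfl fun i _ => ?_
  rw [dd_smul_dir, dd_dd_sum hf, Finset.mul_sum]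
  refine Finset.sum_congr rfl fun j _ => ?_
  rw [dd_dd_smul hf]; unfold Hess; ring
lemma qf_hess' (hf : ContDiffAt ℝ 2 f p) (v : Fin n → ℝ) : qf (Hess f p) v v = d2 (sp v) f p := qf_hess hf v v
lemma aa_hess (hf : ContDiffAt ℝ 2 f p) (r) : aa r (Hess f p) = ∑ k, d2 (sp (r k)) f p :=
  Finset.sum_congr rfl fun k _ => qf_hess' hf _
lemma hess_symm (hf : ContDiffAt ℝ 2 f p) : Symm (Hess f p) := fun i j => dd_comm hf
lemma Lop_eq (hf : ContDiffAt ℝ 2 f p) (r) : Lop r f p = aa r (Hess f p) - dd et f p := by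
  rw [aa_hess hf]; rfl
lemma dd_sp (hv : Fin n → ℝ) : dd (sp hv) f p = ∑ i, hv i * dd (sp (bs i)) f p := by
  rw [sp_eq_sum hv, dd_sum_dir]; exact Finset.sum_congr rfl fun i _ => dd_smul_dir _

/-- gradient vector -/
def grd (f : En n → ℝ) (p : En n) : Fin n → ℝ := fun i => dd (sp (bs i)) f p
lemma dd_sp' (v : Fin n → ℝ) : dd (sp v) f p = dot v (grd f p) := by rw [dd_sp]; rfl

lemma Lop_add (r) (hf : ContDiffAt ℝ 2 f p) (hg : ContDiffAt ℝ 2 g p) :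
    Lop r (fun q => f q + g q) p = Lop r f p + Lop r g p := by
  unfold Lop; rw [dd_add (C2.d hf) (C2.d hg)]; simp only [d2_add hf hg, Finset.sum_add_distrib]; ring
lemma Lop_sub (r) (hf : ContDiffAt ℝ 2 f p) (hg : ContDiffAt ℝ 2 g p) :
    Lop r (fun q => f q - g q) p = Lop r f p - Lop r g p := by
  unfold Lop; rw [dd_sub (C2.d hf) (C2.d hg)]; simp only [d2_sub hf hg, Finset.sum_sub_distrib]; ring
lemma Lop_cmul (r) (c : ℝ) (hf : ContDiffAt ℝ 2 f p) : Lop r (fun q => c * f q) p = c * Lop r f p := by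
  unfold Lop; rw [dd_cmul c (C2.d hf)]; simp only [d2_cmul c hf, ← Finset.mul_sum]; ring
lemma Lop_const (r) (c : ℝ) : Lop r (fun _ => c) p = 0 := by
  unfold Lop; simp [d2_const, dd_const]
lemma Lop_sum (r) {ι : Type*} (s : Finset ι) {F : ι → En n → ℝ} (hF : ∀ i ∈ s, ContDiffAt ℝ 2 (F i) p) :
    Lop r (fun q => ∑ i ∈ s, F i q) p = ∑ i ∈ s, Lop r (F i) p := by
  unfold Lop; rw [dd_sum s fun i hi => C2.d (hF i hi)]; simp only [d2_sum s hF]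
  rw [Finset.sum_comm, Finset.sum_sub_distrib]
/-- carré du champ -/
def Gam2 (r : Fin n → Fin n → ℝ) (f g : En n → ℝ) (p : En n) : ℝ := ∑ k, dd (sp (r k)) f p * dd (sp (r k)) g p
lemma Lop_mul (r) (hf : ContDiffAt ℝ 2 f p) (hg : ContDiffAt ℝ 2 g p) :
    Lop r (fun q => f q * g q) p = Lop r f p * g p + 2 * Gam2 r f g p + f p * Lop r g p := by
  unfold Lop Gam2; rw [dd_mul (C2.d hf) (C2.d hg)]
  simp only [d2_mul hf hg, Finset.sum_add_distrib, ← Finset.mul_sum, ← Finset.sum_mul]; ring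
lemma Lop_sq (r) (hf : ContDiffAt ℝ 2 f p) :
    Lop r (fun q => f q ^ 2) p = 2 * f p * Lop r f p + 2 * Gam2 r f f p := by
  have : (fun q => f q ^ 2) = fun q => f q * f q := by funext q; ring
  rw [this, Lop_mul r hf hf]; ring
lemma Lop_comp (r) {φ : ℝ → ℝ} (hφ : ContDiffAt ℝ 2 φ (f p)) (hf : ContDiffAt ℝ 2 f p) :
    Lop r (fun q => φ (f q)) p = deriv φ (f p) * Lop r f p + deriv (deriv φ) (f p) * Gam2 r f f p := by
  unfold Lop Gam2; rw [dd_comp (C2.d hφ) (C2.d hf)]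
  simp only [d2_comp hφ hf, Finset.sum_add_distrib, ← Finset.mul_sum, ← pow_two]; ring
lemma Gam2_eq (r) : Gam2 r f f p = ∑ k, (dot (r k) (grd f p))^2 := by
  unfold Gam2; exact Finset.sum_congr rfl fun k _ => by rw [dd_sp', pow_two]

/-- at a parabolic max the operator is nonpositive -/
lemma Lop_max (r) (hf : ContDiffAt ℝ 2 f p)
    (h : ∀ᶠ q in 𝓝 p, q.2 ≤ p.2 → f q ≤ f p) : (∀ v, dd (sp v) f p = 0) ∧ (∀ v, d2 (sp v) f p ≤ 0) ∧
      0 ≤ dd et f p ∧ Lop r f p ≤ 0 := by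
  have h1 : ∀ v : Fin n → ℝ, dd (sp v) f p = 0 ∧ d2 (sp v) f p ≤ 0 := by
    intro v
    apply max_line hf
    have := (line_cont (p := p) (v := sp v) 0).eventually (p := fun q => q.2 ≤ p.2 → f q ≤ f p) (by simpa using h)
    filter_upwards [this] with s hs
    exact hs (by simp [sp])
  have h2 : 0 ≤ dd et f p := by
    apply max_left (C2.d hf)
    have := (line_cont (p := p) (v := et) 0).eventually (p := fun q => q.2 ≤ p.2 → f q ≤ f p) (by simpa using h)
    obtain ⟨δ, hδ, h3⟩ := Metric.eventually_nhds_iff.1 this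
    refine ⟨δ/2, by linarith, fun s hs hs' => h3 ?_ (by simp [et]; exact hs')⟩
    rw [Real.dist_eq, sub_zero, abs_lt]; constructor <;> linarith
  refine ⟨fun v => (h1 v).1, fun v => (h1 v).2, h2, ?_⟩
  unfold Lop
  have := Finset.sum_nonpos fun k (_ : k ∈ Finset.univ) => (h1 (r k)).2
  linarith

lemma norm_sq_le_sum (B : Mat n) : ‖B‖^2 ≤ ∑ i, ∑ j, (B i j)^2 := by
  set S := ∑ i, ∑ j, (B i j)^2
  have hS : 0 ≤ S := Finset.sum_nonneg fun i _ => Finset.sum_nonneg fun j _ => sq_nonneg _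
  have : ‖B‖ ≤ Real.sqrt S := by
    refine (pi_norm_le_iff_of_nonneg (Real.sqrt_nonneg _)).2 fun i => (pi_norm_le_iff_of_nonneg (Real.sqrt_nonneg _)).2 fun j => ?_
    apply Real.le_sqrt_of_sq_le
    rw [Real.norm_eq_abs, sq_abs]
    refine le_trans ?_ (Finset.single_le_sum (f := fun i => ∑ j, (B i j)^2) (fun i _ => Finset.sum_nonneg fun j _ => sq_nonneg _) (Finset.mem_univ i))
    exact Finset.single_le_sum (f := fun j => (B i j)^2) (fun j _ => sq_nonneg _) (Finset.mem_univ j)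
  calc ‖B‖^2 ≤ (Real.sqrt S)^2 := by gcongr
    _ = S := Real.sq_sqrt hS

def Good (Dt : Data n) (u : En n → ℝ) (p : En n) : Prop :=
  ContDiffAt ℝ 4 u p ∧ Hess u p ∈ Dt.D ∧ dd et u p = Dt.G (Hess u p)

def Sol (Dt : Data n) (u : En n → ℝ) : Prop := ∃ τ > 0, ∀ p : En n, p.2 < τ → Good Dt u p

variable {Dt : Data n}

lemma Sol.good (h : Sol Dt u) (hp : p.2 ≤ 0) : Good Dt u p := by
  obtain ⟨τ, hτ, h⟩ := h; exact h p (by linarith)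
lemma Sol.ev (h : Sol Dt u) (hp : p.2 ≤ 0) : ∀ᶠ q in 𝓝 p, Good Dt u q := by
  obtain ⟨τ, hτ, h⟩ := h
  have : ∀ᶠ q : En n in 𝓝 p, q.2 < τ := continuous_snd.continuousAt.eventually_lt continuousAt_const (by linarith)
  filter_upwards [this] with q hq using h q hq

lemma Good.c2 (h : Good Dt u p) : ContDiffAt ℝ 2 u p := h.1.of_le (by norm_num)
lemma Good.c3 (h : Good Dt u p) : ContDiffAt ℝ 3 u p := h.1.of_le (by norm_num)
lemma Good.c3d (h : Good Dt u p) (v) : ContDiffAt ℝ 3 (dd v u) p := dd_contDiffAt (n := 4) h.1 le_rfl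
lemma Good.c2d (h : Good Dt u p) (v) : ContDiffAt ℝ 2 (dd v u) p := (h.c3d v).of_le (by norm_num)
lemma Good.c2dd (h : Good Dt u p) (v w) : ContDiffAt ℝ 2 (dd v (dd w u)) p := dd_contDiffAt (n := 3) (h.c3d w) le_rfl
lemma Good.c2d2 (h : Good Dt u p) (v) : ContDiffAt ℝ 2 (d2 v u) p := h.c2dd v v

lemma d2_d2 (h : ContDiffAt ℝ 4 f p) (v w : En n) : d2 v (d2 w f) p = d2 w (d2 v f) p := by
  have h3 : ∀ z, ContDiffAt ℝ 3 (dd z f) p := fun z => dd_contDiffAt (n := 4) h le_rfl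
  have e1 : dd v (d2 w f) =ᶠ[𝓝 p] d2 w (dd v f) := by
    filter_upwards [h.eventually (by simp)] with q hq
    exact (dd_d2 (hq.of_le (by norm_num))).symm
  calc d2 v (d2 w f) p = dd v (dd v (d2 w f)) p := rfl
    _ = dd v (d2 w (dd v f)) p := dd_congr e1
    _ = d2 w (dd v (dd v f)) p := (dd_d2 (h3 v)).symm

/-- the linearized equation -/
lemma lin_eq (hp : Good Dt u p) (hev : ∀ᶠ q in 𝓝 p, Good Dt u q) (v : En n) :
    Lop (Dt.r (Hess u p)) (dd v u) p = 0 ∧ 0 ≤ Lop (Dt.r (Hess u p)) (d2 v u) p ∧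
    Lop (Dt.r (Hess u p)) (d2 v u) p ≤ 2 * Dt.CL * ∑ i, ∑ j, (dd v (dd (sp (bs i)) (dd (sp (bs j)) u)) p)^2 := by
  set r := Dt.r (Hess u p)
  have hp' : p + (0:ℝ) • v = p := by simp
  set F : En n → ℝ := fun q => ∑ k, d2 (sp (r k)) u q - dd et u q with hF
  have hFc1 : ContDiffAt ℝ 2 (fun q => ∑ k, d2 (sp (r k)) u q) p := ContDiffAt.sum fun k _ => hp.c2d2 _
  have hFc : ContDiffAt ℝ 2 F p := hFc1.sub (hp.c2d _)
  have hF1 : ∀ q, Good Dt u q → F q - F p = aa r (Hess u q - Hess u p) - (Dt.G (Hess u q) - Dt.G (Hess u p)) := by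
    intro q hq
    simp only [hF]
    rw [aa_sub, aa_hess hq.c2, aa_hess hp.c2, ← hq.2.2, ← hp.2.2]; ring
  have hdd : dd v F p = Lop r (dd v u) p := by
    simp only [hF]
    rw [dd_sub (C2.d hFc1) (C2.d (hp.c2d _)), dd_sum _ fun k _ => C2.d (hp.c2d2 _), dd_comm hp.c2]
    unfold Lop
    congr 1
    exact Finset.sum_congr rfl fun k _ => (dd_d2 hp.c3).symm
  have hd2 : d2 v F p = Lop r (d2 v u) p := by
    simp only [hF]
    rw [d2_sub hFc1 (hp.c2d _), d2_sum _ fun k _ => hp.c2d2 _, dd_d2 hp.c3]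
    unfold Lop
    congr 1
    exact Finset.sum_congr rfl fun k _ => d2_d2 hp.1 _ _
  have hl : ∀ P : En n → Prop, (∀ᶠ q in 𝓝 p, P q) → ∀ᶠ s : ℝ in 𝓝 0, P (p + s • v) := fun P hP =>
    (line_cont (p := p) (v := v) 0).eventually (p := P) (by beta_reduce; rw [hp']; exact hP)
  have m1 := max_line (f := fun q => (-1) * F q) (v := v) (contDiffAt_const.mul hFc) (by
    filter_upwards [hl _ hev] with s hs
    have := Dt.key _ hp.2.1 _ hs.2.1
    have := hF1 _ hs
    simp only [r] at *
    linarith)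
  rw [dd_cmul _ (C2.d hFc), d2_cmul _ hFc, hdd, hd2] at m1
  refine ⟨by linarith [m1.1], by linarith [m1.2], ?_⟩
  set H : En n → ℝ := fun q => ∑ i, ∑ j, (dd (sp (bs i)) (dd (sp (bs j)) u) q - Hess u p i j)^2 with hH
  have c1 : ∀ i j, ContDiffAt ℝ 2 (fun q => dd (sp (bs i)) (dd (sp (bs j)) u) q - Hess u p i j) p := fun i j =>
    (hp.c2dd _ _).sub contDiffAt_const
  have c2 : ∀ i j, ContDiffAt ℝ 2 (fun q => (dd (sp (bs i)) (dd (sp (bs j)) u) q - Hess u p i j)^2) p := fun i j => (c1 i j).pow 2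
  have c3 : ∀ i, ContDiffAt ℝ 2 (fun q => ∑ j, (dd (sp (bs i)) (dd (sp (bs j)) u) q - Hess u p i j)^2) p :=
    fun i => ContDiffAt.sum fun j _ => c2 i j
  have c4 : ContDiffAt ℝ 2 H p := ContDiffAt.sum fun i _ => c3 i
  have m2 := max_line (f := fun q => F q - Dt.CL * H q) (v := v) (hFc.sub (contDiffAt_const.mul c4)) (by
    filter_upwards [hl _ hev] with s hs
    have h1 := Dt.semi _ hp.2.1 _ hs.2.1
    have h2 := hF1 _ hs
    have h3 : H p = 0 := by simp [hH, Hess]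
    have h4 := norm_sq_le_sum (Hess u (p + s • v) - Hess u p)
    have h5 : H (p + s • v) = ∑ i, ∑ j, ((Hess u (p + s • v) - Hess u p) i j)^2 := rfl
    rw [← h5] at h4
    have h6 := mul_le_mul_of_nonneg_left h4 Dt.CL_pos.le
    rw [h3]
    simp only [r] at *
    linarith)
  rw [d2_sub hFc (contDiffAt_const.mul c4), d2_cmul _ c4, hd2] at m2
  have hH2 : d2 v H p = 2 * ∑ i, ∑ j, (dd v (dd (sp (bs i)) (dd (sp (bs j)) u)) p)^2 := by
    simp only [hH]
    rw [d2_sum _ fun i _ => c3 i, Finset.mul_sum]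
    refine Finset.sum_congr rfl fun i _ => ?_
    rw [d2_sum _ fun j _ => c2 i j, Finset.mul_sum]
    refine Finset.sum_congr rfl fun j _ => ?_
    rw [d2_sq (c1 i j), dd_sub (C2.d (hp.c2dd _ _)) (differentiableAt_const _), dd_const]
    simp [Hess]
  rw [hH2] at m2
  linarith [m2.2]
end Sp
end

section
/-- second-order jets at 0 of functions of a real variable -/
def Jt (f : ℝ → ℝ) (a b c : ℝ) : Prop := ContDiffAt ℝ 2 f 0 ∧ f 0 = a ∧ dd 1 f 0 = b ∧ d2 1 f 0 = c

lemma Jt.const (a : ℝ) : Jt (fun _ => a) a 0 0 := ⟨contDiffAt_const, rfl, dd_const a, d2_const a⟩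
lemma Jt.add {f g : ℝ → ℝ} {a b c a' b' c'} (h : Jt f a b c) (h' : Jt g a' b' c') :
    Jt (fun s => f s + g s) (a + a') (b + b') (c + c') := by
  obtain ⟨h0, rfl, rfl, rfl⟩ := h
  obtain ⟨h0', rfl, rfl, rfl⟩ := h'
  exact ⟨h0.add h0', rfl, dd_add (C2.d h0) (C2.d h0'), d2_add h0 h0'⟩
lemma Jt.sub {f g : ℝ → ℝ} {a b c a' b' c'} (h : Jt f a b c) (h' : Jt g a' b' c') :
    Jt (fun s => f s - g s) (a - a') (b - b') (c - c') := by
  obtain ⟨h0, rfl, rfl, rfl⟩ := h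
  obtain ⟨h0', rfl, rfl, rfl⟩ := h'
  exact ⟨h0.sub h0', rfl, dd_sub (C2.d h0) (C2.d h0'), d2_sub h0 h0'⟩
lemma Jt.mul {f g : ℝ → ℝ} {a b c a' b' c'} (h : Jt f a b c) (h' : Jt g a' b' c') :
    Jt (fun s => f s * g s) (a * a') (b * a' + a * b') (c * a' + 2 * (b * b') + a * c') := by
  obtain ⟨h0, rfl, rfl, rfl⟩ := h
  obtain ⟨h0', rfl, rfl, rfl⟩ := h'
  exact ⟨h0.mul h0', rfl, dd_mul (C2.d h0) (C2.d h0'), d2_mul h0 h0'⟩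
lemma Jt.cmul {f : ℝ → ℝ} {a b c} (k : ℝ) (h : Jt f a b c) : Jt (fun s => k * f s) (k * a) (k * b) (k * c) := by
  obtain ⟨h0, rfl, rfl, rfl⟩ := h
  exact ⟨contDiffAt_const.mul h0, rfl, dd_cmul _ (C2.d h0), d2_cmul _ h0⟩
lemma Jt.sum {ι : Type*} (s : Finset ι) {f : ι → ℝ → ℝ} {a b c : ι → ℝ} (h : ∀ i, Jt (f i) (a i) (b i) (c i)) :
    Jt (fun x => ∑ i ∈ s, f i x) (∑ i ∈ s, a i) (∑ i ∈ s, b i) (∑ i ∈ s, c i) := by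
  refine ⟨ContDiffAt.sum fun i _ => (h i).1, Finset.sum_congr rfl fun i _ => (h i).2.1, ?_, ?_⟩
  · rw [dd_sum s fun i _ => C2.d (h i).1]; exact Finset.sum_congr rfl fun i _ => (h i).2.2.1
  · rw [d2_sum s fun i _ => (h i).1]; exact Finset.sum_congr rfl fun i _ => (h i).2.2.2
lemma Jt.id : Jt (fun s => s) 0 1 0 := by
  have h1 : dd (1:ℝ) (fun s : ℝ => s) = fun _ => 1 := by
    funext s; simp [dd]
  refine ⟨contDiffAt_id, rfl, ?_, ?_⟩
  · rw [h1]
  · unfold d2; rw [h1]; exact dd_const 1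
lemma Jt.inv {f : ℝ → ℝ} {c} (h : Jt f 1 0 c) : Jt (fun s => (f s)⁻¹) 1 0 (-c) := by
  obtain ⟨h0, h1, h2, rfl⟩ := h
  have hi : ContDiffAt ℝ 2 (fun x : ℝ => x⁻¹) (f 0) := by
    rw [h1]; exact contDiffAt_inv ℝ one_ne_zero
  refine ⟨h0.inv (by rw [h1]; norm_num), by simp [h1], ?_, ?_⟩
  · rw [dd_comp (φ := fun x => x⁻¹) (C2.d hi) (C2.d h0), h2, mul_zero]
  · rw [d2_comp (φ := fun x => x⁻¹) hi h0, h2, h1]; simp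
lemma Jt.line {E : Type*} [NormedAddCommGroup E] [NormedSpace ℝ E] {g : E → ℝ} {p v : E} (hg : ContDiffAt ℝ 2 g p) :
    Jt (fun s : ℝ => g (p + s • v)) (g p) (dd v g p) (d2 v g p) := by
  set A : ℝ →L[ℝ] E := ContinuousLinearMap.toSpanSingleton ℝ v
  have e : ∀ s : ℝ, A s = s • v := fun s => rfl
  have hp : p + A 0 = p := by simp
  have hg' : ContDiffAt ℝ 2 g (p + A 0) := by rw [hp]; exact hg
  have e1 : A 1 = v := by rw [e, one_smul]
  refine ⟨cd_affine (m := 2) A p hg', by simp, ?_, ?_⟩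
  · have := dd_affine (b := (1:ℝ)) A p (C2.d hg'); rw [hp, e1] at this; exact this
  · have := d2_affine (b := (1:ℝ)) A p hg'; rw [hp, e1] at this; exact this
lemma Jt.nonneg {f : ℝ → ℝ} {a b c} (h : Jt f a b c) (hm : ∀ᶠ s : ℝ in 𝓝 0, f 0 ≤ f s) : 0 ≤ c := by
  obtain ⟨h0, rfl, rfl, rfl⟩ := h
  have := max_line (f := fun s => (-1) * f s) (p := (0:ℝ)) (v := (1:ℝ)) (contDiffAt_const.mul h0) (by
    filter_upwards [hm] with s hs
    simpa using hs)
  rw [d2_cmul _ h0] at this; linarith [this.2]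

section Rot
variable {n : ℕ}

lemma dot_add_left (a b c : Fin n → ℝ) : dot (a + b) c = dot a c + dot b c := by
  simp [dot, add_mul, Finset.sum_add_distrib]
lemma dot_add_right (a b c : Fin n → ℝ) : dot a (b + c) = dot a b + dot a c := by
  simp [dot, mul_add, Finset.sum_add_distrib]
lemma dot_smul_l (k : ℝ) (a b : Fin n → ℝ) : dot (k • a) b = k * dot a b := by
  simp [dot, Finset.mul_sum, mul_assoc]
lemma dot_smul_r (k : ℝ) (a b : Fin n → ℝ) : dot a (k • b) = k * dot a b := by
  rw [dot_comm, dot_smul_l, dot_comm]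
lemma dot_sum_r {ι : Type*} (s : Finset ι) (a : Fin n → ℝ) (b : ι → Fin n → ℝ) : dot a (∑ i ∈ s, b i) = ∑ i ∈ s, dot a (b i) := by
  simp only [dot, Finset.sum_apply, Finset.mul_sum]; rw [Finset.sum_comm]
lemma qf_add_left (B : Mat n) (a b c : Fin n → ℝ) : qf B (a + b) c = qf B a c + qf B b c := by
  simp [qf, add_mul, Finset.sum_add_distrib]
lemma qf_add_right (B : Mat n) (a b c : Fin n → ℝ) : qf B a (b + c) = qf B a b + qf B a c := by
  simp [qf, mul_add, Finset.sum_add_distrib]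
lemma qf_smul_l (B : Mat n) (k : ℝ) (a b : Fin n → ℝ) : qf B (k • a) b = k * qf B a b := by
  simp [qf, Finset.mul_sum, mul_assoc]
lemma qf_smul_r (B : Mat n) (k : ℝ) (a b : Fin n → ℝ) : qf B a (k • b) = k * qf B a b := by
  simp only [qf, Finset.mul_sum, Pi.smul_apply, smul_eq_mul]
  exact Finset.sum_congr rfl fun i _ => Finset.sum_congr rfl fun j _ => by ring

/-- rotated frame -/
def rv (q : Fin n → Fin n → ℝ) (i0 : Fin n) (Th : Fin n → ℝ) (a b : Fin n → ℝ) (i : Fin n) : Fin n → ℝ :=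
  q i + (a i • Th + b i • q i0)

lemma rv_ON {q : Fin n → Fin n → ℝ} (hq : ON q) {i0 : Fin n} {th : Fin n → ℝ} (h0 : th i0 = 0)
    {ka S t2 : ℝ} (ht : t2 = ∑ i, th i ^ 2) (hrel : 2 * ka + ka^2 * t2 + S^2 = 0) :
    ON (rv q i0 (∑ j, th j • q j) (fun i => th i * ka + (if i = i0 then 1 else 0) * S)
      (fun i => (if i = i0 then 1 else 0) * (ka * t2) - th i * S)) := by
  intro i j
  have hT : ∀ i, dot (q i) (∑ j, th j • q j) = th i := by
    intro i; rw [dot_sum_r]; simp [dot_smul_r, hq i]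
  have hT' : ∀ i, dot (∑ j, th j • q j) (q i) = th i := fun i => by rw [dot_comm, hT]
  have hTT : dot (∑ j, th j • q j) (∑ j, th j • q j) = t2 := by
    rw [dot_sum_r, ht]
    refine Finset.sum_congr rfl fun i _ => ?_
    rw [dot_smul_r, hT']; ring
  unfold rv
  simp only [dot_add_left, dot_add_right, dot_smul_l, dot_smul_r, hT, hT', hTT, hq i j, hq i i0, hq i0 j, hq i0 i0]
  have e : (if i0 = j then (1:ℝ) else 0) = if j = i0 then 1 else 0 := by simp only [eq_comm]
  rw [e, if_pos trivial, h0]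
  linear_combination (th i * th j + (if i = i0 then (1:ℝ) else 0) * (if j = i0 then (1:ℝ) else 0) * t2) * hrel

lemma qf_rv {B : Mat n} (hB : Symm B) (q : Fin n → Fin n → ℝ) (i0 : Fin n) (Th a b : Fin n → ℝ) (i : Fin n) :
    qf B (rv q i0 Th a b i) (rv q i0 Th a b i) = qf B (q i) (q i) + 2 * (a i * qf B (q i) Th) + 2 * (b i * qf B (q i) (q i0))
      + (a i * a i) * qf B Th Th + 2 * ((a i * b i) * qf B Th (q i0)) + (b i * b i) * qf B (q i0) (q i0) := by
  unfold rv
  simp only [qf_add_left, qf_add_right, qf_smul_l, qf_smul_r]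
  rw [qf_comm hB Th (q i), qf_comm hB (q i0) (q i), qf_comm hB (q i0) Th]; ring

variable {α : ℝ} {K : ℕ}

lemma rot_ineq {U : En n → ℝ} {p : En n} (hU : ContDiffAt ℝ 4 U p) {lam : Fin n → ℝ} {q : Fin n → Fin n → ℝ}
    (he : Eig (Hess U p) lam q) (hl : Cone α K lam) (i0 : Fin n)
    (hev : ∀ᶠ s : ℝ in 𝓝 0, ConeM α K (Hess U (p + s • sp (q i0))) ∧
      dd et U (p + s • sp (q i0)) = Gm α K (Hess U (p + s • sp (q i0))))
    (th : Fin n → ℝ) (h0 : th i0 = 0) :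
    ∑ i, (gvi α K lam i - gvi α K lam i0) * (4 * th i * dd (sp (q i)) (d2 (sp (q i0)) U) p - 2 * th i ^2 * (lam i0 - lam i))
      ≤ ∑ i, gvi α K lam i * d2 (sp (q i)) (d2 (sp (q i0)) U) p - dd et (d2 (sp (q i0)) U) p := by
  set e : En n := sp (q i0)
  set g := gvi α K lam
  set t2 := ∑ i, th i ^ 2 with ht2
  set Th : Fin n → ℝ := ∑ j, th j • q j with hTh
  have hU2 : ContDiffAt ℝ 2 U p := hU.of_le (by norm_num)
  have hd3 : ∀ v, ContDiffAt ℝ 3 (dd v U) p := fun v => dd_contDiffAt (n := 4) hU le_rfl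
  have hdd2 : ∀ v w, ContDiffAt ℝ 2 (dd v (dd w U)) p := fun v w => dd_contDiffAt (n := 3) (hd3 w) le_rfl
  -- scalar functions
  set Df : ℝ → ℝ := fun s => (1 + (t2 / 4) * (s * s))⁻¹ with hDf
  set Sf : ℝ → ℝ := fun s => s * Df s with hSf
  set kf : ℝ → ℝ := fun s => (-1/2) * (s * s * Df s) with hkf
  have jD : Jt Df 1 0 (-(t2/2)) := by
    have := ((Jt.const 1).add ((Jt.id.mul Jt.id).cmul (t2/4)))
    have h2 : Jt (fun s : ℝ => 1 + t2/4 * (s*s)) 1 0 (t2/2) := by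
      convert this using 1 <;> ring
    exact h2.inv
  have jS : Jt Sf 0 1 0 := by
    have := Jt.id.mul jD
    convert this using 1 <;> ring
  have jk : Jt kf 0 0 (-1) := by
    have := ((Jt.id.mul Jt.id).mul jD).cmul (-1/2)
    convert this using 1 <;> ring
  have hrel : ∀ s, 2 * kf s + (kf s)^2 * t2 + (Sf s)^2 = 0 := by
    intro s
    have hpos : 0 < 1 + t2/4 * (s*s) := by
      have : 0 ≤ t2 := Finset.sum_nonneg fun i _ => sq_nonneg _
      nlinarith [mul_self_nonneg s, mul_nonneg this (mul_self_nonneg s)]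
    simp only [hkf, hSf, hDf]
    field_simp
    ring
  set δ : Fin n → ℝ := fun i => if i = i0 then 1 else 0 with hδ
  set af : Fin n → ℝ → ℝ := fun i s => th i * kf s + δ i * Sf s
  set bf : Fin n → ℝ → ℝ := fun i s => δ i * (kf s * t2) - th i * Sf s
  have ja : ∀ i, Jt (af i) 0 (δ i) (-th i) := by
    intro i
    have := (jk.cmul (th i)).add (jS.cmul (δ i))
    convert this using 1 <;> ring
  have jb : ∀ i, Jt (bf i) 0 (-th i) (-(δ i * t2)) := by
    intro i
    have := ((jk.mul (Jt.const t2)).cmul (δ i)).sub (jS.cmul (th i))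
    convert this using 1 <;> ring
  set hf : (Fin n → ℝ) → (Fin n → ℝ) → ℝ → ℝ := fun v w s => dd (sp v) (dd (sp w) U) (p + s • e)
  have jh : ∀ v w, Jt (hf v w) (qf (Hess U p) v w) (dd e (dd (sp v) (dd (sp w) U)) p) (d2 e (dd (sp v) (dd (sp w) U)) p) := by
    intro v w; rw [qf_hess hU2]; exact Jt.line (hdd2 _ _)
  set Q : Fin n → ℝ → ℝ := fun i s => hf (q i) (q i) s + 2 * (af i s * hf (q i) Th s) + 2 * (bf i s * hf (q i) (q i0) s)
      + (af i s * af i s) * hf Th Th s + 2 * ((af i s * bf i s) * hf Th (q i0) s) + (bf i s * bf i s) * hf (q i0) (q i0) s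
  have jQ : ∀ i, Jt (Q i) _ _ _ := fun i =>
    (((((jh (q i) (q i)).add (((ja i).mul (jh (q i) Th)).cmul 2)).add (((jb i).mul (jh (q i) (q i0))).cmul 2)).add
      (((ja i).mul (ja i)).mul (jh Th Th))).add ((((ja i).mul (jb i)).mul (jh Th (q i0))).cmul 2)).add
      (((jb i).mul (jb i)).mul (jh (q i0) (q i0)))
  have jφ := (Jt.sum Finset.univ fun i => (jQ i).cmul (g i)).sub (Jt.line (v := e) (dd_contDiffAt (v := et) (m := 2) (n := 4) hU (by norm_num)))
  have hU4 : ∀ᶠ s : ℝ in 𝓝 0, ContDiffAt ℝ 2 U (p + s • e) := by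
    have := (line_cont (p := p) (v := e) 0).eventually (p := fun q => ContDiffAt ℝ 2 U q) (by
      beta_reduce; rw [zero_smul, add_zero]; exact hU2.eventually (by simp))
    exact this
  have hQ0 : ∀ i, Q i 0 = lam i := by
    intro i
    have := (jQ i).2.1
    rw [this, he.qf_self i i, if_pos rfl]; ring
  have hpde0 := hev.self_of_nhds
  rw [zero_smul, add_zero] at hpde0
  have hge := jφ.nonneg (by
    filter_upwards [hU4, hev] with s hs1 hs2
    have hON := rv_ON he.1 h0 (ka := kf s) (S := Sf s) ht2 (hrel s)
    have hk := key hs2.1 hl hON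
    have hq : ∀ i, qf (Hess U (p + s • e)) (rv q i0 Th (fun i => af i s) (fun i => bf i s) i)
        (rv q i0 Th (fun i => af i s) (fun i => bf i s) i) = Q i s := by
      intro i
      rw [qf_rv (hess_symm hs1)]
      simp only [qf_hess hs1]
      rfl
    have hq' : ∑ i, g i * (qf (Hess U (p + s • e)) (rv q i0 Th (fun i => af i s) (fun i => bf i s) i)
        (rv q i0 Th (fun i => af i s) (fun i => bf i s) i) - lam i) = ∑ i, g i * Q i s - ∑ i, g i * lam i := by
      rw [← Finset.sum_sub_distrib]
      exact Finset.sum_congr rfl fun i _ => by rw [hq i]; ring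
    have hk' : Gm α K (Hess U (p + s • e)) ≤ -1 / fv α K lam + (∑ i, g i * Q i s - ∑ i, g i * lam i) := by
      rw [← hq']; exact hk
    have h3 : dd et U p = -1 / fv α K lam := by
      rw [hpde0.2, Gm, he.fm_eq]
    simp only [hQ0, zero_smul, add_zero, h3]
    rw [hs2.2]; linarith)
  -- evaluate
  have w_eq : ∀ v, dd e (dd (sp v) (dd e U)) p = dd (sp v) (d2 e U) p := by
    intro v; exact dd_comm ((hd3 e).of_le (by norm_num))
  have wT : dd e (dd (sp (q i0)) (dd (sp Th) U)) p = ∑ i, th i * dd (sp (q i)) (d2 e U) p := by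
    have e1 : dd (sp (q i0)) (dd (sp Th) U) =ᶠ[𝓝 p] dd (sp Th) (dd e U) := dd_comm_ev hU2
    rw [dd_congr e1, w_eq]
    have : (sp Th : En n) = ∑ j, th j • sp (q j) := by
      rw [hTh]
      ext i <;> simp [sp, Prod.fst_sum, Prod.snd_sum, Finset.sum_apply]
    rw [this, dd_sum_dir]; simp only [dd_smul_dir]
  have hiT : ∀ i, qf (Hess U p) (q i) Th = th i * lam i := by
    intro i
    rw [he.qf_expand]
    have h1 : ∀ j, dot (q j) Th = th j := by
      intro j; rw [hTh, dot_sum_r]; simp [dot_smul_r, he.1 j]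
    simp [h1, he.1 _ i]; ring
  have hTT : qf (Hess U p) Th Th = ∑ i, th i ^ 2 * lam i := by
    rw [he.qf_expand]
    have h1 : ∀ j, dot (q j) Th = th j := by
      intro j; rw [hTh, dot_sum_r]; simp [dot_smul_r, he.1 j]
    simp only [h1]; exact Finset.sum_congr rfl fun i _ => by ring
  have hd2U : d2 e (dd et U) p = dd et (d2 e U) p := dd_d2 (hU.of_le (by norm_num))
  rw [hd2U] at hge
  have hfin : ∀ i, g i * (d2 (sp (q i)) (d2 e U) p - 2 * th i^2 * lam i - 4 * th i * dd (sp (q i)) (d2 e U) p + 2 * th i ^2 * lam i0)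
     + δ i * g i0 * (4 * ∑ i, th i * dd (sp (q i)) (d2 e U) p - 2 * t2 * lam i0 + 2 * ∑ i, th i ^ 2 * lam i)
     = g i * (d2 e (dd (sp (q i)) (dd (sp (q i)) U)) p + 2 * (-th i * qf (Hess U p) (q i) Th + 2 * (δ i * dd e (dd (sp (q i)) (dd (sp Th) U)) p) + 0 * d2 e (dd (sp (q i)) (dd (sp Th) U)) p)
      + 2 * (-(δ i * t2) * qf (Hess U p) (q i) (q i0) + 2 * (-th i * dd e (dd (sp (q i)) (dd (sp (q i0)) U)) p) + 0 * d2 e (dd (sp (q i)) (dd (sp (q i0)) U)) p)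
      + 2 * (δ i * δ i) * qf (Hess U p) Th Th - 4 * (δ i * th i) * qf (Hess U p) Th (q i0) + 2 * (th i * th i) * qf (Hess U p) (q i0) (q i0)) := by
    intro i
    have e2 : d2 e (dd (sp (q i)) (dd (sp (q i)) U)) p = d2 (sp (q i)) (d2 e U) p := d2_d2 hU _ _
    rw [e2, w_eq, hiT, hTT, he.qf_self i i0, he.qf_self i0 i0, if_pos rfl]
    by_cases hi : i = i0
    · subst hi
      rw [wT]; simp only [hδ, if_true, h0]; ring
    · simp only [hδ, if_neg hi]; ring
  have key2 : 0 ≤ ∑ i, (g i * (d2 (sp (q i)) (d2 e U) p - 2 * th i^2 * lam i - 4 * th i * dd (sp (q i)) (d2 e U) p + 2 * th i ^2 * lam i0)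
     + δ i * g i0 * (4 * ∑ i, th i * dd (sp (q i)) (d2 e U) p - 2 * t2 * lam i0 + 2 * ∑ i, th i ^ 2 * lam i)) - dd et (d2 e U) p := by
    refine hge.trans (le_of_eq ?_)
    congr 1
    refine Finset.sum_congr rfl fun i _ => ?_
    rw [hfin i]; ring
  rw [Finset.sum_add_distrib, ← Finset.sum_mul, ← Finset.sum_mul] at key2
  have hδs : ∑ i, δ i = 1 := by simp [hδ]
  rw [hδs] at key2
  have e3 : ∀ i, (g i - g i0) * (4 * th i * dd (sp (q i)) (d2 e U) p - 2 * th i ^2 * (lam i0 - lam i))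
     = g i * d2 (sp (q i)) (d2 e U) p - g i * (d2 (sp (q i)) (d2 e U) p - 2 * th i^2 * lam i - 4 * th i * dd (sp (q i)) (d2 e U) p + 2 * th i ^2 * lam i0)
      - (g i0 * 4) * (th i * dd (sp (q i)) (d2 e U) p) + (g i0 * 2 * lam i0) * th i^2 - (g i0 * 2) * (th i^2 * lam i) := by
    intro i; ring
  rw [Finset.sum_congr rfl fun i _ => e3 i]
  simp only [Finset.sum_add_distrib, Finset.sum_sub_distrib, ← Finset.mul_sum]
  rw [← ht2]
  linarith

lemma pog_second {U : En n → ℝ} {p : En n} (hU : ContDiffAt ℝ 4 U p) {lam : Fin n → ℝ} {q : Fin n → Fin n → ℝ}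
    (he : Eig (Hess U p) lam q) (hl : Cone α K lam) (i0 : Fin n)
    (hev : ∀ᶠ s : ℝ in 𝓝 0, ConeM α K (Hess U (p + s • sp (q i0))) ∧
      dd et U (p + s • sp (q i0)) = Gm α K (Hess U (p + s • sp (q i0))))
    {K0 : ℝ} (hK0 : ∀ i, -K0 ≤ lam i) (hmax : ∀ i, lam i ≤ lam i0) (hpos : 0 < lam i0 + K0) :
    (2 / (lam i0 + K0)) * ∑ i, (gvi α K lam i - gvi α K lam i0) * (dd (sp (q i)) (d2 (sp (q i0)) U) p)^2
      ≤ ∑ i, gvi α K lam i * d2 (sp (q i)) (d2 (sp (q i0)) U) p - dd et (d2 (sp (q i0)) U) p := by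
  have h := rot_ineq hU he hl i0 hev (fun i => if i = i0 then 0 else (1 / (lam i0 + K0)) * dd (sp (q i)) (d2 (sp (q i0)) U) p) (by simp)
  refine le_trans ?_ h
  rw [Finset.mul_sum]
  refine Finset.sum_le_sum fun i _ => ?_
  by_cases hi : i = i0
  · subst hi; simp
  · simp only [if_neg hi]
    have hg := gvi_anti hl (hmax i)
    set w := dd (sp (q i)) (d2 (sp (q i0)) U) p
    set c := 1 / (lam i0 + K0) with hc
    have hcp : 0 < c := by positivity
    have h2 : 2 / (lam i0 + K0) = 2 * c := by rw [hc]; ring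
    have h3 : c * (lam i0 - lam i) ≤ 1 := by
      rw [hc, div_mul_eq_mul_div, one_mul, div_le_one hpos]; linarith [hK0 i]
    rw [h2]
    have h4 : 2 * c * w^2 ≤ 4 * (c * w) * w - 2 * (c * w)^2 * (lam i0 - lam i) := by
      have := mul_le_mul_of_nonneg_left h3 (mul_nonneg hcp.le (sq_nonneg w))
      nlinarith
    have := mul_le_mul_of_nonneg_left h4 (sub_nonneg.2 hg)
    linarith
end Rot
end

section
section OneD
/-- second order Taylor upper bound -/
lemma tay1 {f f' : ℝ → ℝ} {S c : ℝ} (hf : ∀ s ∈ Set.Icc 0 S, HasDerivAt f (f' s) s)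
    (hb : ∀ s ∈ Set.Icc 0 S, f' s ≤ c) : ∀ s ∈ Set.Icc 0 S, f s ≤ f 0 + c * s := by
  intro s hs
  refine image_le_of_deriv_right_le_deriv_boundary (f' := f') (B := fun s => f 0 + c * s) (B' := fun _ => c) (a := 0) (b := S)
    (fun x hx => (hf x hx).continuousAt.continuousWithinAt)
    (fun x hx => (hf x (Set.Ico_subset_Icc_self hx)).hasDerivWithinAt) (by simp) (by fun_prop) ?_
    (fun x hx => hb x (Set.Ico_subset_Icc_self hx)) hs
  intro x hx
  have : HasDerivAt (fun s => f 0 + c * s) c x := by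
    simpa using ((hasDerivAt_id x).const_mul c).const_add (f 0)
  exact this.hasDerivWithinAt

lemma tay2 {f f' f'' : ℝ → ℝ} {S c : ℝ} (hf : ∀ s ∈ Set.Icc 0 S, HasDerivAt f (f' s) s)
    (hf' : ∀ s ∈ Set.Icc 0 S, HasDerivAt f' (f'' s) s)
    (hb : ∀ s ∈ Set.Icc 0 S, f'' s ≤ c) : ∀ s ∈ Set.Icc 0 S, f s ≤ f 0 + f' 0 * s + c * s^2 / 2 := by
  intro s hs
  refine image_le_of_deriv_right_le_deriv_boundary (f' := f') (B := fun s => f 0 + f' 0 * s + c * s^2 / 2) (B' := fun s => f' 0 + c * s) (a := 0) (b := S)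
    (fun x hx => (hf x hx).continuousAt.continuousWithinAt)
    (fun x hx => (hf x (Set.Ico_subset_Icc_self hx)).hasDerivWithinAt) (by simp) (by fun_prop) ?_
    (fun x hx => tay1 hf' hb x (Set.Ico_subset_Icc_self hx)) hs
  intro x hx
  have : HasDerivAt (fun s => f 0 + f' 0 * s + c * s^2 / 2) (f' 0 + c * x) x := by
    have := ((((hasDerivAt_id x).const_mul (f' 0)).const_add (f 0)).add ((((hasDerivAt_id x).pow 2).const_mul c).div_const 2))
    refine this.congr_deriv ?_
    simp; ring
  exact this.hasDerivWithinAt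

lemma walk {f f' f'' : ℝ → ℝ} {G La : ℝ} (hL : 0 < La) (hG : 0 < G)
    (hf : ∀ s, HasDerivAt f (f' s) s)
    (hf' : ∀ s, HasDerivAt f' (f'' s) s) (h0 : f' 0 = -G)
    (hb : ∀ s ∈ Set.Icc 0 (1/La), f s ≤ f 0 → f'' s ≤ La * G) : f (1/La) ≤ f 0 - G / (2 * La) := by
  have hLi : 0 < 1 / La := by positivity
  by_cases hall : ∀ s ∈ Set.Icc 0 (1/La), f s ≤ f 0
  · have := tay2 (fun s _ => hf s) (fun s _ => hf' s) (fun s hs => hb s hs (hall s hs)) (1/La) ⟨hLi.le, le_rfl⟩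
    rw [h0] at this
    refine this.trans (le_of_eq ?_)
    field_simp; ring
  · exfalso
    push Not at hall
    obtain ⟨s1, hs1, hs1f⟩ := hall
    have hev : ∀ᶠ s in 𝓝[>] (0:ℝ), f s < f 0 := by
      have h1 := (hf 0).hasDerivWithinAt (s := Set.Ioi 0)
      have h2 := (hasDerivWithinAt_iff_tendsto_slope' (by simp)).1 h1
      have h3 := h2.eventually_lt_const (u := 0) (by rw [h0]; linarith)
      filter_upwards [h3, self_mem_nhdsWithin] with s hs hs'
      rw [slope_def_field, div_neg_iff] at hs
      have : (0:ℝ) < s := hs'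
      rcases hs with h | h <;> linarith
    obtain ⟨s0, hs0, hs0'⟩ := (mem_nhdsGT_iff_exists_Ioc_subset.1 hev)
    have hs0 : 0 < s0 := hs0
    set A := Set.Icc s0 s1 ∩ f ⁻¹' (Set.Ici (f 0)) with hA
    have hc : Continuous f := continuous_iff_continuousAt.2 fun s => (hf s).continuousAt
    have hAc : IsCompact A := isCompact_Icc.inter_right (isClosed_Ici.preimage hc)
    have hs01 : s0 < s1 := by
      by_contra hh
      have hs1p : 0 < s1 := by
        rcases hs1.1.lt_or_eq with h | h
        · exact h
        · rw [← h] at hs1f; exact absurd hs1f (lt_irrefl _)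
      have : f s1 < f 0 := hs0' ⟨hs1p, not_lt.1 hh⟩
      linarith
    obtain ⟨s, ⟨hs, hsf⟩, hmin⟩ := hAc.exists_isMinOn ⟨s1, ⟨⟨hs01.le, le_rfl⟩, hs1f.le⟩⟩ continuousOn_id
    have hle : ∀ x ∈ Set.Icc 0 s, f x ≤ f 0 := by
      intro x hx
      by_contra hh
      push Not at hh
      have hxs : s0 < x := by
        by_contra h3
        rcases hx.1.lt_or_eq with h | h
        · have : f x < f 0 := hs0' ⟨h, not_lt.1 h3⟩
          linarith
        · rw [← h] at hh; exact lt_irrefl _ hh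
      have hxA : x ∈ A := ⟨⟨hxs.le, hx.2.trans hs.2⟩, hh.le⟩
      have h4 : s ≤ x := hmin hxA
      have h5 : x = s := le_antisymm hx.2 h4
      have h6 : f 0 < f s := h5 ▸ hh
      -- continuity gives a smaller point
      have h7 : ∀ᶠ y in 𝓝 s, f 0 < f y := hc.continuousAt.eventually_const_lt h6
      have h8 : ∀ᶠ y in 𝓝 s, s0 < y := lt_mem_nhds (h5 ▸ hxs)
      have h9 : ∀ᶠ y in 𝓝[<] s, s ≤ y := by
        filter_upwards [mem_nhdsWithin_of_mem_nhds h7, mem_nhdsWithin_of_mem_nhds h8, self_mem_nhdsWithin] with y h1 h2 h3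
        exact hmin (show y ∈ A from ⟨⟨h2.le, (le_of_lt h3).trans hs.2⟩, h1.le⟩)
      obtain ⟨y, hy1, hy2⟩ := (h9.and self_mem_nhdsWithin).exists
      exact absurd hy1 (not_le.2 hy2)
    have hs0s : 0 < s := hs0.trans_le hs.1
    have := tay2 (S := s) (fun s _ => hf s) (fun s _ => hf' s)
      (fun x hx => hb x ⟨hx.1, hx.2.trans (hs.2.trans hs1.2)⟩ (hle x hx)) s ⟨hs0s.le, le_rfl⟩
    have h1 : f 0 ≤ f s := hsf
    rw [h0] at this
    have h2 : La * s ≤ 1 := by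
      have := hs.2.trans hs1.2
      rw [le_div_iff₀ hL] at this; linarith
    nlinarith [mul_pos hG hs0s]
end OneD

section Nsq
variable {n : ℕ}

lemma dd_of_line {E : Type*} [NormedAddCommGroup E] [NormedSpace ℝ E] {f : E → ℝ} {p v : E} {c : ℝ}
    (hf : DifferentiableAt ℝ f p) (h : HasDerivAt (fun s : ℝ => f (p + s • v)) c 0) : dd v f p = c := by
  have h1 := line_hasDeriv (f := f) (p := p) (v := v) (s := 0) (by simpa using hf)
  have := h1.unique h
  simpa using this

/-- squared distance to `x1` -/
def nsq (x1 : Fin n → ℝ) (p : En n) : ℝ := dot (p.1 - x1) (p.1 - x1)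

lemma nsq_contDiff (x1 : Fin n → ℝ) {m : WithTop ℕ∞} : ContDiff ℝ m (nsq x1) := by
  unfold nsq dot
  refine ContDiff.sum fun i _ => ?_
  have : ContDiff ℝ m (fun p : En n => (p.1 - x1) i) := by
    simp only [Pi.sub_apply]
    exact (((contDiff_apply ℝ ℝ i).comp contDiff_fst)).sub contDiff_const
  exact this.mul this

lemma dd_nsq (x1 v : Fin n → ℝ) (p : En n) : dd (sp v) (nsq x1) p = 2 * dot v (p.1 - x1) := by
  refine dd_of_line ((nsq_contDiff x1 (m := 1)).differentiable (by simp)).differentiableAt ?_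
  have e : (fun s : ℝ => nsq x1 (p + s • sp v)) = fun s => nsq x1 p + s * (2 * dot v (p.1 - x1)) + s^2 * dot v v := by
    funext s
    simp only [nsq, dot, sp, Finset.mul_sum, ← Finset.sum_add_distrib]
    refine Finset.sum_congr rfl fun i _ => ?_
    simp; ring
  rw [e]
  have := (((hasDerivAt_id (0:ℝ)).mul_const (2 * dot v (p.1 - x1))).const_add (nsq x1 p)).add (((hasDerivAt_id (0:ℝ)).pow 2).mul_const (dot v v))
  refine this.congr_deriv ?_
  simp
lemma dd_et_nsq (x1 : Fin n → ℝ) (p : En n) : dd et (nsq x1) p = 0 := by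
  refine dd_of_line ((nsq_contDiff x1 (m := 1)).differentiable (by simp)).differentiableAt ?_
  have e : (fun s : ℝ => nsq x1 (p + s • et)) = fun s => nsq x1 p := by
    funext s; simp [nsq, et]
  rw [e]; exact hasDerivAt_const _ _
lemma d2_nsq (x1 v : Fin n → ℝ) (p : En n) : d2 (sp v) (nsq x1) p = 2 * dot v v := by
  unfold d2
  have e : dd (sp v) (nsq x1) = fun p : En n => 2 * dot v (p.1 - x1) := funext fun p => dd_nsq x1 v p
  rw [e]
  refine dd_of_line ?_ ?_
  · unfold dot; simp only [Pi.sub_apply]; fun_prop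
  · have e : (fun s : ℝ => 2 * dot v ((p + s • sp v).1 - x1)) = fun s => 2 * dot v (p.1 - x1) + s * (2 * dot v v) := by
      funext s
      simp only [dot, sp, Finset.mul_sum, ← Finset.sum_add_distrib]
      refine Finset.sum_congr rfl fun i _ => ?_
      simp; ring
    rw [e]
    have := (((hasDerivAt_id (0:ℝ)).mul_const (2 * dot v v)).const_add (2 * dot v (p.1 - x1)))
    refine this.congr_deriv ?_
    simp
lemma Lop_nsq (r : Fin n → Fin n → ℝ) (x1 : Fin n → ℝ) (p : En n) : Lop r (nsq x1) p = 2 * ∑ k, dot (r k) (r k) := by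
  unfold Lop; rw [dd_et_nsq]; simp only [d2_nsq, Finset.mul_sum, sub_zero]
end Nsq
end

section
section Pog
variable {n : ℕ} {α : ℝ} {K : ℕ}

lemma Lop_log (r : Fin n → Fin n → ℝ) {f : En n → ℝ} {p : En n} (hf : ContDiffAt ℝ 2 f p) (h0 : 0 < f p) :
    ContDiffAt ℝ 2 (fun q => Real.log (f q)) p ∧
    (∀ v, dd v (fun q => Real.log (f q)) p = dd v f p / f p) ∧
    Lop r (fun q => Real.log (f q)) p = Lop r f p / f p - Gam2 r f f p / (f p)^2 := by
  have hl : ContDiffAt ℝ 2 Real.log (f p) := Real.contDiffAt_log.2 h0.ne'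
  refine ⟨hl.comp p hf, fun v => ?_, ?_⟩
  · rw [dd_comp (C2.d hl) (C2.d hf), Real.deriv_log]; field_simp
  · rw [Lop_comp r hl hf, Real.deriv_log', deriv_inv]; field_simp; ring

def rowsq (g : Fin n → ℝ) (q : Fin n → Fin n → ℝ) : Fin n → Fin n → ℝ := fun k => Real.sqrt (g k) • q k

lemma Lop_rows {g : Fin n → ℝ} (hg : ∀ i, 0 ≤ g i) (q : Fin n → Fin n → ℝ) {f : En n → ℝ} {p : En n} (hf : ContDiffAt ℝ 2 f p) :
    Lop (rowsq g q) f p = ∑ k, g k * d2 (sp (q k)) f p - dd et f p := by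
  unfold Lop rowsq
  simp only [sp_smul, d2_smul_dir hf, Real.sq_sqrt (hg _)]
lemma Gam_rows {g : Fin n → ℝ} (hg : ∀ i, 0 ≤ g i) (q : Fin n → Fin n → ℝ) {f : En n → ℝ} {p : En n} :
    Gam2 (rowsq g q) f f p = ∑ k, g k * (dd (sp (q k)) f p)^2 := by
  unfold Gam2 rowsq
  refine Finset.sum_congr rfl fun k _ => ?_
  rw [sp_smul, dd_smul_dir]
  have := Real.mul_self_sqrt (hg k)
  linear_combination (dd (sp (q k)) f p)^2 * this

lemma ON.sumsq {q : Fin n → Fin n → ℝ} (h : ON q) (v : Fin n → ℝ) : ∑ i, (dot (q i) v)^2 = dot v v := by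
  rw [← h.parseval v v]; exact Finset.sum_congr rfl fun i _ => by ring

lemma pog_alg {be A X C1 : ℝ} (hbe : 4 * C1 + 2 ≤ be) (hbe2 : 2 < be) (hX : X^2 ≤ C1) :
    -(1/4) ≤ 1/2 * (be * A - X)^2 - be * A^2 := by
  have hb : 0 < be - 2 := by linarith
  have h1 : (be - 2) * (1/2 * (be * A - X)^2 - be * A^2) + X^2 = be / 2 * ((be-2) * A - X)^2 := by ring
  have h2 : 0 ≤ be / 2 * ((be-2) * A - X)^2 := mul_nonneg (by linarith) (sq_nonneg _)
  rw [← h1] at h2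
  by_contra hc
  push Not at hc
  have := mul_lt_mul_of_pos_left hc hb
  linarith

set_option maxHeartbeats 800000 in
lemma pog_point {U : En n → ℝ} {p : En n} (hU : ContDiffAt ℝ 4 U p) {lam : Fin n → ℝ} {q : Fin n → Fin n → ℝ}
    (he : Eig (Hess U p) lam q) (hl : Cone α K lam) (hα : 0 < α) (i0 : Fin n)
    (hev : ∀ᶠ s : ℝ in 𝓝 0, ConeM α K (Hess U (p + s • sp (q i0))) ∧
      dd et U (p + s • sp (q i0)) = Gm α K (Hess U (p + s • sp (q i0))))
    {K0 : ℝ} (hK0' : 0 ≤ K0) (hK0 : ∀ i, -K0 ≤ lam i) (hmax : ∀ i, lam i ≤ lam i0) (hpos : 0 < lam i0) (h3 : 3 * K0 ≤ lam i0)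
    (hd : 0 < 1 - U p) {be C1 m2 : ℝ} (hm2 : -dd et U p ≤ m2) (hx : dot p.1 p.1 ≤ C1) (hbe : 4 * C1 + 2 ≤ be) (hbe2 : 2 < be)
    (hh : ∀ᶠ x in 𝓝 p, x.2 ≤ p.2 → be * Real.log (1 - U x) + Real.log (d2 (sp (q i0)) U x) + 1/2 * nsq 0 x
       ≤ be * Real.log (1 - U p) + Real.log (d2 (sp (q i0)) U p) + 1/2 * nsq 0 p) :
    (3/4) * ∑ i, gvi α K lam i ≤ (3/2) * gvi α K lam i0 * (2 * be^2 * (dot (grd U p) (grd U p)) / (1 - U p)^2 + 2 * C1)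
      + be * (K + 3) * m2 / (1 - U p) := by
  have hC1 : 0 ≤ C1 := (dot_self_nonneg _).trans hx
  have hU2 : ContDiffAt ℝ 2 U p := hU.of_le (by norm_num)
  set g := gvi α K lam with hg
  have hgp : ∀ i, 0 ≤ g i := fun i => (hl.gvi_pos i).le
  set w := d2 (sp (q i0)) U with hw
  have hwp : w p = lam i0 := by rw [hw, ← qf_hess' hU2, he.qf_self, if_pos rfl]
  have hw2 : ContDiffAt ℝ 2 w p := dd_contDiffAt (n := 3) (dd_contDiffAt (n := 4) hU le_rfl) le_rfl
  have hd2 : ContDiffAt ℝ 2 (fun x => 1 - U x) p := contDiffAt_const.sub hU2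
  set r := rowsq g q
  obtain ⟨a1, a2, a3⟩ := Lop_log r hd2 hd
  obtain ⟨b1, b2, b3⟩ := Lop_log r hw2 (by rw [hwp]; exact hpos)
  have a1' : ContDiffAt ℝ 2 (fun x => be * Real.log (1 - U x)) p := contDiffAt_const.mul a1
  have n1 : ContDiffAt ℝ 2 (fun x : En n => 1/2 * nsq 0 x) p := contDiffAt_const.mul (nsq_contDiff 0).contDiffAt
  obtain ⟨m1, _, _, m4⟩ := Lop_max r (f := fun x => be * Real.log (1 - U x) + Real.log (w x) + 1/2 * nsq 0 x) ((a1'.add b1).add n1) hh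
  have hdU : ∀ v, dd v (fun x => 1 - U x) p = - dd v U p := by
    intro v; rw [dd_sub (by fun_prop) (C2.d hU2), dd_const]; ring
  have hLU : Lop r (fun x => 1 - U x) p = - Lop r U p := by
    rw [Lop_sub r contDiffAt_const hU2, Lop_const]; ring
  set d := 1 - U p with hdd
  -- first order
  have f1 : ∀ i, dd (sp (q i)) w p / lam i0 = be * (dd (sp (q i)) U p / d) - dot (q i) p.1 := by
    intro i
    have := m1 (q i)
    rw [dd_add (f := fun x => be * Real.log (1 - U x) + Real.log (w x)) ((C2.d a1').add (C2.d b1)) (C2.d n1), dd_add (C2.d a1') (C2.d b1), dd_cmul _ (C2.d a1), a2, b2, hdU,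
      dd_cmul _ ((nsq_contDiff 0 (m := 1)).differentiable (by simp)).differentiableAt, dd_nsq, hwp] at this
    simp only [sub_zero] at this
    rw [neg_div] at this
    linarith
  rw [Lop_add (f := fun x => be * Real.log (1 - U x) + Real.log (w x)) r (a1'.add b1) n1, Lop_add r a1' b1, Lop_cmul r _ a1, a3, b3, hLU, Lop_cmul r _ (nsq_contDiff 0).contDiffAt,
    Lop_nsq, hwp] at m4
  have hT : ∑ k, dot (r k) (r k) = ∑ i, g i := by
    refine Finset.sum_congr rfl fun k _ => ?_
    show dot (Real.sqrt (g k) • q k) (Real.sqrt (g k) • q k) = g k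
    rw [dot_smul_l, dot_smul_r, he.1 k k, if_pos rfl]
    have := Real.mul_self_sqrt (hgp k); linarith
  rw [hT, Gam_rows hgp, Gam_rows hgp, Lop_rows hgp q hw2, Lop_rows hgp q hU2] at m4
  simp only [hdU, neg_sq] at m4
  have hsec := pog_second hU he hl i0 hev hK0 hmax (by linarith)
  rw [← hw, ← hg] at hsec
  -- L U bound
  have hLUb : ∑ k, g k * d2 (sp (q k)) U p - dd et U p ≤ (K+3) * m2 := by
    have e1 : ∀ k, d2 (sp (q k)) U p = lam k := fun k => by rw [← qf_hess' hU2, he.qf_self, if_pos rfl]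
    simp only [e1]
    have h1 := gvi_euler hl hα
    have h0 := hev.self_of_nhds
    simp only [zero_smul, add_zero] at h0
    have h2 : dd et U p = -1 / fv α K lam := by rw [h0.2, Gm, he.fm_eq]
    have h4 : -dd et U p = 1 / fv α K lam := by rw [h2]; ring
    have h5 : ((K:ℝ)+2) / fv α K lam = (K+2) * (-dd et U p) := by rw [h4]; ring
    rw [h5] at h1
    have hK : (0:ℝ) ≤ K := Nat.cast_nonneg K
    nlinarith
  set W : Fin n → ℝ := fun i => dd (sp (q i)) w p with hW
  set A : Fin n → ℝ := fun i => dd (sp (q i)) U p / d with hA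
  set X : Fin n → ℝ := fun i => dot (q i) p.1 with hX
  set T := ∑ i, g i with hTdef
  set S := ∑ k, g k * d2 (sp (q k)) w p - dd et w p with hS
  set LU := ∑ k, g k * d2 (sp (q k)) U p - dd et U p with hLUd
  have eW : ∀ i, W i = lam i0 * (be * A i - X i) := by
    intro i; have := f1 i; field_simp at this ⊢; simp only [hA, hX, hW]; field_simp; linarith
  have hsec2 : (3/2) * ∑ i, (g i - g i0) * (be * A i - X i)^2 ≤ S / lam i0 := by
    rw [le_div_iff₀ hpos]
    refine le_trans ?_ hsec
    rw [Finset.mul_sum, Finset.sum_mul, Finset.mul_sum]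
    refine Finset.sum_le_sum fun i _ => ?_
    have hgi : 0 ≤ g i - g i0 := sub_nonneg.2 (gvi_anti hl (hmax i))
    have : dd (sp (q i)) w p = lam i0 * (be * A i - X i) := eW i
    rw [this]
    have h5 : 3/2 * lam i0 ≤ 2 / (lam i0 + K0) * lam i0^2 := by
      rw [div_mul_eq_mul_div (2:ℝ) (lam i0 + K0), le_div_iff₀ (by linarith)]; nlinarith
    calc _ = (g i - g i0) * (be * A i - X i)^2 * (3/2 * lam i0) := by ring
      _ ≤ (g i - g i0) * (be * A i - X i)^2 * (2 / (lam i0 + K0) * lam i0^2) := by gcongr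
      _ = _ := by ring
  have e6 : (∑ k, g k * dd (sp (q k)) w p ^2) / lam i0 ^2 = ∑ i, g i * (be * A i - X i)^2 := by
    rw [Finset.sum_div]; refine Finset.sum_congr rfl fun i _ => ?_
    have : dd (sp (q i)) w p = lam i0 * (be * A i - X i) := eW i
    rw [this]; field_simp
  have e7 : (∑ k, g k * dd (sp (q k)) U p ^2) / d ^2 = ∑ i, g i * (A i)^2 := by
    rw [Finset.sum_div]; refine Finset.sum_congr rfl fun i _ => ?_
    simp only [hA]; field_simp
  rw [e6, e7] at m4
  -- pointwise
  have hpt : -(1/4) * T ≤ ∑ i, (1/2 * (g i * (be * A i - X i)^2) - be * (g i * A i ^2)) := by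
    have hXs : ∀ i, X i ^2 ≤ C1 := by
      intro i
      have := he.1.sumsq p.1
      have h2 : X i^2 ≤ ∑ i, (dot (q i) p.1)^2 := Finset.single_le_sum (f := fun i => (dot (q i) p.1)^2) (fun i _ => sq_nonneg _) (Finset.mem_univ i)
      linarith
    rw [hTdef, Finset.mul_sum]
    refine Finset.sum_le_sum fun i _ => ?_
    have hb : 0 < be - 2 := by linarith
    have : -(1/4) ≤ 1/2 * (be * A i - X i)^2 - be * A i^2 := by
      exact pog_alg hbe hbe2 (hXs i)
    have := mul_le_mul_of_nonneg_left this (hgp i)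
    linarith
  rw [Finset.sum_sub_distrib, ← Finset.mul_sum, ← Finset.mul_sum] at hpt
  have e8 : ∑ i, (g i - g i0) * (be * A i - X i)^2 = ∑ i, g i * (be * A i - X i)^2 - g i0 * ∑ i, (be * A i - X i)^2 := by
    rw [Finset.mul_sum, ← Finset.sum_sub_distrib]; exact Finset.sum_congr rfl fun i _ => by ring
  rw [e8] at hsec2
  have hy : ∑ i, (be * A i - X i)^2 ≤ 2 * be^2 * (dot (grd U p) (grd U p)) / d^2 + 2 * C1 := by
    have h1 : ∑ i, (be * A i - X i)^2 ≤ ∑ i, (2 * be^2 / d^2 * (dot (q i) (grd U p))^2 + 2 * (dot (q i) p.1)^2) := by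
      refine Finset.sum_le_sum fun i _ => ?_
      have : A i = dot (q i) (grd U p) / d := by simp only [hA, dd_sp']
      rw [this]
      have e : 2 * be^2 / d^2 * (dot (q i) (grd U p))^2 = 2 * (be * (dot (q i) (grd U p) / d))^2 := by field_simp
      rw [e]; simp only [hX]
      nlinarith [sq_nonneg (be * (dot (q i) (grd U p) / d) + dot (q i) p.1)]
    rw [Finset.sum_add_distrib, ← Finset.mul_sum, ← Finset.mul_sum, he.1.sumsq, he.1.sumsq] at h1
    refine h1.trans ?_
    have : 2 * be^2 / d^2 * dot (grd U p) (grd U p) = 2 * be^2 * (dot (grd U p) (grd U p)) / d^2 := by ring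
    rw [this]; linarith
  have h9 : be * LU / d ≤ be * (K+3) * m2 / d := by
    have : be * LU ≤ be * (K+3) * m2 := by nlinarith
    gcongr
  have h10 := mul_le_mul_of_nonneg_left hy (hgp i0)
  have e11 : be * (-LU / d - ∑ i, g i * A i^2) = - (be * LU / d) - be * ∑ i, g i * A i^2 := by ring
  rw [e11] at m4
  linarith
end Pog
end

section
lemma pog_alg2 {T g1 la d m2 be C1 E G2 B Q : ℝ} (hT : 0 ≤ T) (hg : 0 ≤ g1) (hla : 1 ≤ la) (hd : 0 < d) (hd2 : d ≤ 2)
    (hC1 : 0 ≤ C1) (hE : 0 ≤ E) (hB : 0 ≤ B) (hQ : 0 ≤ Q) (hm2 : 0 ≤ m2)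
    (h1 : (3/4) * T ≤ (3/2) * g1 * (2 * be^2 * G2 / d^2 + 2 * C1) + Q / d)
    (h2 : la * g1 ≤ 2 * m2 + B * (T / la)) (hG : G2 ≤ 4 * (la * E)) :
    la * d^2 ≤ 2 * B * (16 * be^2 * E + 16 * C1) ∨ T ≤ (2 * (2 * m2 * (16 * be^2 * E + 16 * C1) + 4 * Q)) / d^2 := by
  set P := 16 * be^2 * E + 16 * C1 with hP
  have hPn : 0 ≤ P := by positivity
  by_cases hc : la * d^2 ≤ 2 * B * P
  · exact Or.inl hc
  right
  push Not at hc
  rw [le_div_iff₀ (by positivity)]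
  have hd22 : 0 < d^2 := by positivity
  have h3 : (3/4) * (T * d^2) ≤ (3/2) * g1 * (2 * be^2 * G2 + 2 * C1 * d^2) + Q * d := by
    have := mul_le_mul_of_nonneg_right h1 hd22.le
    have e : ((3/2) * g1 * (2 * be^2 * G2 / d^2 + 2 * C1) + Q / d) * d^2 = (3/2) * g1 * (2 * be^2 * G2 + 2 * C1 * d^2) + Q * d := by
      field_simp
    rw [e] at this; linarith
  have hb2 : 0 ≤ be^2 := sq_nonneg _
  have h4 : 2 * be^2 * G2 + 2 * C1 * d^2 ≤ la * (P / 2) := by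
    have a1 : be^2 * G2 ≤ be^2 * (4 * (la * E)) := mul_le_mul_of_nonneg_left hG hb2
    have a2 : d^2 ≤ 4 := by nlinarith
    have a3 : C1 * d^2 ≤ C1 * 4 := mul_le_mul_of_nonneg_left a2 hC1
    have a4 : C1 * 1 ≤ C1 * la := mul_le_mul_of_nonneg_left hla hC1
    rw [hP]; nlinarith
  have h5 : (3/2) * g1 * (2 * be^2 * G2 + 2 * C1 * d^2) ≤ (3/4) * P * (2 * m2 + B * (T / la)) := by
    calc _ ≤ (3/2) * g1 * (la * (P/2)) := by gcongr
      _ = (3/4) * P * (la * g1) := by ring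
      _ ≤ _ := by gcongr
  have h6 : P * (B * (T / la)) ≤ T * d^2 / 2 := by
    have : P * (B * (T / la)) = (2 * B * P) * T / (2 * la) := by field_simp
    rw [this, div_le_div_iff₀ (by positivity) (by norm_num)]
    nlinarith [mul_le_mul_of_nonneg_right hc.le hT]
  have h7 : Q * d ≤ Q * 2 := mul_le_mul_of_nonneg_left hd2 hQ
  nlinarith

section Pog3
variable {n : ℕ} {α : ℝ} {K : ℕ}

lemma pog_concl (hα : 0 < α) (hKn : K + 2 ≤ n) {lam : Fin n → ℝ} (hl : Cone α K lam) {i0 : Fin n} {K0 m1 m2 d C1 E G2 be : ℝ}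
    (hK0' : 0 ≤ K0) (hK0 : ∀ i, -K0 ≤ lam i) (hla : 1 ≤ lam i0) (hla2 : 2 * ((n + 2)^(K+2)) * K0 ≤ lam i0)
    (hm1 : 0 < m1) (hf1 : m1 ≤ 1 / fv α K lam) (hf2 : 1 / fv α K lam ≤ m2) (hd : 0 < d) (hd2 : d ≤ 2) (hC1 : 0 ≤ C1) (hE : 0 ≤ E)
    (hbe : 0 ≤ be)
    (h1 : (3/4) * ∑ i, gvi α K lam i ≤ (3/2) * gvi α K lam i0 * (2 * be^2 * G2 / d^2 + 2 * C1) + be * (K + 3) * m2 / d)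
    (hG : G2 ≤ 4 * (lam i0 * E)) :
    lam i0 * d^(2*(K+1)) ≤ 2 * (2 * (n+2)^(K+2) * K0^2) * (16 * be^2 * E + 16 * C1) * 4^K +
      (2 * (2 * m2 * (16 * be^2 * E + 16 * C1) + 4 * (be * (K+3) * m2)))^(K+1) / m1^(K+2) := by
  have hfv := hl.fv_pos
  have hm2 : 0 < m2 := hm1.trans_le (hf1.trans hf2)
  set T := ∑ i, gvi α K lam i with hT
  have hTf : ∑ i, fvi α K lam i = T * fv α K lam^2 := by
    rw [hT, Finset.sum_mul]; refine Finset.sum_congr rfl fun i _ => ?_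
    unfold gvi; field_simp
  have hTp : 0 ≤ T := Finset.sum_nonneg fun i _ => (hl.gvi_pos i).le
  have h2 : lam i0 * gvi α K lam i0 ≤ 2 * m2 + (2 * (n+2)^(K+2) * K0^2) * (T / lam i0) := by
    have := top_bound' hl hα hK0' hK0 i0 (by linarith) hla2
    rw [hTf] at this
    have h3 : lam i0 * gvi α K lam i0 ≤ 2 * (1 / fv α K lam) + (2 * (n+2)^(K+2) * K0^2) * (T / lam i0) := by
      have e : lam i0 * gvi α K lam i0 = (lam i0 * fvi α K lam i0) / fv α K lam^2 := by unfold gvi; ring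
      rw [e, div_le_iff₀ (by positivity)]
      refine this.trans (le_of_eq ?_)
      field_simp
    linarith
  have hQ : 0 ≤ be * (K+3) * m2 := by positivity
  have hB : (0:ℝ) ≤ 2 * (n+2)^(K+2) * K0^2 := by positivity
  have hlp : 0 < lam i0 := by linarith
  have hP : 0 ≤ 16 * be^2 * E + 16 * C1 := by positivity
  rcases pog_alg2 hTp (hl.gvi_pos i0).le hla hd hd2 hC1 hE hB hQ hm2.le h1 h2 hG with h | h
  · have hdd : d^2 ≤ 4 := by nlinarith
    have : lam i0 * d^(2*(K+1)) = lam i0 * d^2 * (d^2)^K := by rw [← pow_mul]; ring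
    rw [this]
    have h5 : lam i0 * d^2 * (d^2)^K ≤ 2 * (2 * (n+2)^(K+2) * K0^2) * (16 * be^2 * E + 16 * C1) * 4^K := by gcongr
    have : 0 ≤ (2 * (2 * m2 * (16 * be^2 * E + 16 * C1) + 4 * (be * (K+3) * m2)))^(K+1) / m1^(K+2) := by positivity
    linarith
  · have h3 := T_lower hl hα hKn i0
    rw [hTf] at h3
    set N := 2 * (2 * m2 * (16 * be^2 * E + 16 * C1) + 4 * (be * (K+3) * m2)) with hN
    have hNp : 0 ≤ N := by positivity
    have h4 : lam i0 ≤ T^(K+1) * fv α K lam^(K+2) := by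
      have e : (T * fv α K lam^2)^(K+1) = (T^(K+1) * fv α K lam^(K+2)) * fv α K lam^K := by rw [mul_pow, ← pow_mul]; ring
      rw [e] at h3
      exact le_of_mul_le_mul_right h3 (by positivity)
    have h5 : fv α K lam ≤ 1 / m1 := by
      rw [le_div_iff₀ hm1]; rw [le_div_iff₀ hfv] at hf1; linarith
    have h6 : lam i0 ≤ (N / d^2)^(K+1) * (1/m1)^(K+2) := h4.trans (by gcongr)
    have h7 : lam i0 * d^(2*(K+1)) ≤ N^(K+1) / m1^(K+2) := by
      have e : N^(K+1) / m1^(K+2) = ((N / d^2)^(K+1) * (1/m1)^(K+2)) * d^(2*(K+1)) := by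
        rw [pow_mul d 2 (K+1), div_pow, div_pow, one_pow]; field_simp
      rw [e]; gcongr
    have : 0 ≤ 2 * (2 * (n+2)^(K+2) * K0^2) * (16 * be^2 * E + 16 * C1) * 4^K := by positivity
    linarith
end Pog3
end

section
section Pog4
variable {n : ℕ} {α : ℝ} {K : ℕ}

lemma hess_cont {U : En n → ℝ} {p : En n} (hU : ContDiffAt ℝ 4 U p) (i j : Fin n) : ContinuousAt (fun x => Hess U x i j) p :=
  (dd_contDiffAt (n := 3) (m := 2) (v := sp (bs i)) (dd_contDiffAt (n := 4) (m := 3) (v := sp (bs j)) hU le_rfl) le_rfl).continuousAt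

lemma exists_max_fin (hn : 0 < n) (lam : Fin n → ℝ) : ∃ i0, ∀ i, lam i ≤ lam i0 := by
  haveI : Nonempty (Fin n) := ⟨⟨0, hn⟩⟩
  obtain ⟨i, hi⟩ := Finite.exists_max lam
  exact ⟨i, hi⟩

lemma Eig.qf_le {A : Mat n} {lam q} (he : Eig A lam q) {L : ℝ} (hL : ∀ i, lam i ≤ L) (v : Fin n → ℝ) :
    qf A v v ≤ L * dot v v := by
  rw [he.qf_expand, ← he.1.sumsq v, Finset.mul_sum]
  refine Finset.sum_le_sum fun i _ => ?_
  nlinarith [hL i, sq_nonneg (dot (q i) v)]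

lemma qf_unit_to_all {A : Mat n} {L : ℝ} (h : ∀ v, dot v v = 1 → qf A v v ≤ L) (v : Fin n → ℝ) (hv : 0 < dot v v) :
    qf A v v ≤ L * dot v v := by
  set c := (Real.sqrt (dot v v))⁻¹ with hc
  have hs : 0 < Real.sqrt (dot v v) := Real.sqrt_pos.2 hv
  have hc2 : c^2 * dot v v = 1 := by
    rw [hc, inv_pow, Real.sq_sqrt hv.le]; field_simp
  have h1 := h (fun i => c * v i) (by rw [dot_smul_left, dot_comm, dot_smul_left, ← hc2]; ring)
  rw [qf_smul_vec] at h1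
  have h2 := mul_le_mul_of_nonneg_right h1 hv.le
  have : c^2 * qf A v v * dot v v = qf A v v := by
    calc _ = (c^2 * dot v v) * qf A v v := by ring
      _ = _ := by rw [hc2, one_mul]
  linarith

def Phi (be : ℕ) (U : En n → ℝ) (x : En n) (v : Fin n → ℝ) : ℝ :=
  (1 - U x)^be * qf (Hess U x) v v * Real.exp (1/2 * nsq 0 x)

set_option maxHeartbeats 1000000 in
lemma pog_max (hα : 0 < α) (hKn : K + 2 ≤ n) {a m1 m2 K0 : ℝ} (hm1 : 0 < m1) (hK0 : 0 ≤ K0)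
    {U : En n → ℝ} (hU : ∀ p : En n, p.2 ≤ 0 → ContDiffAt ℝ 4 U p)
    (hS : ∀ p : En n, p.2 ≤ 0 → ConeM α K (Hess U p) ∧ dd et U p = Gm α K (Hess U p) ∧ m1 ≤ -dd et U p ∧ -dd et U p ≤ m2)
    (hsc : ∀ p : En n, p.2 ≤ 0 → ∀ v, -K0 * dot v v ≤ qf (Hess U p) v v)
    {C1 : ℝ} {be : ℕ} (hC1 : ∀ p : En n, p.2 ≤ 0 → U p ≤ 1 → dot p.1 p.1 ≤ C1) (hlow : ∀ p : En n, p.2 ≤ 0 → -1 ≤ U p)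
    (hbe : 4 * C1 + 2 ≤ be) (hbe2 : (2:ℝ) < be)
    {p : En n} {xi : Fin n → ℝ} (hp : p.2 ≤ 0) (hp1 : U p < 1) (hxi : dot xi xi = 1)
    (hmax : ∀ x : En n, ∀ v, x.2 ≤ 0 → U x ≤ 1 → dot v v = 1 → Phi be U x v ≤ Phi be U p xi)
    (hL0 : 1 + 3 * K0 + 2 * ((n + 2)^(K+2)) * K0 ≤ qf (Hess U p) xi xi) :
    qf (Hess U p) xi xi * (1 - U p)^(2*(K+1)) ≤
      2 * (2 * (n+2)^(K+2) * K0^2) * (16 * (be:ℝ)^2 * Real.exp (C1/2) + 16 * C1) * 4^K +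
      (2 * (2 * m2 * (16 * (be:ℝ)^2 * Real.exp (C1/2) + 16 * C1) + 4 * (be * (K+3) * m2)))^(K+1) / m1^(K+2) := by
  obtain ⟨hc, hpde, hb1, hb2⟩ := hS p hp
  obtain ⟨lam, q, he⟩ := exists_eig hc.1
  have hl := hc.cone he
  obtain ⟨i0, hi0⟩ := exists_max_fin (by omega) lam
  have hd : 0 < 1 - U p := by linarith
  have hU2 : ContDiffAt ℝ 2 U p := (hU p hp).of_le (by norm_num)
  have hq0 : dot (q i0) (q i0) = 1 := by rw [he.1, if_pos rfl]
  have hqf0 : qf (Hess U p) (q i0) (q i0) = lam i0 := by rw [he.qf_self, if_pos rfl]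
  have hle : qf (Hess U p) xi xi ≤ lam i0 := by have := he.qf_le hi0 xi; rwa [hxi, mul_one] at this
  have hge : lam i0 ≤ qf (Hess U p) xi xi := by
    have := hmax p (q i0) hp hp1.le hq0
    unfold Phi at this
    rw [hqf0] at this
    exact le_of_mul_le_mul_left (le_of_mul_le_mul_right this (Real.exp_pos _)) (by positivity)
  have heq : qf (Hess U p) xi xi = lam i0 := le_antisymm hle hge
  have hPhi : Phi be U p xi = Phi be U p (q i0) := by unfold Phi; rw [hqf0, heq]
  rw [heq] at hL0 ⊢
  have hcn : (0:ℝ) ≤ 2 * ((n + 2)^(K+2)) * K0 := by positivity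
  have hla1 : 1 ≤ lam i0 := by linarith
  have hlp : 0 < lam i0 := by linarith
  have hK0l : ∀ i, -K0 ≤ lam i := by
    intro i; have := hsc p hp (q i); rwa [he.qf_self, if_pos rfl, he.1, if_pos rfl, mul_one] at this
  have hC1p := hC1 p hp hp1.le
  have hC10 : 0 ≤ C1 := (dot_self_nonneg _).trans hC1p
  have hns : nsq 0 p = dot p.1 p.1 := by simp [nsq]
  have hnsx : ∀ x : En n, 0 ≤ nsq 0 x := fun x => dot_self_nonneg _
  set E := Real.exp (C1/2) with hE
  have hEp : 0 < E := Real.exp_pos _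
  have hexp : Real.exp (1/2 * nsq 0 p) ≤ E := by
    rw [hE]; apply Real.exp_le_exp.2; rw [hns]; linarith
  -- Hessian bound in sublevel
  have hsub : ∀ x : En n, x.2 ≤ 0 → U x ≤ U p → ∀ v, 0 < dot v v → qf (Hess U x) v v ≤ (lam i0 * E) * dot v v := by
    intro x hx hxU
    refine qf_unit_to_all fun v hv => ?_
    by_cases h0 : qf (Hess U x) v v ≤ 0
    · exact h0.trans (by positivity)
    push Not at h0
    have h1 := hmax x v hx (by linarith) hv
    rw [hPhi] at h1
    unfold Phi at h1
    rw [hqf0] at h1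
    have h2 : (1 - U p)^be ≤ (1 - U x)^be := by gcongr
    have h3 : 1 ≤ Real.exp (1/2 * nsq 0 x) := Real.one_le_exp (by have := hnsx x; linarith)
    have h4 : (1 - U p)^be * qf (Hess U x) v v ≤ (1 - U p)^be * (lam i0 * E) := by
      calc _ ≤ (1 - U x)^be * qf (Hess U x) v v := by gcongr
        _ ≤ (1 - U x)^be * qf (Hess U x) v v * Real.exp (1/2 * nsq 0 x) := by
            apply le_mul_of_one_le_right _ h3
            have : 0 < 1 - U x := by linarith
            positivity
        _ ≤ _ := h1
        _ ≤ (1 - U p)^be * lam i0 * E := by gcongr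
        _ = _ := by ring
    exact le_of_mul_le_mul_left h4 (by positivity)
  -- gradient bound
  have hgrad : dot (grd U p) (grd U p) ≤ 4 * (lam i0 * E) := by
    set g := grd U p with hg
    have hLa : 0 < lam i0 * E := by positivity
    by_cases hg0 : dot g g ≤ 0
    · linarith
    push Not at hg0
    have ht : ∀ s : ℝ, (p + s • sp (-g)).2 ≤ 0 := by intro s; simpa [sp] using hp
    have hdn : dot (-g) (-g) = dot g g := by simp [dot]
    have hw := walk (f := fun s => U (p + s • sp (-g))) (f' := fun s => dd (sp (-g)) U (p + s • sp (-g)))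
      (f'' := fun s => d2 (sp (-g)) U (p + s • sp (-g))) hLa hg0
      (fun s => line_hasDeriv ((hU _ (ht s)).differentiableAt (by simp)))
      (fun s => line_hasDeriv (f := dd (sp (-g)) U) (C2.dd ((hU _ (ht s)).of_le (by norm_num))))
      (by
        simp only [zero_smul, add_zero]
        rw [dd_sp', ← hg]; simp [dot])
      (by
        intro s _ hs
        simp only [zero_smul, add_zero] at hs
        have := hsub _ (ht s) hs (-g) (by rw [hdn]; exact hg0)
        rwa [hdn, qf_hess' ((hU _ (ht s)).of_le (by norm_num))] at this)
    simp only [zero_smul, add_zero] at hw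
    have h1 := hlow _ (ht (1 / (lam i0 * E)))
    have h2 : dot g g / (2 * (lam i0 * E)) ≤ 2 := by linarith
    rw [div_le_iff₀ (by positivity)] at h2
    linarith
  -- apply pointwise lemma
  have hdp2 : qf (Hess U p) (q i0) (q i0) = d2 (sp (q i0)) U p := qf_hess' hU2 _
  have hpt := pog_point (hU p hp) he hl hα i0
    (Filter.Eventually.of_forall fun s => by
      have := hS (p + s • sp (q i0)) (by simpa [sp] using hp)
      exact ⟨this.1, this.2.1⟩) hK0 hK0l hi0 hlp (by linarith) hd (be := be) (C1 := C1) hb2 hC1p hbe hbe2 (by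
    have hc1 : ∀ᶠ x in 𝓝 p, U x < 1 := (hU p hp).continuousAt.eventually_lt_const hp1
    have hw2 : ContDiffAt ℝ 2 (d2 (sp (q i0)) U) p := dd_contDiffAt (n := 3) (dd_contDiffAt (n := 4) (hU p hp) le_rfl) le_rfl
    have hc2 : ∀ᶠ x in 𝓝 p, 0 < d2 (sp (q i0)) U x :=
      hw2.continuousAt.eventually_const_lt (by rw [← hdp2, hqf0]; exact hlp)
    filter_upwards [hc1, hc2] with x h1 h2 hxt
    have hx0 : x.2 ≤ 0 := hxt.trans hp
    have h3 := hmax x (q i0) hx0 h1.le hq0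
    rw [hPhi] at h3
    unfold Phi at h3
    rw [hdp2, qf_hess' ((hU x hx0).of_le (by norm_num))] at h3
    have hdx : 0 < 1 - U x := by linarith
    have hdpp : 0 < d2 (sp (q i0)) U p := by rw [← hdp2, hqf0]; exact hlp
    have h4 := Real.log_le_log (by positivity) h3
    rw [Real.log_mul (by positivity) (by positivity), Real.log_mul (by positivity) (by positivity), Real.log_pow, Real.log_exp,
      Real.log_mul (by positivity) (by positivity), Real.log_mul (by positivity) (by positivity), Real.log_pow, Real.log_exp] at h4
    exact h4)
  have hfe : -dd et U p = 1 / fv α K lam := by rw [hpde, Gm, he.fm_eq]; ring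
  refine pog_concl hα hKn hl hK0 hK0l hla1 (by linarith) hm1 (hfe ▸ hb1) (hfe ▸ hb2) hd (by linarith [hlow p hp]) hC10 hEp.le (by linarith) hpt hgrad
end Pog4
end

section
section Pog5
variable {n : ℕ} {α : ℝ} {K : ℕ}

lemma abs_le_of_dot {v : Fin n → ℝ} {C : ℝ} (h : dot v v ≤ C) (i : Fin n) : |v i| ≤ C + 1 := by
  have := (sq_le_dot v i).trans h
  rw [abs_le]; constructor <;> nlinarith

theorem pog (hα : 0 < α) (hKn : K + 2 ≤ n) {a m1 K0 : ℝ} (m2 : ℝ) (ha : 0 < a) (hm1 : 0 < m1) (hK0 : 0 ≤ K0) :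
    ∃ (be : ℕ) (Cst : ℝ), ∀ U : En n → ℝ, (∀ p : En n, p.2 ≤ 0 → ContDiffAt ℝ 4 U p) →
    (∀ p : En n, p.2 ≤ 0 → ConeM α K (Hess U p) ∧ dd et U p = Gm α K (Hess U p) ∧ m1 ≤ -dd et U p ∧ -dd et U p ≤ m2) →
    (∀ p : En n, p.2 ≤ 0 → ∀ v, -K0 * dot v v ≤ qf (Hess U p) v v) →
    (∀ p : En n, p.2 ≤ 0 → a * dot p.1 p.1 - m1 * p.2 - 1 ≤ U p) →
    ∀ (p : En n) (v : Fin n → ℝ), p.2 ≤ 0 → U p ≤ 1 → dot v v = 1 → (1 - U p)^be * qf (Hess U p) v v ≤ Cst := by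
  set C1 := 2 / a with hC1
  have hC1p : 0 < C1 := by positivity
  obtain ⟨N, hN⟩ := exists_nat_ge (4 * C1 + 3)
  set be := N + 2 * (K+1) with hbe
  have hbe' : 4 * C1 + 3 ≤ (be:ℝ) := by rw [hbe]; push_cast; linarith [(Nat.cast_nonneg K : (0:ℝ) ≤ K)]
  set E := Real.exp (C1/2) with hE
  have hEp : 0 < E := Real.exp_pos _
  set L0 := 1 + 3 * K0 + 2 * (((n:ℝ) + 2)^(K+2)) * K0 with hL0
  have hL0p : 0 < L0 := by positivity
  set Con := 2 * (2 * (n+2)^(K+2) * K0^2) * (16 * (be:ℝ)^2 * E + 16 * C1) * 4^K +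
      (2 * (2 * m2 * (16 * (be:ℝ)^2 * E + 16 * C1) + 4 * (be * (K+3) * m2)))^(K+1) / m1^(K+2) with hCon
  set D := L0 * 4^(K+1) + |Con| with hD
  have hDp : 0 < D := by positivity
  refine ⟨be, D * 2^N * E, fun U hU hS hsc hgr p0 v0 hp0 hU0 hv0 => ?_⟩
  have hb : ∀ p : En n, p.2 ≤ 0 → U p ≤ 1 → dot p.1 p.1 ≤ C1 ∧ -(2 / m1) ≤ p.2 := by
    intro p hp hp1
    have h1 := hgr p hp
    have h2 := dot_self_nonneg p.1
    constructor
    · rw [hC1, le_div_iff₀ ha]; nlinarith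
    · rw [neg_le, ← sub_nonneg]
      have : - p.2 ≤ 2 / m1 := by rw [le_div_iff₀ hm1]; nlinarith
      linarith
  have hlow : ∀ p : En n, p.2 ≤ 0 → -1 ≤ U p := by
    intro p hp; have h1 := hgr p hp; have h2 := dot_self_nonneg p.1; nlinarith
  set S : Set (En n × (Fin n → ℝ)) := {x | x.1.2 ≤ 0 ∧ U x.1 ≤ 1 ∧ dot x.2 x.2 = 1} with hSdef
  have hdc : Continuous fun v : Fin n → ℝ => dot v v := by unfold dot; fun_prop
  have hScl : IsClosed S := by
    have h1 : IsClosed {x : En n × (Fin n → ℝ) | x.1.2 ≤ 0} := isClosed_le (by fun_prop) continuous_const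
    have h2 : ContinuousOn (fun x : En n × (Fin n → ℝ) => U x.1) {x | x.1.2 ≤ 0} := fun x hx =>
      (ContinuousAt.comp (g := U) (f := Prod.fst) (hU x.1 hx).continuousAt continuousAt_fst).continuousWithinAt
    have h3 := h2.preimage_isClosed_of_isClosed h1 (isClosed_Iic (a := (1:ℝ)))
    have h4 : IsClosed {x : En n × (Fin n → ℝ) | dot x.2 x.2 = 1} := isClosed_eq (hdc.comp continuous_snd) continuous_const
    have := h3.inter h4
    convert this using 1
    ext x; simp [hSdef, and_assoc]
  have hSc : IsCompact S := by
    have h1 : IsCompact ((Set.pi Set.univ (fun _ : Fin n => Set.Icc (-(C1+1)) (C1+1)) ×ˢ Set.Icc (-(2/m1)) 0) ×ˢ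
      Set.pi Set.univ (fun _ : Fin n => Set.Icc (-(1+1:ℝ)) (1+1))) :=
      ((isCompact_univ_pi fun _ => isCompact_Icc).prod isCompact_Icc).prod (isCompact_univ_pi fun _ => isCompact_Icc)
    refine h1.of_isClosed_subset hScl ?_
    rintro ⟨x, v⟩ ⟨h1, h2, h3⟩
    obtain ⟨b1, b2⟩ := hb x h1 h2
    refine ⟨⟨fun i _ => abs_le.1 (abs_le_of_dot b1 i), b2, h1⟩, fun i _ => abs_le.1 (abs_le_of_dot h3.le i)⟩
  have hPc : ContinuousOn (fun x : En n × (Fin n → ℝ) => Phi be U x.1 x.2) S := by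
    intro x hx
    apply ContinuousAt.continuousWithinAt
    have hUx := hU x.1 hx.1
    have c1 : ContinuousAt (fun x : En n × (Fin n → ℝ) => U x.1) x :=
      ContinuousAt.comp (g := U) (f := Prod.fst) hUx.continuousAt continuousAt_fst
    have c2 : ContinuousAt (fun x : En n × (Fin n → ℝ) => qf (Hess U x.1) x.2 x.2) x := by
      unfold qf
      refine tendsto_finsetSum _ fun i _ => tendsto_finsetSum _ fun j _ => ?_
      have c3 : ContinuousAt (fun x : En n × (Fin n → ℝ) => Hess U x.1 i j) x :=
        ContinuousAt.comp (g := fun y => Hess U y i j) (f := Prod.fst) (hess_cont hUx i j) continuousAt_fst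
      have c4 : ∀ i, ContinuousAt (fun x : En n × (Fin n → ℝ) => x.2 i) x := fun i => by fun_prop
      exact ((c4 i).mul c3).mul (c4 j)
    have c5 : ContinuousAt (fun x : En n × (Fin n → ℝ) => Real.exp (1/2 * nsq 0 x.1)) x := by
      have : Continuous (nsq (0 : Fin n → ℝ)) := (nsq_contDiff 0 (m := 0)).continuous
      fun_prop
    unfold Phi
    exact (((continuousAt_const.sub c1).pow be).mul c2).mul c5
  obtain ⟨⟨p, xi⟩, ⟨hp, hp1, hxi⟩, hmax⟩ := hSc.exists_isMaxOn ⟨(p0, v0), ⟨hp0, hU0, hv0⟩⟩ hPc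
  have hmax' : ∀ x : En n, ∀ v, x.2 ≤ 0 → U x ≤ 1 → dot v v = 1 → Phi be U x v ≤ Phi be U p xi :=
    fun x v h1 h2 h3 => hmax (show (x, v) ∈ S from ⟨h1, h2, h3⟩)
  simp only at hp hp1 hxi
  have hns : nsq 0 p = dot p.1 p.1 := by simp [nsq]
  have hexp : Real.exp (1/2 * nsq 0 p) ≤ E := by
    rw [hE]; apply Real.exp_le_exp.2; rw [hns]; linarith [(hb p hp hp1).1]
  have hd2 : 1 - U p ≤ 2 := by linarith [hlow p hp]
  have hd0 : 0 ≤ 1 - U p := by linarith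
  have hbound : Phi be U p xi ≤ D * 2^N * E := by
    rcases hp1.lt_or_eq with hlt | heq
    · have hk : qf (Hess U p) xi xi * (1 - U p)^(2*(K+1)) ≤ D := by
        by_cases h : L0 ≤ qf (Hess U p) xi xi
        · have := pog_max hα hKn (a := a) hm1 hK0 hU hS hsc (fun x h1 h2 => (hb x h1 h2).1) hlow (by linarith) (by linarith) hp hlt hxi hmax' h
          have h5 : Con ≤ |Con| := le_abs_self _
          have h6 : 0 ≤ L0 * 4^(K+1) := by positivity
          rw [hD]; linarith
        · push Not at h
          have e : (1 - U p)^(2*(K+1)) = ((1 - U p)^2)^(K+1) := by rw [pow_mul]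
          have h7 : (1 - U p)^(2*(K+1)) ≤ 4^(K+1) := by
            rw [e]; have : (1 - U p)^2 ≤ 4 := by nlinarith
            gcongr
          have h8 : qf (Hess U p) xi xi * (1 - U p)^(2*(K+1)) ≤ L0 * 4^(K+1) := by
            calc _ ≤ L0 * (1 - U p)^(2*(K+1)) := by gcongr
              _ ≤ _ := by gcongr
          rw [hD]; linarith [abs_nonneg Con]
      unfold Phi
      have e : (1 - U p)^be * qf (Hess U p) xi xi = (qf (Hess U p) xi xi * (1 - U p)^(2*(K+1))) * (1 - U p)^N := by
        rw [hbe, pow_add]; ring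
      rw [e]
      have h9 : (1 - U p)^N ≤ 2^N := by gcongr
      calc _ ≤ D * (1 - U p)^N * Real.exp (1/2 * nsq 0 p) := by gcongr
        _ ≤ _ := by gcongr
    · have : be ≠ 0 := by omega
      unfold Phi; rw [heq]; simp [this]; positivity
  by_cases h0 : qf (Hess U p0) v0 v0 ≤ 0
  · have : (1 - U p0)^be * qf (Hess U p0) v0 v0 ≤ 0 := mul_nonpos_of_nonneg_of_nonpos (pow_nonneg (by linarith) _) h0
    exact this.trans (by positivity)
  · push Not at h0
    have h3 : 1 ≤ Real.exp (1/2 * nsq 0 p0) := Real.one_le_exp (by have : 0 ≤ nsq 0 p0 := dot_self_nonneg _; linarith)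
    calc _ ≤ (1 - U p0)^be * qf (Hess U p0) v0 v0 * Real.exp (1/2 * nsq 0 p0) := by
            apply le_mul_of_one_le_right _ h3
            exact mul_nonneg (pow_nonneg (by linarith) _) h0.le
      _ ≤ Phi be U p xi := hmax' p0 v0 hp0 hU0 hv0
      _ ≤ _ := hbound
end Pog5
end

section
section Rs
variable {n : ℕ} {α : ℝ} {K : ℕ}

/-- parabolic scaling -/
def scl {n : ℕ} (ρ : ℝ) : En n →L[ℝ] En n :=
  (ρ • ContinuousLinearMap.fst ℝ (Fin n → ℝ) ℝ).prod ((ρ^2) • ContinuousLinearMap.snd ℝ (Fin n → ℝ) ℝ)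

lemma scl_apply (ρ : ℝ) (x : En n) : scl ρ x = (ρ • x.1, ρ^2 * x.2) := by
  simp [scl]
lemma scl_sp (ρ : ℝ) (v : Fin n → ℝ) : scl ρ (sp v) = ρ • sp v := by
  rw [scl_apply]; simp [sp]
lemma scl_et (ρ : ℝ) : scl ρ (et : En n) = ρ^2 • et := by
  rw [scl_apply]; simp [et]

/-- parabolic rescaling of a function -/
def rs (p : En n) (ρ : ℝ) (u : En n → ℝ) : En n → ℝ := fun x => (1/ρ^2) * u (p + scl ρ x)

variable {p x : En n} {ρ : ℝ} {u : En n → ℝ}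

lemma rs_cd {m : ℕ} (h : ContDiffAt ℝ m u (p + scl ρ x)) : ContDiffAt ℝ m (rs p ρ u) x :=
  contDiffAt_const.mul (cd_affine (scl ρ) p h)

lemma rs_dd (hρ : ρ ≠ 0) (h : DifferentiableAt ℝ u (p + scl ρ x)) (v : Fin n → ℝ) :
    dd (sp v) (rs p ρ u) x = (1/ρ) * dd (sp v) u (p + scl ρ x) := by
  have h1 : DifferentiableAt ℝ (fun x => u (p + scl ρ x)) x :=
    h.comp (f := fun x => p + scl ρ x) x ((scl ρ).differentiableAt.const_add p)
  unfold rs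
  rw [dd_cmul _ h1, dd_affine _ _ h, scl_sp, dd_smul_dir]
  field_simp
lemma rs_et (hρ : ρ ≠ 0) (h : DifferentiableAt ℝ u (p + scl ρ x)) :
    dd et (rs p ρ u) x = dd et u (p + scl ρ x) := by
  have h1 : DifferentiableAt ℝ (fun x => u (p + scl ρ x)) x :=
    h.comp (f := fun x => p + scl ρ x) x ((scl ρ).differentiableAt.const_add p)
  unfold rs
  rw [dd_cmul _ h1, dd_affine _ _ h, scl_et, dd_smul_dir]
  field_simp
lemma rs_dd2 (hρ : ρ ≠ 0) (h : ContDiffAt ℝ 2 u (p + scl ρ x)) (v w : Fin n → ℝ) :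
    dd (sp v) (dd (sp w) (rs p ρ u)) x = dd (sp v) (dd (sp w) u) (p + scl ρ x) := by
  have e : dd (sp w) (rs p ρ u) =ᶠ[𝓝 x] fun y => (1/ρ) * dd (sp w) u (p + scl ρ y) := by
    have := ((cont_affine (scl ρ) p).continuousAt (x := x)).eventually (C2.ev h)
    filter_upwards [this] with y hy using rs_dd hρ hy w
  have h1 : DifferentiableAt ℝ (fun x => dd (sp w) u (p + scl ρ x)) x :=
    (C2.dd h).comp (f := fun x => p + scl ρ x) x ((scl ρ).differentiableAt.const_add p)
  rw [dd_congr e, dd_cmul _ h1, dd_affine _ _ (C2.dd h), scl_sp, dd_smul_dir]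
  field_simp
lemma rs_hess (hρ : ρ ≠ 0) (h : ContDiffAt ℝ 2 u (p + scl ρ x)) :
    Hess (rs p ρ u) x = Hess u (p + scl ρ x) := by
  funext i j; exact rs_dd2 hρ h _ _
lemma rs_good {Dt : Data n} (hρ : ρ ≠ 0) (h : Good Dt u (p + scl ρ x)) : Good Dt (rs p ρ u) x := by
  refine ⟨rs_cd h.1, ?_, ?_⟩
  · rw [rs_hess hρ h.c2]; exact h.2.1
  · rw [rs_hess hρ h.c2, rs_et hρ (C2.d h.c2)]; exact h.2.2
lemma rs_le (hp : p.2 ≤ 0) (hx : x.2 ≤ 0) : (p + scl ρ x).2 ≤ 0 := by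
  rw [scl_apply]; simp only [Prod.snd_add]; nlinarith [sq_nonneg ρ]
lemma rs_sol {Dt : Data n} (hρ : ρ ≠ 0) (hp : p.2 ≤ 0) (h : Sol Dt u) : Sol Dt (rs p ρ u) := by
  obtain ⟨τ, hτ, h⟩ := h
  have hρ2 : 0 < ρ^2 := by positivity
  refine ⟨τ / ρ^2, by positivity, fun x hx => rs_good hρ (h _ ?_)⟩
  rw [lt_div_iff₀ hρ2] at hx
  rw [scl_apply]; simp only [Prod.snd_add]; nlinarith

theorem pog_u (hα : 0 < α) (hKn : K + 2 ≤ n) {a b m1 m2 K0 : ℝ} (ha : 0 < a) (hm1 : 0 < m1) (hK0 : 0 ≤ K0)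
    {u : En n → ℝ} (hU : ∀ p : En n, p.2 ≤ 0 → ContDiffAt ℝ 4 u p)
    (hS : ∀ p : En n, p.2 ≤ 0 → ConeM α K (Hess u p) ∧ dd et u p = Gm α K (Hess u p) ∧ m1 ≤ -dd et u p ∧ -dd et u p ≤ m2)
    (hsc : ∀ p : En n, p.2 ≤ 0 → ∀ v, -K0 * dot v v ≤ qf (Hess u p) v v)
    (hgr : ∀ p : En n, p.2 ≤ 0 → a * dot p.1 p.1 - m1 * p.2 - b ≤ u p) :
    ∃ C, ∀ (p : En n) (v : Fin n → ℝ), p.2 ≤ 0 → dot v v = 1 → qf (Hess u p) v v ≤ C := by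
  obtain ⟨be, Cst, hpog⟩ := pog (n := n) (K := K) hα hKn m2 ha hm1 hK0
  refine ⟨2^be * |Cst|, fun p v hp hv => ?_⟩
  set M := 1 + |b| + 2 * |u p| with hM
  have hMp : 0 < M := by positivity
  set ρ := Real.sqrt M with hρ
  have hρ2 : ρ^2 = M := Real.sq_sqrt hMp.le
  have hρp : 0 < ρ := Real.sqrt_pos.2 hMp
  have ht : ∀ x : En n, x.2 ≤ 0 → ((0 : En n) + scl ρ x).2 ≤ 0 := fun x hx => rs_le (by simp) hx
  set x : En n := (ρ⁻¹ • p.1, (ρ^2)⁻¹ * p.2) with hx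
  have hxp : (0 : En n) + scl ρ x = p := by
    rw [scl_apply, zero_add, hx]
    ext i
    · simp [hρp.ne']
    · simp [hρp.ne']
  have hx2 : x.2 ≤ 0 := by
    simp only [hx]; exact mul_nonpos_of_nonneg_of_nonpos (by positivity) hp
  have hrx : rs 0 ρ u x = u p / M := by unfold rs; rw [hxp, hρ2]; ring
  have hle : rs 0 ρ u x ≤ 1/2 := by
    rw [hrx, div_le_iff₀ hMp]; have := le_abs_self (u p); have := abs_nonneg b; linarith
  have h := hpog (rs 0 ρ u) (fun y hy => rs_cd (hU _ (ht y hy))) ?_ ?_ ?_ x v hx2 (by linarith) hv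
  · rw [rs_hess hρp.ne' (by rw [hxp]; exact (hU p hp).of_le (by norm_num)), hxp] at h
    by_cases h0 : qf (Hess u p) v v ≤ 0
    · exact h0.trans (by positivity)
    push Not at h0
    have h1 : (1/2:ℝ)^be ≤ (1 - rs 0 ρ u x)^be := by
      have : (1/2:ℝ) ≤ 1 - rs 0 ρ u x := by linarith
      gcongr
    have h2 : (1/2:ℝ)^be * qf (Hess u p) v v ≤ |Cst| := by
      refine le_trans ?_ (h.trans (le_abs_self _))
      gcongr
    calc _ = 2^be * ((1/2:ℝ)^be * qf (Hess u p) v v) := by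
            rw [← mul_assoc, ← mul_pow]; norm_num
      _ ≤ _ := by gcongr
  · intro y hy
    have hc := (hU _ (ht y hy))
    have h2 : ContDiffAt ℝ 2 u (0 + scl ρ y) := hc.of_le (by norm_num)
    rw [rs_hess hρp.ne' h2, rs_et hρp.ne' (C2.d h2)]
    exact hS _ (ht y hy)
  · intro y hy
    rw [rs_hess hρp.ne' ((hU _ (ht y hy)).of_le (by norm_num))]
    exact hsc _ (ht y hy)
  · intro y hy
    have h1 := hgr _ (ht y hy)
    rw [scl_apply, zero_add] at h1
    simp only at h1
    rw [dot_smul_l, dot_smul_r, hρ2] at h1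
    unfold rs
    rw [scl_apply, zero_add, hρ2]
    rw [one_div, inv_mul_eq_div, le_div_iff₀ hMp]
    have hb : b ≤ M := by have := le_abs_self b; have := abs_nonneg (u p); linarith
    refine le_trans ?_ h1
    have e : ρ * (ρ * dot y.1 y.1) = M * dot y.1 y.1 := by linear_combination (dot y.1 y.1) * hρ2
    rw [e]
    nlinarith
end Rs
end

section
section Cyl
variable {n : ℕ}

lemma nsq_continuous (x1 : Fin n → ℝ) : Continuous (nsq x1) := (nsq_contDiff x1 (m := 0)).continuous
lemma nsq_nonneg (x1 : Fin n → ℝ) (p : En n) : 0 ≤ nsq x1 p := dot_self_nonneg _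

lemma cyl_compact (x1 : Fin n → ℝ) (R t0 t1 : ℝ) :
    IsCompact {p : En n | nsq x1 p ≤ R ∧ t0 ≤ p.2 ∧ p.2 ≤ t1} := by
  refine IsCompact.of_isClosed_subset ((isCompact_closedBall x1 (Real.sqrt R)).prod (isCompact_Icc (a := t0) (b := t1))) ?_ ?_
  · refine (isClosed_le (nsq_continuous x1) continuous_const).inter
      ((isClosed_le continuous_const continuous_snd).inter (isClosed_le continuous_snd continuous_const))
  · rintro ⟨x, t⟩ ⟨h1, h2, h3⟩
    refine ⟨?_, h2, h3⟩
    simp only [Metric.mem_closedBall]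
    refine (dist_pi_le_iff (Real.sqrt_nonneg _)).2 fun i => ?_
    rw [Real.dist_eq]
    apply Real.abs_le_sqrt
    have := sq_le_dot (x - x1) i
    simp only [Pi.sub_apply] at this
    simp only [nsq] at h1
    nlinarith

lemma cyl_max {f : En n → ℝ} {x1 : Fin n → ℝ} {R t0 t1 : ℝ}
    (hc : ∀ p : En n, nsq x1 p ≤ R → t0 ≤ p.2 → p.2 ≤ t1 → ContDiffAt ℝ 2 f p)
    (hb1 : ∀ p : En n, nsq x1 p ≤ R → p.2 = t0 → f p ≤ 0)
    (hb2 : ∀ p : En n, nsq x1 p = R → t0 ≤ p.2 → p.2 ≤ t1 → f p ≤ 0)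
    (hi : ∀ p : En n, nsq x1 p < R → t0 < p.2 → p.2 ≤ t1 → 0 < f p → ∃ r, 0 < Lop r f p) :
    ∀ p : En n, nsq x1 p ≤ R → t0 ≤ p.2 → p.2 ≤ t1 → f p ≤ 0 := by
  intro p h1 h2 h3
  obtain ⟨q, hq, hmax⟩ := (cyl_compact x1 R t0 t1).exists_isMaxOn ⟨p, h1, h2, h3⟩
    (f := f) (fun q hq => (hc q hq.1 hq.2.1 hq.2.2).continuousAt.continuousWithinAt)
  refine le_trans (hmax ⟨h1, h2, h3⟩) ?_
  by_contra hpos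
  push Not at hpos
  obtain ⟨hq1, hq2, hq3⟩ := hq
  have hR : nsq x1 q < R := lt_of_le_of_ne hq1 fun h => absurd (hb2 q h hq2 hq3) (not_le.2 hpos)
  have ht : t0 < q.2 := lt_of_le_of_ne hq2 fun h => absurd (hb1 q hq1 h.symm) (not_le.2 hpos)
  obtain ⟨r, hr⟩ := hi q hR ht hq3 hpos
  have := (Lop_max r (hc q hq1 hq2 hq3) ?_).2.2.2
  · linarith
  have e1 : ∀ᶠ z in 𝓝 q, nsq x1 z < R := (nsq_continuous x1).continuousAt.eventually_lt continuousAt_const hR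
  have e2 : ∀ᶠ z : En n in 𝓝 q, t0 < z.2 := continuousAt_const.eventually_lt continuous_snd.continuousAt ht
  filter_upwards [e1, e2] with z hz1 hz2 hz3
  exact hmax ⟨hz1.le, hz2.le, hz3.trans hq3⟩

def tim (a : ℝ) (p : En n) : ℝ := p.2 + a
lemma tim_cd (a : ℝ) {m : WithTop ℕ∞} : ContDiff ℝ m (tim a : En n → ℝ) := contDiff_snd.add contDiff_const
lemma dd_tim (a : ℝ) (v : En n) (p : En n) : dd v (tim a) p = v.2 := by
  refine dd_of_line ((tim_cd a (m := 1)).differentiable (by simp)).differentiableAt ?_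
  have : (fun s : ℝ => tim a (p + s • v)) = fun s => (p.2 + a) + s * v.2 := by
    funext s; simp [tim]; ring
  rw [this]
  simpa using ((hasDerivAt_id (0:ℝ)).mul_const v.2).const_add (p.2 + a)
lemma d2_tim (a : ℝ) (v : En n) (p : En n) : d2 v (tim a) p = 0 := by
  unfold d2
  have : dd v (tim a) = fun _ : En n => v.2 := funext fun p => dd_tim a v p
  rw [this, dd_const]
lemma Lop_tim (r) (a : ℝ) (p : En n) : Lop r (tim a) p = -1 := by
  unfold Lop; simp [d2_tim, dd_tim, et]

/-- exponent of the heat-kernel like barrier -/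
def tht (x1 : Fin n → ℝ) (a m g : ℝ) (p : En n) : ℝ := (-m) * Real.log (tim a p) + (-g) * (nsq x1 p * (tim a p)⁻¹)

lemma tht_Lop (x1 : Fin n → ℝ) (a m g : ℝ) (p : En n) (r) (hs : 0 < tim a p) :
    ContDiffAt ℝ 2 (tht x1 a m g) p ∧
    Lop r (tht x1 a m g) p = m / tim a p - g * (2 * (∑ k, dot (r k) (r k)) / tim a p + nsq x1 p / (tim a p)^2) ∧
    Gam2 r (tht x1 a m g) (tht x1 a m g) p = 4 * g^2 * (∑ k, (dot (r k) (p.1 - x1))^2) / (tim a p)^2 := by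
  set s := tim a p with hs'
  have hc : ContDiffAt ℝ 2 (tim a : En n → ℝ) p := (tim_cd a).contDiffAt
  have hl := Lop_log r hc hs
  have hG : Gam2 r (tim a) (tim a) p = 0 := by unfold Gam2; simp [dd_tim, sp]
  have hn : ContDiffAt ℝ 2 (nsq x1) p := (nsq_contDiff x1).contDiffAt
  have hinv : ContDiffAt ℝ 2 (fun x : ℝ => x⁻¹) s := contDiffAt_inv ℝ hs.ne'
  have hi : ContDiffAt ℝ 2 (fun q : En n => (tim a q)⁻¹) p := hinv.comp p hc
  have hdi : ∀ v, dd (sp v) (fun q : En n => (tim a q)⁻¹) p = 0 := by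
    intro v
    rw [dd_comp (f := tim a) (φ := fun x : ℝ => x⁻¹) (C2.d hinv) (C2.d hc), dd_tim]; simp [sp]
  have hLi : Lop r (fun q : En n => (tim a q)⁻¹) p = 1 / s^2 := by
    rw [Lop_comp r (f := tim a) (φ := fun x : ℝ => x⁻¹) hinv hc, Lop_tim, hG]; simp [hs']
  have hni : ContDiffAt ℝ 2 (fun q : En n => nsq x1 q * (tim a q)⁻¹) p := hn.mul hi
  have hLni : Lop r (fun q : En n => nsq x1 q * (tim a q)⁻¹) p = 2 * (∑ k, dot (r k) (r k)) / s + nsq x1 p / s^2 := by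
    rw [Lop_mul r hn hi, Lop_nsq, hLi]
    have : Gam2 r (nsq x1) (fun q : En n => (tim a q)⁻¹) p = 0 := by unfold Gam2; simp [hdi]
    rw [this]; simp only [← hs']; ring
  have hA : ContDiffAt ℝ 2 (fun q : En n => (-m) * Real.log (tim a q)) p := contDiffAt_const.mul hl.1
  have hB : ContDiffAt ℝ 2 (fun q : En n => (-g) * (nsq x1 q * (tim a q)⁻¹)) p := contDiffAt_const.mul hni
  refine ⟨hA.add hB, ?_, ?_⟩
  · unfold tht
    rw [Lop_add r hA hB, Lop_cmul r _ hl.1, Lop_cmul r _ hni, hLni, hl.2.2, Lop_tim, hG]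
    simp only [← hs']; ring
  · have : ∀ v, dd (sp v) (tht x1 a m g) p = -(2 * g) * dot v (p.1 - x1) / s := by
      intro v
      unfold tht
      rw [dd_add (C2.d hA) (C2.d hB), dd_cmul _ (C2.d hl.1), dd_cmul _ (C2.d hni), hl.2.1, dd_tim,
        dd_mul (C2.d hn) (C2.d hi), hdi, dd_nsq]
      simp only [sp, ← hs']; ring
    unfold Gam2
    simp only [this]
    rw [Finset.mul_sum, Finset.sum_div]
    refine Finset.sum_congr rfl fun k _ => ?_
    field_simp; ring

lemma exp_Lop {f : En n → ℝ} {p : En n} (r) (hf : ContDiffAt ℝ 2 f p) :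
    Lop r (fun q => Real.exp (f q)) p = Real.exp (f p) * (Lop r f p + Gam2 r f f p) := by
  rw [Lop_comp r (φ := Real.exp) Real.contDiff_exp.contDiffAt hf]; simp [Real.deriv_exp]; ring

def Ell (c0 C0 : ℝ) (r : Fin n → Fin n → ℝ) : Prop :=
  (∀ v, c0 * dot v v ≤ ∑ k, (dot (r k) v)^2) ∧ (∀ v, ∑ k, (dot (r k) v)^2 ≤ C0 * dot v v)

lemma Ell.tr {c0 C0 : ℝ} {r : Fin n → Fin n → ℝ} (h : Ell c0 C0 r) : ∑ k, dot (r k) (r k) ≤ n * C0 := by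
  have e : ∀ i : Fin n, ∑ k, (r k i)^2 ≤ C0 := by
    intro i
    have := h.2 (bs i)
    have e1 : ∀ k, dot (r k) (bs i) = r k i := by intro k; simp [dot, bs, Pi.single_apply]
    have e2 : dot (bs i) (bs i : Fin n → ℝ) = 1 := by simp [dot, bs, Pi.single_apply]
    simpa [e1, e2] using this
  calc ∑ k, dot (r k) (r k) = ∑ i, ∑ k, (r k i)^2 := by
        unfold dot; rw [Finset.sum_comm]
        exact Finset.sum_congr rfl fun i _ => Finset.sum_congr rfl fun k _ => by ring
    _ ≤ ∑ i : Fin n, C0 := Finset.sum_le_sum fun i _ => e i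
    _ = n * C0 := by simp

set_option maxHeartbeats 1600000 in
/-- quantitative strong maximum principle -/
theorem SM {c0 C0 : ℝ} (hc0 : 0 < c0) (hC0 : 0 < C0) {T R η ε : ℝ} (hT : 0 < T) (hR : 0 ≤ R) (hη : 0 < η) (hε : 0 < ε) :
    ∃ δ > 0, ∀ (Z : En n → ℝ) (r : En n → Fin n → Fin n → ℝ) (x1 : Fin n → ℝ) (t1 : ℝ),
      (∀ p : En n, p.2 ≤ t1 → ContDiffAt ℝ 2 Z p ∧ Ell c0 C0 (r p) ∧ Lop (r p) Z p ≤ 0 ∧ 0 ≤ Z p) →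
      dot x1 x1 ≤ R → (∀ x, dot (x - x1) (x - x1) ≤ η → ε ≤ Z (x, t1 - T)) → δ ≤ Z (0, t1) := by
  set g := 1 / (4 * c0) with hg
  have hgp : 0 < g := by positivity
  set m := 2 * g * n * C0 + 1 with hm
  have hmp : 0 < m := by positivity
  set τ := g * η / (2 * m) with hτ
  have hτp : 0 < τ := by positivity
  set K := m * Real.log (2 * T) + g * R / T - m * Real.log τ - m with hK
  set σ := min T (g * η / (2 * (|K| + 1))) with hσ
  have hσp : 0 < σ := lt_min hT (by positivity)
  have hσT : σ ≤ T := min_le_left _ _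
  have hσK : |K| + 1 ≤ g * η / (2 * σ) := by
    have h1 : σ ≤ g * η / (2 * (|K| + 1)) := min_le_right _ _
    rw [le_div_iff₀ (by positivity)] at h1 ⊢
    linarith
  have hTσ : 0 < T + σ := by positivity
  set k := ε * Real.exp (m * Real.log σ) with hk
  have hkp : 0 < k := by positivity
  set c1 := Real.exp (-m * Real.log σ - g * η / σ) with hc1
  have hlt : -m * Real.log σ - g * η / σ < -m * Real.log (T + σ) - g * R / (T + σ) := by
    have h1 : -Real.log σ ≤ τ / σ - 1 - Real.log τ := by
      have := Real.log_le_sub_one_of_pos (x := τ / σ) (by positivity)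
      rw [Real.log_div hτp.ne' hσp.ne'] at this; linarith
    have h2 : Real.log (T + σ) ≤ Real.log (2 * T) := Real.log_le_log hTσ (by linarith)
    have h3 : g * R / (T + σ) ≤ g * R / T := by
      apply div_le_div_of_nonneg_left (by positivity) hT (by linarith)
    have h4 : m * (τ / σ) = g * η / (2 * σ) := by rw [hτ]; field_simp
    have h5 : g * η / σ = 2 * (g * η / (2 * σ)) := by field_simp
    have h6 := le_abs_self K
    have h7 := mul_le_mul_of_nonneg_left h1 hmp.le
    have h8 := mul_le_mul_of_nonneg_left h2 hmp.le
    rw [h5]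
    rw [hK] at h6 hσK
    linarith
  refine ⟨k * (Real.exp (-m * Real.log (T + σ) - g * R / (T + σ)) - c1), mul_pos hkp (sub_pos.2 (Real.exp_lt_exp.2 hlt)), ?_⟩
  intro Z r x1 t1 hZ hx1 hball
  set a := -t1 + T + σ with ha
  set R2 := R + η * (T + σ) / σ with hR2
  set φ : En n → ℝ := fun p => Real.exp (tht x1 a m g p) with hφ
  set f : En n → ℝ := fun p => (k * (φ p - c1)) - Z p with hf
  have hs : ∀ p : En n, t1 - T ≤ p.2 → σ ≤ tim a p := fun p hp => by simp only [tim, ha]; linarith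
  have hs0 : ∀ p : En n, t1 - T ≤ p.2 → 0 < tim a p := fun p hp => hσp.trans_le (hs p hp)
  have hφc : ∀ p : En n, t1 - T ≤ p.2 → ContDiffAt ℝ 2 φ p := fun p hp =>
    Real.contDiff_exp.contDiffAt.comp p (tht_Lop x1 a m g p (r p) (hs0 p hp)).1
  have hφc' : ∀ p : En n, t1 - T ≤ p.2 → ContDiffAt ℝ 2 (fun p => k * (φ p - c1)) p := fun p hp =>
    contDiffAt_const.mul ((hφc p hp).sub contDiffAt_const)
  have htht : ∀ p : En n, tht x1 a m g p = -m * Real.log (tim a p) - g * nsq x1 p / tim a p := by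
    intro p; unfold tht; rw [div_eq_mul_inv]; ring
  have key := cyl_max (f := f) (x1 := x1) (R := R2) (t0 := t1 - T) (t1 := t1)
    (fun p _ h2 h3 => (hφc' p h2).sub (hZ p h3).1) ?_ ?_ ?_ (0, t1) ?_ (by simp only; linarith) (by simp)
  · simp only [hf] at key
    have h1 : Real.exp (-m * Real.log (T + σ) - g * R / (T + σ)) ≤ φ (0, t1) := by
      simp only [hφ]; apply Real.exp_le_exp.2
      rw [htht]
      have e1 : tim a ((0, t1) : En n) = T + σ := by simp only [tim, ha]; ring
      have e2 : nsq x1 ((0, t1) : En n) = dot x1 x1 := by simp [nsq, dot]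
      rw [e1, e2]
      have : g * dot x1 x1 / (T + σ) ≤ g * R / (T + σ) := by gcongr
      linarith
    have h2 := mul_le_mul_of_nonneg_left (sub_le_sub_right h1 c1) hkp.le
    linarith
  · intro p h1 h2
    simp only [hf]
    have hZp := (hZ p (by linarith)).2.2.2
    have hsp : tim a p = σ := by simp only [tim, ha]; linarith
    by_cases hη' : nsq x1 p ≤ η
    · have h3 : ε ≤ Z p := by
        have := hball p.1 hη'
        rw [← h2] at this; exact this
      have h4 : φ p ≤ Real.exp (-m * Real.log σ) := by
        simp only [hφ]; apply Real.exp_le_exp.2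
        rw [htht, hsp]
        have : 0 ≤ g * nsq x1 p / σ := by have := nsq_nonneg x1 p; positivity
        linarith
      have h5 : k * Real.exp (-m * Real.log σ) = ε := by
        rw [hk, mul_assoc, ← Real.exp_add]; simp
      have h6 : 0 < c1 := Real.exp_pos _
      have h7 := mul_le_mul_of_nonneg_left h4 hkp.le
      have h8 := mul_pos hkp h6
      linarith
    · push Not at hη'
      have h4 : φ p ≤ c1 := by
        simp only [hφ, hc1]; apply Real.exp_le_exp.2
        rw [htht, hsp]
        have : g * η / σ ≤ g * nsq x1 p / σ := by gcongr
        linarith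
      have := mul_nonneg hkp.le (sub_nonneg.2 h4)
      linarith
  · intro p h1 h2 h3
    simp only [hf]
    have hZp := (hZ p h3).2.2.2
    have h4 : φ p ≤ c1 := by
      simp only [hφ, hc1]; apply Real.exp_le_exp.2
      rw [htht, h1]
      have h5 := hs p h2
      have h6 : tim a p ≤ T + σ := by simp only [tim, ha]; linarith
      have h7 : Real.log σ ≤ Real.log (tim a p) := Real.log_le_log hσp h5
      have h8 : g * η / σ ≤ g * R2 / tim a p := by
        rw [div_le_div_iff₀ hσp (hs0 p h2)]
        have : R2 * σ = R * σ + η * (T + σ) := by rw [hR2]; field_simp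
        calc g * η * tim a p ≤ g * η * (T + σ) := by gcongr
          _ ≤ g * (R2 * σ) := by rw [this]; have := mul_nonneg hgp.le (mul_nonneg hR hσp.le); linarith
          _ = _ := by ring
      have := mul_le_mul_of_nonneg_left h7 hmp.le
      linarith
    have := mul_nonneg hkp.le (sub_nonneg.2 h4)
    linarith
  · intro p h1 h2 h3 _
    obtain ⟨hZc, hell, hLZ, hZp⟩ := hZ p h3
    refine ⟨r p, ?_⟩
    have hcc : ContDiffAt ℝ 2 (fun p => φ p - c1) p := (hφc p h2.le).sub contDiffAt_const
    obtain ⟨ht1, ht2, ht3⟩ := tht_Lop x1 a m g p (r p) (hs0 p h2.le)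
    simp only [hf]
    rw [Lop_sub (f := fun p => k * (φ p - c1)) _ (hφc' p h2.le) hZc, Lop_cmul _ k hcc, Lop_sub (g := fun _ => c1) _ (hφc p h2.le) contDiffAt_const,
      Lop_const]
    have hL : 0 < Lop (r p) φ p := by
      simp only [hφ]
      rw [exp_Lop _ ht1, ht2, ht3]
      apply mul_pos (Real.exp_pos _)
      have hsp := hs0 p h2.le
      set s := tim a p
      have e1 := hell.tr
      have e2 := hell.1 (p.1 - x1)
      change c0 * nsq x1 p ≤ _ at e2
      set A := ∑ k, dot (r p k) (r p k)
      set B := ∑ k, (dot (r p k) (p.1 - x1))^2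
      have e3 : 0 < m - 2 * g * A := by have := mul_le_mul_of_nonneg_left e1 (by positivity : 0 ≤ 2 * g); rw [hm]; linarith
      have e4 : 0 ≤ 4 * g^2 * B - g * nsq x1 p := by
        have h1g : 4 * g * c0 = 1 := by rw [hg]; field_simp
        have h5 : nsq x1 p ≤ 4 * g * B := by
          have := mul_le_mul_of_nonneg_left e2 (by positivity : 0 ≤ 4 * g)
          calc nsq x1 p = 4 * g * c0 * nsq x1 p := by rw [h1g]; ring
            _ ≤ _ := by linarith
        have := mul_le_mul_of_nonneg_left h5 hgp.le
        linarith
      have : m / s - g * (2 * A / s + nsq x1 p / s^2) + 4 * g^2 * B / s^2 = (m - 2*g*A)/s + (4*g^2*B - g * nsq x1 p)/s^2 := by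
        field_simp; ring
      rw [this]
      have := div_pos e3 hsp
      have := div_nonneg e4 (sq_nonneg s)
      linarith
    have := mul_pos hkp hL
    linarith
  · have e2 : nsq x1 ((0, t1) : En n) = dot x1 x1 := by simp [nsq, dot]
    rw [e2, hR2]
    have : 0 ≤ η * (T + σ) / σ := by positivity
    linarith
end Cyl
end

section
section Gh
variable {n : ℕ}

def ev (i j : Fin n) : Fin n → ℝ := bs i + bs j
def Dh (h : ℝ) (v : Fin n → ℝ) (u : En n → ℝ) (p : En n) : ℝ := (u (p + h • sp v) + u (p + (-h) • sp v) - 2 * u p) / h^2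
def gh (Dt : Data n) (u : En n → ℝ) (h : ℝ) (p : En n) : Mat n := fun i j => Dh h (ev i j) u p + 4 * Dt.CL
def g0 (Dt : Data n) (u : En n → ℝ) (p : En n) : Mat n := fun i j => d2 (sp (ev i j)) u p + 4 * Dt.CL
def ip (A B : Mat n) : ℝ := ∑ i, ∑ j, A i j * B i j
def Cls (Dt : Data n) (M : ℝ) (u : En n → ℝ) : Prop :=
  Sol Dt u ∧ ∀ h > 0, ∀ p : En n, p.2 ≤ 0 → ip (gh Dt u h p) (gh Dt u h p) ≤ M

lemma ip_self_nonneg (A : Mat n) : 0 ≤ ip A A := Finset.sum_nonneg fun i _ => Finset.sum_nonneg fun j _ => mul_self_nonneg _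
lemma ip_comm (A B : Mat n) : ip A B = ip B A := by
  unfold ip; exact Finset.sum_congr rfl fun i _ => Finset.sum_congr rfl fun j _ => mul_comm _ _
lemma ip_sub_left (A B C : Mat n) : ip (A - B) C = ip A C - ip B C := by
  unfold ip; simp only [← Finset.sum_sub_distrib]
  exact Finset.sum_congr rfl fun i _ => Finset.sum_congr rfl fun j _ => by simp; ring
lemma ip_sub_right (A B C : Mat n) : ip A (B - C) = ip A B - ip A C := by
  rw [ip_comm, ip_sub_left, ip_comm B, ip_comm C]
lemma ip_sub_self (A B : Mat n) : ip (A - B) (A - B) = ip A A - 2 * ip B A + ip B B := by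
  rw [ip_sub_left, ip_sub_right, ip_sub_right, ip_comm A B]; ring
lemma ip_le {A B : Mat n} {M : ℝ} (hA : ip A A ≤ M) (hB : ip B B ≤ M) : ip B A ≤ M := by
  have h := ip_self_nonneg (A - B)
  rw [ip_sub_self] at h; linarith
lemma ip_close {A B : Mat n} {M ε : ℝ} (hA : ip A A ≤ M) (hB : ip B B ≤ M) (h : M - ε ≤ ip B A) :
    ip (A - B) (A - B) ≤ 2 * ε := by
  rw [ip_sub_self]; linarith
lemma entry_le_ip (A : Mat n) (i j : Fin n) : A i j ^ 2 ≤ ip A A := by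
  have h1 : A i j * A i j ≤ ∑ j, A i j * A i j :=
    Finset.single_le_sum (f := fun j => A i j * A i j) (fun j _ => mul_self_nonneg _) (Finset.mem_univ j)
  have h2 : ∑ j, A i j * A i j ≤ ip A A :=
    Finset.single_le_sum (f := fun i => ∑ j, A i j * A i j) (fun i _ => Finset.sum_nonneg fun j _ => mul_self_nonneg _) (Finset.mem_univ i)
  nlinarith
lemma abs_entry_le {A : Mat n} {ε : ℝ} (hε : 0 ≤ ε) (h : ip A A ≤ ε^2) (i j : Fin n) : |A i j| ≤ ε :=
  abs_le_of_sq_le_sq ((entry_le_ip A i j).trans h) hε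
lemma ip_le_of_entry {A : Mat n} {ε : ℝ} (h : ∀ i j, |A i j| ≤ ε) : ip A A ≤ n * n * ε^2 := by
  calc ip A A ≤ ∑ i : Fin n, ∑ j : Fin n, ε^2 := Finset.sum_le_sum fun i _ => Finset.sum_le_sum fun j _ => by
        rw [← pow_two, ← sq_abs]; have := h i j; have := abs_nonneg (A i j); gcongr
    _ = _ := by simp; ring

lemma ev_comm (i j : Fin n) : ev i j = ev j i := add_comm _ _
lemma gh_symm (Dt : Data n) (u) (h) (p) : Symm (gh Dt u h p) := fun i j => by unfold gh; rw [ev_comm]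
lemma g0_symm (Dt : Data n) (u) (p) : Symm (g0 Dt u p) := fun i j => by unfold g0; rw [ev_comm]

lemma sp_snd (p : En n) (s : ℝ) (v : Fin n → ℝ) : (p + s • sp v).2 = p.2 := by simp [sp]

variable {u : En n → ℝ} {p : En n} {Dt : Data n} {M : ℝ}

lemma Dh_le {h c : ℝ} (hh : 0 < h) {v : Fin n → ℝ} (hc : ∀ s : ℝ, |s| ≤ h → ContDiffAt ℝ 2 u (p + s • sp v))
    (hb : ∀ s : ℝ, |s| ≤ h → d2 (sp v) u (p + s • sp v) ≤ c) : Dh h v u p ≤ c := by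
  have key : ∀ σ : ℝ, |σ| = 1 → u (p + (σ * h) • sp v) ≤ u p + σ * dd (sp v) u p * h + c * h^2 / 2 := by
    intro σ hσ
    have hσ2 : σ * σ = 1 := by rw [← abs_mul_abs_self, hσ]; norm_num
    have habs : ∀ s ∈ Set.Icc 0 h, |σ * s| ≤ h := fun s hs => by
      rw [abs_mul, hσ, one_mul, abs_of_nonneg hs.1]; exact hs.2
    have hl : ∀ (f : En n → ℝ) (s : ℝ), DifferentiableAt ℝ f (p + (σ * s) • sp v) →
        HasDerivAt (fun s : ℝ => f (p + (σ * s) • sp v)) (σ * dd (sp v) f (p + (σ * s) • sp v)) s := by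
      intro f s hf
      have h1 := (line_hasDeriv hf).comp s ((hasDerivAt_id s).const_mul σ)
      refine h1.congr_deriv ?_
      simp; ring
    have := tay2 (f := fun s => u (p + (σ * s) • sp v)) (f' := fun s => σ * dd (sp v) u (p + (σ * s) • sp v))
      (f'' := fun s => σ * (σ * d2 (sp v) u (p + (σ * s) • sp v))) (S := h) (c := c)
      (fun s hs => hl u s (C2.d (hc _ (habs s hs)))) (fun s hs => (hl _ s (C2.dd (hc _ (habs s hs)))).const_mul σ)
      (fun s hs => by rw [← mul_assoc, hσ2, one_mul]; exact hb _ (habs s hs)) h ⟨hh.le, le_rfl⟩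
    simpa using this
  have h1 := key 1 (by simp)
  have h2 := key (-1) (by simp)
  unfold Dh
  rw [div_le_iff₀ (by positivity)]
  simp only [one_mul, neg_mul] at h1 h2
  linarith

lemma dd_neg (f : En n → ℝ) (v q : En n) : dd v (fun q => - f q) q = - dd v f q := by
  unfold dd; rw [fderiv_fun_neg]; rfl
lemma d2_neg (f : En n → ℝ) (v q : En n) : d2 v (fun q => - f q) q = - d2 v f q := by
  unfold d2
  have : dd v (fun q => - f q) = fun q => - dd v f q := funext fun q => dd_neg f v q
  rw [this, dd_neg]
lemma Dh_neg (h : ℝ) (v : Fin n → ℝ) : Dh h v (fun q => - u q) p = - Dh h v u p := by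
  unfold Dh; ring
lemma le_Dh {h c : ℝ} (hh : 0 < h) {v : Fin n → ℝ} (hc : ∀ s : ℝ, |s| ≤ h → ContDiffAt ℝ 2 u (p + s • sp v))
    (hb : ∀ s : ℝ, |s| ≤ h → c ≤ d2 (sp v) u (p + s • sp v)) : c ≤ Dh h v u p := by
  have := Dh_le (u := fun q => - u q) (p := p) (c := -c) hh (v := v) (fun s hs => (hc s hs).neg)
    (fun s hs => by rw [d2_neg]; linarith [hb s hs])
  rw [Dh_neg] at this; linarith

lemma Dh_rs (h ρ : ℝ) (x : En n) (v) : Dh h v (rs p ρ u) x = Dh (ρ * h) v u (p + scl ρ x) := by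
  unfold Dh rs
  have e : ∀ s : ℝ, p + scl ρ (x + s • sp v) = p + scl ρ x + (ρ * s) • sp v := by
    intro s; rw [map_add, map_smul, scl_sp, smul_smul, mul_comm s ρ, add_assoc]
  rw [e, e, mul_neg, mul_pow, ← mul_add, mul_left_comm 2, ← mul_sub, div_eq_mul_inv, div_eq_mul_inv, div_eq_mul_inv, mul_inv]
  ring
lemma gh_rs (h ρ : ℝ) (x : En n) : gh Dt (rs p ρ u) h x = gh Dt u (ρ * h) (p + scl ρ x) := by
  funext i j; unfold gh; rw [Dh_rs]
lemma g0_rs {ρ : ℝ} (hρ : ρ ≠ 0) {x : En n} (h : ContDiffAt ℝ 2 u (p + scl ρ x)) : g0 Dt (rs p ρ u) x = g0 Dt u (p + scl ρ x) := by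
  funext i j; unfold g0 d2; rw [rs_dd2 hρ h]
lemma Cls.rs (hu : Cls Dt M u) (hp : p.2 ≤ 0) {ρ : ℝ} (hρ : 0 < ρ) : Cls Dt M (rs p ρ u) := by
  refine ⟨rs_sol hρ.ne' hp hu.1, fun h hh x hx => ?_⟩
  rw [gh_rs]
  exact hu.2 _ (by positivity) _ (rs_le hp hx)

lemma d2_ev_abs (h : Good Dt u p) (i j) : |d2 (sp (ev i j)) u p| ≤ 4 * Dt.CL := by
  have e : d2 (sp (ev i j)) u p = Hess u p i i + 2 * Hess u p i j + Hess u p j j := by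
    unfold ev; rw [sp_add, d2_add_dir h.c2]; rfl
  have hb := Dt.bdd _ h.2.1
  rw [e]
  have h1 := abs_le.1 (hb i i)
  have h2 := abs_le.1 (hb i j)
  have h3 := abs_le.1 (hb j j)
  rw [abs_le]; constructor <;> linarith

lemma g0_bd (h : Good Dt u p) (i j) : 0 ≤ g0 Dt u p i j ∧ g0 Dt u p i j ≤ 8 * Dt.CL := by
  have := abs_le.1 (d2_ev_abs h i j)
  unfold g0; constructor <;> linarith
lemma gh_bd (hu : Sol Dt u) {h : ℝ} (hh : 0 < h) (hp : p.2 ≤ 0) (i j) : 0 ≤ gh Dt u h p i j ∧ gh Dt u h p i j ≤ 8 * Dt.CL := by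
  have hg : ∀ s : ℝ, Good Dt u (p + s • sp (ev i j)) := fun s => hu.good (by rw [sp_snd]; exact hp)
  have h1 := Dh_le (c := 4 * Dt.CL) hh (v := ev i j) (fun s _ => (hg s).c2) (fun s _ => (abs_le.1 (d2_ev_abs (hg s) i j)).2)
  have h2 := le_Dh (c := -(4 * Dt.CL)) hh (v := ev i j) (fun s _ => (hg s).c2) (fun s _ => (abs_le.1 (d2_ev_abs (hg s) i j)).1)
  unfold gh; constructor <;> linarith

lemma Dh_tendsto (hc : ContDiffAt ℝ 2 u p) (v : Fin n → ℝ) :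
    Tendsto (fun h => Dh h v u p) (𝓝[>] 0) (𝓝 (d2 (sp v) u p)) := by
  rw [Metric.tendsto_nhds]
  intro ε hε
  have hd : ContinuousAt (d2 (sp v) u) p :=
    (dd_contDiffAt (m := 0) (n := 1) (dd_contDiffAt (m := 1) (n := 2) hc le_rfl) le_rfl).continuousAt
  have e1 : ∀ᶠ q in 𝓝 p, ContDiffAt ℝ 2 u q ∧ dist (d2 (sp v) u q) (d2 (sp v) u p) < ε/2 :=
    (hc.eventually (by simp)).and (Metric.tendsto_nhds.1 hd _ (half_pos hε))
  have e2 := (line_cont (p := p) (v := sp v) 0).eventually (p := fun q => ContDiffAt ℝ 2 u q ∧ dist (d2 (sp v) u q) (d2 (sp v) u p) < ε/2) (by simpa using e1)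
  obtain ⟨δ, hδ, h3⟩ := Metric.eventually_nhds_iff.1 e2
  have : Set.Ioo (0:ℝ) δ ∈ 𝓝[>] (0:ℝ) := Ioo_mem_nhdsGT hδ
  filter_upwards [this] with h hh
  have h4 : ∀ s : ℝ, |s| ≤ h → ContDiffAt ℝ 2 u (p + s • sp v) ∧ dist (d2 (sp v) u (p + s • sp v)) (d2 (sp v) u p) < ε/2 := by
    intro s hs; apply h3; rw [Real.dist_eq, sub_zero]; exact lt_of_le_of_lt hs hh.2
  have h5 := Dh_le (c := d2 (sp v) u p + ε/2) hh.1 (fun s hs => (h4 s hs).1) (fun s hs => by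
    have := (h4 s hs).2; rw [Real.dist_eq, abs_lt] at this; linarith)
  have h6 := le_Dh (c := d2 (sp v) u p - ε/2) hh.1 (fun s hs => (h4 s hs).1) (fun s hs => by
    have := (h4 s hs).2; rw [Real.dist_eq, abs_lt] at this; linarith)
  rw [Real.dist_eq, abs_lt]; constructor <;> linarith

lemma Cls.g0_le (hu : Cls Dt M u) (hp : p.2 ≤ 0) : ip (g0 Dt u p) (g0 Dt u p) ≤ M := by
  have h1 : Tendsto (fun h => ip (gh Dt u h p) (gh Dt u h p)) (𝓝[>] 0) (𝓝 (ip (g0 Dt u p) (g0 Dt u p))) := by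
    unfold ip
    refine tendsto_finsetSum _ fun i _ => tendsto_finsetSum _ fun j _ => ?_
    have := (Dh_tendsto (hu.1.good hp).c2 (ev i j)).add_const (4 * Dt.CL)
    exact this.mul this
  refine le_of_tendsto h1 ?_
  filter_upwards [self_mem_nhdsWithin] with h hh using hu.2 h hh p hp

lemma dd_shift (c v : En n) (f : En n → ℝ) : dd v (fun q => f (q + c)) = fun q => dd v f (q + c) := by
  funext q; unfold dd; rw [fderiv_comp_add_right]
lemma Lop_shift (c : En n) (f : En n → ℝ) (r) : Lop r (fun q => f (q + c)) p = Lop r f (p + c) := by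
  unfold Lop d2; simp only [dd_shift]
lemma cd_shift (c : En n) {f : En n → ℝ} {m : WithTop ℕ∞} (h : ContDiffAt ℝ m f (p + c)) : ContDiffAt ℝ m (fun q => f (q + c)) p :=
  ContDiffAt.comp (f := fun q => q + c) (g := f) p h (contDiffAt_id.add contDiffAt_const)

lemma Lop_key (h1 : Good Dt u p) {q : En n} (h2 : Good Dt u q) :
    Lop (Dt.r (Hess u p)) u p ≤ Lop (Dt.r (Hess u p)) u q := by
  rw [Lop_eq h1.c2, Lop_eq h2.c2, h1.2.2, h2.2.2]
  have := Dt.key _ h1.2.1 _ h2.2.1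
  rw [aa_sub] at this; linarith

lemma Dh_sub (hu : Sol Dt u) (hp : p.2 ≤ 0) {h : ℝ} (hh : 0 < h) (v) : ContDiffAt ℝ 2 (Dh h v u) p ∧ 0 ≤ Lop (Dt.r (Hess u p)) (Dh h v u) p := by
  have hg : ∀ s : ℝ, Good Dt u (p + s • sp v) := fun s => hu.good (by rw [sp_snd]; exact hp)
  have hg0 := hu.good hp
  have c1 := cd_shift (p := p) (h • sp v) (hg h).c2
  have c2 := cd_shift (p := p) ((-h) • sp v) (hg (-h)).c2
  have c3 : ContDiffAt ℝ 2 (fun q => 2 * u q) p := contDiffAt_const.mul hg0.c2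
  have c12 : ContDiffAt ℝ 2 (fun q => u (q + h • sp v) + u (q + (-h) • sp v)) p := c1.add c2
  have c123 : ContDiffAt ℝ 2 (fun q => u (q + h • sp v) + u (q + (-h) • sp v) - 2 * u q) p := c12.sub c3
  have e : Dh h v u = fun q => (1/h^2) * (u (q + h • sp v) + u (q + (-h) • sp v) - 2 * u q) := by
    funext q; unfold Dh; ring
  rw [e]
  refine ⟨contDiffAt_const.mul c123, ?_⟩
  rw [Lop_cmul _ _ c123, Lop_sub (f := fun q => u (q + h • sp v) + u (q + (-h) • sp v)) _ c12 c3,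
    Lop_add (f := fun q => u (q + h • sp v)) _ c1 c2, Lop_cmul _ _ hg0.c2, Lop_shift, Lop_shift]
  have k1 := Lop_key hg0 (hg h)
  have k2 := Lop_key hg0 (hg (-h))
  have : 0 < 1/h^2 := by positivity
  apply mul_nonneg this.le; linarith

lemma Data.ell (Dt : Data n) {A : Mat n} (h : A ∈ Dt.D) : Ell Dt.c0 Dt.C0 (Dt.r A) := ⟨Dt.ell1 A h, Dt.ell2 A h⟩

/-- generic supersolution -/
lemma Z_super {W : Fin n → Fin n → En n → ℝ} {γ : Mat n} (hγ : ∀ i j, 0 ≤ γ i j) {c c' : ℝ} {r}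
    (hW : ∀ i j, ContDiffAt ℝ 2 (W i j) p ∧ 0 ≤ Lop r (W i j) p) :
    ContDiffAt ℝ 2 (fun q => c' - ip γ (fun i j => W i j q + c)) p ∧ Lop r (fun q => c' - ip γ (fun i j => W i j q + c)) p ≤ 0 := by
  have c1 : ∀ i j, ContDiffAt ℝ 2 (fun q => W i j q + c) p := fun i j => (hW i j).1.add contDiffAt_const
  have c2 : ∀ i j, ContDiffAt ℝ 2 (fun q => γ i j * (W i j q + c)) p := fun i j => contDiffAt_const.mul (c1 i j)
  have c3 : ∀ i, ContDiffAt ℝ 2 (fun q => ∑ j, γ i j * (W i j q + c)) p := fun i => ContDiffAt.sum fun j _ => c2 i j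
  have c4 : ContDiffAt ℝ 2 (fun q => ∑ i, ∑ j, γ i j * (W i j q + c)) p := ContDiffAt.sum fun i _ => c3 i
  unfold ip
  refine ⟨contDiffAt_const.sub c4, ?_⟩
  rw [Lop_sub (f := fun _ => c') (g := fun q => ∑ i, ∑ j, γ i j * (W i j q + c)) _ contDiffAt_const c4, Lop_const, zero_sub, neg_nonpos, Lop_sum _ _ fun i _ => c3 i]
  refine Finset.sum_nonneg fun i _ => ?_
  rw [Lop_sum _ _ fun j _ => c2 i j]
  refine Finset.sum_nonneg fun j _ => ?_
  rw [Lop_cmul _ _ (c1 i j), Lop_add (g := fun _ => c) _ (hW i j).1 contDiffAt_const, Lop_const, add_zero]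
  exact mul_nonneg (hγ i j) (hW i j).2

lemma Zh_super (hu : Cls Dt M u) {γ : Mat n} (hγ : ∀ i j, 0 ≤ γ i j) (hγM : ip γ γ ≤ M) {h : ℝ} (hh : 0 < h) (hp : p.2 ≤ 0) :
    ContDiffAt ℝ 2 (fun q => M - ip γ (gh Dt u h q)) p ∧ Ell Dt.c0 Dt.C0 (Dt.r (Hess u p)) ∧
    Lop (Dt.r (Hess u p)) (fun q => M - ip γ (gh Dt u h q)) p ≤ 0 ∧ 0 ≤ M - ip γ (gh Dt u h p) := by
  obtain ⟨h1, h2⟩ := Z_super (p := p) (W := fun i j => Dh h (ev i j) u) (c := 4 * Dt.CL) (c' := M) hγ (fun i j => Dh_sub hu.1 hp hh (ev i j))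
  exact ⟨h1, Dt.ell (hu.1.good hp).2.1, h2, by have := ip_le (hu.2 h hh p hp) hγM; linarith⟩

lemma Z0_super (hu : Cls Dt M u) {γ : Mat n} (hγ : ∀ i j, 0 ≤ γ i j) (hγM : ip γ γ ≤ M) (hp : p.2 ≤ 0) :
    ContDiffAt ℝ 2 (fun q => M - ip γ (g0 Dt u q)) p ∧ Ell Dt.c0 Dt.C0 (Dt.r (Hess u p)) ∧
    Lop (Dt.r (Hess u p)) (fun q => M - ip γ (g0 Dt u q)) p ≤ 0 ∧ 0 ≤ M - ip γ (g0 Dt u p) := by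
  have hg := hu.1.good hp
  obtain ⟨h1, h2⟩ := Z_super (p := p) (W := fun i j => d2 (sp (ev i j)) u) (c := 4 * Dt.CL) (c' := M) hγ
    (fun i j => ⟨hg.c2d2 _, (lin_eq hg (hu.1.ev hp) (sp (ev i j))).2.1⟩)
  exact ⟨h1, Dt.ell hg.2.1, h2, by have := ip_le (hu.g0_le hp) hγM; linarith⟩

lemma qf_abs_le' {A : Mat n} {C : ℝ} (hC : ∀ i j, |A i j| ≤ C) (v w : Fin n → ℝ) :
    |qf A v w| ≤ C * (∑ i, |v i|) * ∑ j, |w j| := by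
  have : qf A v w = ∑ i, ∑ j, A i j * v i * w j := by
    unfold qf; exact Finset.sum_congr rfl fun i _ => Finset.sum_congr rfl fun j _ => by ring
  rw [this, mul_assoc, Finset.sum_mul_sum, Finset.mul_sum]
  refine (Finset.abs_sum_le_sum_abs _ _).trans (Finset.sum_le_sum fun i _ => ?_)
  rw [Finset.mul_sum]
  refine (Finset.abs_sum_le_sum_abs _ _).trans (Finset.sum_le_sum fun j _ => ?_)
  rw [abs_mul, abs_mul, mul_assoc]
  gcongr; exact hC i j

lemma sum_abs_ev (i j : Fin n) : ∑ k, |ev i j k| ≤ 2 := by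
  have : ∀ i : Fin n, ∑ k, |(bs i : Fin n → ℝ) k| = 1 := by
    intro i; simp [bs, Pi.single_apply, apply_ite]
  calc _ ≤ ∑ k, (|bs i k| + |bs j k|) := Finset.sum_le_sum fun k _ => by unfold ev; exact abs_add_le _ _
    _ = 2 := by rw [Finset.sum_add_distrib, this, this]; norm_num
lemma sum_abs_le (v : Fin n → ℝ) : ∑ k, |v k| ≤ n * ‖v‖ := by
  calc _ ≤ ∑ k : Fin n, ‖v‖ := Finset.sum_le_sum fun k _ => norm_le_pi_norm v k
    _ = _ := by simp

/-- one-sided derivative bound along a line from a bound of the derivative -/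
lemma line_le {f : En n → ℝ} {v : En n} {S c : ℝ} (hS : 0 ≤ S) (hf : ∀ s ∈ Set.Icc 0 S, DifferentiableAt ℝ f (p + s • v))
    (hb : ∀ s ∈ Set.Icc 0 S, |dd v f (p + s • v)| ≤ c) : |f (p + S • v) - f p| ≤ c * S := by
  have h1 := tay1 (f := fun s => f (p + s • v)) (f' := fun s => dd v f (p + s • v)) (c := c) (S := S)
    (fun s hs => line_hasDeriv (hf s hs)) (fun s hs => (abs_le.1 (hb s hs)).2) S ⟨hS, le_rfl⟩
  have h2 := tay1 (f := fun s => - f (p + s • v)) (f' := fun s => - dd v f (p + s • v)) (c := c) (S := S)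
    (fun s hs => (line_hasDeriv (hf s hs)).neg) (fun s hs => by linarith [(abs_le.1 (hb s hs)).1]) S ⟨hS, le_rfl⟩
  simp only [zero_smul, add_zero] at h1 h2
  rw [abs_le]; constructor <;> linarith

lemma dd_dd_abs (h : Good Dt u p) (v w : Fin n → ℝ) : |dd (sp v) (dd (sp w) u) p| ≤ Dt.CL * (∑ i, |v i|) * ∑ j, |w j| := by
  rw [← qf_hess h.c2]; exact qf_abs_le' (Dt.bdd _ h.2.1) v w

lemma gh_lip (hu : Sol Dt u) {h : ℝ} (hh : 0 < h) {x y : Fin n → ℝ} {t : ℝ} (ht : t ≤ 0) (i j) :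
    |gh Dt u h (y, t) i j - gh Dt u h (x, t) i j| ≤ 4 * Dt.CL * n / h * ‖y - x‖ := by
  set v := y - x with hv
  set e := ev i j with he
  set B := Dt.CL * 2 * (n * ‖v‖) with hB
  have hCL := Dt.CL_pos
  have hgd : ∀ p : En n, p.2 ≤ 0 → |dd (sp e) (dd (sp v) u) p| ≤ B := fun p hp =>
    (dd_dd_abs (hu.good hp) e v).trans (by
      have := sum_abs_ev i j; have := sum_abs_le v
      have h0 : 0 ≤ ∑ j, |v j| := Finset.sum_nonneg fun j _ => abs_nonneg _
      rw [hB]; gcongr)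
  have hdiff : ∀ p : En n, p.2 ≤ 0 → |dd (sp v) u (p + h • sp e) - dd (sp v) u p| ≤ B * h := fun p hp =>
    line_le hh.le (fun s _ => C2.d ((hu.good (by rw [sp_snd]; exact hp)).c2d _)) (fun s _ => hgd _ (by rw [sp_snd]; exact hp))
  have hdd : ∀ p : En n, p.2 ≤ 0 → |dd (sp v) (Dh h e u) p| ≤ 4 * Dt.CL * n / h * ‖v‖ := by
    intro p hp
    have hg : ∀ s : ℝ, Good Dt u (p + s • sp e) := fun s => hu.good (by rw [sp_snd]; exact hp)
    have c1 := C2.d (cd_shift (p := p) (h • sp e) (hg h).c2)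
    have c2 := C2.d (cd_shift (p := p) ((-h) • sp e) (hg (-h)).c2)
    have c3 : DifferentiableAt ℝ (fun q => 2 * u q) p := (C2.d (hu.good hp).c2).const_mul 2
    have c12 : DifferentiableAt ℝ (fun q => u (q + h • sp e) + u (q + (-h) • sp e)) p := c1.add c2
    have ee : Dh h e u = fun q => (1/h^2) * (u (q + h • sp e) + u (q + (-h) • sp e) - 2 * u q) := by
      funext q; unfold Dh; ring
    rw [ee, dd_cmul (f := fun q => u (q + h • sp e) + u (q + (-h) • sp e) - 2 * u q) _ (c12.sub c3), dd_sub (f := fun q => u (q + h • sp e) + u (q + (-h) • sp e)) c12 c3,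
      dd_add (f := fun q => u (q + h • sp e)) c1 c2, dd_cmul _ (C2.d (hu.good hp).c2), dd_shift, dd_shift]
    have h1 := abs_le.1 (hdiff p hp)
    have h2 := hdiff (p + (-h) • sp e) (by rw [sp_snd]; exact hp)
    rw [add_assoc, ← add_smul, neg_add_cancel, zero_smul, add_zero] at h2
    have h2 := abs_le.1 h2
    rw [abs_mul, abs_of_pos (by positivity : 0 < 1/h^2)]
    calc 1/h^2 * |_| ≤ 1/h^2 * (2 * (B * h)) := by
          gcongr; rw [abs_le]; constructor <;> linarith
      _ = _ := by rw [hB]; field_simp; ring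
  have := line_le (f := Dh h e u) (p := (x, t)) (v := sp v) (S := 1) zero_le_one
    (fun s _ => C2.d (Dh_sub hu (by rw [sp_snd]; exact ht) hh e).1) (fun s _ => hdd _ (by rw [sp_snd]; exact ht))
  have e2 : ((x, t) : En n) + (1:ℝ) • sp v = (y, t) := by simp [sp, hv]
  rw [e2, mul_one] at this
  unfold gh
  simpa using this
end Gh
end

section
section Qd
variable {n : ℕ}

def qd (A : Mat n) (l : Fin n → ℝ) (c d : ℝ) (p : En n) : ℝ := (1/2) * qf A p.1 p.1 + dot l p.1 + c * p.2 + d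
def lfn (A : Mat n) (v l : Fin n → ℝ) (p : En n) : ℝ := qf A v p.1 + dot l v

lemma qd_cd (A : Mat n) (l c d) {m : WithTop ℕ∞} : ContDiff ℝ m (qd A l c d) := by
  have h : ∀ i : Fin n, ContDiff ℝ m (fun p : En n => p.1 i) := fun i => (contDiff_apply ℝ ℝ i).comp contDiff_fst
  unfold qd qf dot
  refine (((contDiff_const.mul ?_).add ?_).add (contDiff_const.mul contDiff_snd)).add contDiff_const
  · exact ContDiff.sum fun i _ => ContDiff.sum fun j _ => ((h i).mul contDiff_const).mul (h j)
  · exact ContDiff.sum fun i _ => contDiff_const.mul (h i)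
lemma lfn_cd (A : Mat n) (v l) {m : WithTop ℕ∞} : ContDiff ℝ m (lfn A v l) := by
  have h : ∀ i : Fin n, ContDiff ℝ m (fun p : En n => p.1 i) := fun i => (contDiff_apply ℝ ℝ i).comp contDiff_fst
  unfold lfn qf dot
  exact (ContDiff.sum fun i _ => ContDiff.sum fun j _ => contDiff_const.mul (h j)).add contDiff_const

variable {A : Mat n} {l v : Fin n → ℝ} {c d : ℝ} {p : En n}

lemma quad_deriv (a b c : ℝ) : HasDerivAt (fun s : ℝ => a + s * b + s^2 * c) b 0 := by
  have := (((hasDerivAt_id (0:ℝ)).mul_const b).const_add a).add (((hasDerivAt_id (0:ℝ)).pow 2).mul_const c)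
  refine this.congr_deriv ?_
  simp

lemma dd_qd (hA : Symm A) : dd (sp v) (qd A l c d) p = lfn A v l p := by
  refine dd_of_line ((qd_cd A l c d (m := 1)).differentiable (by simp)).differentiableAt ?_
  have e : (fun s : ℝ => qd A l c d (p + s • sp v)) = fun s => qd A l c d p + s * lfn A v l p + s^2 * ((1/2) * qf A v v) := by
    funext s
    have e1 : (p + s • sp v).1 = p.1 + s • v := by simp [sp]
    unfold qd lfn
    rw [sp_snd, e1, qf_add_left, qf_add_right, qf_add_right, qf_smul_l, qf_smul_l, qf_smul_r, qf_smul_r, dot_add_right, dot_smul_r, qf_comm hA p.1 v]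
    ring
  rw [e]; exact quad_deriv _ _ _
lemma dd_et_qd : dd et (qd A l c d) p = c := by
  refine dd_of_line ((qd_cd A l c d (m := 1)).differentiable (by simp)).differentiableAt ?_
  have e : (fun s : ℝ => qd A l c d (p + s • et)) = fun s => qd A l c d p + s * c + s^2 * 0 := by
    funext s
    have e1 : (p + s • et).1 = p.1 := by simp [et]
    have e2 : (p + s • et).2 = p.2 + s := by simp [et]
    unfold qd; rw [e1, e2]; ring
  rw [e]; exact quad_deriv _ _ _
lemma dd_lfn (w : Fin n → ℝ) : dd (sp w) (lfn A v l) p = qf A v w := by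
  refine dd_of_line ((lfn_cd A v l (m := 1)).differentiable (by simp)).differentiableAt ?_
  have e : (fun s : ℝ => lfn A v l (p + s • sp w)) = fun s => lfn A v l p + s * qf A v w + s^2 * 0 := by
    funext s
    have e1 : (p + s • sp w).1 = p.1 + s • w := by simp [sp]
    unfold lfn
    rw [e1, qf_add_right, qf_smul_r]; ring
  rw [e]; exact quad_deriv _ _ _
lemma dd_et_lfn : dd et (lfn A v l) p = 0 := by
  refine dd_of_line ((lfn_cd A v l (m := 1)).differentiable (by simp)).differentiableAt ?_
  have e : (fun s : ℝ => lfn A v l (p + s • et)) = fun s => lfn A v l p + s * 0 + s^2 * 0 := by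
    funext s
    have e1 : (p + s • et).1 = p.1 := by simp [et]
    unfold lfn; rw [e1]; ring
  rw [e]; exact quad_deriv _ _ _
lemma Lop_lfn (r) : Lop r (lfn A v l) p = 0 := by
  unfold Lop d2
  have : ∀ w : Fin n → ℝ, dd (sp w) (lfn A v l) = fun _ => qf A v w := fun w => funext fun p => dd_lfn w
  simp only [this, dd_const, dd_et_lfn]; simp
lemma d2_qd (hA : Symm A) : d2 (sp v) (qd A l c d) p = qf A v v := by
  unfold d2
  have : dd (sp v) (qd A l c d) = lfn A v l := funext fun p => dd_qd hA
  rw [this, dd_lfn]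
lemma Hess_qd (hA : Symm A) : Hess (qd A l c d) p = A := by
  funext i j
  unfold Hess
  have : dd (sp (bs j)) (qd A l c d) = lfn A (bs j) l := funext fun p => dd_qd hA
  rw [this, dd_lfn, hA i j]
  simp [qf, bs, Pi.single_apply]
end Qd

section TS
variable {n : ℕ} {u : En n → ℝ} {p : En n} {Dt : Data n}

/-- supporting relation for the extended operator at A -/
def ExtD (Dt : Data n) (A : Mat n) (c : ℝ) (A' : Mat n) : Prop :=
  A' ∈ Dt.D ∧ (∀ B ∈ Dt.D, Dt.G B ≤ c + aa (Dt.r A') (B - A)) ∧ ∀ B ∈ Dt.D, c ≤ Dt.G B + aa (Dt.r B) (A - B)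

lemma aa_abs {r : Fin n → Fin n → ℝ} {c0 C0 C : ℝ} (hr : Ell c0 C0 r) (hC : 0 ≤ C) {X : Mat n} (hX : ∀ i j, |X i j| ≤ C) :
    |aa r X| ≤ C * n * (n * C0) := by
  unfold aa
  calc |∑ k, qf X (r k) (r k)| ≤ ∑ k, |qf X (r k) (r k)| := Finset.abs_sum_le_sum_abs _ _
    _ ≤ ∑ k, C * n * dot (r k) (r k) := Finset.sum_le_sum fun k _ => qf_abs_le hX (r k)
    _ = C * n * ∑ k, dot (r k) (r k) := by rw [Finset.mul_sum]
    _ ≤ _ := mul_le_mul_of_nonneg_left hr.tr (by positivity)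

lemma ExtD.bd {A A' : Mat n} {c C : ℝ} (h : ExtD Dt A c A') (hC : 0 ≤ C) {B : Mat n} (hB : B ∈ Dt.D) (hX : ∀ i j, |(B - A) i j| ≤ C) :
    |Dt.G B - c| ≤ C * n * (n * Dt.C0) := by
  have h1 := h.2.1 B hB
  have h2 := h.2.2 B hB
  have h3 := abs_le.1 (aa_abs (Dt.ell h.1) hC hX)
  have h4 := abs_le.1 (aa_abs (Dt.ell hB) hC hX)
  have h5 : aa (Dt.r B) (A - B) = - aa (Dt.r B) (B - A) := by rw [aa_sub, aa_sub]; ring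
  rw [abs_le]; constructor <;> linarith

theorem TS (hu : Sol Dt u) {A A' : Mat n} (hA : Symm A) {c : ℝ} (hE : ExtD Dt A c A') {C R2 t0 ε κ : ℝ} (hC : 0 ≤ C)
    (hAC : ∀ B ∈ Dt.D, ∀ i j, |(B - A) i j| ≤ C) (l : Fin n → ℝ) (d : ℝ) (hκ : 0 < κ)
    (hκR : C * n * (n * Dt.C0) * (-t0) ≤ κ * R2)
    (h0 : ∀ x : Fin n → ℝ, dot x x ≤ R2 → |u (x, t0) - qd A l c d (x, t0)| ≤ ε) :
    ∀ p : En n, dot p.1 p.1 ≤ R2 → t0 ≤ p.2 → p.2 ≤ 0 →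
      |u p - qd A l c d p| ≤ ε + κ * (dot p.1 p.1 + (2 * n * Dt.C0 + 1) * (p.2 - t0)) := by
  set CT := C * n * (n * Dt.C0) with hCT
  have hC0 := Dt.C0_pos
  have hCT0 : 0 ≤ CT := by positivity
  set La := 2 * n * Dt.C0 + 1 with hLa
  have hLap : 0 < La := by positivity
  set q := qd A l c d with hq
  have hqc : ∀ p, ContDiffAt ℝ 2 q p := fun p => (qd_cd A l c d).contDiffAt
  have huq : ∀ p : En n, p.2 ≤ 0 → ContDiffAt ℝ 2 (fun p => u p - q p) p := fun p hp => (hu.good hp).c2.sub (hqc p)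
  have hnsq : ∀ p : En n, nsq 0 p = dot p.1 p.1 := fun p => by simp [nsq]
  have hbar : ∀ p : En n, ContDiffAt ℝ 2 (fun p => ε + κ * (nsq 0 p + La * tim (-t0) p)) p := fun p =>
    contDiffAt_const.add (contDiffAt_const.mul ((nsq_contDiff 0).contDiffAt.add (contDiffAt_const.mul (tim_cd _).contDiffAt)))
  have hLbar : ∀ (p : En n) r, Ell Dt.c0 Dt.C0 r → Lop r (fun p => ε + κ * (nsq 0 p + La * tim (-t0) p)) p < 0 := by
    intro p r hr
    have c1 : ContDiffAt ℝ 2 (nsq (0 : Fin n → ℝ)) p := (nsq_contDiff 0).contDiffAt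
    have c2 : ContDiffAt ℝ 2 (tim (-t0)) p := (tim_cd (n := n) _).contDiffAt
    have c3 : ContDiffAt ℝ 2 (fun q => La * tim (-t0) q) p := contDiffAt_const.mul c2
    have c4 : ContDiffAt ℝ 2 (fun q => nsq 0 q + La * tim (-t0) q) p := c1.add c3
    have c5 : ContDiffAt ℝ 2 (fun q => κ * (nsq 0 q + La * tim (-t0) q)) p := contDiffAt_const.mul c4
    rw [Lop_add (f := fun _ => ε) r contDiffAt_const c5, Lop_const, Lop_cmul r κ c4, Lop_add r c1 c3, Lop_cmul r La c2, Lop_nsq, Lop_tim]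
    have := hr.tr
    have h1 : 2 * ∑ k, dot (r k) (r k) + La * -1 < 0 := by rw [hLa]; linarith
    have := mul_neg_of_pos_of_neg hκ h1
    linarith
  have hlat : ∀ p : En n, dot p.1 p.1 ≤ R2 → t0 ≤ p.2 → p.2 ≤ 0 → |u p - q p| ≤ ε + CT * (p.2 - t0) := by
    intro p h1 h2 h3
    have hl := line_le (f := fun p => u p - q p) (p := (p.1, t0)) (v := et) (S := p.2 - t0) (c := CT) (by linarith)
      (fun s hs => C2.d (huq _ (by simp [et]; linarith [hs.2]))) (fun s hs => by
        have hs2 : (((p.1, t0) : En n) + s • et).2 ≤ 0 := by simp [et]; linarith [hs.2]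
        rw [dd_sub (C2.d (hu.good hs2).c2) (C2.d (hqc _)), hq, dd_et_qd, (hu.good hs2).2.2]
        exact hE.bd hC (hu.good hs2).2.1 (hAC _ (hu.good hs2).2.1))
    have e : ((p.1, t0) : En n) + (p.2 - t0) • et = p := by ext <;> simp [et]
    rw [e] at hl
    have := h0 p.1 h1
    have h5 := abs_sub_abs_le_abs_sub (u p - q p) (u (p.1, t0) - q (p.1, t0))
    linarith
  have hdd : ∀ p : En n, p.2 ≤ 0 → ∀ r, Lop r (fun p => u p - q p) p = aa r (Hess u p - A) - (Dt.G (Hess u p) - c) := by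
    intro p hp r
    have hg := hu.good hp
    rw [Lop_sub r hg.c2 (hqc p), Lop_eq hg.c2, Lop_eq (hqc p), hg.2.2, hq, Hess_qd hA, dd_et_qd, aa_sub]; ring
  have main : ∀ σ : ℝ, |σ| = 1 → (∀ p : En n, p.2 ≤ 0 → ∃ r, Ell Dt.c0 Dt.C0 r ∧ 0 ≤ σ * Lop r (fun p => u p - q p) p) →
      ∀ p : En n, dot p.1 p.1 ≤ R2 → t0 ≤ p.2 → p.2 ≤ 0 → σ * (u p - q p) - (ε + κ * (nsq 0 p + La * tim (-t0) p)) ≤ 0 := by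
    intro σ hσ hL p h1 h2 h3
    have hσa : ∀ x : ℝ, σ * x ≤ |x| := fun x => by
      calc σ * x ≤ |σ * x| := le_abs_self _
        _ = |x| := by rw [abs_mul, hσ, one_mul]
    refine cyl_max (f := fun p => σ * (u p - q p) - (ε + κ * (nsq 0 p + La * tim (-t0) p))) (x1 := 0) (R := R2) (t0 := t0) (t1 := 0) ?_ ?_ ?_ ?_ p (by rw [hnsq]; exact h1) h2 h3
    · intro p _ _ hp; exact (contDiffAt_const.mul (huq p hp)).sub (hbar p)
    · intro p hp ht
      have := h0 p.1 (by rw [← hnsq]; exact hp)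
      rw [← ht] at this
      have h5 := hσa (u p - q p)
      have h6 : 0 ≤ κ * (nsq 0 p + La * tim (-t0) p) := by
        have : tim (-t0) p = 0 := by simp [tim, ht]
        rw [this, mul_zero, add_zero]; exact mul_nonneg hκ.le (nsq_nonneg _ _)
      linarith [show |u p - q p| ≤ ε from this]
    · intro p hp ht1 ht2
      have := hlat p (by rw [← hnsq]; exact hp.le) ht1 ht2
      have h5 := hσa (u p - q p)
      have h6 : CT * (p.2 - t0) ≤ κ * (nsq 0 p + La * tim (-t0) p) := by
        have e1 : CT * (p.2 - t0) ≤ CT * (-t0) := by gcongr; linarith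
        have e2 : 0 ≤ tim (-t0) p := by simp only [tim]; linarith
        have e3 : 0 ≤ κ * (La * tim (-t0) p) := by positivity
        rw [hp, mul_add]; linarith
      linarith
    · intro p hp ht1 ht2 _
      obtain ⟨r, hr, hLr⟩ := hL p ht2
      refine ⟨r, ?_⟩
      rw [Lop_sub (f := fun p => σ * (u p - q p)) (g := fun p => ε + κ * (nsq 0 p + La * tim (-t0) p)) r (contDiffAt_const.mul (huq p ht2)) (hbar p), Lop_cmul r σ (huq p ht2)]
      have := hLbar p r hr
      linarith
  intro p h1 h2 h3
  have m1 := main 1 (by simp) (fun p hp => ⟨Dt.r A', Dt.ell hE.1, by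
    rw [hdd p hp]; have := hE.2.1 _ (hu.good hp).2.1; linarith⟩) p h1 h2 h3
  have m2 := main (-1) (by simp) (fun p hp => ⟨Dt.r (Hess u p), Dt.ell (hu.good hp).2.1, by
    rw [hdd p hp]; have := hE.2.2 _ (hu.good hp).2.1; rw [aa_sub] at this ⊢; linarith⟩) p h1 h2 h3
  rw [hnsq] at m1 m2
  simp only [tim, ← sub_eq_add_neg] at m1 m2
  rw [abs_le]; constructor <;> linarith
end TS
end

section
section B0
variable {n : ℕ} {u : En n → ℝ} {p : En n} {Dt : Data n}

lemma Lop_congr {f g : En n → ℝ} (r) (h : f =ᶠ[𝓝 p] g) : Lop r f p = Lop r g p := by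
  unfold Lop; rw [dd_congr h]; simp only [d2_congr h]

lemma cyl_max' {f : En n → ℝ} {x1 : Fin n → ℝ} {R t0 t1 : ℝ}
    (hc : ∀ p : En n, nsq x1 p ≤ R → t0 ≤ p.2 → p.2 ≤ t1 → ContinuousAt f p)
    (hb1 : ∀ p : En n, nsq x1 p ≤ R → p.2 = t0 → f p ≤ 0)
    (hb2 : ∀ p : En n, nsq x1 p = R → t0 ≤ p.2 → p.2 ≤ t1 → f p ≤ 0)
    (hi : ∀ p : En n, nsq x1 p < R → t0 < p.2 → p.2 ≤ t1 → 0 < f p → ∃ g r, f =ᶠ[𝓝 p] g ∧ ContDiffAt ℝ 2 g p ∧ 0 < Lop r g p) :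
    ∀ p : En n, nsq x1 p ≤ R → t0 ≤ p.2 → p.2 ≤ t1 → f p ≤ 0 := by
  intro p h1 h2 h3
  obtain ⟨q, hq, hmax⟩ := (cyl_compact x1 R t0 t1).exists_isMaxOn ⟨p, h1, h2, h3⟩
    (f := f) (fun q hq => (hc q hq.1 hq.2.1 hq.2.2).continuousWithinAt)
  refine le_trans (hmax ⟨h1, h2, h3⟩) ?_
  by_contra hpos
  push Not at hpos
  obtain ⟨hq1, hq2, hq3⟩ := hq
  have hR : nsq x1 q < R := lt_of_le_of_ne hq1 fun h => absurd (hb2 q h hq2 hq3) (not_le.2 hpos)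
  have ht : t0 < q.2 := lt_of_le_of_ne hq2 fun h => absurd (hb1 q hq1 h.symm) (not_le.2 hpos)
  obtain ⟨g, r, hfg, hg, hr⟩ := hi q hR ht hq3 hpos
  have := (Lop_max r hg ?_).2.2.2
  · linarith
  have e1 : ∀ᶠ z in 𝓝 q, nsq x1 z < R := (nsq_continuous x1).continuousAt.eventually_lt continuousAt_const hR
  have e2 : ∀ᶠ z : En n in 𝓝 q, t0 < z.2 := continuousAt_const.eventually_lt continuous_snd.continuousAt ht
  filter_upwards [e1, e2, hfg] with z hz1 hz2 hz4 hz3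
  rw [← hz4, ← hfg.eq_of_nhds]
  exact hmax ⟨hz1.le, hz2.le, hz3.trans hq3⟩

lemma B0_prod {et w : En n → ℝ} (r) (he : ContDiffAt ℝ 2 et p) (hw : ContDiffAt ℝ 2 w p) (h1 : 0 ≤ et p) (h2 : 0 ≤ w p)
    (hL : 0 ≤ Lop r w p) : 2 * et p * w p ^2 * Lop r et p - 6 * w p ^2 * Gam2 r et et p ≤ Lop r (fun q => (et q * w q)^2) p := by
  rw [Lop_sq (f := fun q => et q * w q) r (he.mul hw), Lop_mul r he hw]
  have e : Gam2 r (fun q => et q * w q) (fun q => et q * w q) p = ∑ k, (dd (sp (r k)) et p * w p + et p * dd (sp (r k)) w p)^2 := by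
    unfold Gam2; exact Finset.sum_congr rfl fun k _ => by rw [dd_mul (C2.d he) (C2.d hw)]; ring
  rw [e]
  have h3 : -(6 * w p^2 * Gam2 r et et p) ≤ 4 * (et p * w p * Gam2 r et w p) + 2 * ∑ k, (dd (sp (r k)) et p * w p + et p * dd (sp (r k)) w p)^2 := by
    unfold Gam2
    simp only [Finset.mul_sum, ← Finset.sum_add_distrib, ← Finset.sum_neg_distrib]
    refine Finset.sum_le_sum fun k _ => ?_
    nlinarith [sq_nonneg (2 * w p * dd (sp (r k)) et p + et p * dd (sp (r k)) w p)]
  have h4 : 0 ≤ 2 * (et p * w p) * (et p * Lop r w p) := by positivity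
  linarith

lemma lfn_grad (hg : Good Dt u p) (hev : ∀ᶠ q in 𝓝 p, Good Dt u q) {A : Mat n} (hA : Symm A) (l : Fin n → ℝ) :
    ContDiffAt ℝ 2 (fun q => ∑ i, (dd (sp (bs i)) u q - lfn A (bs i) l q)^2) p ∧
    2 * Dt.c0 * ∑ i, ∑ j, ((Hess u p - A) i j)^2 ≤
      Lop (Dt.r (Hess u p)) (fun q => ∑ i, (dd (sp (bs i)) u q - lfn A (bs i) l q)^2) p := by
  have hc : ∀ i, ContDiffAt ℝ 2 (fun q => dd (sp (bs i)) u q - lfn A (bs i) l q) p := fun i =>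
    (hg.c2d _).sub (lfn_cd A (bs i) l).contDiffAt
  refine ⟨ContDiffAt.sum fun i _ => (hc i).pow 2, ?_⟩
  rw [Lop_sum (F := fun i q => (dd (sp (bs i)) u q - lfn A (bs i) l q)^2) _ _ fun i _ => (hc i).pow 2, Finset.mul_sum]
  refine Finset.sum_le_sum fun i _ => ?_
  rw [Lop_sq (f := fun q => dd (sp (bs i)) u q - lfn A (bs i) l q) _ (hc i), Lop_sub _ (hg.c2d _) (lfn_cd A (bs i) l).contDiffAt,
    (lin_eq hg hev _).1, Lop_lfn, Gam2_eq]
  have := Dt.ell1 _ hg.2.1 (grd (fun q => dd (sp (bs i)) u q - lfn A (bs i) l q) p)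
  have e : dot (grd (fun q => dd (sp (bs i)) u q - lfn A (bs i) l q) p) (grd (fun q => dd (sp (bs i)) u q - lfn A (bs i) l q) p) =
      ∑ j, ((Hess u p - A) i j)^2 := by
    unfold dot grd
    refine Finset.sum_congr rfl fun j _ => ?_
    rw [dd_sub (C2.d (hg.c2d _)) (C2.d (lfn_cd A (bs i) l).contDiffAt), dd_lfn, dd_comm hg.c2]
    have : qf A (bs i) (bs j) = A i j := by simp [qf, bs, Pi.single_apply]
    rw [this]; simp only [Hess, Pi.sub_apply]; ring
  rw [e] at this
  linarith

lemma B0 (hu : Sol Dt u) {A : Mat n} (hA : Symm A) {C3 E : ℝ} (hC3 : 0 < C3) (l : Fin n → ℝ) {p0 : En n} (hp0 : p0.2 ≤ 0) (w : En n → ℝ)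
    (hw : ∀ p : En n, nsq p0.1 p ≤ 1/4 → p0.2 - 1/4 ≤ p.2 → p.2 ≤ p0.2 → ContDiffAt ℝ 2 w p ∧ 0 ≤ Lop (Dt.r (Hess u p)) w p ∧
      w p ^2 ≤ C3 * ∑ i, ∑ j, ((Hess u p - A) i j)^2)
    (hE : ∀ p : En n, nsq p0.1 p ≤ 1/4 → p0.2 - 1/4 ≤ p.2 → p.2 ≤ p0.2 → ∑ i, (dd (sp (bs i)) u p - lfn A (bs i) l p)^2 ≤ E)
    (h0 : 0 ≤ w p0) : w p0 ^ 2 ≤ C3 * (16 * n * Dt.C0 + 8 + 96 * Dt.C0) / Dt.c0 * E := by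
  have hc0 := Dt.c0_pos
  have hC0 := Dt.C0_pos
  set C4 := 16 * n * Dt.C0 + 8 + 96 * Dt.C0 with hC4
  have hC4p : 0 < C4 := by positivity
  set K := C3 * C4 / Dt.c0 with hK
  have hKp : 0 < K := by positivity
  set η : En n → ℝ := fun p => 1 - 4 * nsq p0.1 p + 4 * tim (-p0.2) p with hη
  set S : En n → ℝ := fun q => ∑ i, (dd (sp (bs i)) u q - lfn A (bs i) l q)^2 with hS
  have hηc : ∀ p, ContDiffAt ℝ 2 η p := fun p =>
    (contDiffAt_const.sub (contDiffAt_const.mul (nsq_contDiff _).contDiffAt)).add (contDiffAt_const.mul (tim_cd _).contDiffAt)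
  have hgood : ∀ p : En n, p.2 ≤ p0.2 → Good Dt u p ∧ ∀ᶠ q in 𝓝 p, Good Dt u q := fun p hp => ⟨hu.good (hp.trans hp0), hu.ev (hp.trans hp0)⟩
  have hSc : ∀ p : En n, p.2 ≤ p0.2 → ContDiffAt ℝ 2 S p := fun p hp => (lfn_grad (hgood p hp).1 (hgood p hp).2 hA l).1
  have key := cyl_max' (f := fun p => (max (η p) 0 * max (w p) 0)^2 + K * S p - K * E) (x1 := p0.1) (R := 1/4) (t0 := p0.2 - 1/4) (t1 := p0.2)
    ?_ ?_ ?_ ?_ p0 (by simp [nsq, dot]) (by linarith) le_rfl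
  · have e1 : η p0 = 1 := by simp [hη, nsq, dot, tim]
    rw [e1, max_eq_left h0, max_eq_left (by norm_num : (0:ℝ) ≤ 1), one_mul] at key
    have : 0 ≤ K * S p0 := mul_nonneg hKp.le (Finset.sum_nonneg fun i _ => sq_nonneg _)
    linarith
  · intro p h1 h2 h3
    have a1 := (hηc p).continuousAt
    have a2 := (hw p h1 h2 h3).1.continuousAt
    have a3 := (hSc p h3).continuousAt
    exact (((a1.max continuousAt_const).mul (a2.max continuousAt_const)).pow 2 |>.add (continuousAt_const.mul a3)).sub continuousAt_const
  · intro p h1 h2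
    have : η p ≤ 0 := by
      have := nsq_nonneg p0.1 p
      simp only [hη, tim]; rw [h2]; linarith
    have h5 := mul_le_mul_of_nonneg_left (hE p h1 h2.ge (by linarith)) hKp.le
    rw [max_eq_right this]; simp only [zero_mul]; simp only [hS]; linarith
  · intro p h1 h2 h3
    have : η p ≤ 0 := by
      simp only [hη, tim]; rw [h1]; linarith
    have h5 := mul_le_mul_of_nonneg_left (hE p h1.le h2 h3) hKp.le
    rw [max_eq_right this]; simp only [zero_mul]; simp only [hS]; linarith
  · intro p h1 h2 h3 hpos
    have h5 := mul_le_mul_of_nonneg_left (hE p h1.le h2.le h3) hKp.le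
    have hne : 0 < (max (η p) 0 * max (w p) 0)^2 := by
      change K * S p ≤ K * E at h5
      linarith
    have hη0 : 0 < η p := by
      by_contra h; push Not at h
      rw [max_eq_right h] at hne; simp at hne
    have hw0 : 0 < w p := by
      by_contra h; push Not at h
      rw [max_eq_right h] at hne; simp at hne
    obtain ⟨hwc, hwL, hw2⟩ := hw p h1.le h2.le h3
    obtain ⟨hg, hev⟩ := hgood p h3
    set r := Dt.r (Hess u p) with hr
    have hell : Ell Dt.c0 Dt.C0 r := Dt.ell hg.2.1
    refine ⟨fun p => (η p * w p)^2 + K * S p - K * E, r, ?_, ?_, ?_⟩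
    · filter_upwards [continuousAt_const.eventually_lt (hηc p).continuousAt hη0, continuousAt_const.eventually_lt hwc.continuousAt hw0] with z z1 z2
      rw [max_eq_left z1.le, max_eq_left z2.le]
    · exact ((((hηc p).mul hwc).pow 2).add (contDiffAt_const.mul (hSc p h3))).sub contDiffAt_const
    · have c1 : ContDiffAt ℝ 2 (fun p => (η p * w p)^2) p := ((hηc p).mul hwc).pow 2
      have c2 : ContDiffAt ℝ 2 (fun p => K * S p) p := contDiffAt_const.mul (hSc p h3)
      rw [Lop_sub (f := fun p => (η p * w p)^2 + K * S p) (g := fun _ => K * E) r (c1.add c2) contDiffAt_const, Lop_const,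
        Lop_add (f := fun p => (η p * w p)^2) (g := fun p => K * S p) r c1 c2, Lop_cmul r K (hSc p h3)]
      have hprod := B0_prod r (hηc p) hwc hη0.le hw0.le hwL
      have hSL := (lfn_grad hg hev hA l).2
      rw [← hr] at hSL
      change _ ≤ Lop r S p at hSL
      set Q := ∑ i, ∑ j, ((Hess u p - A) i j)^2 with hQ
      have d1 : ContDiffAt ℝ 2 (fun p => 4 * nsq p0.1 p) p := contDiffAt_const.mul (nsq_contDiff _).contDiffAt
      have d2' : ContDiffAt ℝ 2 (fun p : En n => 4 * tim (-p0.2) p) p := contDiffAt_const.mul (tim_cd _).contDiffAt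
      have d3 : ContDiffAt ℝ 2 (fun p => 1 - 4 * nsq p0.1 p) p := contDiffAt_const.sub d1
      have hLη : Lop r η p = -(8 * ∑ k, dot (r k) (r k)) - 4 := by
        rw [hη, Lop_add (f := fun p => 1 - 4 * nsq p0.1 p) r d3 d2', Lop_sub (f := fun _ => (1:ℝ)) r contDiffAt_const d1, Lop_const,
          Lop_cmul r 4 (nsq_contDiff _).contDiffAt, Lop_cmul r 4 (tim_cd _).contDiffAt, Lop_nsq, Lop_tim]; ring
      have hdη : ∀ v : Fin n → ℝ, dd (sp v) η p = -8 * dot v (p.1 - p0.1) := by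
        intro v
        rw [hη, dd_add (f := fun p => 1 - 4 * nsq p0.1 p) (C2.d d3) (C2.d d2'), dd_sub (f := fun _ => (1:ℝ)) (by fun_prop) (C2.d d1), dd_const,
          dd_cmul 4 (C2.d (nsq_contDiff _).contDiffAt), dd_cmul 4 (C2.d (tim_cd _).contDiffAt), dd_nsq, dd_tim]; simp [sp]; ring
      have hGη : Gam2 r η η p ≤ 16 * Dt.C0 := by
        have e : Gam2 r η η p = 64 * ∑ k, (dot (r k) (p.1 - p0.1))^2 := by
          unfold Gam2; rw [Finset.mul_sum]
          exact Finset.sum_congr rfl fun k _ => by rw [hdη]; ring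
        have e2 := hell.2 (p.1 - p0.1)
        have e3 : Dt.C0 * dot (p.1 - p0.1) (p.1 - p0.1) ≤ Dt.C0 * (1/4) := mul_le_mul_of_nonneg_left h1.le hC0.le
        rw [e]; linarith
      have hη1 : η p ≤ 1 := by
        have := nsq_nonneg p0.1 p
        simp only [hη, tim]; linarith
      have htr := hell.tr
      have hLη2 : -(8 * n * Dt.C0 + 4) ≤ η p * Lop r η p := by
        have : -(8 * n * Dt.C0 + 4) ≤ Lop r η p := by rw [hLη]; linarith
        have h7 : 0 ≤ 8 * n * Dt.C0 + 4 := by positivity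
        nlinarith
      have hw2p : 0 < w p^2 := by positivity
      have m1 : -(C4 * w p^2) ≤ 2 * η p * w p ^2 * Lop r η p - 6 * w p ^2 * Gam2 r η η p := by
        have e : 2 * η p * w p ^2 * Lop r η p - 6 * w p ^2 * Gam2 r η η p = w p^2 * (2 * (η p * Lop r η p) - 6 * Gam2 r η η p) := by ring
        rw [e]
        have := mul_le_mul_of_nonneg_left (show -C4 ≤ 2 * (η p * Lop r η p) - 6 * Gam2 r η η p by rw [hC4]; linarith) hw2p.le
        linarith
      have m2 : K * (2 * Dt.c0 * Q) ≤ K * Lop r S p := mul_le_mul_of_nonneg_left hSL hKp.le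
      have m3 : K * (2 * Dt.c0 * Q) = 2 * (C4 * (C3 * Q)) := by rw [hK]; field_simp
      have m4 : C4 * w p^2 ≤ C4 * (C3 * Q) := mul_le_mul_of_nonneg_left hw2 hC4p.le
      have m5 : 0 < C4 * w p^2 := by positivity
      linarith
end B0
end

section
section B1
variable {n : ℕ} {u : En n → ℝ} {p : En n} {Dt : Data n}

lemma entry_le_sqrt (X : Mat n) (i j : Fin n) : |X i j| ≤ Real.sqrt (∑ i, ∑ j, (X i j)^2) := by
  refine Real.le_sqrt_of_sq_le ?_
  rw [sq_abs]
  exact (Finset.single_le_sum (f := fun j => (X i j)^2) (fun _ _ => sq_nonneg _) (Finset.mem_univ j)).trans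
    (Finset.single_le_sum (f := fun i => ∑ j, (X i j)^2) (fun _ _ => Finset.sum_nonneg fun _ _ => sq_nonneg _) (Finset.mem_univ i))

lemma interp {f f' f'' : ℝ → ℝ} {S C ε : ℝ} (hS : 0 < S) (hf : ∀ s ∈ Set.Icc 0 S, HasDerivAt f (f' s) s)
    (hf' : ∀ s ∈ Set.Icc 0 S, HasDerivAt f' (f'' s) s) (hb : ∀ s ∈ Set.Icc 0 S, |f'' s| ≤ C) (hε : ∀ s ∈ Set.Icc 0 S, |f s| ≤ ε) :
    |f' 0| * S ≤ 2 * ε + C * S^2 / 2 := by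
  have h1 := tay2 hf hf' (fun s hs => (abs_le.1 (hb s hs)).2) S ⟨hS.le, le_rfl⟩
  have h2 := tay2 (f := fun s => - f s) (f' := fun s => - f' s) (f'' := fun s => - f'' s) (c := C) (fun s hs => (hf s hs).neg) (fun s hs => (hf' s hs).neg)
    (fun s hs => by have := (abs_le.1 (hb s hs)).1; linarith) S ⟨hS.le, le_rfl⟩
  have h3 := abs_le.1 (hε S ⟨hS.le, le_rfl⟩)
  have h4 := abs_le.1 (hε 0 ⟨le_rfl, hS.le⟩)
  have : |f' 0| * S = |f' 0 * S| := by rw [abs_mul, abs_of_pos hS]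
  rw [this, abs_le]
  constructor <;> linarith

lemma dot_bs (i : Fin n) : dot (bs i) (bs i : Fin n → ℝ) = 1 := by simp [dot, bs, Pi.single_apply]
lemma dot_bs_l (i : Fin n) (v : Fin n → ℝ) : dot (bs i) v = v i := by simp [dot, bs, Pi.single_apply]
lemma qf_bs (A : Mat n) (i j : Fin n) : qf A (bs i) (bs j) = A i j := by simp [qf, bs, Pi.single_apply]

lemma nsq_step {x1 : Fin n → ℝ} {i : Fin n} {s : ℝ} (hp : nsq x1 p ≤ 1/4) (hs : 0 ≤ s) (hs2 : s ≤ 1/2) : nsq x1 (p + s • sp (bs i)) ≤ 1 := by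
  have e : nsq x1 (p + s • sp (bs i)) = nsq x1 p + 2 * s * (p.1 - x1) i + s^2 := by
    have e1 : (p + s • sp (bs i)).1 - x1 = (p.1 - x1) + s • bs i := by ext; simp [sp]; ring
    unfold nsq
    rw [e1, dot_add_left, dot_add_right, dot_add_right, dot_smul_l, dot_smul_l, dot_smul_r, dot_smul_r, dot_bs, dot_comm (p.1 - x1) (bs i), dot_bs_l]
    ring
  have h1 := (sq_le_dot (p.1 - x1) i).trans hp
  have h2 : (p.1 - x1) i ≤ 1/2 := by nlinarith
  rw [e]
  have h3 : s * (p.1 - x1) i ≤ 1/2 * (1/2) := by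
    have := mul_le_mul_of_nonneg_left h2 hs
    nlinarith
  nlinarith

lemma grad_interp (hu : Sol Dt u) {A : Mat n} (hA : Symm A) {C c d ε : ℝ} (hC : 0 ≤ C) (hAC : ∀ B ∈ Dt.D, ∀ i j, |(B - A) i j| ≤ C)
    (l : Fin n → ℝ) {p0 : En n} (hp0 : p0.2 ≤ 0) (hε : 0 < ε) (hε2 : ε ≤ 1/16)
    (h : ∀ p : En n, nsq p0.1 p ≤ 1 → p0.2 - 1 ≤ p.2 → p.2 ≤ p0.2 → |u p - qd A l c d p| ≤ ε)
    (hp : nsq p0.1 p ≤ 1/4) (hp1 : p0.2 - 1/4 ≤ p.2) (hp2 : p.2 ≤ p0.2) (i : Fin n) :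
    |dd (sp (bs i)) u p - lfn A (bs i) l p| ≤ (2 + C) * Real.sqrt ε := by
  set S := Real.sqrt ε with hSd
  have hS : 0 < S := Real.sqrt_pos.2 hε
  have hS2 : S^2 = ε := Real.sq_sqrt hε.le
  have hS3 : S ≤ 1/2 := by nlinarith
  have hg : ∀ s : ℝ, Good Dt u (p + s • sp (bs i)) := fun s => hu.good (by rw [sp_snd]; linarith)
  have hq : ∀ q : En n, ContDiffAt ℝ 2 (qd A l c d) q := fun q => (qd_cd A l c d).contDiffAt
  have h1 := interp (f := fun s => u (p + s • sp (bs i)) - qd A l c d (p + s • sp (bs i)))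
    (f' := fun s => dd (sp (bs i)) u (p + s • sp (bs i)) - dd (sp (bs i)) (qd A l c d) (p + s • sp (bs i)))
    (f'' := fun s => d2 (sp (bs i)) u (p + s • sp (bs i)) - d2 (sp (bs i)) (qd A l c d) (p + s • sp (bs i))) (C := C) (ε := ε) hS
    (fun s _ => (line_hasDeriv (C2.d (hg s).c2)).sub (line_hasDeriv (C2.d (hq _))))
    (fun s _ => (line_hasDeriv (C2.dd (hg s).c2)).sub (line_hasDeriv (C2.dd (hq _))))
    (fun s _ => by
      rw [d2_qd hA, ← qf_hess' (hg s).c2, qf_bs, qf_bs]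
      exact hAC _ (hg s).2.1 i i)
    (fun s hs => h _ (nsq_step hp hs.1 (hs.2.trans hS3)) (by rw [sp_snd]; linarith) (by rw [sp_snd]; linarith))
  simp only [zero_smul, add_zero, dd_qd hA] at h1
  rw [← hS2] at h1
  have h2 : |dd (sp (bs i)) u p - lfn A (bs i) l p| ≤ 2 * S + C * S / 2 := by
    by_contra hc; push Not at hc
    have := mul_lt_mul_of_pos_right hc hS
    nlinarith
  have : 0 ≤ C * S := by positivity
  linarith

theorem B1 (Dt : Data n) {C : ℝ} (hC : 0 ≤ C) : ∃ C5 > 0, ∀ (u : En n → ℝ) (A A' : Mat n) (c d ε : ℝ) (l : Fin n → ℝ) (p0 : En n),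
    Sol Dt u → Symm A → ExtD Dt A c A' → (∀ B ∈ Dt.D, ∀ i j, |(B - A) i j| ≤ C) → p0.2 ≤ 0 → 0 < ε → ε ≤ 1/16 →
    (∀ p : En n, nsq p0.1 p ≤ 1 → p0.2 - 1 ≤ p.2 → p.2 ≤ p0.2 → |u p - qd A l c d p| ≤ ε) →
    ∀ v, |qf (Hess u p0 - A) v v| ≤ C5 * Real.sqrt ε * dot v v := by
  have hc0 := Dt.c0_pos
  have hC0 := Dt.C0_pos
  set C3 : ℝ := ((n:ℝ) * (n * Dt.C0))^2 + (n:ℝ)^2 + 1 with hC3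
  have hC3p : 0 < C3 := by positivity
  set K := C3 * (16 * n * Dt.C0 + 8 + 96 * Dt.C0) / Dt.c0 with hK
  have hKp : 0 < K := by positivity
  set C6 := Real.sqrt (K * (n * (2 + C)^2)) with hC6
  have hC6n : 0 ≤ C6 := Real.sqrt_nonneg _
  have hnn : (0:ℝ) ≤ n := Nat.cast_nonneg n
  refine ⟨(C6 + 1) * (1 + (1 + n * Dt.C0) / Dt.c0), by positivity, ?_⟩
  intro u A A' c d ε l p0 hu hA hE hAC hp0 hε hε2 h
  have hg : ∀ p : En n, p.2 ≤ p0.2 → Good Dt u p := fun p hp => hu.good (hp.trans hp0)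
  set κ := C6 * Real.sqrt ε with hκ
  have hκ0 : 0 ≤ κ := by positivity
  have hκ2 : κ^2 = K * (n * ((2 + C) * Real.sqrt ε)^2) := by
    rw [hκ, mul_pow, mul_pow, hC6, Real.sq_sqrt (by positivity)]; ring
  have hgrad : ∀ p : En n, nsq p0.1 p ≤ 1/4 → p0.2 - 1/4 ≤ p.2 → p.2 ≤ p0.2 →
      ∑ i, (dd (sp (bs i)) u p - lfn A (bs i) l p)^2 ≤ n * ((2 + C) * Real.sqrt ε)^2 := by
    intro p h1 h2 h3
    calc ∑ i, (dd (sp (bs i)) u p - lfn A (bs i) l p)^2 ≤ ∑ i : Fin n, ((2 + C) * Real.sqrt ε)^2 :=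
          Finset.sum_le_sum fun i _ => by
            rw [← sq_abs]
            exact pow_le_pow_left₀ (abs_nonneg _) (grad_interp hu hA hC hAC l hp0 hε hε2 h h1 h2 h3 i) 2
      _ = _ := by simp
  have hmain : ∀ w : En n → ℝ, (∀ p : En n, p.2 ≤ p0.2 → ContDiffAt ℝ 2 w p ∧ 0 ≤ Lop (Dt.r (Hess u p)) w p ∧
      w p ^2 ≤ C3 * ∑ i, ∑ j, ((Hess u p - A) i j)^2) → w p0 ≤ κ := by
    intro w hw
    rcases le_total (w p0) 0 with h0 | h0
    · exact h0.trans hκ0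
    have := B0 hu hA hC3p l hp0 w (fun p _ _ h3 => hw p h3) hgrad h0
    rw [← hK, ← hκ2] at this
    exact (pow_le_pow_iff_left₀ h0 hκ0 two_ne_zero).1 this
  have hQ : ∀ X : Mat n, (Real.sqrt (∑ i, ∑ j, (X i j)^2))^2 = ∑ i, ∑ j, (X i j)^2 := fun X =>
    Real.sq_sqrt (Finset.sum_nonneg fun i _ => Finset.sum_nonneg fun j _ => sq_nonneg _)
  have hQn : ∀ X : Mat n, 0 ≤ ∑ i, ∑ j, (X i j)^2 := fun X => Finset.sum_nonneg fun i _ => Finset.sum_nonneg fun j _ => sq_nonneg _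
  have hup : ∀ v, dot v v = 1 → qf (Hess u p0 - A) v v ≤ κ := by
    intro v hv
    rw [qf_sub, qf_hess' (hg p0 le_rfl).c2]
    refine hmain (fun p => d2 (sp v) u p - qf A v v) fun p hp => ⟨(((hg p hp).c2d2 _).sub contDiffAt_const), ?_, ?_⟩
    · rw [Lop_sub _ ((hg p hp).c2d2 _) contDiffAt_const, Lop_const, sub_zero]
      exact (lin_eq (hg p hp) (hu.ev (hp.trans hp0)) _).2.1
    · rw [← qf_hess' (hg p hp).c2, ← qf_sub]
      have := qf_abs_le (entry_le_sqrt (Hess u p - A)) v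
      rw [hv, mul_one] at this
      have h2 := pow_le_pow_left₀ (abs_nonneg _) this 2
      rw [sq_abs, mul_pow, hQ] at h2
      have := hQn (Hess u p - A)
      have h4 : (n:ℝ)^2 * ∑ i, ∑ j, ((Hess u p - A) i j)^2 ≤ C3 * ∑ i, ∑ j, ((Hess u p - A) i j)^2 :=
        mul_le_mul_of_nonneg_right (by rw [hC3]; nlinarith [sq_nonneg ((n:ℝ) * (n * Dt.C0))]) this
      linarith
  have ht : c - Dt.G (Hess u p0) ≤ κ := by
    rw [← (hg p0 le_rfl).2.2]
    refine hmain (fun p => c - dd et u p) fun p hp => ⟨contDiffAt_const.sub ((hg p hp).c2d _), ?_, ?_⟩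
    · rw [Lop_sub _ contDiffAt_const ((hg p hp).c2d _), Lop_const, (lin_eq (hg p hp) (hu.ev (hp.trans hp0)) _).1]; simp
    · rw [(hg p hp).2.2]
      have := hE.bd (Real.sqrt_nonneg _) (hg p hp).2.1 (entry_le_sqrt (Hess u p - A))
      have h2 := pow_le_pow_left₀ (abs_nonneg _) this 2
      rw [sq_abs, mul_assoc, mul_pow, hQ] at h2
      have := hQn (Hess u p - A)
      have h4 : ((n:ℝ) * (n * Dt.C0))^2 * ∑ i, ∑ j, ((Hess u p - A) i j)^2 ≤ C3 * ∑ i, ∑ j, ((Hess u p - A) i j)^2 :=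
        mul_le_mul_of_nonneg_right (by rw [hC3]; nlinarith [sq_nonneg (n:ℝ)]) this
      nlinarith
  have haa : -κ ≤ aa (Dt.r A') (Hess u p0 - A) := by
    have := hE.2.1 _ (hg p0 le_rfl).2.1
    linarith
  have hX : Symm (Hess u p0 - A) := fun i j => by
    simp only [Pi.sub_apply]; rw [hess_symm (hg p0 le_rfl).c2 i j, hA i j]
  set X := Hess u p0 - A with hXd
  obtain ⟨lam, q, he⟩ := exists_eig hX
  have hlq : ∀ i, qf X (q i) (q i) = lam i := by
    intro i; rw [he.qf_expand]; simp [he.1 _ i]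
  have hlam : ∀ i, lam i ≤ κ := fun i => by rw [← hlq]; exact hup _ (by rw [he.1 i i]; simp)
  set r := Dt.r A' with hr
  set m : Fin n → ℝ := fun i => ∑ k, (dot (r k) (q i))^2 with hm
  have hm1 : ∀ i, Dt.c0 ≤ m i := fun i => by
    have := Dt.ell1 _ hE.1 (q i); rw [he.1 i i] at this; simpa using this
  have hm2 : ∀ i, m i ≤ Dt.C0 := fun i => by
    have := Dt.ell2 _ hE.1 (q i); rw [he.1 i i] at this; simpa using this
  have haa2 : aa r X = ∑ i, lam i * m i := by
    unfold aa
    simp only [he.qf_expand, hm, Finset.mul_sum]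
    rw [Finset.sum_comm]
    exact Finset.sum_congr rfl fun i _ => Finset.sum_congr rfl fun k _ => by rw [dot_comm]; ring
  have hlow : ∀ j, -((1 + n * Dt.C0) / Dt.c0 * κ) ≤ lam j := by
    intro j
    rcases le_total 0 (lam j) with h0 | h0
    · exact le_trans (by have : 0 ≤ (1 + n * Dt.C0) / Dt.c0 * κ := by positivity
                         linarith) h0
    have h1 : aa r X ≤ lam j * m j + n * (κ * Dt.C0) := by
      rw [haa2, ← Finset.add_sum_erase _ _ (Finset.mem_univ j)]
      have : ∑ i ∈ Finset.univ.erase j, lam i * m i ≤ ∑ i ∈ Finset.univ.erase j, κ * Dt.C0 := Finset.sum_le_sum fun i _ => by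
        calc lam i * m i ≤ κ * m i := mul_le_mul_of_nonneg_right (hlam i) (hc0.le.trans (hm1 i))
          _ ≤ κ * Dt.C0 := mul_le_mul_of_nonneg_left (hm2 i) hκ0
      have h2 : ∑ i ∈ Finset.univ.erase j, κ * Dt.C0 ≤ ∑ i : Fin n, κ * Dt.C0 :=
        Finset.sum_le_sum_of_subset_of_nonneg (Finset.erase_subset _ _) fun _ _ _ => by positivity
      have h3 : ∑ i : Fin n, κ * Dt.C0 = n * (κ * Dt.C0) := by simp
      linarith
    have h2 : lam j * m j ≤ lam j * Dt.c0 := mul_le_mul_of_nonpos_left (hm1 j) h0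
    have h3 : -((1 + n * Dt.C0) * κ) ≤ lam j * Dt.c0 := by nlinarith
    have h4 : -((1 + n * Dt.C0) / Dt.c0 * κ) = -((1 + n * Dt.C0) * κ) / Dt.c0 := by ring
    rw [h4, div_le_iff₀ hc0]; exact h3
  intro v
  have hb : ∀ j, |lam j| ≤ (C6 + 1) * (1 + (1 + n * Dt.C0) / Dt.c0) * Real.sqrt ε := by
    intro j
    set P := (1 + n * Dt.C0) / Dt.c0 with hP
    have hPp : 0 ≤ P := by positivity
    have e : (C6 + 1) * (1 + P) * Real.sqrt ε = κ + P * κ + (1 + P) * Real.sqrt ε := by rw [hκ]; ring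
    have e1 : 0 ≤ (1 + P) * Real.sqrt ε := by positivity
    have e2 : 0 ≤ P * κ := by positivity
    rw [e, abs_le]; constructor <;> linarith [hlow j, hlam j]
  rw [he.qf_expand, ← he.1.sumsq v, Finset.mul_sum]
  refine (Finset.abs_sum_le_sum_abs _ _).trans (Finset.sum_le_sum fun i _ => ?_)
  rw [← pow_two, abs_mul, abs_of_nonneg (sq_nonneg (dot (q i) v))]
  exact mul_le_mul_of_nonneg_right (hb i) (sq_nonneg _)
end B1
end

section
section Rows
variable {n : ℕ}

lemma exists_rows {B : Mat n} (hB : Symm B) (hpos : ∀ v, 0 ≤ qf B v v) :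
    ∃ w : Fin n → Fin n → ℝ, ∀ X : Mat n, aa w X = ∑ i, ∑ j, B i j * X i j := by
  obtain ⟨lam, q, he⟩ := exists_eig hB
  have hl : ∀ k, 0 ≤ lam k := by
    intro k
    have := hpos (q k)
    rw [he.qf_expand] at this
    simpa [he.1 _ k] using this
  refine ⟨rowsq lam q, fun X => ?_⟩
  have hBe : ∀ i j, B i j = ∑ k, lam k * (q k i * q k j) := by
    intro i j
    rw [← qf_bs B i j, he.qf_expand]
    refine Finset.sum_congr rfl fun k _ => ?_
    rw [dot_comm, dot_bs_l, dot_comm, dot_bs_l]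
  unfold aa rowsq
  simp only [qf_smul_l, qf_smul_r]
  simp only [hBe, Finset.sum_mul, qf, Finset.mul_sum]
  rw [Finset.sum_comm]
  refine Finset.sum_congr rfl fun i _ => ?_
  rw [Finset.sum_comm]
  refine Finset.sum_congr rfl fun j _ => Finset.sum_congr rfl fun k _ => ?_
  have := Real.mul_self_sqrt (hl k)
  calc _ = (Real.sqrt (lam k) * Real.sqrt (lam k)) * (q k i * X i j * q k j) := by ring
    _ = _ := by rw [this]; ring

def am (r : Fin n → Fin n → ℝ) : Mat n := fun i j => ∑ k, r k i * r k j
lemma aa_am (r : Fin n → Fin n → ℝ) (X : Mat n) : aa r X = ∑ i, ∑ j, am r i j * X i j := by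
  unfold aa qf am
  simp only [Finset.sum_mul]
  rw [Finset.sum_comm]
  refine Finset.sum_congr rfl fun i _ => ?_
  rw [Finset.sum_comm]
  exact Finset.sum_congr rfl fun j _ => Finset.sum_congr rfl fun k _ => by ring
def ot (g : Fin n → ℝ) : Mat n := fun i j => g i * g j
lemma qf_ot (g v w : Fin n → ℝ) : qf (ot g) v w = dot v g * dot w g := by
  unfold qf ot dot
  rw [Finset.sum_mul_sum]
  exact Finset.sum_congr rfl fun i _ => Finset.sum_congr rfl fun j _ => by ring
lemma sum_ot (g : Fin n → ℝ) (X : Mat n) : ∑ i, ∑ j, ot g i j * X i j = qf X g g := by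
  unfold qf ot
  exact Finset.sum_congr rfl fun i _ => Finset.sum_congr rfl fun j _ => by ring
lemma aa_ot (r : Fin n → Fin n → ℝ) (g : Fin n → ℝ) : aa r (ot g) = ∑ k, (dot (r k) g)^2 := by
  unfold aa; exact Finset.sum_congr rfl fun k _ => by rw [qf_ot]; ring
def idm : Mat n := fun i j => if i = j then 1 else 0
lemma qf_idm (v w : Fin n → ℝ) : qf idm v w = dot v w := by simp [qf, idm, dot]
lemma aa_idm (r : Fin n → Fin n → ℝ) : aa r idm = ∑ k, dot (r k) (r k) := by
  unfold aa; exact Finset.sum_congr rfl fun k _ => by rw [qf_idm]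
lemma qf_am (r : Fin n → Fin n → ℝ) (v : Fin n → ℝ) : qf (am r) v v = ∑ k, (dot (r k) v)^2 := by
  rw [← aa_ot, aa_am, ← sum_ot]
  exact Finset.sum_congr rfl fun i _ => Finset.sum_congr rfl fun j _ => by ring
lemma am_symm (r : Fin n → Fin n → ℝ) : Symm (am r) := fun i j => Finset.sum_congr rfl fun k _ => by ring
lemma ot_symm (g : Fin n → ℝ) : Symm (ot g) := fun i j => by unfold ot; ring

lemma rows_sub_vec {r : Fin n → Fin n → ℝ} {v : Fin n → ℝ} (h : ∀ y, (dot v y)^2 ≤ ∑ k, (dot (r k) y)^2) :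
    ∃ w : Fin n → Fin n → ℝ, ∀ X : Mat n, aa w X = aa r X - qf X v v := by
  obtain ⟨w, hw⟩ := exists_rows (B := am r - ot v) (fun i j => by simp only [Pi.sub_apply]; rw [am_symm r i j, ot_symm v i j]) (fun y => by
    rw [qf_sub, qf_am, qf_ot]; have := h y; rw [dot_comm y v]; linarith [pow_two (dot v y)])
  refine ⟨w, fun X => ?_⟩
  rw [hw, aa_am, ← sum_ot]
  simp only [← Finset.sum_sub_distrib, Pi.sub_apply, sub_mul]

lemma rows_sub {rx ry : Fin n → Fin n → ℝ} {t : ℝ} (h : ∀ y, t * ∑ k, (dot (ry k) y)^2 ≤ ∑ k, (dot (rx k) y)^2) :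
    ∃ w : Fin n → Fin n → ℝ, ∀ X : Mat n, aa w X = aa rx X - t * aa ry X := by
  obtain ⟨w, hw⟩ := exists_rows (B := am rx - t • am ry) (fun i j => by
    simp only [Pi.sub_apply, Pi.smul_apply]; rw [am_symm rx i j, am_symm ry i j]) (fun y => by
    rw [qf_sub, qf_smul, qf_am, qf_am]; have := h y; linarith)
  refine ⟨w, fun X => ?_⟩
  rw [hw, aa_am, aa_am]
  simp only [Finset.mul_sum, ← Finset.sum_sub_distrib, Pi.sub_apply, sub_mul, Pi.smul_apply, smul_eq_mul, mul_assoc]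

lemma dot_cs (v w : Fin n → ℝ) : (dot v w)^2 ≤ dot v v * dot w w := by
  have := Finset.sum_mul_sq_le_sq_mul_sq Finset.univ v w
  simpa [dot, pow_two] using this

set_option maxHeartbeats 1000000 in
lemma hol_alg {rx ry : Fin n → Fin n → ℝ} {c0 C0 ω ε σ Lh B : ℝ} (hc0 : 0 < c0) (hC0 : 0 < C0) (hx : Ell c0 C0 rx) (hy : Ell c0 C0 ry)
    {T1 T2 : Mat n} {gx gy : Fin n → Fin n → Fin n → ℝ} {z : Fin n → ℝ} (hz : 0 < dot z z) (hσ : 0 < σ) (hL : 0 < Lh) (hB : 0 ≤ B)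
    (hω : ∀ v, |∑ k, (dot (rx k) v)^2 - ∑ k, (dot (ry k) v)^2| ≤ ω * dot v v) (hω0 : 0 ≤ ω)
    (hε : 0 < ε) (h1 : ω ≤ ε * c0 / 2) (h2 : n * ω ≤ c0 / 4) (h3 : ε ≤ 1/4) (h4 : ε * (n * C0) ≤ c0 / 8)
    (H : ∀ a b : Fin n → ℝ, qf T1 a a - qf T2 b b + 2 * ∑ i, ∑ j, (dot a (gx i j) - dot b (gy i j))^2
      - Lh * (σ / 2 * dot (a - b) (a - b) - 3/4 * (σ / dot z z) * (dot z (a - b))^2) - 2 * B * (dot a a + dot b b) ≤ 0) :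
    aa rx T1 - aa ry T2 + ε * c0 * (∑ i, ∑ j, dot (gx i j) (gx i j) + ∑ i, ∑ j, dot (gy i j) (gy i j)) + Lh * σ * c0 / 2 - 4 * B * (n * C0) ≤ 0 := by
  set s := dot z z with hs
  have hnn : (0:ℝ) ≤ n := Nat.cast_nonneg n
  obtain ⟨v, hv⟩ : ∃ v : Fin n → ℝ, v = Real.sqrt (c0 / s) • z := ⟨_, rfl⟩
  have hq2 : Real.sqrt (c0 / s) * Real.sqrt (c0 / s) = c0 / s := Real.mul_self_sqrt (by positivity)
  have hvv : dot v v = c0 := by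
    rw [hv, dot_smul_l, dot_smul_r, ← mul_assoc, hq2, ← hs]; field_simp
  have hzv : (dot z v)^2 = c0 * s := by
    rw [hv, dot_smul_r, mul_pow, pow_two, hq2, ← hs]; field_simp
  obtain ⟨w, hw⟩ := rows_sub_vec (r := ry) (v := v) (fun y => by
    refine (dot_cs v y).trans ?_
    rw [hvv]; exact hy.1 y)
  obtain ⟨b, hb⟩ := rows_sub (rx := rx) (ry := ry) (t := 1 - ε) (fun y => by
    have e1 := (abs_le.1 (hω y)).1
    have e2 := hy.1 y
    have e3 := dot_self_nonneg y
    have e4 : ω * dot y y ≤ ε * c0 / 2 * dot y y := mul_le_mul_of_nonneg_right h1 e3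
    have e5 : ε * (c0 * dot y y) ≤ ε * ∑ k, (dot (ry k) y)^2 := mul_le_mul_of_nonneg_left e2 hε.le
    have e6 : 0 ≤ ε * c0 * dot y y := by positivity
    linarith)
  have dz : ∀ x : Fin n → ℝ, dot x 0 = 0 := fun x => by simp [dot]
  have dz' : ∀ x : Fin n → ℝ, dot 0 x = 0 := fun x => by simp [dot]
  have qz : ∀ X : Mat n, qf X 0 0 = 0 := fun X => by simp [qf]
  -- four instances
  have i1 := H v (-v)
  have e1 : v - -v = (2:ℝ) • v := by ext; simp; ring
  have e2 : qf T2 (-v) (-v) = qf T2 v v := by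
    have : -v = (-1:ℝ) • v := by simp
    rw [this, qf_smul_l, qf_smul_r]; ring
  have e3 : dot (-v) (-v) = dot v v := by
    have : -v = (-1:ℝ) • v := by simp
    rw [this, dot_smul_l, dot_smul_r]; ring
  rw [e1, e2, e3, dot_smul_l, dot_smul_r, dot_smul_r, mul_pow, hzv, hvv] at i1
  have e4 : Lh * (σ / 2 * (2 * (2 * c0)) - 3 / 4 * (σ / s) * (2 ^ 2 * (c0 * s))) = -(Lh * σ * c0) := by field_simp; ring
  rw [e4] at i1
  have e5 : 0 ≤ 2 * ∑ i, ∑ j, (dot v (gx i j) - dot (-v) (gy i j))^2 := by positivity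
  have I1 : qf T1 v v - qf T2 v v + Lh * σ * c0 - 4 * B * c0 ≤ 0 := by linarith
  have I2 : aa w T1 - aa w T2 - 4 * B * aa w idm ≤ 0 := by
    have : ∀ k, qf T1 (w k) (w k) - qf T2 (w k) (w k) - 4 * B * dot (w k) (w k) ≤ 0 := by
      intro k
      have := H (w k) (w k)
      rw [sub_self, dz, dz] at this
      have e5 : 0 ≤ 2 * ∑ i, ∑ j, (dot (w k) (gx i j) - dot (w k) (gy i j))^2 := by positivity
      linarith
    have := Finset.sum_nonpos fun k (_ : k ∈ Finset.univ) => this k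
    rw [aa_idm]; unfold aa
    simpa [Finset.sum_sub_distrib, ← Finset.mul_sum] using this
  have I3 : aa b T1 + 2 * ∑ i, ∑ j, aa b (ot (gx i j)) - Lh * (σ / 2) * aa b idm - 2 * B * aa b idm ≤ 0 := by
    have : ∀ k, qf T1 (b k) (b k) + 2 * ∑ i, ∑ j, (dot (b k) (gx i j))^2 - Lh * (σ/2) * dot (b k) (b k) - 2 * B * dot (b k) (b k) ≤ 0 := by
      intro k
      have := H (b k) 0
      rw [sub_zero, qz, dz] at this
      simp only [dz', sub_zero, add_zero] at this
      have e5 : 0 ≤ Lh * (3 / 4 * (σ / s) * dot z (b k) ^ 2) := by positivity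
      linarith
    have := Finset.sum_nonpos fun k (_ : k ∈ Finset.univ) => this k
    rw [aa_idm]
    simp only [aa_ot]
    have e : ∑ i, ∑ j, ∑ k, (dot (b k) (gx i j))^2 = ∑ k, ∑ i, ∑ j, (dot (b k) (gx i j))^2 := by
      rw [Finset.sum_comm]
      conv_lhs => enter [2, j]; rw [Finset.sum_comm]
      rw [Finset.sum_comm]
      refine Finset.sum_congr rfl fun k _ => ?_
      rw [Finset.sum_comm]
    rw [e]; unfold aa
    simpa [Finset.sum_sub_distrib, Finset.sum_add_distrib, ← Finset.mul_sum] using this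
  have I4 : - aa ry T2 + 2 * ∑ i, ∑ j, aa ry (ot (gy i j)) - Lh * (σ / 2) * aa ry idm - 2 * B * aa ry idm ≤ 0 := by
    have : ∀ k, - qf T2 (ry k) (ry k) + 2 * ∑ i, ∑ j, (dot (ry k) (gy i j))^2 - Lh * (σ/2) * dot (ry k) (ry k) - 2 * B * dot (ry k) (ry k) ≤ 0 := by
      intro k
      have := H 0 (ry k)
      have e0 : (0 : Fin n → ℝ) - ry k = (-1:ℝ) • ry k := by simp
      rw [e0, qz, dz, dot_smul_l, dot_smul_r, dot_smul_r] at this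
      simp only [dz', zero_sub, neg_sq, zero_add] at this
      have e5 : 0 ≤ Lh * (3 / 4 * (σ / s) * (-1 * dot z (ry k)) ^ 2) := by positivity
      linarith
    have := Finset.sum_nonpos fun k (_ : k ∈ Finset.univ) => this k
    rw [aa_idm]
    simp only [aa_ot]
    have e : ∑ i, ∑ j, ∑ k, (dot (ry k) (gy i j))^2 = ∑ k, ∑ i, ∑ j, (dot (ry k) (gy i j))^2 := by
      rw [Finset.sum_comm]
      conv_lhs => enter [2, j]; rw [Finset.sum_comm]
      rw [Finset.sum_comm]
      refine Finset.sum_congr rfl fun k _ => ?_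
      rw [Finset.sum_comm]
    rw [e]; unfold aa
    simpa [Finset.sum_sub_distrib, Finset.sum_add_distrib, ← Finset.mul_sum] using this
  -- square terms
  have S3 : ε * c0 / 2 * ∑ i, ∑ j, dot (gx i j) (gx i j) ≤ ∑ i, ∑ j, aa b (ot (gx i j)) := by
    rw [Finset.mul_sum]; refine Finset.sum_le_sum fun i _ => ?_
    rw [Finset.mul_sum]; refine Finset.sum_le_sum fun j _ => ?_
    rw [hb, aa_ot, aa_ot]
    set y := gx i j
    have e1 := (abs_le.1 (hω y)).1
    have e2 := hy.1 y
    have e3 := dot_self_nonneg y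
    have e4 : ω * dot y y ≤ ε * c0 / 2 * dot y y := mul_le_mul_of_nonneg_right h1 e3
    have e5 : ε * (c0 * dot y y) ≤ ε * ∑ k, (dot (ry k) y)^2 := mul_le_mul_of_nonneg_left e2 hε.le
    linarith
  have S4 : c0 * ∑ i, ∑ j, dot (gy i j) (gy i j) ≤ ∑ i, ∑ j, aa ry (ot (gy i j)) := by
    rw [Finset.mul_sum]; refine Finset.sum_le_sum fun i _ => ?_
    rw [Finset.mul_sum]; refine Finset.sum_le_sum fun j _ => ?_
    rw [aa_ot]; exact hy.1 _
  have hgyn : 0 ≤ ∑ i, ∑ j, dot (gy i j) (gy i j) := Finset.sum_nonneg fun i _ => Finset.sum_nonneg fun j _ => dot_self_nonneg _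
  have tx : aa rx idm ≤ n * C0 := by rw [aa_idm]; exact hx.tr
  have ty : aa ry idm ≤ n * C0 := by rw [aa_idm]; exact hy.tr
  have ty0 : 0 ≤ aa ry idm := by rw [aa_idm]; exact Finset.sum_nonneg fun k _ => dot_self_nonneg _
  have txy : aa rx idm - aa ry idm ≤ n * ω := by
    have e : ∀ r : Fin n → Fin n → ℝ, aa r idm = ∑ i, ∑ k, (dot (r k) (bs i))^2 := by
      intro r; rw [aa_idm, Finset.sum_comm]
      refine Finset.sum_congr rfl fun k _ => ?_
      simp only [dot_comm (r k), dot_bs_l]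
      exact Finset.sum_congr rfl fun i _ => by ring
    rw [e, e, ← Finset.sum_sub_distrib]
    calc _ ≤ ∑ i : Fin n, ω := Finset.sum_le_sum fun i _ => by
          have := (abs_le.1 (hω (bs i))).2; rwa [dot_bs, mul_one] at this
      _ = _ := by simp
  -- combine
  have J1 := mul_le_mul_of_nonneg_left I1 (show 0 ≤ 1 - ε by linarith)
  have J2 := mul_le_mul_of_nonneg_left I2 (show 0 ≤ 1 - ε by linarith)
  have J4 := mul_le_mul_of_nonneg_left I4 hε.le
  have hS4 := mul_le_mul_of_nonneg_left S4 hε.le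
  rw [hw, hw, hw, qf_idm, hvv] at J2
  rw [hb, hb] at I3
  have hσL : 0 < Lh * σ := by positivity
  have bb : aa rx idm - (1 - ε) * aa ry idm ≤ c0/4 + c0/8 := by nlinarith
  have m1 : Lh * σ * (aa rx idm - (1 - ε) * aa ry idm) ≤ Lh * σ * (c0/4 + c0/8) := mul_le_mul_of_nonneg_left bb hσL.le
  have m2 : Lh * σ * (ε * aa ry idm) ≤ Lh * σ * (c0 / 8) := mul_le_mul_of_nonneg_left (by nlinarith) hσL.le
  have m3 : Lh * σ * (c0 * ε) ≤ Lh * σ * (c0 * (1/4)) := mul_le_mul_of_nonneg_left (by nlinarith) hσL.le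
  have m4 : B * aa rx idm ≤ B * (n * C0) := mul_le_mul_of_nonneg_left tx hB
  have m5 : B * aa ry idm ≤ B * (n * C0) := mul_le_mul_of_nonneg_left ty hB
  have m6 : 0 ≤ ε * (c0 * ∑ i, ∑ j, dot (gy i j) (gy i j)) := by positivity
  linarith [J1, J2, J4, I3, S3, hS4, m1, m2, m3, m4, m5, m6]
end Rows
end

section
lemma Jt.rpow {f : ℝ → ℝ} {a b c : ℝ} (h : Jt f a b c) (ha : 0 < a) :
    Jt (fun s => (f s) ^ (1/4:ℝ)) (a ^ (1/4:ℝ)) (1/4 * a ^ (-3/4:ℝ) * b)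
      (1/4 * a ^ (-3/4:ℝ) * c - 3/16 * (a ^ (-3/4:ℝ) / a) * b^2) := by
  obtain ⟨h0, rfl, rfl, rfl⟩ := h
  have hi : ContDiffAt ℝ 2 (fun x : ℝ => x ^ (1/4:ℝ)) (f 0) := Real.contDiffAt_rpow_const_of_ne ha.ne'
  have d1 : ∀ x : ℝ, 0 < x → deriv (fun x : ℝ => x ^ (1/4:ℝ)) x = 1/4 * x ^ (-3/4:ℝ) := by
    intro x hx
    rw [Real.deriv_rpow_const]; norm_num
  have d2' : deriv (deriv (fun x : ℝ => x ^ (1/4:ℝ))) (f 0) = - 3/16 * ((f 0) ^ (-3/4:ℝ) / f 0) := by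
    have : deriv (fun x : ℝ => x ^ (1/4:ℝ)) =ᶠ[𝓝 (f 0)] fun x => 1/4 * x ^ (-3/4:ℝ) := by
      filter_upwards [lt_mem_nhds ha] with x hx using d1 x hx
    rw [this.deriv_eq, deriv_const_mul_field, Real.deriv_rpow_const, Real.rpow_sub ha, Real.rpow_one]
    ring
  refine ⟨h0.rpow_const_of_ne ha.ne', rfl, ?_, ?_⟩
  · rw [dd_comp (φ := fun x => x ^ (1/4:ℝ)) (C2.d hi) (C2.d h0), d1 _ ha]
  · rw [d2_comp (φ := fun x => x ^ (1/4:ℝ)) hi h0, d1 _ ha, d2']; ring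

section Hol
variable {n : ℕ}

def hf (Lh B : ℝ) (F : Fin n → Fin n → En n → ℝ) (p q : En n) : ℝ :=
  ∑ i, ∑ j, (F i j p - F i j (q.1, p.2))^2 - Lh * (nsq q.1 p) ^ (1/4:ℝ) - B * (nsq 0 p + nsq 0 q - p.2)

lemma hol_second {Lh B : ℝ} {F : Fin n → Fin n → En n → ℝ} {x y : Fin n → ℝ} {t : ℝ}
    (hx : ∀ i j, ContDiffAt ℝ 2 (F i j) (x, t)) (hy : ∀ i j, ContDiffAt ℝ 2 (F i j) (y, t))
    (hz : 0 < dot (x - y) (x - y)) (a b : Fin n → ℝ)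
    (hm : ∀ᶠ s : ℝ in 𝓝 0, hf Lh B F ((x, t) + s • sp a) ((y, t) + s • sp b) ≤ hf Lh B F (x, t) (y, t)) :
    ∑ i, ∑ j, 2 * (F i j (x,t) - F i j (y,t)) * d2 (sp a) (F i j) (x,t)
     - ∑ i, ∑ j, 2 * (F i j (x,t) - F i j (y,t)) * d2 (sp b) (F i j) (y,t)
     + 2 * ∑ i, ∑ j, (dot a (grd (F i j) (x,t)) - dot b (grd (F i j) (y,t)))^2
      - Lh * ((dot (x-y) (x-y)) ^ (-3/4:ℝ) / 2 * dot (a - b) (a - b) - 3/4 * ((dot (x-y) (x-y)) ^ (-3/4:ℝ) / dot (x-y) (x-y)) * (dot (x-y) (a - b))^2)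
      - 2 * B * (dot a a + dot b b) ≤ 0 := by
  have J1 : ∀ i j, Jt (fun s : ℝ => F i j ((x,t) + s • sp a) - F i j ((y,t) + s • sp b)) _ _ _ :=
    fun i j => (Jt.line (hx i j)).sub (Jt.line (hy i j))
  have J2 := Jt.sum Finset.univ fun i => Jt.sum Finset.univ fun j => (J1 i j).mul (J1 i j)
  have J3 := (Jt.line (g := nsq (0 : Fin n → ℝ)) (p := ((x - y, 0) : En n)) (v := sp (a - b)) (nsq_contDiff 0).contDiffAt).rpow
    (by simpa [nsq] using hz)
  have J4 := (Jt.line (g := nsq (0 : Fin n → ℝ)) (p := ((x, t) : En n)) (v := sp a) (nsq_contDiff 0).contDiffAt).add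
    (Jt.line (g := nsq (0 : Fin n → ℝ)) (p := ((y, t) : En n)) (v := sp b) (nsq_contDiff 0).contDiffAt)
  have J5 := (J2.sub (J3.cmul Lh)).sub ((J4.sub (Jt.const t)).cmul B)
  have J6 := J5.cmul (-1)
  have key := J6.nonneg (by
    filter_upwards [hm] with s hs
    have e : ∀ s : ℝ, ((((∑ i, ∑ j, (F i j ((x, t) + s • sp a) - F i j ((y, t) + s • sp b)) * (F i j ((x, t) + s • sp a) - F i j ((y, t) + s • sp b))) -
      Lh * nsq (0 : Fin n → ℝ) ((x - y, 0) + s • sp (a - b)) ^ (1 / 4:ℝ)) -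
      B * (nsq (0 : Fin n → ℝ) ((x, t) + s • sp a) + nsq (0 : Fin n → ℝ) ((y, t) + s • sp b) - t))) = hf Lh B F ((x, t) + s • sp a) ((y, t) + s • sp b) := by
      intro s
      have e1 : nsq (0 : Fin n → ℝ) ((x - y, 0) + s • sp (a - b)) = nsq ((y, t) + s • sp b : En n).1 ((x, t) + s • sp a) := by
        unfold nsq; congr 1 <;> (ext i; simp [sp]; ring)
      have e2 : (((y, t) + s • sp b : En n).1, ((x, t) + s • sp a : En n).2) = ((y, t) + s • sp b : En n) := by
        simp [sp]
      have e3 : ((x, t) + s • sp a : En n).2 = t := by simp [sp]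
      unfold hf
      rw [e1, e2, e3]
      simp only [pow_two]
    have e0 := e 0
    simp only [zero_smul, add_zero] at e0
    simp only [e]
    simpa using hs)
  have n0 : nsq (0 : Fin n → ℝ) ((x - y, 0) : En n) = dot (x - y) (x - y) := by simp [nsq]
  simp only [d2_nsq, dd_nsq, n0, sub_zero] at key
  simp only [dd_sp'] at key
  have e7 : dot (a - b) (x - y) = dot (x - y) (a - b) := dot_comm _ _
  rw [e7] at key
  have e8 : ∑ i, ∑ j, ((d2 (sp a) (F i j) (x, t) - d2 (sp b) (F i j) (y, t)) * (F i j (x, t) - F i j (y, t)) +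
      2 * ((dot a (grd (F i j) (x, t)) - dot b (grd (F i j) (y, t))) * (dot a (grd (F i j) (x, t)) - dot b (grd (F i j) (y, t)))) +
      (F i j (x, t) - F i j (y, t)) * (d2 (sp a) (F i j) (x, t) - d2 (sp b) (F i j) (y, t))) = 
      ∑ i, ∑ j, 2 * (F i j (x,t) - F i j (y,t)) * d2 (sp a) (F i j) (x,t)
     - ∑ i, ∑ j, 2 * (F i j (x,t) - F i j (y,t)) * d2 (sp b) (F i j) (y,t)
     + 2 * ∑ i, ∑ j, (dot a (grd (F i j) (x,t)) - dot b (grd (F i j) (y,t)))^2 := by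
    simp only [Finset.mul_sum, ← Finset.sum_sub_distrib, ← Finset.sum_add_distrib]
    exact Finset.sum_congr rfl fun i _ => Finset.sum_congr rfl fun j _ => by ring
  rw [e8] at key
  linarith

lemma hol_time {Lh B : ℝ} {F : Fin n → Fin n → En n → ℝ} {x y : Fin n → ℝ} {t : ℝ}
    (hx : ∀ i j, ContDiffAt ℝ 2 (F i j) (x, t)) (hy : ∀ i j, ContDiffAt ℝ 2 (F i j) (y, t))
    (hm : ∃ δ > 0, ∀ s : ℝ, -δ ≤ s → s ≤ 0 → hf Lh B F ((x, t) + s • et) ((y, t) + s • et) ≤ hf Lh B F (x, t) (y, t)) :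
    0 ≤ ∑ i, ∑ j, 2 * (F i j (x,t) - F i j (y,t)) * (dd et (F i j) (x,t) - dd et (F i j) (y,t)) + B := by
  have J1 : ∀ i j, Jt (fun s : ℝ => F i j ((x,t) + s • et) - F i j ((y,t) + s • et)) _ _ _ :=
    fun i j => (Jt.line (hx i j)).sub (Jt.line (hy i j))
  have J2 := Jt.sum Finset.univ fun i => Jt.sum Finset.univ fun j => (J1 i j).mul (J1 i j)
  have J3 := J2.add (Jt.id.cmul B)
  have key := max_left (v := (1:ℝ)) (C2.d J3.1) (by
    obtain ⟨δ, hδ, hm⟩ := hm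
    refine ⟨δ, hδ, fun s h1 h2 => ?_⟩
    have := hm s h1 h2
    have e1 : nsq ((y, t) + s • et : En n).1 ((x, t) + s • et) = nsq y (x, t) := by simp [nsq, et]
    have e2 : (((y, t) + s • et : En n).1, ((x, t) + s • et : En n).2) = ((y, t) + s • et : En n) := by
      simp [et]
    have e3 : nsq 0 ((x, t) + s • et : En n) = nsq 0 ((x,t) : En n) := by simp [nsq, et]
    have e4 : nsq 0 ((y, t) + s • et : En n) = nsq 0 ((y,t) : En n) := by simp [nsq, et]
    have e5 : ((x, t) + s • et : En n).2 = t + s := by simp [et]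
    unfold hf at this
    rw [e1, e2, e3, e4, e5] at this
    simp only [zero_add, smul_eq_mul, mul_one, zero_smul, add_zero, mul_zero, ← pow_two]
    linarith)
  rw [J3.2.2.1] at key
  have e8 : ∑ i, ∑ j, ((dd et (F i j) (x, t) - dd et (F i j) (y, t)) * (F i j (x, t) - F i j (y, t)) +
      (F i j (x, t) - F i j (y, t)) * (dd et (F i j) (x, t) - dd et (F i j) (y, t))) = 
      ∑ i, ∑ j, 2 * (F i j (x,t) - F i j (y,t)) * (dd et (F i j) (x,t) - dd et (F i j) (y,t)) :=
    Finset.sum_congr rfl fun i _ => Finset.sum_congr rfl fun j _ => by ring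
  rw [e8] at key; linarith
end Hol
end

section
section Hol2
variable {n : ℕ} {Dt : Data n} {u : En n → ℝ} {p : En n}

lemma d2_ev (h : Good Dt u p) (i j) : d2 (sp (ev i j)) u p = Hess u p i i + 2 * Hess u p i j + Hess u p j j := by
  unfold ev; rw [sp_add, d2_add_dir h.c2]; rfl
lemma hess_ev (h : Good Dt u p) (i j) :
    Hess u p i j = 1/2 * (d2 (sp (ev i j)) u p - 1/4 * d2 (sp (ev i i)) u p - 1/4 * d2 (sp (ev j j)) u p) := by
  rw [d2_ev h, d2_ev h, d2_ev h]; ring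

lemma third_ev (hp : Good Dt u p) (hev : ∀ᶠ q in 𝓝 p, Good Dt u q) (v : En n) (i j) :
    dd v (dd (sp (bs i)) (dd (sp (bs j)) u)) p = 1/2 * (dd v (d2 (sp (ev i j)) u) p - 1/4 * dd v (d2 (sp (ev i i)) u) p
      - 1/4 * dd v (d2 (sp (ev j j)) u) p) := by
  have e : dd (sp (bs i)) (dd (sp (bs j)) u) =ᶠ[𝓝 p] fun q => 1/2 * (d2 (sp (ev i j)) u q - 1/4 * d2 (sp (ev i i)) u q - 1/4 * d2 (sp (ev j j)) u q) := by
    filter_upwards [hev] with q hq using hess_ev hq i j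
  have c : ∀ a b, DifferentiableAt ℝ (d2 (sp (ev a b)) u) p := fun a b => C2.d (hp.c2d2 _)
  rw [dd_congr e, dd_cmul (f := fun q => d2 (sp (ev i j)) u q - 1/4 * d2 (sp (ev i i)) u q - 1/4 * d2 (sp (ev j j)) u q) _
      (((c i j).sub ((c i i).const_mul _)).sub ((c j j).const_mul _)),
    dd_sub (f := fun q => d2 (sp (ev i j)) u q - 1/4 * d2 (sp (ev i i)) u q) ((c i j).sub ((c i i).const_mul _)) ((c j j).const_mul _),
    dd_sub (c i j) ((c i i).const_mul _), dd_cmul _ (c i i), dd_cmul _ (c j j)]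

lemma third_bd (hp : Good Dt u p) (hev : ∀ᶠ q in 𝓝 p, Good Dt u q) {W : ℝ}
    (hW : ∀ i j, dot (grd (d2 (sp (ev i j)) u) p) (grd (d2 (sp (ev i j)) u) p) ≤ W) (a b : Fin n) :
    ∑ i, ∑ j, (dd (sp (ev a b)) (dd (sp (bs i)) (dd (sp (bs j)) u)) p)^2 ≤ n * n * (3 * W) := by
  have h1 : ∀ k i j : Fin n, |dd (sp (bs k)) (d2 (sp (ev i j)) u) p| ≤ Real.sqrt W := fun k i j =>
    Real.abs_le_sqrt ((pow_two _).trans_le ((sq_le_dot (grd (d2 (sp (ev i j)) u) p) k).trans (hW i j)))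
  have h2 : ∀ i j : Fin n, |dd (sp (ev a b)) (d2 (sp (ev i j)) u) p| ≤ 2 * Real.sqrt W := by
    intro i j
    unfold ev
    rw [sp_add, dd_add_dir]
    have := abs_add_le (dd (sp (bs a)) (d2 (sp (bs i + bs j)) u) p) (dd (sp (bs b)) (d2 (sp (bs i + bs j)) u) p)
    have e1 := h1 a i j
    have e2 := h1 b i j
    unfold ev at e1 e2
    linarith
  have h3 : ∀ i j : Fin n, (dd (sp (ev a b)) (dd (sp (bs i)) (dd (sp (bs j)) u)) p)^2 ≤ 3 * W := by
    intro i j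
    have hW0 : 0 ≤ W := (dot_self_nonneg _).trans (hW i j)
    have hs := Real.sq_sqrt hW0
    have hs0 := Real.sqrt_nonneg W
    have e1 := abs_le.1 (h2 i j)
    have e2 := abs_le.1 (h2 i i)
    have e3 := abs_le.1 (h2 j j)
    have : |dd (sp (ev a b)) (dd (sp (bs i)) (dd (sp (bs j)) u)) p| ≤ 3/2 * Real.sqrt W := by
      rw [third_ev hp hev, abs_le]; constructor <;> linarith
    rw [← sq_abs]
    have e4 := abs_nonneg (dd (sp (ev a b)) (dd (sp (bs i)) (dd (sp (bs j)) u)) p)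
    nlinarith
  calc _ ≤ ∑ i : Fin n, ∑ j : Fin n, 3 * W := Finset.sum_le_sum fun i _ => Finset.sum_le_sum fun j _ => h3 i j
    _ = _ := by simp; ring

lemma Lop_sum_bd (hp : Good Dt u p) (hev : ∀ᶠ q in 𝓝 p, Good Dt u q) :
    ∑ a, ∑ b, Lop (Dt.r (Hess u p)) (d2 (sp (ev a b)) u) p ≤ 6 * Dt.CL * (n:ℝ)^4 *
      ∑ i, ∑ j, dot (grd (d2 (sp (ev i j)) u) p) (grd (d2 (sp (ev i j)) u) p) := by
  set W := ∑ i, ∑ j, dot (grd (d2 (sp (ev i j)) u) p) (grd (d2 (sp (ev i j)) u) p) with hWd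
  have hW : ∀ i j, dot (grd (d2 (sp (ev i j)) u) p) (grd (d2 (sp (ev i j)) u) p) ≤ W := by
    intro i j
    have h1 := Finset.single_le_sum (f := fun j => dot (grd (d2 (sp (ev i j)) u) p) (grd (d2 (sp (ev i j)) u) p)) (fun j _ => dot_self_nonneg _) (Finset.mem_univ j)
    have h2 := Finset.single_le_sum (f := fun i => ∑ j, dot (grd (d2 (sp (ev i j)) u) p) (grd (d2 (sp (ev i j)) u) p)) (fun i _ => Finset.sum_nonneg fun j _ => dot_self_nonneg _) (Finset.mem_univ i)
    exact h1.trans h2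
  calc _ ≤ ∑ a : Fin n, ∑ b : Fin n, 2 * Dt.CL * (n * n * (3 * W)) := Finset.sum_le_sum fun a _ => Finset.sum_le_sum fun b _ => by
        refine (lin_eq hp hev _).2.2.trans ?_
        have := third_bd hp hev hW a b
        have := Dt.CL_pos
        gcongr
    _ = _ := by simp; ring

lemma ip_tri (A B C : Mat n) : ip (A - B) (A - B) ≤ 2 * ip (A - C) (A - C) + 2 * ip (B - C) (B - C) := by
  unfold ip
  simp only [Finset.mul_sum, ← Finset.sum_add_distrib]
  refine Finset.sum_le_sum fun i _ => Finset.sum_le_sum fun j _ => ?_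
  simp only [Pi.sub_apply]
  nlinarith [sq_nonneg (A i j - C i j + (B i j - C i j))]

lemma hess_diff {q : En n} (hp : Good Dt u p) (hq : Good Dt u q) {κ : ℝ} (hκ : 0 ≤ κ)
    (h : ∀ i j, |d2 (sp (ev i j)) u p - d2 (sp (ev i j)) u q| ≤ κ) : ‖Hess u p - Hess u q‖ ≤ κ := by
  refine (pi_norm_le_iff_of_nonneg hκ).2 fun i => (pi_norm_le_iff_of_nonneg hκ).2 fun j => ?_
  rw [Real.norm_eq_abs]
  simp only [Pi.sub_apply]
  rw [hess_ev hp, hess_ev hq]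
  have e1 := abs_le.1 (h i j)
  have e2 := abs_le.1 (h i i)
  have e3 := abs_le.1 (h j j)
  rw [abs_le]; constructor <;> linarith
end Hol2
end

section
section Hol3
variable {n : ℕ} {Dt : Data n} {u : En n → ℝ}

lemma qf_sum {ι : Type*} (s : Finset ι) (f : ι → Mat n) (v w : Fin n → ℝ) : qf (∑ i ∈ s, f i) v w = ∑ i ∈ s, qf (f i) v w := by
  classical
  induction s using Finset.induction with
  | empty => simp [qf]
  | insert a s ha ih => rw [Finset.sum_insert ha, Finset.sum_insert ha, qf_add, ih]
lemma aa_sum {ι : Type*} (s : Finset ι) (f : ι → Mat n) (r) : aa r (∑ i ∈ s, f i) = ∑ i ∈ s, aa r (f i) := by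
  unfold aa; simp only [qf_sum]; rw [Finset.sum_comm]

set_option maxHeartbeats 1000000 in
lemma hol_pt (hu : Sol Dt u) {κ0 ε Lh B : ℝ} {x y : Fin n → ℝ} {t : ℝ} (ht : t ≤ 0) (hκ : 0 < κ0) (hε : 0 < ε) (hL : 0 < Lh) (hB : 0 ≤ B)
    (hΔ : ∀ i j, |d2 (sp (ev i j)) u (x,t) - d2 (sp (ev i j)) u (y,t)| ≤ 2 * κ0)
    (hz : 0 < dot (x - y) (x - y)) (hz4 : dot (x - y) (x - y) ≤ 4)
    (h1 : 2 * Dt.CL * κ0 ≤ ε * Dt.c0 / 2) (h2 : n * (2 * Dt.CL * κ0) ≤ Dt.c0 / 4) (h3 : ε ≤ 1/4) (h4 : ε * (n * Dt.C0) ≤ Dt.c0 / 8)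
    (h5 : 24 * κ0 * Dt.CL * (n:ℝ)^4 ≤ ε * Dt.c0) (h6 : B * (4 * (n * Dt.C0) + 1) < Lh * Dt.c0 / 8)
    (hm : ∀ a b, ∀ᶠ s : ℝ in 𝓝 0, hf Lh B (fun i j => d2 (sp (ev i j)) u) ((x, t) + s • sp a) ((y, t) + s • sp b) ≤ hf Lh B (fun i j => d2 (sp (ev i j)) u) (x, t) (y, t))
    (hmt : ∃ δ > 0, ∀ s : ℝ, -δ ≤ s → s ≤ 0 → hf Lh B (fun i j => d2 (sp (ev i j)) u) ((x, t) + s • et) ((y, t) + s • et) ≤ hf Lh B (fun i j => d2 (sp (ev i j)) u) (x, t) (y, t)) : False := by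
  have hc0 := Dt.c0_pos
  have hC0 := Dt.C0_pos
  have hCL := Dt.CL_pos
  have gx : Good Dt u (x,t) := hu.good ht
  have gy : Good Dt u (y,t) := hu.good ht
  have ex := hu.ev (p := (x,t)) ht
  have ey := hu.ev (p := (y,t)) ht
  have cx : ∀ i j, ContDiffAt ℝ 2 (d2 (sp (ev i j)) u) (x,t) := fun i j => gx.c2d2 _
  have cy : ∀ i j, ContDiffAt ℝ 2 (d2 (sp (ev i j)) u) (y,t) := fun i j => gy.c2d2 _
  set Δ : Fin n → Fin n → ℝ := fun i j => d2 (sp (ev i j)) u (x,t) - d2 (sp (ev i j)) u (y,t) with hΔd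
  set s := dot (x - y) (x - y) with hs
  set σ := s ^ (-3/4:ℝ) with hσd
  have hσ : 0 < σ := Real.rpow_pos_of_pos hz _
  have hσ4 : 1/4 ≤ σ := by
    have e1 : (4:ℝ) ^ (-3/4:ℝ) ≤ σ := Real.rpow_le_rpow_of_nonpos hz hz4 (by norm_num)
    have e2 : (4:ℝ) ^ (-1:ℝ) ≤ (4:ℝ) ^ (-3/4:ℝ) := Real.rpow_le_rpow_of_exponent_le (by norm_num) (by norm_num)
    have e3 : (4:ℝ) ^ (-1:ℝ) = 1/4 := by rw [Real.rpow_neg_one]; norm_num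
    linarith
  set T1 : Mat n := ∑ i, ∑ j, (2 * Δ i j) • Hess (d2 (sp (ev i j)) u) (x,t) with hT1
  set T2 : Mat n := ∑ i, ∑ j, (2 * Δ i j) • Hess (d2 (sp (ev i j)) u) (y,t) with hT2
  have q1 : ∀ a, qf T1 a a = ∑ i, ∑ j, 2 * Δ i j * d2 (sp a) (d2 (sp (ev i j)) u) (x,t) := by
    intro a; rw [hT1, qf_sum]; refine Finset.sum_congr rfl fun i _ => ?_
    rw [qf_sum]; exact Finset.sum_congr rfl fun j _ => by rw [qf_smul, qf_hess' (cx i j)]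
  have q2 : ∀ a, qf T2 a a = ∑ i, ∑ j, 2 * Δ i j * d2 (sp a) (d2 (sp (ev i j)) u) (y,t) := by
    intro a; rw [hT2, qf_sum]; refine Finset.sum_congr rfl fun i _ => ?_
    rw [qf_sum]; exact Finset.sum_congr rfl fun j _ => by rw [qf_smul, qf_hess' (cy i j)]
  set rx := Dt.r (Hess u (x,t)) with hrx
  set ry := Dt.r (Hess u (y,t)) with hry
  have hω : ∀ v, |∑ k, (dot (rx k) v)^2 - ∑ k, (dot (ry k) v)^2| ≤ (2 * Dt.CL * κ0) * dot v v := by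
    intro v
    refine (Dt.lip _ gx.2.1 _ gy.2.1 v).trans ?_
    have := hess_diff gx gy (by positivity) hΔ
    have e := dot_self_nonneg v
    refine mul_le_mul_of_nonneg_right ?_ e
    nlinarith
  have alg := hol_alg (rx := rx) (ry := ry) (T1 := T1) (T2 := T2) (ω := 2 * Dt.CL * κ0) (ε := ε) (σ := σ) (Lh := Lh) (B := B)
    (gx := fun i j => grd (d2 (sp (ev i j)) u) (x,t)) (gy := fun i j => grd (d2 (sp (ev i j)) u) (y,t)) (z := x - y)
    hc0 hC0 (Dt.ell gx.2.1) (Dt.ell gy.2.1) hz hσ hL hB hω (by positivity) hε h1 h2 h3 h4 (fun a b => by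
      have := hol_second cx cy hz a b (hm a b)
      rw [q1, q2]
      exact this)
  have tm := hol_time cx cy hmt
  have a1 : aa rx T1 = ∑ i, ∑ j, 2 * Δ i j * (Lop rx (d2 (sp (ev i j)) u) (x,t) + dd et (d2 (sp (ev i j)) u) (x,t)) := by
    rw [hT1, aa_sum]; refine Finset.sum_congr rfl fun i _ => ?_
    rw [aa_sum]; exact Finset.sum_congr rfl fun j _ => by rw [aa_smul, Lop_eq (cx i j)]; ring
  have a2 : aa ry T2 = ∑ i, ∑ j, 2 * Δ i j * (Lop ry (d2 (sp (ev i j)) u) (y,t) + dd et (d2 (sp (ev i j)) u) (y,t)) := by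
    rw [hT2, aa_sum]; refine Finset.sum_congr rfl fun i _ => ?_
    rw [aa_sum]; exact Finset.sum_congr rfl fun j _ => by rw [aa_smul, Lop_eq (cy i j)]; ring
  have a3 : aa rx T1 - aa ry T2 ≥ ∑ i, ∑ j, 2 * Δ i j * (dd et (d2 (sp (ev i j)) u) (x,t) - dd et (d2 (sp (ev i j)) u) (y,t))
      - 4 * κ0 * (∑ i, ∑ j, Lop rx (d2 (sp (ev i j)) u) (x,t) + ∑ i, ∑ j, Lop ry (d2 (sp (ev i j)) u) (y,t)) := by
    rw [a1, a2]
    simp only [Finset.mul_sum, ← Finset.sum_sub_distrib, ← Finset.sum_add_distrib]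
    refine Finset.sum_le_sum fun i _ => Finset.sum_le_sum fun j _ => ?_
    have l1 := (lin_eq gx ex (sp (ev i j))).2.1
    have l2 := (lin_eq gy ey (sp (ev i j))).2.1
    rw [← hrx] at l1
    rw [← hry] at l2
    have d := abs_le.1 (hΔ i j)
    have d1 : 0 ≤ (2 * κ0 + Δ i j) * Lop rx (d2 (sp (ev i j)) u) (x,t) := mul_nonneg (by simp only [hΔd]; linarith) l1
    have d2 : 0 ≤ (2 * κ0 - Δ i j) * Lop ry (d2 (sp (ev i j)) u) (y,t) := mul_nonneg (by simp only [hΔd]; linarith) l2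
    linarith
  have b1 := Lop_sum_bd gx ex
  have b2 := Lop_sum_bd gy ey
  set Wx := ∑ i, ∑ j, dot (grd (d2 (sp (ev i j)) u) (x,t)) (grd (d2 (sp (ev i j)) u) (x,t)) with hWx
  set Wy := ∑ i, ∑ j, dot (grd (d2 (sp (ev i j)) u) (y,t)) (grd (d2 (sp (ev i j)) u) (y,t)) with hWy
  have hWx0 : 0 ≤ Wx := Finset.sum_nonneg fun i _ => Finset.sum_nonneg fun j _ => dot_self_nonneg _
  have hWy0 : 0 ≤ Wy := Finset.sum_nonneg fun i _ => Finset.sum_nonneg fun j _ => dot_self_nonneg _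
  have b3 := mul_le_mul_of_nonneg_left b1 (show 0 ≤ 4 * κ0 by positivity)
  have b4 := mul_le_mul_of_nonneg_left b2 (show 0 ≤ 4 * κ0 by positivity)
  have b5 := mul_le_mul_of_nonneg_right h5 hWx0
  have b6 := mul_le_mul_of_nonneg_right h5 hWy0
  have b7 : Lh * Dt.c0 / 2 * (1/4) ≤ Lh * Dt.c0 / 2 * σ := mul_le_mul_of_nonneg_left hσ4 (by positivity)
  rw [← hrx] at b3
  rw [← hry] at b4
  have tm' : 0 ≤ ∑ i, ∑ j, 2 * Δ i j * (dd et (d2 (sp (ev i j)) u) (x,t) - dd et (d2 (sp (ev i j)) u) (y,t)) + B := tm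
  have alg' : aa rx T1 - aa ry T2 + ε * Dt.c0 * (Wx + Wy) + Lh * σ * Dt.c0 / 2 - 4 * B * (n * Dt.C0) ≤ 0 := alg
  clear_value T1 T2 Wx Wy σ
  linarith

set_option maxHeartbeats 1000000 in
theorem HOL (Dt : Data n) : ∃ κ0 > 0, ∃ C1 > 0, ∀ u (γ : Mat n), Sol Dt u →
    (∀ p : En n, nsq 0 p ≤ 1 → -1 ≤ p.2 → p.2 ≤ 0 → ip (g0 Dt u p - γ) (g0 Dt u p - γ) ≤ κ0^2) →
    ∀ y, dot y y ≤ 1 → ip (g0 Dt u (y,0) - g0 Dt u (0,0)) (g0 Dt u (y,0) - g0 Dt u (0,0)) ≤ C1 * (dot y y) ^ (1/4:ℝ) := by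
  have hc0 := Dt.c0_pos
  have hC0 := Dt.C0_pos
  have hCL := Dt.CL_pos
  have hn : (0:ℝ) ≤ n := Nat.cast_nonneg n
  obtain ⟨ε, hε, e1, e2⟩ : ∃ ε > 0, ε ≤ 1/4 ∧ ε * (n * Dt.C0) ≤ Dt.c0 / 8 := by
    refine ⟨min (1/4) (Dt.c0 / (8 * (n * Dt.C0 + 1))), by positivity, min_le_left _ _, ?_⟩
    calc _ ≤ Dt.c0 / (8 * (n * Dt.C0 + 1)) * (n * Dt.C0 + 1) := mul_le_mul (min_le_right _ _) (by linarith) (by positivity) (by positivity)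
      _ = _ := by field_simp
  obtain ⟨κ0, hκ, k1, k2, k3⟩ : ∃ κ0 > 0, 2 * Dt.CL * κ0 ≤ ε * Dt.c0 / 2 ∧ n * (2 * Dt.CL * κ0) ≤ Dt.c0 / 4 ∧
      24 * κ0 * Dt.CL * (n:ℝ)^4 ≤ ε * Dt.c0 := by
    set X := 24 * Dt.CL * ((n:ℝ)^4 + n + 1) with hX
    have hX0 : 0 < X := by positivity
    have hn4 : 0 ≤ (n:ℝ)^4 := by positivity
    have k0 : ε * Dt.c0 / X * X = ε * Dt.c0 := by field_simp
    have hk : 0 < ε * Dt.c0 / X := by positivity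
    have m1 : 0 ≤ ε * Dt.c0 / X * Dt.CL * (n:ℝ)^4 := by positivity
    have m2 : 0 ≤ ε * Dt.c0 / X * Dt.CL * n := by positivity
    have m3 : 0 ≤ ε * Dt.c0 / X * Dt.CL := by positivity
    rw [hX] at k0
    rw [← hX] at k0
    have k0' : ε * Dt.c0 / X * (24 * Dt.CL * ((n:ℝ)^4 + n + 1)) = ε * Dt.c0 := k0
    refine ⟨ε * Dt.c0 / X, hk, ?_, ?_, ?_⟩
    · nlinarith
    · nlinarith
    · nlinarith
  obtain ⟨B, hB⟩ : ∃ B, B = 4 * κ0^2 := ⟨_, rfl⟩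
  have hB0 : 0 < B := by rw [hB]; positivity
  obtain ⟨Lh, hL0, hL⟩ : ∃ Lh > 0, B * (4 * (n * Dt.C0) + 1) < Lh * Dt.c0 / 8 := by
    refine ⟨(B * (4 * (n * Dt.C0) + 1) + 1) * 8 / Dt.c0, by positivity, ?_⟩
    have : (B * (4 * (n * Dt.C0) + 1) + 1) * 8 / Dt.c0 * Dt.c0 / 8 = B * (4 * (n * Dt.C0) + 1) + 1 := by field_simp
    rw [this]; linarith
  refine ⟨κ0, hκ, Lh + B, by positivity, fun u γ hu hflat y hy => ?_⟩
  set F : Fin n → Fin n → En n → ℝ := fun i j => d2 (sp (ev i j)) u with hF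
  set S : Set (En n) := {p : En n | nsq 0 p ≤ 1 ∧ -1 ≤ p.2 ∧ p.2 ≤ 0} with hS
  have hSc : IsCompact S := cyl_compact 0 1 (-1) 0
  have hΔ : ∀ x y : Fin n → ℝ, ∀ t : ℝ, nsq 0 ((x,t) : En n) ≤ 1 → nsq 0 ((y,t) : En n) ≤ 1 → -1 ≤ t → t ≤ 0 →
      ip (g0 Dt u (x,t) - g0 Dt u (y,t)) (g0 Dt u (x,t) - g0 Dt u (y,t)) ≤ B := by
    intro x y t h1 h2 h3 h4
    have := ip_tri (g0 Dt u (x,t)) (g0 Dt u (y,t)) γ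
    have a1 := hflat (x,t) h1 h3 h4
    have a2 := hflat (y,t) h2 h3 h4
    linarith
  have hsum : ∀ p q : En n, ∑ i, ∑ j, (F i j p - F i j q)^2 = ip (g0 Dt u p - g0 Dt u q) (g0 Dt u p - g0 Dt u q) := by
    intro p q; unfold ip g0
    refine Finset.sum_congr rfl fun i _ => Finset.sum_congr rfl fun j _ => ?_
    simp only [Pi.sub_apply, hF]; ring
  have hcont : ContinuousOn (fun z : En n × En n => hf Lh B F z.1 z.2) (S ×ˢ S) := by
    rintro ⟨p, q⟩ ⟨hp, hq⟩
    refine ContinuousAt.continuousWithinAt ?_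
    unfold hf
    have c : ∀ i j, ∀ p : En n, p.2 ≤ 0 → ContinuousAt (F i j) p := fun i j p h => ((hu.good h).c2d2 _).continuousAt
    have c1 : ∀ i j, ContinuousAt (fun z : En n × En n => F i j z.1) (p, q) := fun i j =>
      ContinuousAt.comp (f := Prod.fst) (c i j p hp.2.2) continuousAt_fst
    have c2 : ∀ i j, ContinuousAt (fun z : En n × En n => F i j (z.2.1, z.1.2)) (p, q) := fun i j =>
      ContinuousAt.comp (g := F i j) (f := fun z : En n × En n => (z.2.1, z.1.2)) (c i j (q.1, p.2) hp.2.2) (by fun_prop)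
    have c3 : Continuous (fun z : En n × En n => nsq z.2.1 z.1) := by unfold nsq dot; fun_prop
    have c4 : Continuous (fun z : En n × En n => nsq 0 z.1 + nsq 0 z.2 - z.1.2) := by unfold nsq dot; fun_prop
    have c5 : Continuous (fun z : En n × En n => (nsq z.2.1 z.1)^(1/4:ℝ)) := c3.rpow_const (fun _ => Or.inr (by norm_num))
    refine ((ContinuousAt.sub ?_ ((continuous_const.mul c5).continuousAt)).sub ((continuous_const.mul c4).continuousAt))
    exact tendsto_finsetSum _ fun i _ => tendsto_finsetSum _ fun j _ => ((c1 i j).sub (c2 i j)).pow 2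
  have h00 : ((0,0) : En n) ∈ S := by simp [hS, nsq, dot]
  have hy0 : ((y,0) : En n) ∈ S := by simp [hS, nsq, hy]
  have main : ∀ p ∈ S, ∀ q ∈ S, hf Lh B F p q ≤ 0 := by
    intro p hp q hq
    obtain ⟨⟨⟨x, t⟩, ⟨y, t'⟩⟩, ⟨hX, hY⟩, hmax⟩ := (hSc.prod hSc).exists_isMaxOn ⟨(p, q), hp, hq⟩ hcont
    refine le_trans (hmax (a := (p,q)) ⟨hp, hq⟩) ?_
    by_contra hpos
    push Not at hpos
    simp only at hX hY hpos
    obtain ⟨x1, x2, x3⟩ := hX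
    obtain ⟨y1, y2, y3⟩ := hY
    simp only at x2 x3 y2 y3
    have hyt : ((y,t) : En n) ∈ S := ⟨y1, x2, x3⟩
    have hv : hf Lh B F (x,t) (y,t') = ip (g0 Dt u (x,t) - g0 Dt u (y,t)) (g0 Dt u (x,t) - g0 Dt u (y,t)) - Lh * (dot (x-y) (x-y)) ^ (1/4:ℝ)
        - B * (dot x x + dot y y - t) := by
      rw [← hsum]; simp [hf, nsq]
    have hnx : nsq 0 ((x,t) : En n) = dot x x := by simp [nsq]
    have hny : nsq 0 ((y,t') : En n) = dot y y := by simp [nsq]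
    have hny' : nsq 0 ((y,t) : En n) = dot y y := by simp [nsq]
    have hD := hΔ x y t x1 (by rw [hny', ← hny]; exact y1) x2 x3
    rw [hv] at hpos
    have hzz := dot_self_nonneg (x - y)
    have hr : 0 ≤ Lh * (dot (x-y) (x-y)) ^ (1/4:ℝ) := by positivity
    have hxx := dot_self_nonneg x
    have hyy := dot_self_nonneg y
    have hlt : dot x x + dot y y - t < 1 := by
      by_contra hcon
      push Not at hcon
      nlinarith
    have hz : 0 < dot (x - y) (x - y) := by
      rcases hzz.lt_or_eq with h | h
      · exact h
      · exfalso
        have hxy : x = y := by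
          funext i
          have e := sq_le_dot (x - y) i
          rw [← h] at e
          have : (x - y) i = 0 := by nlinarith
          simpa [sub_eq_zero] using this
        rw [hxy] at hpos
        have e0 : ip (g0 Dt u (y,t) - g0 Dt u (y,t)) (g0 Dt u (y,t) - g0 Dt u (y,t)) = 0 := by simp [ip]
        rw [e0] at hpos
        have hr' : 0 ≤ Lh * (dot (y-y) (y-y)) ^ (1/4:ℝ) := mul_nonneg hL0.le (Real.rpow_nonneg (dot_self_nonneg _) _)
        nlinarith
    have hz4 : dot (x - y) (x - y) ≤ 4 := by
      have e1 := dot_self_nonneg (x + y)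
      have e2 : dot (x - y) (x - y) + dot (x + y) (x + y) = 2 * dot x x + 2 * dot y y := by
        unfold dot; simp only [Finset.mul_sum, ← Finset.sum_add_distrib]
        exact Finset.sum_congr rfl fun i _ => by simp only [Pi.add_apply, Pi.sub_apply]; ring
      linarith
    have hvv : hf Lh B F (x,t) (y,t') = hf Lh B F (x,t) (y,t) := by simp [hf, nsq]
    refine hol_pt hu (x := x) (y := y) (t := t) x3 hκ hε hL0 hB0.le (fun i j => ?_) hz hz4 k1 k2 e1 e2 k3 hL (fun a b => ?_) ?_
    · have := abs_entry_le (A := g0 Dt u (x,t) - g0 Dt u (y,t)) (ε := 2 * κ0) (by positivity) (by linarith) i j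
      simpa [g0] using this
    · have c1 : ∀ᶠ s : ℝ in 𝓝 0, nsq 0 ((x,t) + s • sp a : En n) < 1 :=
        ((nsq_continuous 0).comp (by fun_prop : Continuous fun s : ℝ => ((x,t) + s • sp a : En n))).continuousAt.eventually_lt continuousAt_const (by simp [nsq]; linarith)
      have c2 : ∀ᶠ s : ℝ in 𝓝 0, nsq 0 ((y,t) + s • sp b : En n) < 1 :=
        ((nsq_continuous 0).comp (by fun_prop : Continuous fun s : ℝ => ((y,t) + s • sp b : En n))).continuousAt.eventually_lt continuousAt_const (by simp [nsq]; linarith)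
      filter_upwards [c1, c2] with s h1 h2
      rw [← hvv]
      refine hmax (a := ((x,t) + s • sp a, (y,t) + s • sp b)) ⟨⟨h1.le, ?_, ?_⟩, ⟨h2.le, ?_, ?_⟩⟩ <;> simpa [sp]
    · refine ⟨t + 1, by linarith, fun s h1 h2 => ?_⟩
      rw [← hvv]
      refine hmax (a := ((x,t) + s • et, (y,t) + s • et)) ⟨⟨?_, ?_, ?_⟩, ⟨?_, ?_, ?_⟩⟩
      · simpa [nsq, et] using x1
      · simp [et]; linarith
      · simp [et]; linarith
      · simpa [nsq, et] using y1
      · simp [et]; linarith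
      · simp [et]; linarith
  have := main _ hy0 _ h00
  have hv : hf Lh B F (y,0) (0,0) = ip (g0 Dt u (y,0) - g0 Dt u (0,0)) (g0 Dt u (y,0) - g0 Dt u (0,0)) - Lh * (dot y y) ^ (1/4:ℝ)
        - B * (dot y y) := by
    rw [← hsum]; simp [hf, nsq, dot]
  rw [hv] at this
  have hr : dot y y ≤ (dot y y) ^ (1/4:ℝ) := by
    have := Real.rpow_le_rpow_of_exponent_ge' (dot_self_nonneg y) hy (by norm_num : (0:ℝ) ≤ 1/4) (by norm_num : (1/4:ℝ) ≤ 1)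
    simpa using this
  nlinarith
end Hol3
end

section
section Lat
lemma mvt1 {f f' : ℝ → ℝ} {a b C : ℝ} (hf : ∀ s, HasDerivAt f (f' s) s) (hb : ∀ s ∈ Set.uIcc a b, |f' s| ≤ C) : |f b - f a| ≤ C * |b - a| := by
  have := (convex_uIcc a b).norm_image_sub_le_of_norm_hasDerivWithin_le (f := f) (f' := f') (C := C)
    (fun s _ => (hf s).hasDerivWithinAt) (fun s hs => by rw [Real.norm_eq_abs]; exact hb s hs) Set.left_mem_uIcc Set.right_mem_uIcc
  simpa [Real.norm_eq_abs] using this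

lemma mvt2 {f f' : ℝ → ℝ} {a b C : ℝ} (hf : ∀ s, HasDerivAt f (f' s) s) (hb : ∀ s ∈ Set.uIcc a b, |f' s - f' a| ≤ C) :
    |f b - f a - (b - a) * f' a| ≤ C * |b - a| := by
  have := mvt1 (f := fun s => f s - s * f' a) (f' := fun s => f' s - f' a) (a := a) (b := b) (C := C)
    (fun s => by
      have := (hf s).sub ((hasDerivAt_id s).mul_const (f' a))
      simp only [one_mul] at this
      exact this) hb
  have e : f b - f a - (b - a) * f' a = f b - b * f' a - (f a - a * f' a) := by ring
  rw [e]; exact this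

lemma lat1 {f f' f'' : ℝ → ℝ} {C h S ε : ℝ} (hf : ∀ s, HasDerivAt f (f' s) s) (hf' : ∀ s, HasDerivAt f' (f'' s) s)
    (hC : ∀ s, |f'' s| ≤ C) (hh : 0 < h) (hS : 0 ≤ S) (hε : 0 ≤ ε)
    (hd : ∀ s, 0 ≤ s → s ≤ S → |f (s + h) + f (s - h) - 2 * f s| ≤ ε * h^2) : |f' S - f' 0| ≤ S * ε + 3 * C * h := by
  have hC0 : 0 ≤ C := (abs_nonneg _).trans (hC 0)
  have d1 : ∀ a b, |f' b - f' a| ≤ C * |b - a| := fun a b => mvt1 hf' (fun s _ => hC s)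
  have d2 : ∀ s, |f (s + h) - f s - h * f' s| ≤ C * h * h := by
    intro s
    have := mvt2 (a := s) (b := s + h) (C := C * h) hf (fun r hr => by
      refine (d1 s r).trans ?_
      refine mul_le_mul_of_nonneg_left ?_ hC0
      rw [Set.uIcc_of_le (by linarith)] at hr
      rw [abs_of_nonneg (by linarith [hr.1])]; linarith [hr.2])
    rwa [add_sub_cancel_left, abs_of_pos hh] at this
  have d3 : ∀ k : ℕ, (k:ℝ) * h ≤ S → |(f (k * h + h) - f (k * h)) - (f h - f 0)| ≤ k * (ε * h^2) := by
    intro k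
    induction k with
    | zero => intro _; simp
    | succ k ih =>
      intro hk
      push_cast at hk ⊢
      have i1 := ih (by linarith)
      have i2 := hd ((k + 1) * h) (by positivity) hk
      have e1 : ((k:ℝ) + 1) * h - h = k * h := by ring
      have e2 : (k:ℝ) * h + h = (k + 1) * h := by ring
      rw [e1] at i2
      rw [e2] at i1
      rw [abs_le] at *
      constructor <;> linarith [i1.1, i1.2, i2.1, i2.2]
  set N := ⌊S / h⌋₊ with hN
  have hN1 : (N:ℝ) * h ≤ S := by
    have := Nat.floor_le (show 0 ≤ S / h by positivity)
    rwa [le_div_iff₀ hh] at this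
  have hN2 : S - N * h ≤ h := by
    have := Nat.lt_floor_add_one (S / h)
    rw [div_lt_iff₀ hh] at this
    linarith
  have a1 := d3 N hN1
  have a2 := d2 (N * h)
  have a3 := d2 0
  rw [zero_add] at a3
  have a4 : |f' S - f' (N * h)| ≤ C * h := (d1 _ _).trans (mul_le_mul_of_nonneg_left (by rw [abs_of_nonneg (by linarith)]; exact hN2) hC0)
  have a5 : (N:ℝ) * (ε * h^2) ≤ S * ε * h := by
    have : (N * h) * (ε * h) ≤ S * (ε * h) := mul_le_mul_of_nonneg_right hN1 (by positivity)
    linarith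
  have a6 : h * |f' (N * h) - f' 0| ≤ h * (S * ε + 2 * C * h) := by
    rw [← abs_of_pos hh, ← abs_mul, abs_of_pos hh]
    rw [abs_le] at *
    constructor <;> nlinarith [a1.1, a1.2, a2.1, a2.2, a3.1, a3.2]
  have a7 := le_of_mul_le_mul_left a6 hh
  rw [abs_le] at *
  constructor <;> linarith [a4.1, a4.2, a7.1, a7.2]

variable {n : ℕ}
lemma norm_bs (i : Fin n) : ‖(bs i : Fin n → ℝ)‖ ≤ 1 := by
  refine (pi_norm_le_iff_of_nonneg (by norm_num)).2 fun j => ?_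
  unfold bs; rw [Pi.single_apply]; split_ifs <;> simp

lemma norm_add_bs (x : Fin n → ℝ) (s : ℝ) (i : Fin n) : ‖x + s • bs i‖ ≤ ‖x‖ + |s| := by
  refine (norm_add_le _ _).trans ?_
  rw [norm_smul, Real.norm_eq_abs]
  have := mul_le_mul_of_nonneg_left (norm_bs i) (abs_nonneg s)
  linarith

lemma lat3 {Y : (Fin n → ℝ) → ℝ} {P : Fin n → (Fin n → ℝ) → ℝ} {R ω : ℝ}
    (hY : ∀ x i s, HasDerivAt (fun s : ℝ => Y (x + s • bs i)) (P i (x + s • bs i)) s)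
    (E1 : ∀ x i (s : ℝ), ‖x‖ ≤ 2 * R → |s| ≤ R → |P i (x + s • bs i) - P i x| ≤ ω)
    (E2 : ∀ x i j (s : ℝ), ‖x‖ ≤ 2 * R → |s| ≤ R → |P i (x + s • (bs i + bs j)) + P j (x + s • (bs i + bs j)) - P i x - P j x| ≤ ω)
    {x : Fin n → ℝ} {s : ℝ} (hx : ‖x‖ ≤ R) (hs : |s| ≤ R) (i j : Fin n) : |P j (x + s • bs i) - P j x| ≤ 4 * ω := by
  have hR : 0 ≤ R := (abs_nonneg s).trans hs
  rcases eq_or_ne s 0 with rfl | h0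
  · have := E1 x i 0 (by linarith) (by simpa)
    have h2 : 0 ≤ ω := (abs_nonneg _).trans this
    simpa using h2
  have hadd : ∀ a b : Fin n, x + s • (bs a + bs b) = x + s • bs a + s • bs b := fun a b => by rw [smul_add, add_assoc]
  have hcm : x + s • bs j + s • bs i = x + s • bs i + s • (bs j : Fin n → ℝ) := by rw [add_assoc, add_assoc, add_comm (s • bs j)]
  have n1 : ∀ a : Fin n, ‖x + s • bs a‖ ≤ 2 * R := fun a => (norm_add_bs x s a).trans (by linarith)
  have T : ∀ y : Fin n → ℝ, ‖y‖ ≤ 2 * R → ∀ a : Fin n, |Y (y + s • bs a) - Y y - s * P a y| ≤ ω * |s| := by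
    intro y hy a
    have := mvt2 (f := fun s : ℝ => Y (y + s • bs a)) (a := 0) (b := s) (C := ω) (hY y a) (fun r hr => by
      simp only [zero_smul, add_zero]
      refine E1 y a r hy ?_
      rcases le_total 0 s with h | h
      · rw [Set.uIcc_of_le h] at hr; rw [abs_of_nonneg hr.1]; exact hr.2.trans ((le_abs_self s).trans hs)
      · rw [Set.uIcc_of_ge h] at hr; rw [abs_of_nonpos hr.2]; linarith [hr.1, neg_abs_le s])
    simpa using this
  have t1 := T x (by linarith) j
  have t2 := T (x + s • bs i) (n1 i) j
  have t3 := T x (by linarith) i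
  have t4 := T (x + s • bs j) (n1 j) i
  rw [hcm] at t4
  have f1 := E2 x i j s (by linarith) hs
  rw [hadd] at f1
  have f2 := E1 (x + s • bs i) j s (n1 i) hs
  have f3 := E1 (x + s • bs j) i s (n1 j) hs
  rw [hcm] at f3
  have sp : 0 < |s| := abs_pos.2 h0
  have g1 : |s| * |(P j (x + s • bs i) - P j x) - (P i (x + s • bs j) - P i x)| ≤ |s| * (4 * ω) := by
    rw [← abs_mul]
    rw [abs_le] at t1 t2 t3 t4 ⊢
    constructor <;> linarith [t1.1, t1.2, t2.1, t2.2, t3.1, t3.2, t4.1, t4.2]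
  have g2 := le_of_mul_le_mul_left g1 sp
  have : 0 ≤ ω := (abs_nonneg _).trans f1
  rw [abs_le] at *
  constructor <;> linarith [g2.1, g2.2, f1.1, f1.2, f2.1, f2.2, f3.1, f3.2]

lemma lat4 {Y : (Fin n → ℝ) → ℝ} {P : Fin n → (Fin n → ℝ) → ℝ} {R ω : ℝ} (hR : 0 ≤ R)
    (hY : ∀ x i s, HasDerivAt (fun s : ℝ => Y (x + s • bs i)) (P i (x + s • bs i)) s)
    (E1 : ∀ x i (s : ℝ), ‖x‖ ≤ 2 * R → |s| ≤ R → |P i (x + s • bs i) - P i x| ≤ ω)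
    (E2 : ∀ x i j (s : ℝ), ‖x‖ ≤ 2 * R → |s| ≤ R → |P i (x + s • (bs i + bs j)) + P j (x + s • (bs i + bs j)) - P i x - P j x| ≤ ω)
    (hω : 0 ≤ ω) {x : Fin n → ℝ} (hx : ‖x‖ ≤ R) : |Y x - Y 0 - ∑ i, x i * P i 0| ≤ n * (4 * n + 1) * R * ω := by
  have hxi : ∀ i, |x i| ≤ R := fun i => by
    have := norm_le_pi_norm x i; rw [Real.norm_eq_abs] at this; exact this.trans hx
  have key : ∀ S : Finset (Fin n), (‖∑ i ∈ S, x i • (bs i : Fin n → ℝ)‖ ≤ R) ∧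
      (∀ j, |P j (∑ i ∈ S, x i • (bs i : Fin n → ℝ)) - P j 0| ≤ S.card * (4 * ω)) ∧
      |Y (∑ i ∈ S, x i • (bs i : Fin n → ℝ)) - Y 0 - ∑ i ∈ S, x i * P i 0| ≤ S.card * ((4 * n + 1) * R * ω) := by
    intro S
    induction S using Finset.induction with
    | empty => simp [hR]
    | insert a S ha ih =>
      obtain ⟨i1, i2, i3⟩ := ih
      rw [Finset.sum_insert ha, Finset.sum_insert ha, Finset.card_insert_of_notMem ha, add_comm (x a • bs a)]
      set y := ∑ i ∈ S, x i • (bs i : Fin n → ℝ) with hy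
      push_cast
      have b1 := fun j => lat3 hY E1 E2 i1 (hxi a) a j
      refine ⟨?_, fun j => ?_, ?_⟩
      · refine (pi_norm_le_iff_of_nonneg hR).2 fun k => ?_
        have : (y + x a • bs a) k = ∑ i ∈ insert a S, x i * (bs i : Fin n → ℝ) k := by
          rw [Finset.sum_insert ha, hy]; simp [Finset.sum_apply]; ring
        rw [this]
        have e : ∑ i ∈ insert a S, x i * (bs i : Fin n → ℝ) k = if k ∈ insert a S then x k else 0 := by
          simp [bs, Pi.single_apply]
        rw [e]; split_ifs
        · exact hxi k
        · simpa using hR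
      · have := b1 j
        have c := i2 j
        rw [abs_le] at *
        constructor <;> linarith [this.1, this.2, c.1, c.2]
      · have := mvt2 (f := fun s : ℝ => Y (y + s • bs a)) (a := 0) (b := x a) (C := ω) (hY y a) (fun r hr => by
          simp only [zero_smul, add_zero]
          refine E1 y a r (by linarith) ?_
          have h' := hxi a
          rcases le_total 0 (x a) with h | h
          · rw [Set.uIcc_of_le h] at hr; rw [abs_of_nonneg hr.1]; exact hr.2.trans ((le_abs_self _).trans h')
          · rw [Set.uIcc_of_ge h] at hr; rw [abs_of_nonpos hr.2]; linarith [hr.1, neg_abs_le (x a)])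
        simp only [sub_zero, zero_smul, add_zero] at this
        have hcard : (S.card : ℝ) ≤ n := by
          have := Finset.card_le_univ S; simp at this; exact_mod_cast this
        have m1 : |x a * P a y - x a * P a 0| ≤ R * (n * (4 * ω)) := by
          rw [← mul_sub, abs_mul]
          refine mul_le_mul (hxi a) ((i2 a).trans ?_) (abs_nonneg _) hR
          gcongr
        have m2 : ω * |x a| ≤ ω * R := mul_le_mul_of_nonneg_left (hxi a) hω
        have := this.trans m2
        rw [abs_le] at *
        constructor <;> linarith [this.1, this.2, i3.1, i3.2, m1.1, m1.2]
  have e : ∑ i, x i • (bs i : Fin n → ℝ) = x := by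
    funext k; simp [bs, Finset.sum_apply, Pi.single_apply]
  have := (key Finset.univ).2.2
  rw [e] at this
  simp only [Finset.card_univ, Fintype.card_fin] at this
  linarith
end Lat
end

section
section Lat2
variable {n : ℕ} {Dt : Data n} {u : En n → ℝ} {M : ℝ}

lemma norm_ev (i j : Fin n) : ‖(ev i j : Fin n → ℝ)‖ ≤ 2 := by
  unfold ev; refine (norm_add_le _ _).trans ?_; linarith [norm_bs i, norm_bs j]
lemma norm_add_ev (x : Fin n → ℝ) (s : ℝ) (i j : Fin n) : ‖x + s • ev i j‖ ≤ ‖x‖ + 2 * |s| := by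
  refine (norm_add_le _ _).trans ?_
  rw [norm_smul, Real.norm_eq_abs]
  have := mul_le_mul_of_nonneg_left (norm_ev i j) (abs_nonneg s)
  linarith
lemma pt_sp (x : Fin n → ℝ) (t s : ℝ) (v : Fin n → ℝ) : ((x, t) : En n) + s • sp v = (x + s • v, t) := by
  simp [sp]

lemma lat2 (hu : Sol Dt u) {A γ : Mat n} (hA : Symm A) {C h R ε t0 : ℝ} (hC : 0 ≤ C) (hh : 0 < h) (hR : 0 ≤ R) (hε : 0 ≤ ε)
    (hAC : ∀ B ∈ Dt.D, ∀ i j, |(B - A) i j| ≤ C) (hγ : ∀ i j, qf A (ev i j) (ev i j) = γ i j - 4 * Dt.CL) (ht : t0 ≤ 0)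
    (hg : ∀ x : Fin n → ℝ, ‖x‖ ≤ 6 * R → ∀ i j, |gh Dt u h (x, t0) i j - γ i j| ≤ ε) (c : ℝ) :
    ∃ l d, ∀ x : Fin n → ℝ, ‖x‖ ≤ R → |u (x, t0) - qd A l c d (x, t0)| ≤ n * (4 * n + 1) * R * (R * ε + 12 * C * h) := by
  set y : En n → ℝ := fun p => u p - qd A 0 0 0 p with hy
  have hcu : ∀ p : En n, p.2 ≤ 0 → ContDiffAt ℝ 2 u p := fun p hp => (hu.good hp).c2
  have hcy : ∀ p : En n, p.2 ≤ 0 → ContDiffAt ℝ 2 y p := fun p hp => (hcu p hp).sub (qd_cd A 0 0 0).contDiffAt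
  have hd2 : ∀ p : En n, p.2 ≤ 0 → ∀ i j, |d2 (sp (ev i j)) y p| ≤ 4 * C := by
    intro p hp i j
    rw [hy, d2_sub (f := u) (hcu p hp) (qd_cd A 0 0 0).contDiffAt, d2_qd hA, ← qf_hess' (hcu p hp), ← qf_sub]
    refine (qf_abs_le' (hAC _ (hu.good hp).2.1) _ _).trans ?_
    have h1 := sum_abs_ev i j
    have h0 : 0 ≤ ∑ k, |ev i j k| := Finset.sum_nonneg fun k _ => abs_nonneg _
    nlinarith [mul_le_mul h1 h1 h0 (by norm_num)]
  have hDq : ∀ p : En n, ∀ i j, Dh h (ev i j) (qd A 0 0 0) p = γ i j - 4 * Dt.CL := by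
    intro p i j
    refine le_antisymm (Dh_le hh (fun s _ => (qd_cd A 0 0 0).contDiffAt) fun s _ => ?_) (le_Dh hh (fun s _ => (qd_cd A 0 0 0).contDiffAt) fun s _ => ?_)
    · rw [d2_qd hA, hγ]
    · rw [d2_qd hA, hγ]
  have hDy : ∀ x : Fin n → ℝ, ‖x‖ ≤ 6 * R → ∀ i j, |Dh h (ev i j) y (x, t0)| ≤ ε := by
    intro x hx i j
    have e : Dh h (ev i j) y (x, t0) = Dh h (ev i j) u (x, t0) - Dh h (ev i j) (qd A 0 0 0) (x, t0) := by
      unfold Dh; rw [hy]; ring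
    have := hg x hx i j
    rw [e, hDq]
    unfold gh at this
    convert this using 2; ring
  have step0 : ∀ x : Fin n → ℝ, ∀ i j, ∀ S : ℝ, 0 ≤ S → ‖x‖ + 2 * S ≤ 6 * R →
      |dd (sp (ev i j)) y (x + S • ev i j, t0) - dd (sp (ev i j)) y (x, t0)| ≤ S * ε + 3 * (4 * C) * h := by
    intro x i j S hS hx
    have hsn : ∀ s : ℝ, (((x, t0) : En n) + s • sp (ev i j)).2 ≤ 0 := fun s => by rw [sp_snd]; exact ht
    have := lat1 (f := fun s => y ((x, t0) + s • sp (ev i j))) (f' := fun s => dd (sp (ev i j)) y ((x, t0) + s • sp (ev i j)))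
      (f'' := fun s => d2 (sp (ev i j)) y ((x, t0) + s • sp (ev i j))) (C := 4 * C) (h := h) (S := S) (ε := ε)
      (fun s => line_hasDeriv (C2.d (hcy _ (hsn s)))) (fun s => line_hasDeriv (C2.dd (hcy _ (hsn s))))
      (fun s => hd2 _ (hsn s) i j) hh hS hε (fun s h0 h1 => by
        have := hDy (x + s • ev i j) ((norm_add_ev x s i j).trans (by rw [abs_of_nonneg h0]; linarith)) i j
        unfold Dh at this
        rw [abs_div, abs_of_pos (by positivity : 0 < h^2), div_le_iff₀ (by positivity), ← pt_sp] at this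
        have e1 : ((x, t0) : En n) + (s + h) • sp (ev i j) = (x, t0) + s • sp (ev i j) + h • sp (ev i j) := by rw [add_smul, add_assoc]
        have e2 : ((x, t0) : En n) + (s - h) • sp (ev i j) = (x, t0) + s • sp (ev i j) + (-h) • sp (ev i j) := by
          rw [add_assoc, ← add_smul, sub_eq_add_neg]
        simp only [e1, e2]
        exact this)
    simpa [pt_sp] using this
  have step : ∀ x : Fin n → ℝ, ∀ i j, ∀ S : ℝ, |S| ≤ R → ‖x‖ ≤ 2 * R →
      |dd (sp (ev i j)) y (x + S • ev i j, t0) - dd (sp (ev i j)) y (x, t0)| ≤ R * ε + 12 * C * h := by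
    intro x i j S hS hx
    have hm : |S| * ε ≤ R * ε := mul_le_mul_of_nonneg_right hS hε
    rcases le_total 0 S with h0 | h0
    · rw [abs_of_nonneg h0] at hS hm
      have := step0 x i j S h0 (by linarith)
      linarith
    · have h2 := norm_add_ev x S i j
      rw [abs_of_nonpos h0] at hS hm h2
      have := step0 (x + S • ev i j) i j (-S) (by linarith) (by linarith)
      rw [neg_smul, add_neg_cancel_right, abs_sub_comm] at this
      linarith
  have hdir : ∀ i j p, dd (sp (ev i j)) y p = dd (sp (bs i)) y p + dd (sp (bs j)) y p := fun i j p => by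
    unfold ev; rw [sp_add, dd_add_dir]
  have hω : 0 ≤ R * ε + 12 * C * h := by positivity
  refine ⟨fun i => dd (sp (bs i)) y (0, t0), y (0, t0) - c * t0, fun x hx => ?_⟩
  have := lat4 (Y := fun x => y (x, t0)) (P := fun i x => dd (sp (bs i)) y (x, t0)) (R := R) (ω := R * ε + 12 * C * h) hR
    (fun x i s => by
      have := line_hasDeriv (f := y) (p := (x, t0)) (v := sp (bs i)) (s := s) (C2.d (hcy _ (by rw [sp_snd]; exact ht)))
      simpa only [pt_sp] using this)
    (fun x i s hx hs => by
      have h1 := step x i i (s / 2) (by rw [abs_div, abs_two]; linarith [abs_nonneg s]) hx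
      have e : x + (s / 2) • ev i i = x + s • (bs i : Fin n → ℝ) := by
        unfold ev; rw [← two_smul ℝ, smul_smul]; congr 2; ring
      rw [e, hdir, hdir] at h1
      rw [abs_le] at *
      constructor <;> linarith [h1.1, h1.2])
    (fun x i j s hx hs => by
      have h1 := step x i j s hs hx
      rw [hdir, hdir] at h1
      unfold ev at h1
      rw [abs_le] at *
      constructor <;> linarith [h1.1, h1.2]) hω hx
  refine le_trans (le_of_eq ?_) this
  congr 1
  have e : dot (fun i => dd (sp (bs i)) y (0, t0)) x = ∑ i, x i * dd (sp (bs i)) y (0, t0) := by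
    unfold dot; exact Finset.sum_congr rfl fun i _ => mul_comm _ _
  unfold qd
  simp only [e]
  simp only [hy, qd]
  have z : dot (0 : Fin n → ℝ) x = 0 := by simp [dot]
  have z0 : dot (0 : Fin n → ℝ) 0 = 0 := by simp [dot]
  rw [z, z0]; ring

def Abm (b : Mat n) : Mat n := fun i j => 1/2 * (b i j - 1/4 * b i i - 1/4 * b j j)
lemma Abm_symm {b : Mat n} (hb : ∀ i j, b i j = b j i) : Symm (Abm b) := fun i j => by unfold Abm; rw [hb i j]; ring
lemma Abm_qf {b : Mat n} (hb : ∀ i j, b i j = b j i) (i j) : qf (Abm b) (ev i j) (ev i j) = b i j := by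
  have h : ∀ i j : Fin n, qf (Abm b) (bs i) (bs j) = Abm b i j := fun i j => by simp [qf, bs, Pi.single_apply]
  unfold ev
  rw [qf_add_left, qf_add_right, qf_add_right, h, h, h, h]
  unfold Abm; rw [hb j i]; ring
lemma Abm_abs {b : Mat n} {C : ℝ} (hb : ∀ i j, |b i j| ≤ C) (i j) : |Abm b i j| ≤ C := by
  have h1 := abs_le.1 (hb i j)
  have h2 := abs_le.1 (hb i i)
  have h3 := abs_le.1 (hb j j)
  unfold Abm
  rw [abs_le]; constructor <;> linarith [h1.1, h1.2, h2.1, h2.2, h3.1, h3.2]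

lemma norm_sq_le_dot (v : Fin n → ℝ) {R : ℝ} (hR : 0 ≤ R) (h : dot v v ≤ R^2) : ‖v‖ ≤ R := by
  refine (pi_norm_le_iff_of_nonneg hR).2 fun i => ?_
  rw [Real.norm_eq_abs]
  refine abs_le_of_sq_le_sq ?_ hR
  have := sq_le_dot v i
  nlinarith
lemma dot_le_norm (v : Fin n → ℝ) {R : ℝ} (h : ‖v‖ ≤ R) : dot v v ≤ n * R^2 := by
  unfold dot
  calc ∑ i, v i * v i ≤ ∑ i : Fin n, R^2 := Finset.sum_le_sum fun i _ => by
        have := (norm_le_pi_norm v i).trans h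
        rw [Real.norm_eq_abs] at this
        nlinarith [sq_le_sq' (abs_le.1 this).1 (abs_le.1 this).2]
    _ = _ := by simp

lemma slice (Dt : Data n) (M : ℝ) {h ρ ε : ℝ} (hh : 0 < h) (hρ : 0 ≤ ρ) (hε : 0 < ε) : ∃ δ > 0, ∀ u (γ : Mat n) (t1 : ℝ), Cls Dt M u →
    (∀ i j, 0 ≤ γ i j) → ip γ γ ≤ M → t1 ≤ 0 → M - δ ≤ ip γ (gh Dt u h (0, t1)) →
    ∀ x : Fin n → ℝ, ‖x‖ ≤ ρ → ∀ i j, |gh Dt u h (x, t1 - 15) i j - γ i j| ≤ ε := by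
  have hCL := Dt.CL_pos
  set L := 4 * Dt.CL * n / h with hL
  have hL0 : 0 ≤ L := by positivity
  set w := ε / (2 * (L + 1)) with hw
  have hwp : 0 < w := by positivity
  obtain ⟨δ, hδ, H⟩ := SM (n := n) Dt.c0_pos Dt.C0_pos (T := 15) (R := n * ρ^2) (η := w^2) (ε := ε^2 / 16) (by norm_num) (by positivity) (by positivity) (by positivity)
  refine ⟨δ / 2, by positivity, fun u γ t1 hu hγ hγM ht1 hδ' x hx i j => ?_⟩
  by_contra! hcon
  have := H (fun q => M - ip γ (gh Dt u h q)) (fun q => Dt.r (Hess u q)) x t1 (fun p hp => Zh_super hu hγ hγM hh (hp.trans ht1)) (dot_le_norm x hx) (fun y hy => by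
    have hn := norm_sq_le_dot _ hwp.le hy
    have hl := gh_lip hu.1 hh (x := x) (y := y) (t := t1 - 15) (by linarith) i j
    have hl2 : L * ‖y - x‖ ≤ ε / 2 := by
      refine (mul_le_mul_of_nonneg_left hn hL0).trans ?_
      rw [hw, mul_div_assoc', div_le_div_iff₀ (by positivity) (by positivity)]
      nlinarith
    have hl3 := hl.trans hl2
    by_contra! hc
    have hb := ip_close (hu.2 h hh (y, t1 - 15) (by simp; linarith)) hγM (ε := ε^2/16) (by linarith)
    have := abs_entry_le (ε := ε / 2) (by positivity) (hb.trans (by nlinarith [sq_nonneg ε])) i j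
    simp only [Pi.sub_apply] at this
    have : |gh Dt u h (x, t1 - 15) i j - γ i j| ≤ ε := by
      rw [abs_le] at *
      constructor <;> linarith [hl3.1, hl3.2, this.1, this.2]
    linarith)
  linarith

lemma dot_tri2 (x y : Fin n → ℝ) : dot x x ≤ 2 * dot y y + 2 * dot (x - y) (x - y) := by
  unfold dot
  rw [Finset.mul_sum, Finset.mul_sum, ← Finset.sum_add_distrib]
  exact Finset.sum_le_sum fun i _ => by simp only [Pi.sub_apply]; nlinarith [sq_nonneg (2 * y i - x i)]

set_option maxHeartbeats 1000000 in
theorem LemS (Dt : Data n) (M : ℝ) {κ : ℝ} (hκ : 0 < κ) : ∃ h > 0, h ≤ 1/8 ∧ ∃ δ > 0, ∀ u (γ : Mat n) (t1 : ℝ), Cls Dt M u →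
    (∀ i j, γ i j = γ j i) → (∀ i j, 0 ≤ γ i j) → ip γ γ ≤ M → -1 ≤ t1 → t1 ≤ 0 → M - δ ≤ ip γ (gh Dt u h (0, t1)) →
    ∀ p : En n, nsq 0 p ≤ 4 → -4 ≤ p.2 → p.2 ≤ 0 → ∀ i j, |g0 Dt u p i j - γ i j| ≤ κ := by
  have hCL := Dt.CL_pos
  have hC0 := Dt.C0_pos
  set C := 5 * Dt.CL + √M with hC
  have hCp : 0 < C := by positivity
  obtain ⟨C5, hC5, hB⟩ := B1 Dt hCp.le
  set εB := min (1/16) ((κ / (4 * C5))^2) with hεB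
  have hεBp : 0 < εB := lt_min (by norm_num) (by positivity)
  set La := 2 * n * Dt.C0 + 1 with hLa
  have hLap : 0 < La := by positivity
  set κT := εB / (2 * (10 + La * 16)) with hκT
  have hκTp : 0 < κT := by positivity
  set W := 16 * (C * n * (n * Dt.C0)) / κT with hW
  have hW0 : 0 ≤ W := by positivity
  set R := 4 + W with hR
  have hR2 : 16 * (C * n * (n * Dt.C0)) ≤ κT * R^2 := by
    have : 16 * (C * n * (n * Dt.C0)) = κT * W := by rw [hW]; field_simp
    rw [this]; refine mul_le_mul_of_nonneg_left ?_ hκTp.le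
    rw [hR]; nlinarith
  have hR16 : 16 ≤ R^2 := by rw [hR]; nlinarith
  set K := n * (4 * n + 1) * R with hK
  have hK0 : 0 ≤ K := by positivity
  set ε := εB / (4 * (K * R + 1)) with hε
  have hεp : 0 < ε := by positivity
  set h := εB / (4 * (12 * K * C + 1)) with hh
  have hhp : 0 < h := by positivity
  have hsmall : K * (R * ε + 12 * C * h) ≤ εB / 2 := by
    have h1 : K * R * ε ≤ εB / 4 := by
      rw [hε, mul_div_assoc', div_le_div_iff₀ (by positivity) (by positivity)]
      nlinarith
    have h2 : 12 * K * C * h ≤ εB / 4 := by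
      rw [hh, mul_div_assoc', div_le_div_iff₀ (by positivity) (by positivity)]
      nlinarith
    nlinarith
  obtain ⟨δ, hδ, hS⟩ := slice Dt M hhp (ρ := 6 * R) (by positivity) hεp
  have hh8 : h ≤ 1/8 := by
    have : εB ≤ 1/16 := min_le_left _ _
    rw [hh, div_le_iff₀ (by positivity)]
    have : 0 ≤ K * C := by positivity
    nlinarith
  refine ⟨h, hhp, hh8, δ, hδ, fun u γ t1 hu hsym hγ hγM ht1 ht1' hclose p hp1 hp2 hp3 i j => ?_⟩
  have hsl := hS u γ t1 hu hγ hγM ht1' hclose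
  set b : Mat n := fun i j => γ i j - 4 * Dt.CL with hb
  have hbs : ∀ i j, b i j = b j i := fun i j => by simp only [hb]; rw [hsym]
  have hA := Abm_symm hbs
  have hγabs : ∀ i j, |γ i j| ≤ √M := fun i j => Real.abs_le_sqrt ((entry_le_ip γ i j).trans hγM)
  have hbabs : ∀ i j, |b i j| ≤ √M + 4 * Dt.CL := fun i j => by
    simp only [hb]
    have := abs_le.1 (hγabs i j)
    rw [abs_le]; constructor <;> linarith [this.1, this.2]
  have hAC : ∀ B ∈ Dt.D, ∀ i j, |(B - Abm b) i j| ≤ C := fun B hB i j => by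
    have h1 := abs_le.1 (Dt.bdd B hB i j)
    have h2 := abs_le.1 (Abm_abs hbabs i j)
    simp only [Pi.sub_apply]
    rw [abs_le, hC]; constructor <;> linarith [h1.1, h1.2, h2.1, h2.2]
  obtain ⟨c, A', hA', hE1, hE2⟩ := Dt.ext (Abm b) hA ⟨_, (hu.1.good (p := 0) (by simp)).2.1⟩
  have hE : ExtD Dt (Abm b) c A' := ⟨hA', hE1, hE2⟩
  obtain ⟨l, d, hq⟩ := lat2 hu.1 hA hCp.le hhp (by positivity) hεp.le hAC (Abm_qf hbs) (by linarith : t1 - 15 ≤ 0) hsl c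
  have hTS := TS hu.1 hA hE (R2 := R^2) (t0 := t1 - 15) (ε := εB / 2) (κ := κT) hCp.le hAC l d hκTp (by
      refine le_trans ?_ hR2
      rw [mul_comm]
      exact mul_le_mul_of_nonneg_right (by linarith) (by positivity)) (fun x hx => (hq x (norm_sq_le_dot x (by positivity) hx)).trans hsmall)
  have hp1' : dot p.1 p.1 ≤ 4 := by unfold nsq at hp1; simpa using hp1
  have hfin := hB u (Abm b) A' c d εB l p hu.1 hA hE hAC hp3 hεBp (min_le_left _ _) (fun q hq1 hq2 hq3 => by
    have hdq : dot q.1 q.1 ≤ 10 := by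
      have := dot_tri2 q.1 p.1
      unfold nsq at hq1
      linarith
    refine (hTS q (by linarith) (by linarith) (by linarith)).trans ?_
    have : κT * (dot q.1 q.1 + La * (q.2 - (t1 - 15))) ≤ κT * (10 + La * 16) := by
      refine mul_le_mul_of_nonneg_left ?_ hκTp.le
      have : La * (q.2 - (t1 - 15)) ≤ La * 16 := mul_le_mul_of_nonneg_left (by linarith) hLap.le
      linarith
    have e : κT * (10 + La * 16) = εB / 2 := by rw [hκT]; field_simp
    linarith) (ev i j)
  have hde : dot (ev i j) (ev i j) ≤ 4 := by
    have h1 := sum_abs_ev i j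
    have h2 : ∀ k, |ev i j k| ≤ 2 := fun k => (Finset.single_le_sum (f := fun k => |ev i j k|) (fun k _ => abs_nonneg _) (Finset.mem_univ k)).trans h1
    calc dot (ev i j) (ev i j) ≤ ∑ k, 2 * |ev i j k| := Finset.sum_le_sum fun k _ => by
          rw [← abs_mul_abs_self]; exact mul_le_mul_of_nonneg_right (h2 k) (abs_nonneg _)
      _ ≤ 4 := by rw [← Finset.mul_sum]; linarith
  have hg := hu.1.good hp3
  have e : g0 Dt u p i j - γ i j = qf (Hess u p - Abm b) (ev i j) (ev i j) := by
    rw [qf_sub, Abm_qf hbs, qf_hess' hg.c2]; simp only [hb, g0]; ring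
  rw [e]
  refine hfin.trans ?_
  have hsq : √εB ≤ κ / (4 * C5) := by
    rw [Real.sqrt_le_left (by positivity)]; exact min_le_right _ _
  calc C5 * √εB * dot (ev i j) (ev i j) ≤ C5 * (κ / (4 * C5)) * 4 := by
        gcongr
        exact dot_self_nonneg _
    _ = κ := by field_simp
end Lat2
end

section
section S7
variable {n : ℕ} {Dt : Data n} {u : En n → ℝ} {M : ℝ}

lemma ip_diff {A B C D : Mat n} {a : ℝ} (h : ∀ i j, a ≤ A i j * B i j - C i j * D i j) : n * n * a ≤ ip A B - ip C D := by
  have : ip A B - ip C D = ∑ i, ∑ j, (A i j * B i j - C i j * D i j) := by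
    unfold ip; simp only [← Finset.sum_sub_distrib]
  rw [this]
  calc (n:ℝ) * n * a = ∑ i : Fin n, ∑ j : Fin n, a := by simp; ring
    _ ≤ _ := Finset.sum_le_sum fun i _ => Finset.sum_le_sum fun j _ => h i j

lemma dot_ev_le (i j : Fin n) : dot (ev i j) (ev i j) ≤ 4 := by
  have h1 := sum_abs_ev i j
  have h2 : ∀ k, |ev i j k| ≤ 2 := fun k => (Finset.single_le_sum (f := fun k => |ev i j k|) (fun k _ => abs_nonneg _) (Finset.mem_univ k)).trans h1
  calc dot (ev i j) (ev i j) ≤ ∑ k, 2 * |ev i j k| := Finset.sum_le_sum fun k _ => by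
        rw [← abs_mul_abs_self]; exact mul_le_mul_of_nonneg_right (h2 k) (abs_nonneg _)
    _ ≤ 4 := by rw [← Finset.mul_sum]; linarith

lemma g0_rs' (hu : Sol Dt u) {p x : En n} {ρ : ℝ} (hρ : 0 < ρ) (hp : p.2 ≤ 0) (hx : x.2 ≤ 0) :
    g0 Dt (rs p ρ u) x = g0 Dt u (p + scl ρ x) := g0_rs hρ.ne' (hu.good (rs_le hp hx)).c2

def Flat (Dt : Data n) (κ ρ : ℝ) (γ : Mat n) (u : En n → ℝ) : Prop :=
  ∀ p : En n, nsq 0 p ≤ ρ^2 → -ρ^2 ≤ p.2 → p.2 ≤ 0 → ip (g0 Dt u p - γ) (g0 Dt u p - γ) ≤ κ^2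

lemma nsq_zero (p : En n) : nsq 0 p = dot p.1 p.1 := by unfold nsq; simp

/-- Hölder estimate at any point of the half cylinder. -/
lemma hol_at {κ C1 : ℝ} (hκ : ∀ u (γ : Mat n), Sol Dt u → Flat Dt κ 1 γ u →
    ∀ y, dot y y ≤ 1 → ip (g0 Dt u (y,0) - g0 Dt u (0,0)) (g0 Dt u (y,0) - g0 Dt u (0,0)) ≤ C1 * (dot y y) ^ (1/4:ℝ))
    {γ : Mat n} (hu : Sol Dt u) {x1 : Fin n → ℝ} {t ρ : ℝ} (hρ : 0 < ρ) (ht : t ≤ 0)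
    (hF : ∀ p : En n, dot (p.1 - x1) (p.1 - x1) ≤ ρ^2 → t - ρ^2 ≤ p.2 → p.2 ≤ t → ip (g0 Dt u p - γ) (g0 Dt u p - γ) ≤ κ^2)
    {x : Fin n → ℝ} (hx : dot (x - x1) (x - x1) ≤ ρ^2) :
    ip (g0 Dt u (x, t) - g0 Dt u (x1, t)) (g0 Dt u (x, t) - g0 Dt u (x1, t)) ≤ C1 * (dot (x - x1) (x - x1) / ρ^2) ^ (1/4:ℝ) := by
  have hr2 : 0 < ρ^2 := by positivity
  have hd : dot (ρ⁻¹ • (x - x1)) (ρ⁻¹ • (x - x1)) = dot (x - x1) (x - x1) / ρ^2 := by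
    rw [dot_smul_l, dot_smul_r]; field_simp
  have e1 : ((x1, t) : En n) + scl ρ (ρ⁻¹ • (x - x1), 0) = (x, t) := by
    rw [scl_apply]; simp [smul_smul, hρ.ne']
  have e0 : ((x1, t) : En n) + scl ρ (0, 0) = (x1, t) := by rw [scl_apply]; simp
  have := hκ (rs (x1, t) ρ u) γ (rs_sol hρ.ne' ht hu) (fun p h1 h2 h3 => by
      rw [g0_rs' hu hρ ht h3]
      rw [nsq_zero] at h1
      refine hF _ ?_ ?_ ?_
      · rw [scl_apply]; simp only [Prod.fst_add, add_sub_cancel_left]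
        rw [dot_smul_l, dot_smul_r]; nlinarith
      · rw [scl_apply]; simp only [Prod.snd_add]; nlinarith
      · rw [scl_apply]; simp only [Prod.snd_add]; nlinarith) (ρ⁻¹ • (x - x1)) (by rw [hd, div_le_one hr2]; exact hx)
  rw [g0_rs' hu hρ ht le_rfl, g0_rs' hu hρ ht le_rfl, e1, e0, hd] at this
  exact this

/-- Claim I: doubling. -/
lemma claimI (Dt : Data n) (M : ℝ) {κ C1 : ℝ} (hκ0 : 0 < κ) (hC1 : 0 < C1) (hκ : ∀ u (γ : Mat n), Sol Dt u → Flat Dt κ 1 γ u →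
    ∀ y, dot y y ≤ 1 → ip (g0 Dt u (y,0) - g0 Dt u (0,0)) (g0 Dt u (y,0) - g0 Dt u (0,0)) ≤ C1 * (dot y y) ^ (1/4:ℝ)) :
    ∃ δ > 0, ∀ u, Cls Dt M u → Flat Dt κ 1 (g0 Dt u (0,0)) u → M - δ ≤ ip (g0 Dt u (0,0)) (g0 Dt u (0,0)) →
      Flat Dt κ 2 (g0 Dt u (0,0)) u := by
  have hCL := Dt.CL_pos
  obtain ⟨h, hh, hh8, δS, hδS, hS⟩ := LemS Dt M (κ := κ / (n + 1)) (by positivity)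
  set ω := δS / (2 * (n * n * (8 * Dt.CL) + 1)) with hω
  have hωp : 0 < ω := by positivity
  set η := min (1/16) ((ω^2 / (4 * C1))^4 / 4) with hη
  have hηp : 0 < η := lt_min (by norm_num) (by positivity)
  obtain ⟨δ, hδ, hSM⟩ := SM (n := n) Dt.c0_pos Dt.C0_pos (T := 1/16) (R := 1/4) (η := η) (ε := ω^2/8) (by norm_num) (by norm_num) hηp (by positivity)
  refine ⟨min (δ/2) (δS/2), lt_min (by positivity) (by positivity), fun u hu hF hcl => ?_⟩
  set γ := g0 Dt u (0,0) with hγ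
  have hg0 : Good Dt u (0,0) := hu.1.good le_rfl
  have hγb : ∀ i j, 0 ≤ γ i j ∧ γ i j ≤ 8 * Dt.CL := g0_bd hg0
  have hγM : ip γ γ ≤ M := hu.g0_le le_rfl
  have hnear : ∀ x1 : Fin n → ℝ, dot x1 x1 ≤ 1/16 → ip (g0 Dt u (x1, -(1/16)) - γ) (g0 Dt u (x1, -(1/16)) - γ) ≤ ω^2 := by
    intro x1 hx1
    by_contra! hcon
    have := hSM (fun q => M - ip γ (g0 Dt u q)) (fun q => Dt.r (Hess u q)) x1 0 (fun p hp => Z0_super hu (fun i j => (hγb i j).1) hγM hp) (by linarith)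
      (fun x hx => by
        by_contra! hc
        have hb := ip_close (hu.g0_le (p := (x, 0 - 1/16)) (by norm_num)) hγM (ε := ω^2/8) (by linarith)
        rw [zero_sub] at hb
        have hx4 : dot (x - x1) (x - x1) ≤ (1/2)^2 := by have := min_le_left (1/16) ((ω^2 / (4 * C1))^4 / 4); norm_num; linarith
        have hol := hol_at hκ hu.1 (γ := γ) (x1 := x1) (t := -(1/16)) (ρ := 1/2) (by norm_num) (by norm_num) (fun p h1 h2 h3 => by
          refine hF p ?_ (by norm_num at h2 ⊢; linarith) (by linarith)
          rw [nsq_zero]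
          have := dot_tri2 p.1 x1
          norm_num at h1 ⊢; linarith) hx4
        have hp : (dot (x - x1) (x - x1) / (1/2)^2) ^ (1/4:ℝ) ≤ ω^2 / (4 * C1) := by
          have h1 : dot (x - x1) (x - x1) / (1/2)^2 ≤ (ω^2 / (4 * C1))^4 := by
            have := min_le_right (1/16) ((ω^2 / (4 * C1))^4 / 4)
            rw [div_le_iff₀ (by norm_num)]; linarith
          refine (Real.rpow_le_rpow (div_nonneg (dot_self_nonneg _) (by norm_num)) h1 (by norm_num)).trans ?_
          rw [← Real.rpow_natCast, ← Real.rpow_mul (by positivity)]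
          norm_num
        have hol2 : C1 * (dot (x - x1) (x - x1) / (1/2)^2) ^ (1/4:ℝ) ≤ ω^2/4 := by
          refine (mul_le_mul_of_nonneg_left hp hC1.le).trans (le_of_eq ?_)
          field_simp
        have ht := ip_tri (g0 Dt u (x1, -(1/16))) γ (g0 Dt u (x, -(1/16)))
        have e1 : ip (g0 Dt u (x1, -(1/16)) - g0 Dt u (x, -(1/16))) (g0 Dt u (x1, -(1/16)) - g0 Dt u (x, -(1/16))) = ip (g0 Dt u (x, -(1/16)) - g0 Dt u (x1, -(1/16))) (g0 Dt u (x, -(1/16)) - g0 Dt u (x1, -(1/16))) := by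
          rw [ip_sub_self, ip_sub_self, ip_comm (g0 Dt u (x, -(1/16))) (g0 Dt u (x1, -(1/16)))]; ring
        have e2 : ip (γ - g0 Dt u (x, -(1/16))) (γ - g0 Dt u (x, -(1/16))) = ip (g0 Dt u (x, -(1/16)) - γ) (g0 Dt u (x, -(1/16)) - γ) := by
          rw [ip_sub_self, ip_sub_self, ip_comm (g0 Dt u (x, -(1/16))) γ]; ring
        rw [e1, e2] at ht
        nlinarith [sq_nonneg ω])
    have h2 := min_le_left (δ/2) (δS/2)
    change δ ≤ M - ip γ γ at this
    linarith
  have hgh : ∀ i j, γ i j - ω ≤ gh Dt u h (0, -(1/16)) i j := by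
    intro i j
    have : γ i j - ω - 4 * Dt.CL ≤ Dh h (ev i j) u (0, -(1/16)) := by
      refine le_Dh hh (fun s _ => (hu.1.good (by rw [sp_snd]; norm_num)).c2) fun s hs => ?_
      rw [pt_sp, zero_add]
      have hd : dot (s • ev i j) (s • ev i j) ≤ 1/16 := by
        rw [dot_smul_l, dot_smul_r]
        have h1 := dot_ev_le i j
        have h2 : s^2 ≤ (1/8)^2 := sq_le_sq' (by linarith [(abs_le.1 hs).1]) (by linarith [(abs_le.1 hs).2])
        nlinarith [dot_self_nonneg (ev i j), sq_nonneg s]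
      have := abs_le.1 (abs_entry_le hωp.le (hnear _ hd) i j)
      simp only [Pi.sub_apply] at this
      unfold g0 at this
      linarith [this.1]
    unfold gh; linarith
  have hip : M - δS ≤ ip γ (gh Dt u h (0, -(1/16))) := by
    have h1 := ip_diff (A := γ) (B := gh Dt u h (0, -(1/16))) (C := γ) (D := γ) (a := -(8 * Dt.CL * ω)) (fun i j => by
      have a1 := hgh i j
      have a2 := hγb i j
      nlinarith [mul_le_mul_of_nonneg_left a1 a2.1, mul_le_mul_of_nonneg_right a2.2 hωp.le])
    have h2 : n * n * (8 * Dt.CL * ω) ≤ δS / 2 := by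
      have : (0:ℝ) ≤ n * n * (8 * Dt.CL) := by positivity
      have e : n * n * (8 * Dt.CL * ω) = n * n * (8 * Dt.CL) * ω := by ring
      rw [e, hω, mul_div_assoc', div_le_div_iff₀ (by positivity) (by positivity)]
      nlinarith
    have h3 := min_le_right (δ/2) (δS/2)
    linarith
  have := hS u γ (-(1/16)) hu (fun i j => by rw [hγ, g0_symm]) (fun i j => (hγb i j).1) hγM (by norm_num) (by norm_num) hip
  intro p h1 h2 h3
  refine (ip_le_of_entry (fun i j => this p (by linarith) (by linarith) h3 i j)).trans ?_
  rw [div_pow, mul_div_assoc', div_le_iff₀ (by positivity)]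
  have : (0:ℝ) ≤ n := by positivity
  nlinarith [sq_nonneg κ, mul_nonneg this (sq_nonneg κ)]
end S7
end

section
section S8
variable {n : ℕ} {Dt : Data n} {u : En n → ℝ} {M : ℝ}

lemma rs_zero_pt (ρ : ℝ) (p : En n) : ρ ≠ 0 → (0 : En n) + scl ρ (ρ⁻¹ • p.1, (ρ^2)⁻¹ * p.2) = p := by
  intro h
  rw [scl_apply, zero_add]
  refine Prod.ext ?_ ?_
  · simp [smul_smul, h]
  · simp; field_simp

lemma flat_rs (hu : Sol Dt u) {κ ρ σ : ℝ} {γ : Mat n} (hρ : 0 < ρ) : Flat Dt κ σ γ (rs 0 ρ u) ↔ Flat Dt κ (ρ * σ) γ u := by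
  constructor
  · intro h p h1 h2 h3
    have h3' : (ρ^2)⁻¹ * p.2 ≤ 0 := mul_nonpos_of_nonneg_of_nonpos (by positivity) h3
    have := h (ρ⁻¹ • p.1, (ρ^2)⁻¹ * p.2) (by
      rw [nsq_zero] at *; simp only [dot_smul_l, dot_smul_r]
      rw [mul_pow] at h1
      rw [← mul_assoc, ← mul_inv, ← sq, inv_mul_le_iff₀ (by positivity)]; exact h1) (by
      simp only; rw [mul_pow] at h2; rw [le_inv_mul_iff₀ (by positivity)]; linarith) h3'
    rw [g0_rs' hu hρ (by simp) h3', rs_zero_pt ρ p hρ.ne'] at this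
    exact this
  · intro h p h1 h2 h3
    rw [g0_rs' hu hρ (by simp) h3]
    have hr : 0 < ρ^2 := by positivity
    refine h _ ?_ ?_ ?_
    · rw [nsq_zero] at *; rw [scl_apply, zero_add, mul_pow]; simp only [dot_smul_l, dot_smul_r]; nlinarith
    · rw [scl_apply, zero_add, mul_pow]; simp only; nlinarith
    · rw [scl_apply, zero_add]; simp only; nlinarith

/-- For a solution, there is a time below which the spatial Hessian is constant on slices. -/
lemma slices (Dt : Data n) (hu : Sol Dt u) : ∃ t' ≤ 0, ∀ t ≤ t', ∀ x, Hess u (x, t) = Hess u (0, t) := by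
  have hCL := Dt.CL_pos
  obtain ⟨κ, hκp, C1, hC1, hH⟩ := HOL Dt
  have hκ : ∀ u (γ : Mat n), Sol Dt u → Flat Dt κ 1 γ u →
    ∀ y, dot y y ≤ 1 → ip (g0 Dt u (y,0) - g0 Dt u (0,0)) (g0 Dt u (y,0) - g0 Dt u (0,0)) ≤ C1 * (dot y y) ^ (1/4:ℝ) :=
    fun u γ hu hF => hH u γ hu (fun p h1 h2 h3 => hF p (by linarith) (by linarith) h3)
  set S : Set ℝ := {m | ∃ h > 0, ∃ p : En n, p.2 ≤ 0 ∧ m = ip (gh Dt u h p) (gh Dt u h p)} with hS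
  have hbdd : BddAbove S := by
    refine ⟨n * n * (8 * Dt.CL)^2, ?_⟩
    rintro m ⟨h, hh, p, hp, rfl⟩
    refine ip_le_of_entry fun i j => ?_
    have := gh_bd hu hh hp i j
    rw [abs_of_nonneg this.1]; exact this.2
  have hne : S.Nonempty := ⟨_, 1, one_pos, 0, le_rfl, rfl⟩
  set M := sSup S with hM
  have hcls : Cls Dt M u := ⟨hu, fun h hh p hp => le_csSup hbdd ⟨h, hh, p, hp, rfl⟩⟩
  obtain ⟨δI, hδI, hI⟩ := claimI Dt M hκp hC1 hκ
  set κ' := min (κ / (2 * (n + 1))) (δI / (2 * (n * n * (16 * Dt.CL) + 1))) with hκ'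
  have hκ'p : 0 < κ' := lt_min (by positivity) (by positivity)
  obtain ⟨h, hh, -, δ1, hδ1, hLS⟩ := LemS Dt M hκ'p
  obtain ⟨m, ⟨hs, hhs, ps, hps, rfl⟩, hm⟩ := exists_lt_of_lt_csSup hne (show M - min δ1 (δI/2) < sSup S by
    have : 0 < min δ1 (δI/2) := lt_min hδ1 (by positivity)
    linarith)
  have hm1 := min_le_left δ1 (δI/2)
  have hm2 := min_le_right δ1 (δI/2)
  set ρ := hs / h with hρ
  have hρp : 0 < ρ := by positivity
  set v := rs ps ρ u with hv
  have hvc : Cls Dt M v := hcls.rs hps hρp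
  have hγ0 : gh Dt v h (0,0) = gh Dt u hs ps := by
    rw [hv, gh_rs, hρ, div_mul_cancel₀ _ hh.ne']
    congr 1
    rw [scl_apply]; simp
  set γ0 := gh Dt v h (0,0) with hγ0d
  have hb0 : ∀ i j, 0 ≤ γ0 i j ∧ γ0 i j ≤ 8 * Dt.CL := gh_bd hvc.1 hh le_rfl
  have hc0 : M - min δ1 (δI/2) < ip γ0 γ0 := by rw [hγ0]; exact hm
  have hnr := hLS v γ0 0 hvc (fun i j => by rw [hγ0d]; exact gh_symm Dt v h (0,0) i j) (fun i j => (hb0 i j).1) (hvc.2 h hh _ le_rfl) (by norm_num) le_rfl (by linarith)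
  set γ := g0 Dt v (0,0) with hγ
  have hz : ∀ i j, |γ i j - γ0 i j| ≤ κ' := hnr (0,0) (by rw [nsq_zero]; simp [dot]) (by norm_num) le_rfl
  have hgb : ∀ i j, 0 ≤ γ i j ∧ γ i j ≤ 8 * Dt.CL := g0_bd (hvc.1.good le_rfl)
  have hF1 : Flat Dt κ 1 γ v := by
    intro p h1 h2 h3
    refine (ip_le_of_entry (ε := 2 * κ') (fun i j => ?_)).trans ?_
    · have a1 := hnr p (by linarith) (by linarith) h3 i j
      have a2 := hz i j
      simp only [Pi.sub_apply]
      rw [abs_le] at *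
      constructor <;> linarith [a1.1, a1.2, a2.1, a2.2]
    · have h4 : 2 * κ' ≤ κ / (n + 1) := by
        have : κ' ≤ κ / (2 * (n + 1)) := min_le_left _ _
        rw [le_div_iff₀ (by positivity)] at *
        linarith
      have h5 : (2 * κ')^2 ≤ (κ / (n + 1))^2 := by gcongr
      refine (mul_le_mul_of_nonneg_left h5 (by positivity)).trans ?_
      rw [div_pow, mul_div_assoc', div_le_iff₀ (by positivity)]
      have : (0:ℝ) ≤ n := by positivity
      nlinarith [sq_nonneg κ, mul_nonneg this (sq_nonneg κ)]
  have hcl : M - δI ≤ ip γ γ := by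
    have h1 := ip_diff (A := γ) (B := γ) (C := γ0) (D := γ0) (a := -(16 * Dt.CL * κ')) (fun i j => by
      have a1 := abs_le.1 (hz i j)
      have a2 := hb0 i j
      have a3 := hgb i j
      have : (γ0 i j - γ i j) * (γ0 i j + γ i j) ≤ κ' * (16 * Dt.CL) := by
        refine (mul_le_mul_of_nonneg_right (show γ0 i j - γ i j ≤ κ' by linarith [a1.1]) (by linarith [a2.1, a3.1])).trans ?_
        exact mul_le_mul_of_nonneg_left (by linarith [a2.2, a3.2]) hκ'p.le
      nlinarith)
    have h2 : n * n * (16 * Dt.CL * κ') ≤ δI / 2 := by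
      have h3 : κ' ≤ δI / (2 * (n * n * (16 * Dt.CL) + 1)) := min_le_right _ _
      rw [le_div_iff₀ (by positivity)] at h3
      nlinarith
    linarith
  have hFk : ∀ k : ℕ, Flat Dt κ (2^k) γ v := by
    intro k
    induction k with
    | zero => simpa using hF1
    | succ k ih =>
      have h2k : (0:ℝ) < 2^k := by positivity
      have hg : g0 Dt (rs 0 (2^k) v) (0,0) = γ := by
        rw [g0_rs' hvc.1 h2k (by simp) le_rfl, hγ]; congr 1; rw [scl_apply]; simp
      have := hI (rs 0 (2^k) v) (hvc.rs (by simp) h2k)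
      rw [hg] at this
      have := this ((flat_rs hvc.1 h2k).2 (by rwa [mul_one])) hcl
      rw [flat_rs hvc.1 h2k] at this
      rwa [pow_succ]
  have hall : ∀ p : En n, p.2 ≤ 0 → ip (g0 Dt v p - γ) (g0 Dt v p - γ) ≤ κ^2 := by
    intro p hp
    obtain ⟨k, hk⟩ := pow_unbounded_of_one_lt (nsq 0 p - p.2 + 1) (one_lt_two (α := ℝ))
    have h0 : 0 ≤ nsq 0 p := by rw [nsq_zero]; exact dot_self_nonneg _
    have h1 : (2:ℝ)^k ≤ (2^k)^2 := by
      have : (1:ℝ) ≤ 2^k := one_le_pow₀ (by norm_num)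
      nlinarith
    exact hFk k p (by linarith) (by linarith) hp
  have hconst : ∀ t ≤ 0, ∀ x x1, g0 Dt v (x, t) = g0 Dt v (x1, t) := by
    intro t ht x x1
    have hle : ip (g0 Dt v (x, t) - g0 Dt v (x1, t)) (g0 Dt v (x, t) - g0 Dt v (x1, t)) ≤ 0 := by
      have hl : Tendsto (fun ρ : ℝ => C1 * (dot (x - x1) (x - x1) / ρ^2) ^ (1/4:ℝ)) atTop (𝓝 0) := by
        have h1 : Tendsto (fun ρ : ℝ => dot (x - x1) (x - x1) / ρ^2) atTop (𝓝 0) :=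
          tendsto_const_nhds.div_atTop (tendsto_pow_atTop (by norm_num))
        have h2 := (h1.rpow_const (p := (1/4:ℝ)) (Or.inr (by norm_num))).const_mul C1
        rw [Real.zero_rpow (by norm_num), mul_zero] at h2
        exact h2
      refine ge_of_tendsto hl ?_
      filter_upwards [eventually_gt_atTop 0, (tendsto_pow_atTop (α := ℝ) (two_ne_zero)).eventually_ge_atTop (dot (x - x1) (x - x1))] with ρ h1 h2
      exact hol_at hκ hvc.1 (γ := γ) h1 ht (fun p _ _ h3 => hall p (h3.trans ht)) h2
    have h0 : ∀ i j, g0 Dt v (x, t) i j - g0 Dt v (x1, t) i j = 0 := fun i j => by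
      have := abs_entry_le (A := g0 Dt v (x, t) - g0 Dt v (x1, t)) le_rfl (by linarith) i j
      simpa using this
    funext i j; linarith [h0 i j]
  refine ⟨ps.2, hps, fun t ht x => ?_⟩
  have hpt : ∀ x : Fin n → ℝ, ps + scl ρ (ρ⁻¹ • (x - ps.1), (ρ^2)⁻¹ * (t - ps.2)) = (x, t) := by
    intro x
    rw [scl_apply]
    refine Prod.ext ?_ ?_
    · simp [smul_smul, hρp.ne']
    · simp; field_simp; ring
  have htn : (ρ^2)⁻¹ * (t - ps.2) ≤ 0 := mul_nonpos_of_nonneg_of_nonpos (by positivity) (by linarith)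
  have hg : ∀ x, g0 Dt v (ρ⁻¹ • (x - ps.1), (ρ^2)⁻¹ * (t - ps.2)) = g0 Dt u (x, t) := fun x => by
    rw [hv, g0_rs' hu hρp hps htn, hpt]
  have he : g0 Dt u (x, t) = g0 Dt u (0, t) := by rw [← hg, ← hg]; exact hconst _ htn _ _
  have hd : ∀ i j, d2 (sp (ev i j)) u (x, t) = d2 (sp (ev i j)) u (0, t) := fun i j => by
    have := congrFun (congrFun he i) j
    unfold g0 at this; linarith
  funext i j
  rw [hess_ev (hu.good (ht.trans hps)), hess_ev (hu.good (ht.trans hps)), hd, hd, hd]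

lemma quad_slice (hu : Sol Dt u) {t : ℝ} (ht : t ≤ 0) (h : ∀ x, Hess u (x, t) = Hess u (0, t)) (c : ℝ) :
    ∃ l d, ∀ x, u (x, t) = qd (Hess u (0, t)) l c d (x, t) := by
  set A := Hess u (0, t) with hA
  have hg : ∀ x, Good Dt u (x, t) := fun x => hu.good ht
  have hAs : Symm A := hess_symm (hg 0).c2
  set y : En n → ℝ := fun p => u p - qd A 0 0 0 p with hy
  have hcy : ∀ x, ContDiffAt ℝ 2 y (x, t) := fun x => (hg x).c2.sub (qd_cd A 0 0 0).contDiffAt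
  refine ⟨grd y (0, t), y (0, t) - c * t, fun x => ?_⟩
  have hp : ∀ s : ℝ, ((0, t) : En n) + s • sp x = (s • x, t) := fun s => by rw [pt_sp, zero_add]
  have hd0 : ∀ s : ℝ, d2 (sp x) y ((0, t) + s • sp x) = 0 := fun s => by
    rw [hp, hy, d2_sub (f := u) (hg _).c2 (qd_cd A 0 0 0).contDiffAt, d2_qd hAs, ← qf_hess' (hg _).c2, h, sub_self]
  have hm : ∀ s : ℝ, dd (sp x) y ((0, t) + s • sp x) = dd (sp x) y (0, t) := fun s => by
    have := mvt1 (f := fun s : ℝ => dd (sp x) y ((0, t) + s • sp x)) (f' := fun s => d2 (sp x) y ((0, t) + s • sp x)) (a := 0) (b := s) (C := 0)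
      (fun s => line_hasDeriv (C2.dd (by rw [hp]; exact hcy _))) (fun s _ => by rw [hd0]; simp)
    simp at this
    linarith
  have := mvt2 (f := fun s : ℝ => y ((0, t) + s • sp x)) (f' := fun s => dd (sp x) y ((0, t) + s • sp x)) (a := 0) (b := 1) (C := 0)
      (fun s => line_hasDeriv (C2.d (by rw [hp]; exact hcy _))) (fun s _ => by rw [hm, hm]; simp)
  simp only [zero_mul, abs_nonpos_iff, one_smul, zero_smul, sub_zero, one_mul, dd_sp'] at this
  unfold qd
  simp only
  rw [dot_comm]
  have z : dot (0 : Fin n → ℝ) x = 0 := by simp [dot]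
  have hyx : y (x, t) = u (x, t) - 1/2 * qf A x x := by simp only [hy, qd]; rw [z]; ring
  have hp1 : ((0, t) : En n) + sp x = (x, t) := by simpa using hp 1
  rw [hp1, add_zero] at this
  linarith

lemma qd_forward (hu : Sol Dt u) {t : ℝ} (ht : t ≤ 0) (h : ∀ x, Hess u (x, t) = Hess u (0, t)) :
    ∃ A l c d, Symm A ∧ ∀ p : En n, t ≤ p.2 → p.2 ≤ 0 → u p = qd A l c d p := by
  have hCL := Dt.CL_pos
  have hC0 := Dt.C0_pos
  set A := Hess u (0, t) with hA
  have hg : Good Dt u (0, t) := hu.good ht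
  have hAs : Symm A := hess_symm hg.c2
  obtain ⟨c, A', hA', hE1, hE2⟩ := Dt.ext A hAs ⟨_, hg.2.1⟩
  obtain ⟨l, d, hq⟩ := quad_slice hu ht h c
  have hAC : ∀ B ∈ Dt.D, ∀ i j, |(B - A) i j| ≤ 2 * Dt.CL := fun B hB i j => by
    have h1 := abs_le.1 (Dt.bdd B hB i j)
    have h2 := abs_le.1 (Dt.bdd A hg.2.1 i j)
    simp only [Pi.sub_apply]
    rw [abs_le]; constructor <;> linarith [h1.1, h1.2, h2.1, h2.2]
  refine ⟨A, l, c, d, hAs, fun p h1 h2 => ?_⟩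
  set W := dot p.1 p.1 + (2 * n * Dt.C0 + 1) * (p.2 - t) with hW
  have hb : ∀ κ > 0, |u p - qd A l c d p| ≤ κ * W := by
    intro κ hκ
    set Y := 2 * Dt.CL * n * (n * Dt.C0) * (-t) with hY
    have := TS hu hAs ⟨hA', hE1, hE2⟩ (R2 := max (dot p.1 p.1) (Y / κ)) (t0 := t) (ε := 0) (κ := κ) (by positivity) hAC l d hκ (by
      rw [← div_le_iff₀' hκ]; exact le_max_right _ _) (fun x _ => by have := hq x; rw [← hA] at this; rw [this]; simp) p (le_max_left _ _) h1 h2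
    linarith
  have hlim : Tendsto (fun κ : ℝ => κ * W) (𝓝[>] 0) (𝓝 0) := by
    have : Tendsto (fun κ : ℝ => κ * W) (𝓝 0) (𝓝 (0 * W)) := tendsto_id.mul_const W
    rw [zero_mul] at this
    exact this.mono_left nhdsWithin_le_nhds
  have := ge_of_tendsto hlim (by filter_upwards [self_mem_nhdsWithin] with κ hκ using hb κ hκ)
  have := abs_nonpos_iff.1 this
  linarith

theorem rigid (Dt : Data n) (hu : Sol Dt u) : ∃ A l c d, Symm A ∧ ∀ p : En n, p.2 ≤ 0 → u p = qd A l c d p := by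
  obtain ⟨t', ht', hs⟩ := slices Dt hu
  obtain ⟨A, l, c, d, hA, h⟩ := qd_forward hu (t := t' - 1) (by linarith) (hs _ (by linarith))
  refine ⟨A, l, c, d, hA, fun p hp => ?_⟩
  have hm1 := min_le_left (t' - 1) p.2
  have hm2 := min_le_right (t' - 1) p.2
  obtain ⟨A1, l1, c1, d1, hA1, h1⟩ := qd_forward hu (t := min (t' - 1) p.2) (by linarith) (hs _ (by linarith))
  have e : ∀ q : En n, t' - 1 ≤ q.2 → q.2 ≤ 0 → qd A1 l1 c1 d1 q = qd A l c d q := fun q a b => by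
    rw [← h q a b, ← h1 q (hm1.trans a) b]
  have e0 := e (p.1, 0) (by simp; linarith) le_rfl
  have e1 := e (p.1, t' - 1) le_rfl (by simp; linarith)
  rw [h1 p hm2 hp]
  unfold qd at *
  simp only at e0 e1
  have hc : c1 = c := by
    have : (c1 - c) * (t' - 1) = 0 := by linarith
    rcases mul_eq_zero.1 this with h | h
    · linarith
    · linarith
  rw [hc] at e0 ⊢
  linarith
end S8
end

section
section F1
variable {n : ℕ} {u : En n → ℝ} {α : ℝ} {K : ℕ}

lemma Eig.qf_ge {A : Mat n} {lam q} (he : Eig A lam q) {L : ℝ} (hL : ∀ i, L ≤ lam i) (v : Fin n → ℝ) :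
    L * dot v v ≤ qf A v v := by
  rw [he.qf_expand, ← he.1.sumsq v, Finset.mul_sum]
  refine Finset.sum_le_sum fun i _ => ?_
  nlinarith [hL i, sq_nonneg (dot (q i) v)]

lemma Hess_shift (c : En n) (p : En n) : Hess (fun q => u (q + c)) p = Hess u (p + c) := by
  funext i j; unfold Hess; simp only [dd_shift]

/-- the structural facts known at every interior point -/
def Str (α : ℝ) (K : ℕ) (K0 m1 m2 : ℝ) (u : En n → ℝ) (p : En n) : Prop :=
  ContDiffAt ℝ 4 u p ∧ (∃ lam q, Eig (Hess u p) lam q ∧ Cone α K lam ∧ ∀ i, -K0 ≤ lam i) ∧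
    dd et u p = Gm α K (Hess u p) ∧ m1 ≤ -dd et u p ∧ -dd et u p ≤ m2

lemma core_shift (hα : 0 < α) (hKn : K + 2 ≤ n) {a b m1 m2 K0 : ℝ} (ha : 0 < a) (hm1 : 0 < m1) (hK0 : 0 ≤ K0)
    (hS : ∀ p : En n, p.2 < 0 → Str α K K0 m1 m2 u p)
    (hgr : ∀ p : En n, p.2 < 0 → a * dot p.1 p.1 - m1 * p.2 - b ≤ u p) {s : ℝ} (hs : 0 < s) :
    ∃ A l c d, Symm A ∧ ∀ p : En n, p.2 ≤ -s → u p = qd A l c d p := by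
  have hm2 : 0 < m2 := by
    have := (hS (0, -1) (by norm_num)).2.2.2
    linarith [this.1, this.2]
  -- Hessian bound for t ≤ -s/2
  set c1 : En n := (0, -(s/2)) with hc1
  obtain ⟨C, hC⟩ := pog_u (u := fun q => u (q + c1)) (m2 := m2) (b := b) hα hKn ha hm1 hK0
    (fun p hp => cd_shift c1 (hS (p + c1) (by simp [hc1]; linarith)).1)
    (fun p hp => by
      obtain ⟨_, ⟨lam, q, he, hc, _⟩, h3⟩ := hS (p + c1) (by simp [hc1]; linarith)
      rw [Hess_shift, dd_shift]
      refine ⟨⟨he.symm, fun j hj => ?_⟩, h3⟩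
      rw [he.2.2, he.2.2, ← es_hat_succ]; exact hc (j+1) (by omega))
    (fun p hp v => by
      obtain ⟨_, ⟨lam, q, he, hc, hl⟩, h3⟩ := hS (p + c1) (by simp [hc1]; linarith)
      rw [Hess_shift]; exact he.qf_ge hl v)
    (fun p hp => by
      have := hgr (p + c1) (by simp [hc1]; linarith)
      simp [hc1] at this ⊢
      nlinarith)
  have hC' : ∀ p : En n, p.2 ≤ -(s/2) → ∀ v, dot v v = 1 → qf (Hess u p) v v ≤ C := fun p hp v hv => by
    have := hC (p - c1) v (by simp [hc1]; linarith) hv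
    rwa [Hess_shift, sub_add_cancel] at this
  obtain ⟨Dt, hG, hD⟩ := exists_data (m2 := m2) hα n K (C := max K0 |C|) (m1 := 1 / m2) (by positivity) (by positivity)
  set c2 : En n := (0, -s) with hc2
  have hSol : Sol Dt (fun q => u (q + c2)) := by
    refine ⟨s/2, by positivity, fun p hp => ?_⟩
    have hp2 : (p + c2).2 ≤ -(s/2) := by simp [hc2]; linarith
    obtain ⟨hcd, ⟨lam, q, he, hc, hl⟩, h3, h4, h5⟩ := hS (p + c2) (by linarith)
    have hfv : 0 < fv α K lam := hc _ le_rfl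
    refine ⟨cd_shift c2 hcd, ?_, ?_⟩
    · rw [Hess_shift]
      refine hD _ lam q he hc (fun i => ?_) ?_
      · have h6 := hC' _ hp2 (q i) (by rw [he.1]; simp)
        rw [he.qf_self] at h6
        simp only [if_true] at h6
        rw [abs_le]
        exact ⟨by linarith [hl i, le_max_left K0 |C|], (h6.trans (le_abs_self C)).trans (le_max_right _ _)⟩
      · rw [h3, Gm, he.fm_eq, neg_div, neg_neg, div_le_iff₀ hfv] at h5
        rw [div_le_iff₀ hm2]; linarith
    · rw [Hess_shift, hG, dd_shift]; exact h3
  obtain ⟨A, l, c, d, hA, h⟩ := rigid Dt hSol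
  refine ⟨A, l, c, d + c * s, hA, fun p hp => ?_⟩
  have := h (p - c2) (by simp [hc2]; linarith)
  simp only [sub_add_cancel] at this
  rw [this]
  simp [qd, hc2]; ring

lemma core_all (hα : 0 < α) (hKn : K + 2 ≤ n) {a b m1 m2 K0 : ℝ} (ha : 0 < a) (hm1 : 0 < m1) (hK0 : 0 ≤ K0)
    (hS : ∀ p : En n, p.2 < 0 → Str α K K0 m1 m2 u p)
    (hgr : ∀ p : En n, p.2 < 0 → a * dot p.1 p.1 - m1 * p.2 - b ≤ u p) :
    ∃ A l c d, Symm A ∧ ∀ p : En n, p.2 < 0 → u p = qd A l c d p := by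
  obtain ⟨A, l, c, d, hA, h⟩ := core_shift hα hKn ha hm1 hK0 hS hgr (s := 1) one_pos
  refine ⟨A, l, c, d, hA, fun p hp => ?_⟩
  obtain ⟨A1, l1, c1, d1, hA1, h1⟩ := core_shift hα hKn ha hm1 hK0 hS hgr (s := min 1 (-p.2)) (lt_min one_pos (by linarith))
  have e : ∀ q : En n, q.2 ≤ -1 → qd A1 l1 c1 d1 q = qd A l c d q := fun q hq => by
    rw [← h q hq, ← h1 q (by linarith [min_le_left 1 (-p.2)])]
  have e0 := e (p.1, -1) le_rfl
  have e1 := e (p.1, -2) (by norm_num)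
  rw [h1 p (by linarith [min_le_right 1 (-p.2)])]
  unfold qd at *
  simp only at e0 e1
  have hc : c1 = c := by linarith
  rw [hc] at e0 ⊢
  linarith
end F1
end

section F2
variable {n : ℕ} {u : En n → ℝ}

lemma uT_eq {x : Fin n → ℝ} {t : ℝ} (h : DifferentiableAt ℝ u (x, t)) :
    HasDerivAt (fun s => u (x, s)) (dd et u (x, t)) t := by
  have h1 : HasDerivAt (fun s : ℝ => ((x, s) : En n)) et t :=
    (hasDerivAt_const t x).prodMk (hasDerivAt_id t)
  exact HasFDerivAt.comp_hasDerivAt t h.hasFDerivAt h1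

lemma slice_fderiv {x : Fin n → ℝ} {t : ℝ} (h : DifferentiableAt ℝ u (x, t)) (v : Fin n → ℝ) :
    fderiv ℝ (fun y => u (y, t)) x v = dd (sp v) u (x, t) := by
  have h1 : HasFDerivAt (fun y : Fin n → ℝ => ((y, t) : En n)) (ContinuousLinearMap.inl ℝ (Fin n → ℝ) ℝ) x :=
    hasFDerivAt_prodMk_left x t
  have := (h.hasFDerivAt.comp x h1).fderiv
  change fderiv ℝ (u ∘ fun y => (y, t)) x v = _
  rw [this]; simp [dd, sp]

lemma hessX_eq {x : Fin n → ℝ} {t : ℝ} (h : ContDiffAt ℝ 2 u (x, t)) :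
    hessX u x t = Matrix.of (Hess u (x, t)) := by
  have hcont : ContinuousAt (fun y : Fin n → ℝ => ((y, t) : En n)) x := by fun_prop
  have hsl : ContDiffAt ℝ 2 (fun y => u (y, t)) x :=
    ContDiffAt.comp (g := u) (f := fun y => (y, t)) x h (contDiffAt_id.prodMk contDiffAt_const)
  have hev : ∀ᶠ y in 𝓝 x, DifferentiableAt ℝ u (y, t) := by
    have := h.eventually (by simp)
    filter_upwards [hcont.eventually this] with y hy
    exact hy.differentiableAt (by norm_num)
  ext i j
  change iteratedFDeriv ℝ 2 (fun y => u (y, t)) x ![Pi.single i 1, Pi.single j 1] = dd (sp (bs i)) (dd (sp (bs j)) u) (x, t)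
  rw [iteratedFDeriv_two_apply]
  simp only [Matrix.cons_val_zero, Matrix.cons_val_one]
  have hd : DifferentiableAt ℝ (fderiv ℝ (fun y => u (y, t))) x :=
    (hsl.fderiv_right (m := 1) (by norm_num)).differentiableAt (by norm_num)
  have e1 : fderiv ℝ (fderiv ℝ (fun y => u (y, t))) x (Pi.single i 1) (Pi.single j 1) =
      fderiv ℝ (fun y => fderiv ℝ (fun y => u (y, t)) y (Pi.single j 1)) x (Pi.single i 1) := by
    rw [fderiv_clm_apply hd (differentiableAt_const _)]; simp
  rw [e1]
  have e2 : (fun y => fderiv ℝ (fun y => u (y, t)) y (Pi.single j 1)) =ᶠ[𝓝 x] fun y => dd (sp (bs j)) u (y, t) := by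
    filter_upwards [hev] with y hy
    exact slice_fderiv hy _
  rw [e2.fderiv_eq]
  exact slice_fderiv (C2.dd h) _

lemma esymmR_nat (j : ℕ) (lam : Fin n → ℝ) : esymmR (j : ℤ) lam = es Finset.univ j lam := by
  simp [esymmR, sigmaOn, es]

lemma eig_hessX {x : Fin n → ℝ} {t : ℝ} (h : ContDiffAt ℝ 2 u (x, t)) (hh : (hessX u x t).IsHermitian) :
    ∃ q, Eig (Hess u (x, t)) hh.eigenvalues q := by
  obtain ⟨q, hq⟩ := eig_of_herm (A := hessX u x t) hh
  refine ⟨q, ?_⟩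
  have : (hessX u x t : Mat n) = Hess u (x, t) := hessX_eq h
  rw [← this]; exact hq

lemma eucNorm_sq (x : Fin n → ℝ) : eucNorm x ^ 2 = dot x x := by
  unfold eucNorm dot
  rw [Real.sq_sqrt (Finset.sum_nonneg fun i _ => sq_nonneg _)]
  exact Finset.sum_congr rfl fun i _ => by ring
end F2

/-- **Rigidity theorem for the parabolic sum Hessian equation** (Theorem 1.7):
a `(k-1)`-convex, semi-convex entire solution of
`-∂ₜu ⋅ (σ_k(λ(D²ₓu)) + α σ_{k-1}(λ(D²ₓu))) = 1` on `ℝⁿ × (-∞,0]` with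
`x ↦ u(x,0)` of quadratic growth and `0 < m₁ ≤ -∂ₜu ≤ m₂` must have the form
`u(x,t) = -mt + p(x)` with `m > 0` and `p` a quadratic polynomial. -/
theorem rigidity_parabolic_sum_hessian
    {n k : ℕ} (hk : 2 ≤ k) (hkn : k ≤ n) (α : ℝ) (hα : 0 < α)
    (u : (Fin n → ℝ) × ℝ → ℝ)
    -- `u ∈ C⁴(ℝⁿ × (-∞,0])`
    (hu4 : ContDiffOn ℝ 4 u {p : (Fin n → ℝ) × ℝ | p.2 ≤ 0})
    -- the spatial Hessian of `u` is symmetric (true for `C²` functions)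
    (hherm : ∀ (x : Fin n → ℝ) (t : ℝ), t ≤ 0 → (hessX u x t).IsHermitian)
    -- `u` is `(k-1)`-convex
    (hconv : ∀ (x : Fin n → ℝ) (t : ℝ) (ht : t ≤ 0),
      (hherm x t ht).eigenvalues ∈ GammaCone n (k - 1))
    -- `u` is semi-convex with constant `K₀`
    (K₀ : ℝ) (hK₀ : 0 < K₀)
    (hsemi : ∀ (x : Fin n → ℝ) (t : ℝ) (ht : t ≤ 0) (i : Fin n),
      -K₀ < (hherm x t ht).eigenvalues i)
    -- `u` solves the parabolic sum Hessian equation on `ℝⁿ × (-∞,0]`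
    (heq : ∀ (x : Fin n → ℝ) (t : ℝ) (ht : t ≤ 0),
      (-(uT u x t)) * (esymmR (k : ℤ) (hherm x t ht).eigenvalues
          + α * esymmR ((k : ℤ) - 1) (hherm x t ht).eigenvalues) = 1)
    -- `x ↦ u(x,0)` has quadratic growth
    (a b R : ℝ) (ha : 0 < a) (hb : 0 < b) (hR : 0 < R)
    (hgrowth : ∀ x : Fin n → ℝ, R ≤ eucNorm x → a * (eucNorm x) ^ 2 - b ≤ u (x, 0))
    -- `0 < m₁ ≤ -∂ₜu ≤ m₂`
    (m₁ m₂ : ℝ) (hm₁ : 0 < m₁)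
    (hmt : ∀ (x : Fin n → ℝ) (t : ℝ), t ≤ 0 →
      m₁ ≤ -(uT u x t) ∧ -(uT u x t) ≤ m₂) :
    ∃ (m : ℝ) (A : Matrix (Fin n) (Fin n) ℝ) (bv : Fin n → ℝ) (c : ℝ),
      0 < m ∧ A.IsSymm ∧
      ∀ (x : Fin n → ℝ) (t : ℝ), t ≤ 0 →
        u (x, t) = -(m * t)
          + ((1 / 2) * (∑ i, ∑ j, A i j * x i * x j) + (∑ i, bv i * x i) + c) := by
  obtain ⟨K, rfl⟩ : ∃ K, k = K + 2 := ⟨k - 2, by omega⟩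
  have hcd : ∀ p : En n, p.2 < 0 → ContDiffAt ℝ 4 u p := fun p hp => by
    refine hu4.contDiffAt ?_
    have : {p : En n | p.2 < 0} ∈ 𝓝 p := (isOpen_lt continuous_snd continuous_const).mem_nhds hp
    exact mem_of_superset this fun q hq => show q.2 ≤ 0 from le_of_lt hq
  have hcd2 : ∀ p : En n, p.2 < 0 → ContDiffAt ℝ 2 u p := fun p hp => (hcd p hp).of_le (by norm_num)
  have hdif : ∀ p : En n, p.2 < 0 → DifferentiableAt ℝ u p := fun p hp => (hcd p hp).differentiableAt (by norm_num)
  have hut : ∀ p : En n, p.2 < 0 → uT u p.1 p.2 = dd et u p := fun p hp => (uT_eq (hdif p hp)).deriv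
  have hS : ∀ p : En n, p.2 < 0 → Str α K K₀ m₁ m₂ u p := by
    intro p hp
    obtain ⟨q, he⟩ := eig_hessX (x := p.1) (t := p.2) (hcd2 p hp) (hherm p.1 p.2 hp.le)
    have h1 := hconv p.1 p.2 hp.le
    have h2 := heq p.1 p.2 hp.le
    have h3 := hmt p.1 p.2 hp.le
    have h4 := hsemi p.1 p.2 hp.le
    generalize (hherm p.1 p.2 hp.le).eigenvalues = lam at *
    rw [hut p hp] at h2 h3
    have ek : esymmR ((K + 2 : ℕ) : ℤ) lam = es Finset.univ (K+2) lam := esymmR_nat _ _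
    have ek1 : esymmR (((K + 2 : ℕ) : ℤ) - 1) lam = es Finset.univ (K+1) lam := by
      rw [← esymmR_nat]; congr 1; push_cast; ring
    have efv : fv α K lam = es Finset.univ (K+2) lam + α * es Finset.univ (K+1) lam := by
      unfold fv; rw [es_hat_succ]; ring
    rw [ek, ek1, ← efv] at h2
    have hpos : 0 < -dd et u p := by linarith [h3.1]
    have hfv : 0 < fv α K lam := by
      by_contra hcon
      have := mul_nonpos_of_nonneg_of_nonpos hpos.le (not_lt.1 hcon)
      linarith
    have hes : ∀ j ≤ K + 1, 0 < es Finset.univ j lam := by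
      intro j hj
      rcases Nat.eq_zero_or_pos j with rfl | hj0
      · rw [es_zero]; norm_num
      · rw [← esymmR_nat]; exact h1 j hj0 (by omega)
    refine ⟨hcd p hp, ⟨lam, q, he, ?_, fun i => (h4 i).le⟩, ?_, h3⟩
    · intro j hj
      rcases hj.lt_or_eq with hj | rfl
      · cases j with
        | zero => rw [es_zero]; norm_num
        | succ j =>
          rw [es_hat_succ]
          have := mul_pos hα (hes j (by omega))
          linarith [hes (j+1) (by omega)]
      · exact hfv
    · have he' : Eig (Hess u p) lam q := he
      rw [Gm, he'.fm_eq, eq_div_iff hfv.ne']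
      linarith
  have hline : ∀ x : Fin n → ℝ, ContinuousOn (fun t : ℝ => u (x, t)) (Set.Iic 0) := fun x =>
    hu4.continuousOn.comp (by fun_prop) fun t ht => ht
  have hmono : ∀ (x : Fin n → ℝ) (t : ℝ), t ≤ 0 → u (x, 0) - m₁ * t ≤ u (x, t) := by
    intro x t ht
    have : AntitoneOn (fun t : ℝ => u (x, t) + m₁ * t) (Set.Iic 0) := by
      refine antitoneOn_of_hasDerivWithinAt_nonpos (f' := fun t => dd et u (x, t) + m₁) (convex_Iic 0) ((hline x).add (by fun_prop)) ?_ ?_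
      · intro s hs
        rw [interior_Iic] at hs
        have h1 := uT_eq (hdif (x, s) hs)
        have h2 : HasDerivAt (fun t : ℝ => m₁ * t) m₁ s := by simpa using (hasDerivAt_id s).const_mul m₁
        exact (h1.add h2).hasDerivWithinAt
      · intro s hs
        rw [interior_Iic] at hs
        have := (hS (x, s) hs).2.2.2.1
        linarith
    have := this (a := t) ht (b := 0) (Set.mem_Iic.2 le_rfl) ht
    simp at this
    linarith
  -- growth at every x
  obtain ⟨b', hb'⟩ : ∃ b', ∀ x : Fin n → ℝ, a * dot x x - b' ≤ u (x, 0) := by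
    have hc0 : Continuous fun x : Fin n → ℝ => u (x, 0) :=
      hu4.continuousOn.comp_continuous (by fun_prop) fun x => show (0:ℝ) ≤ 0 from le_rfl
    obtain ⟨L, hL⟩ := (isCompact_closedBall (0 : Fin n → ℝ) R).exists_bound_of_continuousOn hc0.continuousOn
    refine ⟨max b (a * R^2 + L), fun x => ?_⟩
    rcases le_total R (eucNorm x) with h | h
    · have := hgrowth x h
      rw [eucNorm_sq] at this
      linarith [le_max_left b (a * R^2 + L)]
    · have hx0 : 0 ≤ eucNorm x := Real.sqrt_nonneg _
      have hd : dot x x ≤ R^2 := by rw [← eucNorm_sq]; gcongr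
      have hx : x ∈ Metric.closedBall (0 : Fin n → ℝ) R := by
        rw [mem_closedBall_zero_iff, pi_norm_le_iff_of_nonneg hR.le]
        intro i
        refine abs_le_of_sq_le_sq ?_ hR.le
        refine le_trans ?_ hd
        unfold dot
        have := Finset.single_le_sum (f := fun i => x i * x i) (fun i _ => mul_self_nonneg _) (Finset.mem_univ i)
        simpa [sq] using this
      have h5 := (abs_le.1 (hL x hx)).1
      have := mul_le_mul_of_nonneg_left hd ha.le
      linarith [le_max_right b (a * R^2 + L)]
  have hgr : ∀ p : En n, p.2 < 0 → a * dot p.1 p.1 - m₁ * p.2 - b' ≤ u p := fun p hp => by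
    have h1 := hmono p.1 p.2 hp.le
    have h2 := hb' p.1
    have : u (p.1, p.2) = u p := rfl
    linarith
  obtain ⟨A, l, c, d, hA, h⟩ := core_all hα hkn ha hm₁ hK₀.le hS hgr
  have hqc : ∀ x : Fin n → ℝ, Continuous fun t : ℝ => qd A l c d (x, t) := fun x =>
    (qd_cd A l c d (m := 0)).continuous.comp (by fun_prop)
  have hall : ∀ (x : Fin n → ℝ) (t : ℝ), t ≤ 0 → u (x, t) = qd A l c d (x, t) := by
    intro x t ht
    rcases ht.lt_or_eq with ht | rfl
    · exact h (x, t) ht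
    · have h1 : Tendsto (fun t : ℝ => u (x, t)) (𝓝[<] 0) (𝓝 (u (x, 0))) :=
        ((hline x) 0 (Set.mem_Iic.2 le_rfl)).mono_left (nhdsWithin_mono _ Set.Iio_subset_Iic_self)
      have h2 : Tendsto (fun t : ℝ => qd A l c d (x, t)) (𝓝[<] 0) (𝓝 (qd A l c d (x, 0))) :=
        (hqc x).continuousAt.mono_left nhdsWithin_le_nhds
      refine tendsto_nhds_unique h1 (h2.congr' ?_)
      filter_upwards [self_mem_nhdsWithin] with t ht
      exact (h (x, t) ht).symm
  refine ⟨-c, Matrix.of A, l, d, ?_, ?_, fun x t ht => ?_⟩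
  · have h1 := hmono 0 (-1) (by norm_num)
    rw [hall 0 0 le_rfl, hall 0 (-1) (by norm_num)] at h1
    simp only [qd] at h1
    linarith
  · ext i j; exact hA j i
  · rw [hall x t ht]
    have e1 : qf A x x = ∑ i, ∑ j, Matrix.of A i j * x i * x j := by
      unfold qf
      exact Finset.sum_congr rfl fun i _ => Finset.sum_congr rfl fun j _ => by
        rw [Matrix.of_apply]; ring
    simp only [qd, e1, dot]
    ring
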